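/- (Theorem 4, oracle inequality without structure) Let p∈(1,+∞], suppose 𝔓={{1,…,d}} (no independence structure) and Assumptions (N1)-(N2) hold, and let f̃ be the estimator given by the Goldenshluger–Lepski selection rule over the family {f̃_h : h∈H_{p,{1,…,d}}}. Then there exists an absolute constant C_p = C_p(d,K,q) > 0 such that for every integer n ≥ 3 and every probability density f on ℝ^d: R_p[f̃,f] ≤ inf_{h∈H_{p,{1,…,d}}} { (1+2‖K‖_1^d)·R_p[f̃_h,f] + 2γ_p·U_p(h) } + 2C_p·n^{-1/2}. -/

import Mathlib

open MeasureTheory ENNReal Filter Finset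
open scoped ENNReal Topology

noncomputable section

namespace Deconv

/-- Euclidean inner product on a finite coordinate space. -/
def dotp {ι : Type} [Fintype ι] (t x : ι → ℝ) : ℝ := ∑ j, t j * x j

/-- Fourier transform `ĝ(t) = ∫ e^{i⟨t,x⟩} g(x) dx` of a real function. -/
def ftI {ι : Type} [Fintype ι] (g : (ι → ℝ) → ℝ) (t : ι → ℝ) : ℂ :=
  ∫ x : ι → ℝ, Complex.exp (Complex.I * (dotp t x : ℝ)) * (g x : ℂ)

/-- Glue coordinates indexed by `I` with coordinates indexed by `Iᶜ`. -/
def glue {d : ℕ} (I : Finset (Fin d)) (xI : I → ℝ) (y : ↥(Iᶜ) → ℝ) : Fin d → ℝ :=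
  fun i => if h : i ∈ I then xI ⟨i, h⟩ else y ⟨i, Finset.mem_compl.mpr h⟩

/-- Marginal density on the coordinates indexed by `I`. -/
def marginal {d : ℕ} (I : Finset (Fin d)) (g : (Fin d → ℝ) → ℝ) (xI : I → ℝ) : ℝ :=
  ∫ y : ↥(Iᶜ) → ℝ, g (glue I xI y)

/-- A probability density. -/
def IsDensity {ι : Type} [Fintype ι] (g : (ι → ℝ) → ℝ) : Prop :=
  (∀ x, 0 ≤ g x) ∧ (∫ x, g x) = 1

/-- Product kernel `K_I`. -/
def KI {d : ℕ} (I : Finset (Fin d)) (K : ℝ → ℝ) (xI : I → ℝ) : ℝ := ∏ j : I, K (xI j)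

/-- Rescaled product kernel `K_{h_I}`. -/
def Kh {d : ℕ} (I : Finset (Fin d)) (K : ℝ → ℝ) (h : Fin d → ℝ) (xI : I → ℝ) : ℝ :=
  (∏ j ∈ I, h j)⁻¹ * ∏ j : I, K (xI j / h ↑j)

/-- The deconvolution kernel `L_{(h_I)}`. -/
def Lh {d : ℕ} (I : Finset (Fin d)) (K : ℝ → ℝ) (q : (Fin d → ℝ) → ℝ) (h : Fin d → ℝ)
    (xI : I → ℝ) : ℂ :=
  (((2 * Real.pi) ^ (-(I.card : ℝ)) : ℝ) : ℂ) *
    ∫ t : I → ℝ, Complex.exp (-(Complex.I * (dotp t xI : ℝ))) *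
      (ftI (Kh I K h) t / ftI (marginal I q) t)

/-- Convolution of two densities on `ℝ^d`. -/
def conv {d : ℕ} (f g : (Fin d → ℝ) → ℝ) (x : Fin d → ℝ) : ℝ := ∫ y, f (x - y) * g y

/-- Law of the observation vector `Y^{(n)} = (Y_1,…,Y_n)`, `Y_k = X_k + ε_k`:
the `n`-fold product of the measure with density `f ⋆ q`. -/
def obsMeasure (d n : ℕ) (f q : (Fin d → ℝ) → ℝ) : Measure (Fin n → Fin d → ℝ) :=
  Measure.pi fun _ => volume.withDensity fun x => ENNReal.ofReal (conv f q x)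

/-- Kernel deconvolution estimator `f̃_{h_I}` built from the sample `y`. -/
def fHat {d : ℕ} (I : Finset (Fin d)) (K : ℝ → ℝ) (q : (Fin d → ℝ) → ℝ) (h : Fin d → ℝ)
    {n : ℕ} (y : Fin n → Fin d → ℝ) (xI : I → ℝ) : ℂ :=
  (n : ℂ)⁻¹ * ∑ k, Lh I K q h (fun j => xI j - y k ↑j)

/-- Expectation `E_f f̃_{h_I}(x_I)`. -/
def fHatMean {d : ℕ} (I : Finset (Fin d)) (K : ℝ → ℝ) (f q : (Fin d → ℝ) → ℝ)
    (h : Fin d → ℝ) (xI : I → ℝ) : ℂ :=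
  ∫ y : Fin d → ℝ, Lh I K q h (fun j => xI j - y ↑j)
    ∂(volume.withDensity fun x => ENNReal.ofReal (conv f q x))

/-- Stochastic error `ξ_{h_I} = f̃_{h_I} - E_f f̃_{h_I}`. -/
def xiProc {d : ℕ} (I : Finset (Fin d)) (K : ℝ → ℝ) (f q : (Fin d → ℝ) → ℝ) (h : Fin d → ℝ)
    {n : ℕ} (y : Fin n → Fin d → ℝ) (xI : I → ℝ) : ℂ :=
  fHat I K q h y xI - fHatMean I K f q h xI

/-- `λ_max = max_j λ_j`. -/
def lamMax {d : ℕ} (lam : Fin d → ℝ) : ℝ := sSup (Set.range lam)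

/-- `b_p = (1/2) ∧ (1 - 1/p)`  (with the convention `p.toReal = 0` for `p = ∞`). -/
def bp (p : ℝ≥0∞) : ℝ := min (1 / 2) (1 - 1 / p.toReal)

/-- The constant `c_p` of the bandwidth grid. -/
def cpGrid {d : ℕ} (lam : Fin d → ℝ) (p : ℝ≥0∞) : ℝ :=
  min 1 ((p.toReal / Real.exp 1 * (1 + lamMax lam * max 2 (p.toReal / (p.toReal - 1))))
    ^ (-(p.toReal * (bp p + lamMax lam))))

/-- Minimal bandwidth `h_min^{(p)}`. -/
def hminG (p : ℝ≥0∞) (n : ℕ) (m : ℕ) : ℝ :=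
  if p = ⊤ then (n : ℝ)⁻¹ else (n : ℝ) ^ (-(max 1 (p.toReal / m)))

/-- Maximal bandwidth `h_max^{(p)}`. -/
def hmaxG (p : ℝ≥0∞) (n : ℕ) (m : ℕ) : ℝ :=
  if p = ⊤ then 1 else (Real.log n) ^ (-(p.toReal / m))

/-- Membership in the dyadic bandwidth set `H_{p,I}` (only the coordinates in `I` matter). -/
def memGrid {d : ℕ} (lam : Fin d → ℝ) (p : ℝ≥0∞) (n : ℕ) (I : Finset (Fin d))
    (h : Fin d → ℝ) : Prop :=
  (∀ j ∈ I, ∃ k : ℕ, 1 ≤ k ∧ h j = 2 ^ (-(k : ℝ))) ∧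
  (∀ j ∈ I, hminG p n I.card ≤ h j ∧ h j ≤ hmaxG p n I.card) ∧
  ((if p = ⊤ then Real.sqrt (Real.log n) else cpGrid lam p) ≤
    ((n : ℝ) * ∏ j ∈ I, h j) ^ bp p * ∏ j ∈ I, h j ^ lam j)

/-- The majorant `U_p(h_I)`. -/
def Up {d : ℕ} (K : ℝ → ℝ) (q : (Fin d → ℝ) → ℝ) (lam : Fin d → ℝ) (p : ℝ≥0∞) (n : ℕ)
    (I : Finset (Fin d)) (h : Fin d → ℝ) : ℝ≥0∞ :=
  if p = ⊤ then
    ENNReal.ofReal ((n : ℝ) ^ (-(1 : ℝ) / 2) * Real.sqrt (Real.log n) *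
      ∏ j ∈ I, h j ^ (-lam j - 1 / 2))
  else if p = 2 then
    ENNReal.ofReal ((n : ℝ) ^ (-(1 : ℝ) / 2) * ∏ j ∈ I, h j ^ (-lam j - 1 / 2))
  else if p.toReal < 2 then
    ENNReal.ofReal ((n : ℝ) ^ (1 / p.toReal - 1)) * eLpNorm (Lh I K q h) p volume
  else
    ENNReal.ofReal ((n : ℝ) ^ (-(1 : ℝ) / 2)) *
      (ENNReal.ofReal (∏ j ∈ I, h j ^ (-lam j - 1 / 2)) +
        ENNReal.ofReal (Real.sqrt (Real.log n)) *
          eLpNorm (Lh I K q h) (ENNReal.ofReal (2 * p.toReal / (p.toReal + 2))) volume)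

/-- First-order partial derivative in direction `j` of a complex-valued function. -/
def cpd {ι : Type} [Fintype ι] [DecidableEq ι] (j : ι) (φ : (ι → ℝ) → ℂ) (t : ι → ℝ) : ℂ :=
  fderiv ℝ φ t (Pi.single j 1)

/-- Iterated mixed partial derivative `D^α φ`. -/
def multiPD {ι : Type} [Fintype ι] [DecidableEq ι] (α : ι → ℕ) (φ : (ι → ℝ) → ℂ) :
    (ι → ℝ) → ℂ :=
  (Finset.univ (α := ι)).toList.foldr (fun j ψ => (cpd j)^[α j] ψ) φ

/-- Assumption (N2), case `p = 2`: lower bound on `|q̂_I|`. -/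
def N2two {d : ℕ} (I : Finset (Fin d)) (q : (Fin d → ℝ) → ℝ) (A : ℝ) (lam : Fin d → ℝ) :
    Prop :=
  ∀ t : I → ℝ, A⁻¹ * ∏ j : I, (1 + t j ^ 2) ^ (-lam ↑j / 2) ≤ ‖ftI (marginal I q) t‖

/-- Assumption (N2), case `p ∈ (1,∞) \ {2}`. -/
def N2mid {d : ℕ} (I : Finset (Fin d)) (q : (Fin d → ℝ) → ℝ) (A : ℝ) (lam : Fin d → ℝ) :
    Prop :=
  (∀ t : I → ℝ, ftI (marginal I q) t ≠ 0) ∧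
  ContDiff ℝ I.card (fun t : I → ℝ => (ftI (marginal I q) t)⁻¹) ∧
  ∀ α : I → ℕ, (∑ j, α j) ≤ I.card → ∀ t : I → ℝ,
    ‖multiPD α (fun u => (ftI (marginal I q) u)⁻¹) t * ∏ j, (t j : ℂ) ^ α j‖ ≤
      A * ∏ j : I, (1 + t j ^ 2) ^ (lam ↑j / 2)

/-- Assumption (N2), case `p = ∞`. -/
def N2inf {d : ℕ} (I : Finset (Fin d)) (q : (Fin d → ℝ) → ℝ) (A : ℝ) (lam : Fin d → ℝ) :
    Prop :=
  (∀ t : I → ℝ, ftI (marginal I q) t ≠ 0) ∧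
  ContDiff ℝ 1 (fun t : I → ℝ => (ftI (marginal I q) t)⁻¹) ∧
  ∀ k : I, ∀ a : ℕ, a ≤ 1 → ∀ t : I → ℝ,
    ‖(cpd k)^[a] (fun u => (ftI (marginal I q) u)⁻¹) t‖ ≤
      A * ∏ j : I, (1 + t j ^ 2) ^ (lam ↑j / 2)

/-- Assumptions (N1)-(N2) of the paper, for a given `p` and a given block `I`. -/
def N1N2 {d : ℕ} (p : ℝ≥0∞) (I : Finset (Fin d)) (q : (Fin d → ℝ) → ℝ) (A : ℝ)
    (lam : Fin d → ℝ) : Prop :=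
  0 < A ∧ (∀ j, 0 < lam j) ∧
  (p = 2 → Integrable (ftI (marginal I q)) ∧ N2two I q A lam) ∧
  (2 < p → eLpNorm (marginal I q) ⊤ volume < ⊤) ∧
  (p ≠ 2 → p ≠ ⊤ → N2mid I q A lam) ∧
  (p = ⊤ → N2inf I q A lam)

/-- `K` is a symmetric Schwartz kernel integrating to one. -/
def IsKernel (K : ℝ → ℝ) : Prop :=
  (∃ KS : SchwartzMap ℝ ℝ, ⇑KS = K) ∧ (∀ z, K (-z) = K z) ∧ (∫ z, K z) = 1

/-- `⌊a⌋`, the largest integer strictly smaller than `a` (for `a > 0`). -/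
def flr (a : ℝ) : ℕ := ⌈a⌉₊ - 1

/-- Partial derivative in direction `j` of a real function on `ℝ^ι`. -/
def rpd {ι : Type} [Fintype ι] [DecidableEq ι] (j : ι) (g : (ι → ℝ) → ℝ) (x : ι → ℝ) : ℝ :=
  fderiv ℝ g x (Pi.single j 1)

/-- The anisotropic Nikolskii class `N_{r,s}(β,L)` of probability densities. -/
def Nikolskii {ι : Type} [Fintype ι] [DecidableEq ι] (r : ι → ℝ≥0∞) (β L : ι → ℝ) :
    Set ((ι → ℝ) → ℝ) :=
  {g | IsDensity g ∧
    (∀ j, ∀ k ≤ flr (β j), eLpNorm ((rpd j)^[k] g) (r j) volume ≤ ENNReal.ofReal (L j)) ∧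
    (∀ j, ∀ z : ℝ,
      eLpNorm (fun x => (rpd j)^[flr (β j)] g (x + z • (Pi.single j 1 : ι → ℝ)) -
        (rpd j)^[flr (β j)] g x) (r j) volume ≤
          ENNReal.ofReal (L j * |z| ^ (β j - flr (β j))))}

/-- Partitions of `{1,…,d}`. -/
abbrev Part (d : ℕ) := Finpartition (Finset.univ : Finset (Fin d))

/-- The operation `P ⋄ P'` on partitions. -/
def diamond {d : ℕ} (P P' : Part d) : Finset (Finset (Fin d)) :=
  ((P.parts ×ˢ P'.parts).image fun z => z.1 ∩ z.2).filter fun I => I.Nonempty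

/-- The class `N_{r,d}(β,L,P)` taking smoothness and independence structure into account. -/
def NikolskiiP {d : ℕ} (𝔓 : Set (Part d)) (r : Fin d → ℝ≥0∞) (β L : Fin d → ℝ) (P : Part d) :
    Set ((Fin d → ℝ) → ℝ) :=
  {g | IsDensity g ∧ (∀ x, g x = ∏ I ∈ P.parts, marginal I g fun j => x ↑j) ∧
    ∀ P' ∈ 𝔓, ∀ P'' ∈ 𝔓, ∀ I ∈ diamond P' P'',
      marginal I g ∈
        Nikolskii (fun j : I => r ↑j) (fun j : I => β ↑j) (fun j : I => L ↑j)}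

/-- The set of partitions encoding an independence structure of `f`. -/
def structSet {d : ℕ} (𝔓 : Set (Part d)) (f : (Fin d → ℝ) → ℝ) : Set (Part d) :=
  {P ∈ 𝔓 | ∀ x, f x = ∏ I ∈ P.parts, marginal I f fun j => x ↑j}

/-- The set `H_p[𝔓]` of admissible pairs `(h,P)`. -/
def HpSet {d : ℕ} (lam : Fin d → ℝ) (p : ℝ≥0∞) (n : ℕ) (𝔓 : Set (Part d)) :
    Set ((Fin d → ℝ) × Part d) :=
  {hP | hP.2 ∈ 𝔓 ∧ ∀ I ∈ hP.2.parts, memGrid lam p n I hP.1}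

/-- The product estimator `f̃_{(h,P)}`. -/
def fHatProd {d : ℕ} (K : ℝ → ℝ) (q : (Fin d → ℝ) → ℝ) {n : ℕ}
    (hP : (Fin d → ℝ) × Part d) (y : Fin n → Fin d → ℝ) (x : Fin d → ℝ) : ℂ :=
  ∏ I ∈ hP.2.parts, fHat I K q hP.1 y fun j => x ↑j

/-- Smoothed estimator `f̃_{h_I,η_I} = K_{η_I} ⋆ f̃_{h_I}`. -/
def fHatConv {d : ℕ} (K : ℝ → ℝ) (q : (Fin d → ℝ) → ℝ) (I : Finset (Fin d))
    (h η : Fin d → ℝ) {n : ℕ} (y : Fin n → Fin d → ℝ) (xI : I → ℝ) : ℂ :=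
  ∫ u : I → ℝ, ((Kh I K η u : ℝ) : ℂ) * fHat I K q h y fun j => xI j - u j

/-- Auxiliary estimator `f̃_{(h,P),(η,P')}`. -/
def fHatProdAux {d : ℕ} (K : ℝ → ℝ) (q : (Fin d → ℝ) → ℝ) {n : ℕ}
    (hP ηP' : (Fin d → ℝ) × Part d) (y : Fin n → Fin d → ℝ) (x : Fin d → ℝ) : ℂ :=
  ∏ I ∈ diamond hP.2 ηP'.2, fHatConv K q I hP.1 ηP'.1 y fun j => x ↑j

/-- `𝔡 = sup_{P ∈ 𝔓} |P|`. -/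
def Dd {d : ℕ} (𝔓 : Set (Part d)) : ℕ := sSup ((fun P : Part d => P.parts.card) '' 𝔓)

/-- The random quantity `Ḡ_p`. -/
def Gbar {d : ℕ} (K : ℝ → ℝ) (q : (Fin d → ℝ) → ℝ) (lam : Fin d → ℝ) (p : ℝ≥0∞)
    (𝔓 : Set (Part d)) {n : ℕ} (y : Fin n → Fin d → ℝ) : ℝ≥0∞ :=
  max 1 (ENNReal.ofReal ((∫ z, |K z|) ^ d) *
    ⨆ hP ∈ HpSet lam p n 𝔓, ⨆ P' ∈ 𝔓, ⨆ I ∈ diamond hP.2 P',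
      eLpNorm (fHat I K q hP.1 y) p volume)

/-- The random threshold `Λ_p = 𝔡 γ_p Ḡ_p^{𝔡(𝔡-1)}`. -/
def LamThr {d : ℕ} (K : ℝ → ℝ) (q : (Fin d → ℝ) → ℝ) (lam : Fin d → ℝ) (p : ℝ≥0∞)
    (𝔓 : Set (Part d)) (γp : ℝ≥0∞) {n : ℕ} (y : Fin n → Fin d → ℝ) : ℝ≥0∞ :=
  (Dd 𝔓 : ℝ≥0∞) * γp * Gbar K q lam p 𝔓 y ^ (Dd 𝔓 * (Dd 𝔓 - 1))

/-- `U_p(h,P) = sup_{I ∈ P} U_p(h_I)`. -/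
def UpPart {d : ℕ} (K : ℝ → ℝ) (q : (Fin d → ℝ) → ℝ) (lam : Fin d → ℝ) (p : ℝ≥0∞) (n : ℕ)
    (hP : (Fin d → ℝ) × Part d) : ℝ≥0∞ :=
  ⨆ I ∈ hP.2.parts, Up K q lam p n I hP.1

/-- The quantity `Δ̃_p(h,P)` of the selection rule. -/
def DeltaT {d : ℕ} (K : ℝ → ℝ) (q : (Fin d → ℝ) → ℝ) (lam : Fin d → ℝ) (p : ℝ≥0∞)
    (𝔓 : Set (Part d)) (γp : ℝ≥0∞) {n : ℕ} (y : Fin n → Fin d → ℝ)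
    (hP : (Fin d → ℝ) × Part d) : ℝ≥0∞ :=
  ⨆ ηP' ∈ HpSet lam p n 𝔓,
    (eLpNorm (fun x => fHatProdAux K q hP ηP' y x - fHatProd K q ηP' y x) p volume -
      LamThr K q lam p 𝔓 γp y * UpPart K q lam p n ηP')

/-- The selection criterion. -/
def crit {d : ℕ} (K : ℝ → ℝ) (q : (Fin d → ℝ) → ℝ) (lam : Fin d → ℝ) (p : ℝ≥0∞)
    (𝔓 : Set (Part d)) (γp : ℝ≥0∞) {n : ℕ} (y : Fin n → Fin d → ℝ)
    (hP : (Fin d → ℝ) × Part d) : ℝ≥0∞ :=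
  DeltaT K q lam p 𝔓 γp y hP + LamThr K q lam p 𝔓 γp y * UpPart K q lam p n hP

/-- `(h̃,P̃)` obeys the data-driven selection rule. -/
def IsSelection {d : ℕ} (K : ℝ → ℝ) (q : (Fin d → ℝ) → ℝ) (lam : Fin d → ℝ) (p : ℝ≥0∞)
    (𝔓 : Set (Part d)) (γp : ℝ≥0∞) {n : ℕ}
    (sel : (Fin n → Fin d → ℝ) → (Fin d → ℝ) × Part d) : Prop :=
  ∀ y, sel y ∈ HpSet lam p n 𝔓 ∧
    crit K q lam p 𝔓 γp y (sel y) = ⨅ hP ∈ HpSet lam p n 𝔓, crit K q lam p 𝔓 γp y hP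

/-- `L_p`-risk of the selected estimator `f̃ = f̃_{(h̃,P̃)}` (`E_f ‖f̃ - f‖_∞` for `p = ∞`). -/
def riskSel {d : ℕ} (K : ℝ → ℝ) (q : (Fin d → ℝ) → ℝ) (p : ℝ≥0∞) {n : ℕ}
    (sel : (Fin n → Fin d → ℝ) → (Fin d → ℝ) × Part d) (f : (Fin d → ℝ) → ℝ) : ℝ≥0∞ :=
  if p = ⊤ then
    ∫⁻ y, eLpNorm (fun x => fHatProd K q (sel y) y x - (f x : ℂ)) ⊤ volume
      ∂obsMeasure d n f q
  else
    (∫⁻ y, eLpNorm (fun x => fHatProd K q (sel y) y x - (f x : ℂ)) p volume ^ p.toReal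
      ∂obsMeasure d n f q) ^ (1 / p.toReal)

/-- The oracle risk `R_p[(h,P),f]`. -/
def riskOracle {d : ℕ} (K : ℝ → ℝ) (q : (Fin d → ℝ) → ℝ) (p : ℝ≥0∞) (𝔓 : Set (Part d))
    (n : ℕ) (hP : (Fin d → ℝ) × Part d) (f : (Fin d → ℝ) → ℝ) : ℝ≥0∞ :=
  if p = ⊤ then
    ∫⁻ y, (⨆ P' ∈ 𝔓, ⨆ I ∈ diamond hP.2 P',
      eLpNorm (fun xI => fHat I K q hP.1 y xI - (marginal I f xI : ℂ)) ⊤ volume)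
      ∂obsMeasure d n f q
  else
    (∫⁻ y, (⨆ P' ∈ 𝔓, ⨆ I ∈ diamond hP.2 P',
      eLpNorm (fun xI => fHat I K q hP.1 y xI - (marginal I f xI : ℂ)) p volume) ^ p.toReal
      ∂obsMeasure d n f q) ^ (1 / p.toReal)

/-- `f_p = 1 ∨ sup_{P,P' ∈ 𝔓} sup_{I ∈ P⋄P'} ‖f_I‖_p` (as an extended real). -/
def fpE {d : ℕ} (p : ℝ≥0∞) (𝔓 : Set (Part d)) (f : (Fin d → ℝ) → ℝ) : ℝ≥0∞ :=
  max 1 (⨆ P ∈ 𝔓, ⨆ P' ∈ 𝔓, ⨆ I ∈ diamond P P', eLpNorm (marginal I f) p volume)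

/-- Criterion of the Goldenshluger–Lepski rule in the structureless case `𝔓 = {{1,…,d}}`
(where `Λ_p = γ_p`): `Δ̃_p(h) + γ_p U_p(h)` with
`Δ̃_p(h) = sup_{η ∈ H_p} [‖K_η ⋆ f̃_h - f̃_η‖_p - γ_p U_p(η)]_+`. -/
def critU {d : ℕ} (K : ℝ → ℝ) (q : (Fin d → ℝ) → ℝ) (lam : Fin d → ℝ) (p : ℝ≥0∞)
    (γp : ℝ≥0∞) (n : ℕ) (y : Fin n → Fin d → ℝ) (h : Fin d → ℝ) : ℝ≥0∞ :=
  (⨆ η ∈ {η : Fin d → ℝ | memGrid lam p n (Finset.univ : Finset (Fin d)) η},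
    (eLpNorm (fun xI => fHatConv K q Finset.univ h η y xI -
        fHat Finset.univ K q η y xI) p volume -
      γp * Up K q lam p n Finset.univ η)) +
  γp * Up K q lam p n Finset.univ h

/-- Risk `R_p[f̃_h, f]` of the kernel estimator with a fixed bandwidth `h`
(`E_f ‖f̃_h - f‖_∞` for `p = ∞`). -/
def riskH {d : ℕ} (K : ℝ → ℝ) (q : (Fin d → ℝ) → ℝ) (p : ℝ≥0∞) (n : ℕ) (h : Fin d → ℝ)
    (f : (Fin d → ℝ) → ℝ) : ℝ≥0∞ :=
  if p = ⊤ then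
    ∫⁻ y, eLpNorm (fun xI : ↥(Finset.univ : Finset (Fin d)) → ℝ =>
      fHat Finset.univ K q h y xI - (f (fun i => xI ⟨i, Finset.mem_univ i⟩) : ℂ)) ⊤ volume
      ∂obsMeasure d n f q
  else
    (∫⁻ y, eLpNorm (fun xI : ↥(Finset.univ : Finset (Fin d)) → ℝ =>
      fHat Finset.univ K q h y xI - (f (fun i => xI ⟨i, Finset.mem_univ i⟩) : ℂ)) p volume
        ^ p.toReal ∂obsMeasure d n f q) ^ (1 / p.toReal)

/-- Risk of the data-driven estimator `f̃ = f̃_{h̃}` in the structureless case. -/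
def riskSelU {d : ℕ} (K : ℝ → ℝ) (q : (Fin d → ℝ) → ℝ) (p : ℝ≥0∞) (n : ℕ)
    (sel : (Fin n → Fin d → ℝ) → Fin d → ℝ) (f : (Fin d → ℝ) → ℝ) : ℝ≥0∞ :=
  if p = ⊤ then
    ∫⁻ y, eLpNorm (fun xI : ↥(Finset.univ : Finset (Fin d)) → ℝ =>
      fHat Finset.univ K q (sel y) y xI - (f (fun i => xI ⟨i, Finset.mem_univ i⟩) : ℂ)) ⊤
        volume ∂obsMeasure d n f q
  else
    (∫⁻ y, eLpNorm (fun xI : ↥(Finset.univ : Finset (Fin d)) → ℝ =>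
      fHat Finset.univ K q (sel y) y xI - (f (fun i => xI ⟨i, Finset.mem_univ i⟩) : ℂ)) p
        volume ^ p.toReal ∂obsMeasure d n f q) ^ (1 / p.toReal)

local notation "oR" => ENNReal.ofReal


lemma exp_le_quad {z c : ℝ} (hz : z ≤ c) (hc : 0 ≤ c) :
    Real.exp z ≤ 1 + z + z ^ 2 * Real.exp c := by
  rcases le_or_gt z 0 with h0 | h0
  · have h1 : Real.exp z ≤ 1 + z + z ^ 2 := by
      have h2 : 1 - z ≤ Real.exp (-z) := by have := Real.add_one_le_exp (-z); linarith
      have h3 : Real.exp z * Real.exp (-z) = 1 := by rw [← Real.exp_add]; simp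
      have h4 : Real.exp z * (1 - z) ≤ 1 := by
        calc _ ≤ Real.exp z * Real.exp (-z) := by gcongr
          _ = 1 := h3
      have h5 : Real.exp z ≤ 1 / (1 - z) := by
        rw [le_div_iff₀ (by linarith)]; exact h4
      refine h5.trans ?_
      rw [div_le_iff₀ (by linarith)]
      nlinarith [sq_nonneg z, mul_nonneg (neg_nonneg.2 h0) (sq_nonneg z)]
    have h6 : (1:ℝ) ≤ Real.exp c := Real.one_le_exp hc
    nlinarith [sq_nonneg z]
  · have h2 : 1 - z ≤ Real.exp (-z) := by have := Real.add_one_le_exp (-z); linarith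
    have h3 : Real.exp z * Real.exp (-z) = 1 := by rw [← Real.exp_add]; simp
    have h4 : Real.exp z * (1 - z) ≤ 1 := by
        calc _ ≤ Real.exp z * Real.exp (-z) := by gcongr
          _ = 1 := h3
    have h5 : Real.exp z ≤ 1 + z * Real.exp z := by nlinarith
    have h6 : Real.exp z ≤ Real.exp c := Real.exp_le_exp.2 hz
    have h7 : z * Real.exp z ≤ z * (1 + z * Real.exp z) := by gcongr
    have h8 : z^2 * Real.exp z ≤ z^2 * Real.exp c := by gcongr
    nlinarith

lemma scalar_small {p : ℝ} (hp : 0 < p) (a b : ℂ) (hab : ‖b‖ < ‖a‖ / 2) :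
    ‖a + b‖ ^ p ≤ ‖a‖ ^ p + p * ‖a‖ ^ (p - 2) * ((starRingEnd ℂ a) * b).re
      + (p / 2 + 7 * p ^ 2 * Real.exp (p * (5/8))) * (‖a‖ ^ (p - 2) * ‖b‖ ^ 2) := by
  have ha : 0 < ‖a‖ := by
    by_contra h
    have : ‖a‖ = 0 := le_antisymm (not_lt.1 h) (norm_nonneg _)
    rw [this] at hab; have := norm_nonneg b; linarith
  set r := ‖a‖ with hr
  set w := ((starRingEnd ℂ a) * b).re with hw
  have hwle : |w| ≤ r * ‖b‖ := by
    have := Complex.abs_re_le_norm ((starRingEnd ℂ a) * b)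
    rwa [norm_mul, RCLike.norm_conj] at this
  have hsq : ‖a + b‖ ^ 2 = r ^ 2 + 2 * w + ‖b‖ ^ 2 := by
    have h1 : ‖a+b‖^2 = Complex.normSq (a+b) := (Complex.normSq_eq_norm_sq _).symm
    have h2 : r^2 = Complex.normSq a := (Complex.normSq_eq_norm_sq _).symm
    have h3 : ‖b‖^2 = Complex.normSq b := (Complex.normSq_eq_norm_sq _).symm
    rw [h1, h2, h3, hw]
    simp [Complex.normSq_apply]; ring
  set z := (2 * w + ‖b‖ ^ 2) / r ^ 2 with hz
  have hb0 := norm_nonneg b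
  have hr2 : 0 < r ^ 2 := by positivity
  have hzr : z * r ^ 2 = 2 * w + ‖b‖ ^ 2 := by rw [hz]; field_simp
  have hsq2 : ‖a + b‖ ^ 2 = r ^ 2 * (1 + z) := by rw [hsq]; linarith
  have hzabs : |z| * r ^ 2 ≤ 5/2 * (r * ‖b‖) := by
    rw [← abs_of_pos hr2, ← abs_mul, hzr]
    refine (abs_add_le _ _).trans ?_
    rw [abs_mul, abs_of_pos (show (0:ℝ) < 2 by norm_num), abs_of_nonneg (sq_nonneg ‖b‖)]
    nlinarith
  have hzle : |z| ≤ 5/4 := by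
    have : |z| * r^2 ≤ 5/4 * r^2 := by nlinarith
    exact le_of_mul_le_mul_right this hr2
  have hz2 : z ^ 2 * r ^ 2 ≤ 25/4 * ‖b‖ ^ 2 := by
    have h1 : (|z| * r^2)^2 ≤ (5/2 * (r * ‖b‖))^2 := by
      apply pow_le_pow_left₀ (by positivity) hzabs
    rw [mul_pow, sq_abs] at h1
    have : z^2 * r^2 * r^2 ≤ 25/4 * ‖b‖^2 * r^2 := by nlinarith
    exact le_of_mul_le_mul_right this hr2
  have h1z : 0 ≤ 1 + z := by
    by_contra h
    have : r^2 * (1+z) < 0 := mul_neg_of_pos_of_neg hr2 (not_le.1 h)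
    have h2 := sq_nonneg ‖a+b‖
    linarith
  have hpow : ‖a + b‖ ^ p = r ^ p * (1 + z) ^ (p / 2) := by
    have h1 : ‖a+b‖ ^ p = (‖a+b‖^2) ^ (p/2) := by
      rw [← Real.rpow_natCast, ← Real.rpow_mul (norm_nonneg _)]; congr 1; push_cast; ring
    have h2 : r ^ p = (r^2) ^ (p/2) := by
      rw [← Real.rpow_natCast, ← Real.rpow_mul ha.le]; congr 1; push_cast; ring
    rw [h1, h2, hsq2, Real.mul_rpow hr2.le h1z]
  have hbern : (1 + z) ^ (p/2) ≤ Real.exp (z * (p/2)) := by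
    calc (1+z)^(p/2) ≤ (Real.exp z)^(p/2) := by
          apply Real.rpow_le_rpow h1z _ (by positivity)
          have := Real.add_one_le_exp z; linarith
      _ = _ := by rw [← Real.exp_mul]
  have hquad := exp_le_quad (z := z * (p/2)) (c := p * (5/8))
    (by nlinarith [le_abs_self z]) (by positivity)
  have hrp : r ^ p = r ^ (p-2) * r^2 := by
    rw [← Real.rpow_natCast, ← Real.rpow_add ha]; congr 1; push_cast; ring
  have hR : 0 < r ^ (p-2) := Real.rpow_pos_of_pos ha _
  have hE := Real.exp_pos (p * (5/8))
  rw [hpow]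
  calc r ^ p * (1+z)^(p/2) ≤ r^p * (1 + z * (p/2) + (z*(p/2))^2 * Real.exp (p * (5/8))) := by
        gcongr; exact hbern.trans hquad
    _ = r^p + r^(p-2) * (z * r^2) * (p/2) +
          r^(p-2) * (z^2 * r^2) * ((p/2)^2 * Real.exp (p * (5/8))) := by rw [hrp]; ring
    _ ≤ r^p + r^(p-2) * (z * r^2) * (p/2) +
          r^(p-2) * (25/4 * ‖b‖^2) * ((p/2)^2 * Real.exp (p * (5/8))) := by gcongr
    _ ≤ _ := by
        rw [hzr]
        have : 0 ≤ r^(p-2) * ‖b‖^2 * (p^2 * Real.exp (p * (5/8))) := by positivity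
        nlinarith

lemma scalar_large {p : ℝ} (hp : 1 ≤ p) (a b : ℂ) (hab : ‖a‖ / 2 ≤ ‖b‖) :
    ‖a + b‖ ^ p ≤ ‖a‖ ^ p + p * ‖a‖ ^ (p - 2) * ((starRingEnd ℂ a) * b).re
      + (3 ^ p + p * 2 ^ (p-1)) * ‖b‖ ^ p := by
  have hb := norm_nonneg b
  have ha := norm_nonneg a
  have h1 : ‖a + b‖ ^ p ≤ 3 ^ p * ‖b‖ ^ p := by
    rw [← Real.mul_rpow (by norm_num) hb]
    apply Real.rpow_le_rpow (norm_nonneg _) _ (by linarith)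
    have := norm_add_le a b; linarith
  have h2 : -(‖a‖ ^ (p-2) * ((starRingEnd ℂ a) * b).re) ≤ 2^(p-1) * ‖b‖^p := by
    rcases ha.eq_or_lt with h0 | h0
    · have : a = 0 := by rw [← norm_eq_zero]; exact h0.symm
      subst this; simp; positivity
    have hw : |((starRingEnd ℂ a) * b).re| ≤ ‖a‖ * ‖b‖ := by
      have := Complex.abs_re_le_norm ((starRingEnd ℂ a) * b)
      rwa [norm_mul, RCLike.norm_conj] at this
    have hb0 : 0 < ‖b‖ := by linarith
    calc -(‖a‖ ^ (p-2) * ((starRingEnd ℂ a) * b).re) = ‖a‖^(p-2) * (-((starRingEnd ℂ a) * b).re) := by ring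
      _ ≤ ‖a‖^(p-2) * (‖a‖ * ‖b‖) := by
          gcongr
          exact (neg_le_abs _).trans hw
      _ = ‖a‖^(p-1) * ‖b‖ := by
          rw [← mul_assoc]; congr 1
          nth_rewrite 2 [← Real.rpow_one ‖a‖]
          rw [← Real.rpow_add h0]; congr 1; ring
      _ ≤ (2 * ‖b‖)^(p-1) * ‖b‖ := by
          gcongr
          linarith
      _ = 2^(p-1) * ‖b‖^p := by
          rw [Real.mul_rpow (by norm_num) hb, mul_assoc]; congr 1
          nth_rewrite 2 [← Real.rpow_one ‖b‖]
          rw [← Real.rpow_add hb0]; congr 1; ring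
  have h3 : 0 ≤ ‖a‖^p := by positivity
  have h4 := mul_le_mul_of_nonneg_left h2 (show 0 ≤ p by linarith)
  nlinarith

def cS (p : ℝ) : ℝ := (p / 2 + 7 * p ^ 2 * Real.exp (p * (5/8))) + (3 ^ p + p * 2 ^ (p-1))

lemma cS_pos {p : ℝ} (hp : 0 < p) : 0 < cS p := by unfold cS; positivity

lemma scalar_ge {p : ℝ} (hp : 1 ≤ p) (a b : ℂ) :
    ‖a + b‖ ^ p ≤ ‖a‖ ^ p + p * ‖a‖ ^ (p - 2) * ((starRingEnd ℂ a) * b).re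
      + cS p * (‖a‖ ^ (p - 2) * ‖b‖ ^ 2 + ‖b‖ ^ p) := by
  have hb := norm_nonneg b
  have ha := norm_nonneg a
  have e1 : 0 ≤ (p / 2 + 7 * p ^ 2 * Real.exp (p * (5/8))) * ‖b‖^p := by positivity
  have e2 : 0 ≤ (p / 2 + 7 * p ^ 2 * Real.exp (p * (5/8))) * (‖a‖ ^ (p - 2) * ‖b‖ ^ 2) := by positivity
  have e3 : 0 ≤ (3 ^ p + p * 2 ^ (p-1)) * (‖a‖ ^ (p - 2) * ‖b‖ ^ 2) := by positivity
  have e4 : 0 ≤ (3 ^ p + p * 2 ^ (p-1)) * ‖b‖^p := by positivity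
  rcases lt_or_ge ‖b‖ (‖a‖/2) with h | h
  · have := scalar_small (by linarith : 0 < p) a b h
    unfold cS; nlinarith
  · have := scalar_large hp a b h
    unfold cS; nlinarith

lemma scalar_le {p : ℝ} (hp : 1 ≤ p) (hp2 : p ≤ 2) (a b : ℂ) :
    ‖a + b‖ ^ p ≤ ‖a‖ ^ p + p * ‖a‖ ^ (p - 2) * ((starRingEnd ℂ a) * b).re
      + cS p * ‖b‖ ^ p := by
  have hb := norm_nonneg b
  have ha := norm_nonneg a
  have e1 : 0 ≤ (p / 2 + 7 * p ^ 2 * Real.exp (p * (5/8))) * ‖b‖^p := by positivity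
  have e4 : 0 ≤ (3 ^ p + p * 2 ^ (p-1)) * ‖b‖^p := by positivity
  rcases lt_or_ge ‖b‖ (‖a‖/2) with h | h
  · have := scalar_small (by linarith : 0 < p) a b h
    have h2 : ‖a‖ ^ (p - 2) * ‖b‖ ^ 2 ≤ ‖b‖^p := by
      rcases hb.eq_or_lt with h0 | h0
      · rw [← h0]; simp; positivity
      calc ‖a‖ ^ (p - 2) * ‖b‖ ^ 2 ≤ ‖b‖^(p-2) * ‖b‖^2 := by
            exact mul_le_mul_of_nonneg_right
              (Real.rpow_le_rpow_of_nonpos h0 (by linarith) (by linarith)) (by positivity)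
        _ = ‖b‖^p := by
            rw [← Real.rpow_natCast, ← Real.rpow_add h0]; congr 1; push_cast; ring
    have h3 := mul_le_mul_of_nonneg_left h2 (show 0 ≤ (p / 2 + 7 * p ^ 2 * Real.exp (p * (5/8))) by positivity)
    unfold cS; nlinarith
  · have := scalar_large hp a b h
    unfold cS; nlinarith

section abs
variable {X Y : Type} [MeasurableSpace X] [MeasurableSpace Y]

lemma intp_add {ν : Measure X} {p : ℝ} (hp : 1 ≤ p) {s t : X → ℂ} (hs : Measurable s) (ht : Measurable t)
    (hsi : Integrable (fun x => ‖s x‖ ^ p) ν) (hti : Integrable (fun x => ‖t x‖ ^ p) ν) :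
    Integrable (fun x => ‖s x + t x‖ ^ p) ν := by
  refine ((hsi.add hti).const_mul (2 ^ p)).mono' ((hs.add ht).norm.pow_const p).aestronglyMeasurable (ae_of_all _ fun x => ?_)
  rw [Real.norm_of_nonneg (by positivity)]
  have h1 : ‖s x + t x‖ ≤ 2 * max ‖s x‖ ‖t x‖ := by
    have := norm_add_le (s x) (t x)
    have := le_max_left ‖s x‖ ‖t x‖
    have := le_max_right ‖s x‖ ‖t x‖
    linarith
  have h0 : 0 ≤ max ‖s x‖ ‖t x‖ := (norm_nonneg _).trans (le_max_left _ _)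
  calc ‖s x + t x‖ ^ p ≤ (2 * max ‖s x‖ ‖t x‖) ^ p :=
        Real.rpow_le_rpow (norm_nonneg _) h1 (by linarith)
    _ = 2 ^ p * (max ‖s x‖ ‖t x‖) ^ p := Real.mul_rpow (by norm_num) h0
    _ ≤ 2 ^ p * (‖s x‖ ^ p + ‖t x‖ ^ p) := by
        gcongr
        rcases max_cases ‖s x‖ ‖t x‖ with h | h <;> rw [h.1]
        · have : 0 ≤ ‖t x‖ ^ p := by positivity
          linarith
        · have : 0 ≤ ‖s x‖ ^ p := by positivity
          linarith

def Jf (p : ℝ) (a : ℂ) : ℂ := ((‖a‖ ^ (p - 2) : ℝ) : ℂ) * (starRingEnd ℂ a)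

lemma norm_Jf {p : ℝ} (hp : 1 < p) (a : ℂ) : ‖Jf p a‖ = ‖a‖ ^ (p - 1) := by
  unfold Jf
  rw [norm_mul, RCLike.norm_conj, Complex.norm_real, Real.norm_of_nonneg (by positivity)]
  rcases (norm_nonneg a).eq_or_lt with h | h
  · rw [← h, mul_zero, Real.zero_rpow (by linarith)]
  · nth_rewrite 2 [← Real.rpow_one ‖a‖]
    rw [← Real.rpow_add h]; congr 1; ring

@[fun_prop]
lemma measurable_Jf (p : ℝ) : Measurable (Jf p) := by
  unfold Jf; fun_prop

def Wf (ν : Measure X) (p : ℝ) (ζ : X → Y → ℂ) (s : X → ℂ) (y : Y) : ℂ :=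
  ∫ x, Jf p (s x) * ζ x y ∂ν

def Nf (ν : Measure X) (p H : ℝ) (s : X → ℂ) : ℝ := (H ^ p + ∫ x, ‖s x‖ ^ p ∂ν) ^ (1 / p)

lemma holder_J {ν : Measure X} {p : ℝ} (hp : 1 < p) {s t : X → ℂ} (hs : Measurable s) (ht : Measurable t)
    (hsi : Integrable (fun x => ‖s x‖ ^ p) ν) (hti : Integrable (fun x => ‖t x‖ ^ p) ν) :
    Integrable (fun x => ‖Jf p (s x)‖ * ‖t x‖) ν ∧
    ∫ x, ‖Jf p (s x)‖ * ‖t x‖ ∂ν ≤ (∫ x, ‖s x‖ ^ p ∂ν) ^ ((p - 1) / p) * (∫ x, ‖t x‖ ^ p ∂ν) ^ (1 / p) := by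
  have hpq : (p / (p - 1)).HolderConjugate p := (Real.HolderConjugate.conjExponent hp).symm
  have e1 : ∀ x, ‖Jf p (s x)‖ ^ (p / (p-1)) = ‖s x‖ ^ p := fun x => by
    rw [norm_Jf hp, ← Real.rpow_mul (norm_nonneg _)]
    congr 1; field_simp [show p - 1 ≠ 0 by linarith]
  have h1 : MemLp (fun x => ‖Jf p (s x)‖) (oR (p / (p-1))) ν := by
    have hm : AEStronglyMeasurable (fun x => ‖Jf p (s x)‖) ν := ((measurable_Jf p).comp hs).norm.aestronglyMeasurable
    rw [← integrable_norm_rpow_iff hm (by simp; exact hpq.pos) (by simp)]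
    rw [ENNReal.toReal_ofReal hpq.nonneg]
    simpa [e1] using hsi
  have h2 : MemLp (fun x => ‖t x‖) (oR p) ν := by
    rw [← integrable_norm_rpow_iff (by fun_prop) (by simp; linarith) (by simp)]
    rw [ENNReal.toReal_ofReal (by linarith)]
    simpa using hti
  constructor
  · haveI : ENNReal.HolderConjugate (oR (p / (p-1))) (oR p) := hpq.ennrealOfReal
    exact h1.integrable_mul h2
  · have := integral_mul_le_Lp_mul_Lq_of_nonneg hpq (ae_of_all ν fun x => norm_nonneg (Jf p (s x)))
      (ae_of_all ν fun x => norm_nonneg (t x)) h1 h2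
    simp only [e1] at this
    convert this using 3
    field_simp

lemma Nf_pos {ν : Measure X} {p H : ℝ} (hH : 0 < H) (s : X → ℂ) : 0 < Nf ν p H s := by
  unfold Nf
  have : 0 ≤ ∫ x, ‖s x‖ ^ p ∂ν := integral_nonneg fun x => by positivity
  positivity

lemma Nf_ge {ν : Measure X} {p H : ℝ} (hp : 1 < p) (hH : 0 < H) (s : X → ℂ) : H ≤ Nf ν p H s := by
  unfold Nf
  have : 0 ≤ ∫ x, ‖s x‖ ^ p ∂ν := integral_nonneg fun x => by positivity
  calc H = (H ^ p) ^ (1 / p) := by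
        rw [← Real.rpow_mul hH.le, mul_one_div_cancel (by linarith), Real.rpow_one]
    _ ≤ _ := Real.rpow_le_rpow (by positivity) (by linarith) (by positivity)

lemma Nf_pow {ν : Measure X} {p H : ℝ} (hp : 1 < p) (hH : 0 < H) (s : X → ℂ) :
    Nf ν p H s ^ p = H ^ p + ∫ x, ‖s x‖ ^ p ∂ν := by
  unfold Nf
  have : 0 ≤ ∫ x, ‖s x‖ ^ p ∂ν := integral_nonneg fun x => by positivity
  rw [← Real.rpow_mul (by positivity), one_div_mul_cancel (by linarith), Real.rpow_one]

lemma Nf_ge_norm {ν : Measure X} {p H : ℝ} (hp : 1 < p) (hH : 0 < H) (s : X → ℂ) {a : ℝ} (ha : 0 ≤ a) :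
    (∫ x, ‖s x‖ ^ p ∂ν) ^ (a / p) ≤ Nf ν p H s ^ a := by
  have h0 : 0 ≤ ∫ x, ‖s x‖ ^ p ∂ν := integral_nonneg fun x => by positivity
  calc (∫ x, ‖s x‖ ^ p ∂ν) ^ (a / p) ≤ (Nf ν p H s ^ p) ^ (a / p) := by
        rw [Nf_pow hp hH]
        apply Real.rpow_le_rpow h0 _ (by positivity)
        have : 0 < H ^ p := by positivity
        linarith
    _ = _ := by
        rw [← Real.rpow_mul (Nf_pos hH s).le]; congr 1; field_simp

lemma root_concave {p A u : ℝ} (hp : 1 < p) (hA : 0 < A) (hu : 0 ≤ A ^ p + u) :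
    (A ^ p + u) ^ (1 / p) ≤ A + A ^ (1 - p) * u / p := by
  have hAp : 0 < A ^ p := by positivity
  have h1 : A ^ p + u = A ^ p * (1 + u / A ^ p) := by field_simp
  have h2 : -1 ≤ u / A ^ p := by rw [le_div_iff₀ hAp]; linarith
  rw [h1, Real.mul_rpow hAp.le (by linarith), ← Real.rpow_mul hA.le,
    mul_one_div_cancel (by linarith), Real.rpow_one]
  have h3 := rpow_one_add_le_one_add_mul_self h2 (p := 1 / p) (by positivity)
    (by rw [div_le_one (by linarith)]; linarith)
  calc A * (1 + u / A ^ p) ^ (1 / p) ≤ A * (1 + 1 / p * (u / A ^ p)) := by gcongr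
    _ = _ := by
      rw [Real.rpow_sub hA, Real.rpow_one]; field_simp

lemma step {ν : Measure X} [SigmaFinite ν] {μ : Measure Y} [IsProbabilityMeasure μ] {p H M σ lm b1 b2 c : ℝ}
    (hp : 1 < p) (hH : 0 < H) (hM : 0 ≤ M) (hl : 0 ≤ lm) (hb1 : 0 ≤ b1) (hb2 : 0 ≤ b2)
    {ζ : X → Y → ℂ} (hζ : Measurable (Function.uncurry ζ))
    (hζi : ∀ y, Integrable (fun x => ‖ζ x y‖ ^ p) ν) (hζM : ∀ y, ∫ x, ‖ζ x y‖ ^ p ∂ν ≤ M ^ p)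
    (hζ0 : ∀ x, ∫ y, ζ x y ∂μ = 0)
    {s : X → ℂ} (hs : Measurable s) (hsi : Integrable (fun x => ‖s x‖ ^ p) ν)
    (hσ : ∫ y, ‖Wf ν p ζ s y‖ ^ 2 ∂μ ≤ σ ^ 2 * (Nf ν p H s ^ (p - 1)) ^ 2)
    {Q : Y → ℝ} (hQ0 : ∀ y, 0 ≤ Q y) (hQm : Measurable Q)
    (hQ1 : ∀ y, Q y ≤ Nf ν p H s ^ (p - 1) * b1) (hQ2 : ∫ y, Q y ∂μ ≤ Nf ν p H s ^ (p - 1) * b2)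
    (hQ : ∀ y, ∫ x, ‖s x + ζ x y‖ ^ p ∂ν ≤ ∫ x, ‖s x‖ ^ p ∂ν + p * (Wf ν p ζ s y).re + Q y)
    (hc : lm * (M + b1) ≤ c) :
    ∫⁻ y, oR (Real.exp (lm * Nf ν p H (fun x => s x + ζ x y))) ∂μ ≤
      oR (Real.exp (lm * Nf ν p H s +
        (lm * b2 + 2 * Real.exp c * lm ^ 2 * σ ^ 2 + 2 * Real.exp c * lm ^ 2 * (b1 * b2)))) := by
  set A := Nf ν p H s with hA
  have hA0 : 0 < A := Nf_pos hH s
  have hc0 : 0 ≤ c := le_trans (by positivity) hc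
  have hAB : A ^ (1 - p) * A ^ (p - 1) = 1 := by
    rw [← Real.rpow_add hA0]; simp
  have hA1 : 0 < A ^ (1 - p) := by positivity
  have hp0 : 0 < p := by linarith
  have hζy : ∀ y, Measurable fun x => ζ x y := fun y => hζ.comp (measurable_id.prodMk measurable_const)
  have hWb : ∀ y, ‖Wf ν p ζ s y‖ ≤ A ^ (p - 1) * M := fun y => by
    have h := (holder_J hp hs (hζy y) hsi (hζi y)).2
    calc ‖Wf ν p ζ s y‖ ≤ ∫ x, ‖Jf p (s x)‖ * ‖ζ x y‖ ∂ν := by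
          unfold Wf
          refine (norm_integral_le_integral_norm _).trans (le_of_eq ?_)
          simp [norm_mul]
      _ ≤ _ := h
      _ ≤ A ^ (p - 1) * (M ^ p) ^ (1 / p) := by
          gcongr
          · exact Nf_ge_norm hp hH s (by linarith)
          · exact hζM y
      _ = _ := by
          rw [← Real.rpow_mul hM, mul_one_div_cancel (by linarith), Real.rpow_one]
  have hJm : Measurable (fun z : X × Y => Jf p (s z.1) * ζ z.1 z.2) := by
    exact ((measurable_Jf p).comp (hs.comp measurable_fst)).mul hζ
  have hWm : Measurable (Wf ν p ζ s) := by
    have : StronglyMeasurable (fun z : Y × X => Jf p (s z.2) * ζ z.2 z.1) :=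
      (hJm.comp measurable_swap).stronglyMeasurable
    exact this.integral_prod_right'.measurable
  have hWi : Integrable (Wf ν p ζ s) μ :=
    Integrable.of_bound hWm.aestronglyMeasurable _ (ae_of_all _ hWb)
  have hprod : Integrable (fun z : X × Y => Jf p (s z.1) * ζ z.1 z.2) (ν.prod μ) := by
    rw [integrable_prod_iff' hJm.aestronglyMeasurable]
    constructor
    · refine ae_of_all _ fun y => ?_
      have := (holder_J hp hs (hζy y) hsi (hζi y)).1
      refine this.mono' ?_ (ae_of_all _ fun x => by simp [norm_mul])
      exact (((measurable_Jf p).comp hs).mul (hζy y)).aestronglyMeasurable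
    · refine Integrable.of_bound ?_ (A ^ (p - 1) * M) (ae_of_all _ fun y => ?_)
      · have : StronglyMeasurable (fun z : Y × X => ‖Jf p (s z.2) * ζ z.2 z.1‖) :=
          (hJm.comp measurable_swap).norm.stronglyMeasurable
        exact this.integral_prod_right'.aestronglyMeasurable
      · rw [Real.norm_of_nonneg (integral_nonneg fun x => norm_nonneg _)]
        have h := (holder_J hp hs (hζy y) hsi (hζi y)).2
        simp only [norm_mul]
        refine h.trans ?_
        calc _ ≤ A ^ (p - 1) * (M ^ p) ^ (1 / p) := by
              gcongr
              · exact Nf_ge_norm hp hH s (by linarith)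
              · exact hζM y
          _ = _ := by
              rw [← Real.rpow_mul hM, mul_one_div_cancel (by linarith), Real.rpow_one]
  have hW0 : ∫ y, Wf ν p ζ s y ∂μ = 0 := by
    unfold Wf
    rw [← integral_integral_swap (f := fun x y => Jf p (s x) * ζ x y) hprod]
    simp [integral_const_mul, hζ0]
  have hWre0 : ∫ y, (Wf ν p ζ s y).re ∂μ = 0 := by
    have := integral_re hWi
    simp only [hW0] at this
    simpa using this
  set a : Y → ℝ := fun y => A ^ (1 - p) * (Wf ν p ζ s y).re with ha
  set b : Y → ℝ := fun y => A ^ (1 - p) * Q y / p with hb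
  have ham : Measurable a := by
    have : Measurable fun y => (Wf ν p ζ s y).re := Complex.measurable_re.comp hWm
    exact this.const_mul _
  have hbm : Measurable b := (hQm.const_mul _).div_const _
  have hab : ∀ y, |a y| ≤ M := fun y => by
    rw [ha]; simp only [abs_mul, abs_of_pos hA1]
    calc A ^ (1 - p) * |(Wf ν p ζ s y).re| ≤ A ^ (1 - p) * (A ^ (p - 1) * M) := by
          gcongr; exact (Complex.abs_re_le_norm _).trans (hWb y)
      _ = M := by rw [← mul_assoc, hAB, one_mul]
  have hb0 : ∀ y, 0 ≤ b y := fun y => by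
    have := hQ0 y
    simp only [hb]; positivity
  have hbb : ∀ y, b y ≤ b1 := fun y => by
    have := hQ0 y
    simp only [hb]
    rw [div_le_iff₀ hp0]
    calc A ^ (1 - p) * Q y ≤ A ^ (1 - p) * (A ^ (p - 1) * b1) := by gcongr; exact hQ1 y
      _ = b1 * 1 := by rw [← mul_assoc, hAB]; ring
      _ ≤ b1 * p := by gcongr
  have hai : Integrable a μ := Integrable.of_bound ham.aestronglyMeasurable M
    (ae_of_all _ fun y => by rw [Real.norm_eq_abs]; exact hab y)
  have hbi : Integrable b μ := Integrable.of_bound hbm.aestronglyMeasurable b1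
    (ae_of_all _ fun y => by rw [Real.norm_of_nonneg (hb0 y)]; exact hbb y)
  have ha2i : Integrable (fun y => a y ^ 2) μ := by
    refine Integrable.of_bound (ham.pow_const 2).aestronglyMeasurable (M ^ 2)
      (ae_of_all _ fun y => ?_)
    rw [Real.norm_of_nonneg (sq_nonneg _), ← sq_abs]
    gcongr; exact hab y
  have hEa : ∫ y, a y ∂μ = 0 := by
    simp only [ha, integral_const_mul, hWre0, mul_zero]
  have hEb : ∫ y, b y ∂μ ≤ b2 := by
    simp only [hb, integral_div, integral_const_mul]
    rw [div_le_iff₀ hp0]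
    calc A ^ (1 - p) * ∫ y, Q y ∂μ ≤ A ^ (1 - p) * (A ^ (p - 1) * b2) := by gcongr
      _ = b2 * 1 := by rw [← mul_assoc, hAB]; ring
      _ ≤ b2 * p := by gcongr
  have hEa2 : ∫ y, a y ^ 2 ∂μ ≤ σ ^ 2 := by
    have hW2 : Integrable (fun y => ‖Wf ν p ζ s y‖ ^ 2) μ := by
      refine Integrable.of_bound (hWm.norm.pow_const 2).aestronglyMeasurable ((A ^ (p - 1) * M) ^ 2)
        (ae_of_all _ fun y => ?_)
      rw [Real.norm_of_nonneg (sq_nonneg _)]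
      gcongr; exact hWb y
    calc ∫ y, a y ^ 2 ∂μ ≤ ∫ y, (A ^ (1 - p)) ^ 2 * ‖Wf ν p ζ s y‖ ^ 2 ∂μ := by
          apply integral_mono ha2i (hW2.const_mul _)
          intro y
          simp only [ha, mul_pow]
          gcongr (A ^ (1 - p)) ^ 2 * ?_
          rw [← sq_abs]
          gcongr
          exact Complex.abs_re_le_norm _
      _ = (A ^ (1 - p)) ^ 2 * ∫ y, ‖Wf ν p ζ s y‖ ^ 2 ∂μ := integral_const_mul _ _
      _ ≤ (A ^ (1 - p)) ^ 2 * (σ ^ 2 * (A ^ (p - 1)) ^ 2) := by gcongr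
      _ = σ ^ 2 * (A ^ (1 - p) * A ^ (p - 1)) ^ 2 := by ring
      _ = σ ^ 2 := by rw [hAB]; ring
  have hpt : ∀ y, Nf ν p H (fun x => s x + ζ x y) ≤ A + (a y + b y) := fun y => by
    have h0 : 0 ≤ ∫ x, ‖s x + ζ x y‖ ^ p ∂ν := integral_nonneg fun x => by positivity
    have hHp : 0 < H ^ p := by positivity
    have hAp := Nf_pow (ν := ν) hp hH s
    rw [← hA] at hAp
    have h1 : H ^ p + ∫ x, ‖s x + ζ x y‖ ^ p ∂ν ≤ A ^ p + (p * (Wf ν p ζ s y).re + Q y) := by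
      rw [hAp]; have := hQ y; linarith
    calc Nf ν p H (fun x => s x + ζ x y) ≤ (A ^ p + (p * (Wf ν p ζ s y).re + Q y)) ^ (1 / p) := by
          unfold Nf; exact Real.rpow_le_rpow (by linarith) h1 (by positivity)
      _ ≤ A + A ^ (1 - p) * (p * (Wf ν p ζ s y).re + Q y) / p :=
          root_concave hp hA0 (by linarith)
      _ = _ := by simp only [ha, hb]; field_simp
  set E := Real.exp c with hE
  have hE0 : 0 < E := Real.exp_pos _
  have hpt2 : ∀ y, Real.exp (lm * Nf ν p H (fun x => s x + ζ x y)) ≤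
      Real.exp (lm * A) * (1 + (lm * a y + lm * b y) + (2 * E * lm ^ 2 * a y ^ 2 + 2 * E * lm ^ 2 * b1 * b y)) := fun y => by
    have hz : lm * (a y + b y) ≤ c := by
      refine le_trans ?_ hc
      have := hbb y; have := (le_abs_self _).trans (hab y)
      gcongr
    calc Real.exp (lm * Nf ν p H (fun x => s x + ζ x y)) ≤ Real.exp (lm * A + lm * (a y + b y)) := by
          apply Real.exp_le_exp.2; rw [← mul_add]; gcongr; exact hpt y
      _ = Real.exp (lm * A) * Real.exp (lm * (a y + b y)) := Real.exp_add _ _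
      _ ≤ Real.exp (lm * A) * (1 + lm * (a y + b y) + (lm * (a y + b y)) ^ 2 * E) := by
          gcongr; exact exp_le_quad hz hc0
      _ ≤ _ := by
          gcongr Real.exp (lm * A) * ?_
          have h1 : (a y + b y) ^ 2 ≤ 2 * a y ^ 2 + 2 * (b1 * b y) := by
            have := mul_le_mul_of_nonneg_right (hbb y) (hb0 y)
            nlinarith [sq_nonneg (a y - b y)]
          have h2 : lm ^ 2 * E * (a y + b y) ^ 2 ≤ lm ^ 2 * E * (2 * a y ^ 2 + 2 * (b1 * b y)) := by gcongr
          nlinarith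
  have hint : Integrable (fun y => 1 + (lm * a y + lm * b y) + (2 * E * lm ^ 2 * a y ^ 2 + 2 * E * lm ^ 2 * b1 * b y)) μ := by
    exact ((integrable_const 1).add ((hai.const_mul _).add (hbi.const_mul _))).add
      ((ha2i.const_mul _).add (hbi.const_mul _))
  calc ∫⁻ y, oR (Real.exp (lm * Nf ν p H (fun x => s x + ζ x y))) ∂μ
      ≤ ∫⁻ y, oR (Real.exp (lm * A) * (1 + (lm * a y + lm * b y) + (2 * E * lm ^ 2 * a y ^ 2 + 2 * E * lm ^ 2 * b1 * b y))) ∂μ :=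
        lintegral_mono fun y => ENNReal.ofReal_le_ofReal (hpt2 y)
    _ = oR (∫ y, Real.exp (lm * A) * (1 + (lm * a y + lm * b y) + (2 * E * lm ^ 2 * a y ^ 2 + 2 * E * lm ^ 2 * b1 * b y)) ∂μ) := by
        rw [ofReal_integral_eq_lintegral_ofReal (hint.const_mul _)]
        exact ae_of_all _ fun y => (Real.exp_pos _).le.trans (hpt2 y)
    _ ≤ _ := by
        apply ENNReal.ofReal_le_ofReal
        rw [integral_const_mul, Real.exp_add]
        gcongr
        have i1 : Integrable (fun y => lm * a y) μ := hai.const_mul _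
        have i2 : Integrable (fun y => lm * b y) μ := hbi.const_mul _
        have i3 : Integrable (fun y => 2 * E * lm ^ 2 * a y ^ 2) μ := ha2i.const_mul _
        have i4 : Integrable (fun y => 2 * E * lm ^ 2 * b1 * b y) μ := hbi.const_mul _
        have i5 : Integrable (fun y => lm * a y + lm * b y) μ := i1.add i2
        have i6 : Integrable (fun y => 2 * E * lm ^ 2 * a y ^ 2 + 2 * E * lm ^ 2 * b1 * b y) μ := i3.add i4
        have i7 : Integrable (fun y => 1 + (lm * a y + lm * b y)) μ := (integrable_const 1).add i5
        rw [integral_add i7 i6, integral_add (integrable_const 1) i5, integral_add i1 i2, integral_add i3 i4]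
        simp only [integral_const_mul, hEa, integral_const, probReal_univ, smul_eq_mul, mul_zero, zero_add, mul_one]
        have h1 : lm * ∫ y, b y ∂μ ≤ lm * b2 := by gcongr
        have h2 : 2 * E * lm ^ 2 * ∫ y, a y ^ 2 ∂μ ≤ 2 * E * lm ^ 2 * σ ^ 2 := by gcongr
        have h3 : 2 * E * lm ^ 2 * b1 * ∫ y, b y ∂μ ≤ 2 * E * lm ^ 2 * b1 * b2 := by gcongr
        have h4 := Real.add_one_le_exp (lm * b2 + 2 * E * lm ^ 2 * σ ^ 2 + 2 * E * lm ^ 2 * (b1 * b2))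
        nlinarith

lemma Nf_meas {ν : Measure X} [SFinite ν] {Z : Type} [MeasurableSpace Z] {p H : ℝ} {g : X → Z → ℂ}
    (hg : Measurable (Function.uncurry g)) : Measurable fun z => Nf ν p H (fun x => g x z) := by
  have : StronglyMeasurable (fun z : Z × X => ‖g z.2 z.1‖ ^ p) :=
    ((hg.comp measurable_swap).norm.pow_const p).stronglyMeasurable
  unfold Nf
  exact (measurable_const.add this.integral_prod_right'.measurable).pow_const _

lemma sum_meas {n : ℕ} {ζ : X → Y → ℂ} (hζ : Measurable (Function.uncurry ζ)) {s : X → ℂ} (hs : Measurable s) :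
    Measurable (Function.uncurry fun (x : X) (y : Fin n → Y) => s x + ∑ k, ζ x (y k)) := by
  refine (hs.comp measurable_fst).add (Finset.measurable_sum _ fun k _ => ?_)
  exact hζ.comp (measurable_fst.prodMk ((measurable_pi_apply k).comp measurable_snd))

lemma super {ν : Measure X} [SigmaFinite ν] {μ : Measure Y} [IsProbabilityMeasure μ] {p H lm δ : ℝ}
    (hp : 1 < p) {ζ : X → Y → ℂ} (hζ : Measurable (Function.uncurry ζ))
    (hζi : ∀ y, Integrable (fun x => ‖ζ x y‖ ^ p) ν)
    (hstep : ∀ s : X → ℂ, Measurable s → Integrable (fun x => ‖s x‖ ^ p) ν →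
      ∫⁻ y, oR (Real.exp (lm * Nf ν p H (fun x => s x + ζ x y))) ∂μ ≤
      oR (Real.exp (lm * Nf ν p H s + δ))) (n : ℕ) :
    ∀ s : X → ℂ, Measurable s → Integrable (fun x => ‖s x‖ ^ p) ν →
      ∫⁻ y : Fin n → Y, oR (Real.exp (lm * Nf ν p H (fun x => s x + ∑ k, ζ x (y k)))) ∂(Measure.pi fun _ => μ) ≤
      oR (Real.exp (lm * Nf ν p H s + n * δ)) := by
  have hζy : ∀ y, Measurable fun x => ζ x y := fun y => hζ.comp (measurable_id.prodMk measurable_const)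
  induction n with
  | zero => intro s hs hsi; simp
  | succ n ih =>
    intro s hs hsi
    have mp := (measurePreserving_piFinSuccAbove (fun _ : Fin (n+1) => μ) 0).symm
    rw [← mp.lintegral_comp_emb (MeasurableEquiv.measurableEmbedding _)]
    have hm : Measurable fun y : Fin (n+1) → Y => oR (Real.exp (lm * Nf ν p H (fun x => s x + ∑ k, ζ x (y k)))) :=
      ENNReal.measurable_ofReal.comp (Real.measurable_exp.comp ((Nf_meas (sum_meas hζ hs)).const_mul _))
    have hm2 := hm.comp mp.measurable
    rw [lintegral_prod _ (by exact hm2.aemeasurable)]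
    calc _ ≤ ∫⁻ y0, oR (Real.exp (n * δ)) * oR (Real.exp (lm * Nf ν p H (fun x => s x + ζ x y0))) ∂μ := by
          refine lintegral_mono fun y0 => ?_
          have := ih (fun x => s x + ζ x y0) (hs.add (hζy y0)) (intp_add hp.le hs (hζy y0) hsi (hζi y0))
          rw [← ENNReal.ofReal_mul (Real.exp_pos _).le, ← Real.exp_add, add_comm ((n:ℝ) * δ)]
          refine le_trans (le_of_eq ?_) this
          refine lintegral_congr fun y => ?_
          simp [MeasurableEquiv.piFinSuccAbove, Fin.sum_univ_succ, add_assoc]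
      _ ≤ oR (Real.exp (n * δ)) * oR (Real.exp (lm * Nf ν p H s + δ)) := by
          rw [lintegral_const_mul']
          · gcongr; exact hstep s hs hsi
          · simp
      _ = _ := by
          rw [← ENNReal.ofReal_mul (Real.exp_pos _).le, ← Real.exp_add]
          congr 2; push_cast; ring

lemma rpow_le_exp {m t : ℝ} (hm : 0 < m) (ht : 0 ≤ t) : t ^ m ≤ m ^ m * Real.exp t := by
  have h1 : t / m ≤ Real.exp (t / m) := by have := Real.add_one_le_exp (t / m); linarith
  calc t ^ m = m ^ m * (t / m) ^ m := by
        rw [← Real.mul_rpow hm.le (by positivity)]; congr 1; field_simp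
    _ ≤ m ^ m * (Real.exp (t / m)) ^ m := by gcongr
    _ = _ := by rw [← Real.exp_mul]; congr 2; field_simp

lemma Nf_zero {ν : Measure X} {p H : ℝ} (hp : 1 < p) (hH : 0 < H) : Nf ν p H (fun _ => 0) = H := by
  unfold Nf
  simp only [norm_zero, Real.zero_rpow (show p ≠ 0 by linarith), integral_zero, add_zero]
  rw [← Real.rpow_mul hH.le, mul_one_div_cancel (by linarith), Real.rpow_one]

lemma super_tail {ν : Measure X} [SigmaFinite ν] {μ : Measure Y} [IsProbabilityMeasure μ] {p H lm δ : ℝ}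
    (hp : 1 < p) (hH : 0 < H) (hl : 0 < lm) {ζ : X → Y → ℂ} (hζ : Measurable (Function.uncurry ζ))
    (hζi : ∀ y, Integrable (fun x => ‖ζ x y‖ ^ p) ν)
    (hstep : ∀ s : X → ℂ, Measurable s → Integrable (fun x => ‖s x‖ ^ p) ν →
      ∫⁻ y, oR (Real.exp (lm * Nf ν p H (fun x => s x + ζ x y))) ∂μ ≤
      oR (Real.exp (lm * Nf ν p H s + δ))) (n : ℕ) {m T : ℝ} (hm : 0 < m) :
    ∫⁻ y : Fin n → Y, oR ((max ((∫ x, ‖∑ k, ζ x (y k)‖ ^ p ∂ν) ^ (1 / p) - T) 0) ^ m) ∂(Measure.pi fun _ => μ) ≤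
      oR (m ^ m * lm ^ (-m) * Real.exp (lm * H + n * δ - lm * T)) := by
  have h1 := super hp hζ hζi hstep n (fun _ => 0) measurable_const
    (by simp [Real.zero_rpow (show p ≠ 0 by linarith)])
  simp only [zero_add] at h1
  rw [Nf_zero hp hH] at h1
  calc _ ≤ ∫⁻ y : Fin n → Y, oR (m ^ m * lm ^ (-m) * Real.exp (- (lm * T))) *
        oR (Real.exp (lm * Nf ν p H (fun x => ∑ k, ζ x (y k)))) ∂(Measure.pi fun _ => μ) := by
        refine lintegral_mono fun y => ?_
        rw [← ENNReal.ofReal_mul (by positivity)]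
        apply ENNReal.ofReal_le_ofReal
        set N := Nf ν p H (fun x => ∑ k, ζ x (y k)) with hN
        have h2 : (∫ x, ‖∑ k, ζ x (y k)‖ ^ p ∂ν) ^ (1 / p) ≤ N := by
          have := Nf_ge_norm (ν := ν) hp hH (fun x => ∑ k, ζ x (y k)) (a := 1) (by norm_num)
          rwa [Real.rpow_one] at this
        rw [mul_assoc _ (Real.exp _), ← Real.exp_add]
        rcases le_total ((∫ x, ‖∑ k, ζ x (y k)‖ ^ p ∂ν) ^ (1 / p) - T) 0 with h3 | h3
        · rw [max_eq_right h3, Real.zero_rpow hm.ne']; positivity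
        · rw [max_eq_left h3]
          have h4 := rpow_le_exp hm (t := lm * ((∫ x, ‖∑ k, ζ x (y k)‖ ^ p ∂ν) ^ (1 / p) - T)) (by positivity)
          rw [Real.mul_rpow hl.le h3] at h4
          have h5 : lm ^ (-m) * lm ^ m = 1 := by rw [← Real.rpow_add hl]; simp
          calc _ = lm ^ (-m) * (lm ^ m * ((∫ x, ‖∑ k, ζ x (y k)‖ ^ p ∂ν) ^ (1 / p) - T) ^ m) := by
                rw [← mul_assoc, h5, one_mul]
            _ ≤ lm ^ (-m) * (m ^ m * Real.exp (lm * ((∫ x, ‖∑ k, ζ x (y k)‖ ^ p ∂ν) ^ (1 / p) - T))) := by gcongr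
            _ = m ^ m * lm ^ (-m) * Real.exp (lm * ((∫ x, ‖∑ k, ζ x (y k)‖ ^ p ∂ν) ^ (1 / p) - T)) := by ring
            _ ≤ _ := by
              gcongr
              have := mul_le_mul_of_nonneg_left h2 hl.le
              linarith
    _ ≤ oR (m ^ m * lm ^ (-m) * Real.exp (- (lm * T))) * oR (Real.exp (lm * H + n * δ)) := by
        rw [lintegral_const_mul' _ _ (by simp)]
        gcongr
    _ = _ := by
        rw [← ENNReal.ofReal_mul (by positivity), mul_assoc, ← Real.exp_add]
        congr 3; ring

end abs

section abs
variable {X Y : Type} [MeasurableSpace X] [MeasurableSpace Y]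

def cen (μ : Measure Y) (ℓ : X → Y → ℂ) (x : X) (y : Y) : ℂ := ℓ x y - ∫ y', ℓ x y' ∂μ

lemma center_sq {μ : Measure Y} [IsProbabilityMeasure μ] {w : Y → ℂ} (hw : Measurable w) {B : ℝ}
    (hB : ∀ y, ‖w y‖ ≤ B) : ∫ y, ‖w y - ∫ y', w y' ∂μ‖ ^ 2 ∂μ ≤ ∫ y, ‖w y‖ ^ 2 ∂μ := by
  set m := ∫ y', w y' ∂μ with hm
  have hwi : Integrable w μ := Integrable.of_bound hw.aestronglyMeasurable B (ae_of_all _ hB)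
  have h2 : Integrable (fun y => ‖w y‖ ^ 2) μ := by
    refine Integrable.of_bound (hw.norm.pow_const 2).aestronglyMeasurable (B ^ 2) (ae_of_all _ fun y => ?_)
    rw [Real.norm_of_nonneg (sq_nonneg _)]; gcongr; exact hB y
  have hci : Integrable (fun y => (starRingEnd ℂ m) * w y) μ := hwi.const_mul _
  have hre : Integrable (fun y => 2 * ((starRingEnd ℂ m) * w y).re) μ := hci.re.const_mul 2
  have e : ∀ y, ‖w y - m‖ ^ 2 = ‖w y‖ ^ 2 - 2 * ((starRingEnd ℂ m) * w y).re + ‖m‖ ^ 2 := fun y => by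
    simp only [← Complex.normSq_eq_norm_sq, Complex.normSq_sub]
    rw [mul_comm (w y)]; ring
  have e2 : ∫ y, ((starRingEnd ℂ m) * w y).re ∂μ = ‖m‖ ^ 2 := by
    have := integral_re hci
    rw [integral_const_mul, ← hm] at this
    simp only [RCLike.re_to_complex] at this
    rw [this, ← Complex.normSq_eq_norm_sq, mul_comm, Complex.mul_conj, Complex.ofReal_re]
  simp only [e]
  have i1 : Integrable (fun y => ‖w y‖ ^ 2 - 2 * ((starRingEnd ℂ m) * w y).re) μ := h2.sub hre
  rw [integral_add i1 (integrable_const _), integral_sub h2 hre, integral_const_mul, e2]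
  simp only [integral_const, probReal_univ, one_smul]
  nlinarith [sq_nonneg ‖m‖]

lemma prodp {ν : Measure X} [SigmaFinite ν] {μ : Measure Y} [IsProbabilityMeasure μ] {p M : ℝ}
    {ℓ : X → Y → ℂ} (hℓ : Measurable (Function.uncurry ℓ))
    (hi : ∀ y, Integrable (fun x => ‖ℓ x y‖ ^ p) ν) (hM : ∀ y, ∫ x, ‖ℓ x y‖ ^ p ∂ν ≤ M) :
    Integrable (fun z : X × Y => ‖ℓ z.1 z.2‖ ^ p) (ν.prod μ) := by
  have hm : Measurable (fun z : X × Y => ‖ℓ z.1 z.2‖ ^ p) := hℓ.norm.pow_const p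
  rw [integrable_prod_iff' hm.aestronglyMeasurable]
  refine ⟨ae_of_all _ hi, ?_⟩
  refine Integrable.of_bound ?_ M (ae_of_all _ fun y => ?_)
  · have : StronglyMeasurable (fun z : Y × X => ‖‖ℓ z.2 z.1‖ ^ p‖) :=
      (hm.comp measurable_swap).norm.stronglyMeasurable
    exact this.integral_prod_right'.aestronglyMeasurable
  · rw [Real.norm_of_nonneg (integral_nonneg fun x => norm_nonneg _)]
    refine le_trans (le_of_eq ?_) (hM y)
    congr 1; ext x; rw [Real.norm_of_nonneg (by positivity)]

lemma mean_meas {μ : Measure Y} [IsProbabilityMeasure μ]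
    {ℓ : X → Y → ℂ} (hℓ : Measurable (Function.uncurry ℓ)) : Measurable fun x => ∫ y, ℓ x y ∂μ := by
  have : StronglyMeasurable (fun z : X × Y => ℓ z.1 z.2) := hℓ.stronglyMeasurable
  exact this.integral_prod_right'.measurable

lemma cen_meas {μ : Measure Y} [IsProbabilityMeasure μ]
    {ℓ : X → Y → ℂ} (hℓ : Measurable (Function.uncurry ℓ)) : Measurable (Function.uncurry (cen μ ℓ)) := by
  exact hℓ.sub ((mean_meas hℓ).comp measurable_fst)

lemma mean_lp {ν : Measure X} [SigmaFinite ν] {μ : Measure Y} [IsProbabilityMeasure μ] {p M : ℝ} (hp : 1 < p)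
    {ℓ : X → Y → ℂ} (hℓ : Measurable (Function.uncurry ℓ))
    (hb : ∀ x, ∃ B, ∀ y, ‖ℓ x y‖ ≤ B)
    (hi : ∀ y, Integrable (fun x => ‖ℓ x y‖ ^ p) ν) (hM : ∀ y, ∫ x, ‖ℓ x y‖ ^ p ∂ν ≤ M) :
    Integrable (fun x => ‖∫ y, ℓ x y ∂μ‖ ^ p) ν ∧ ∫ x, ‖∫ y, ℓ x y ∂μ‖ ^ p ∂ν ≤ M := by
  have hP := prodp (μ := μ) hℓ hi hM
  have hj : ∀ x, ‖∫ y, ℓ x y ∂μ‖ ^ p ≤ ∫ y, ‖ℓ x y‖ ^ p ∂μ := fun x => by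
    obtain ⟨B, hB⟩ := hb x
    have hxm : Measurable (ℓ x) := hℓ.comp (measurable_const.prodMk measurable_id)
    have hB0 : ∀ y, 0 ≤ B := fun y => (norm_nonneg _).trans (hB y)
    have hni : Integrable (fun y => ‖ℓ x y‖) μ := by
      refine Integrable.of_bound hxm.norm.aestronglyMeasurable B (ae_of_all _ fun y => ?_)
      rw [norm_norm]; exact hB y
    have hnp : Integrable (fun y => ‖ℓ x y‖ ^ p) μ := by
      refine Integrable.of_bound (hxm.norm.pow_const p).aestronglyMeasurable (B ^ p) (ae_of_all _ fun y => ?_)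
      rw [Real.norm_of_nonneg (by positivity)]
      exact Real.rpow_le_rpow (norm_nonneg _) (hB y) (by linarith)
    calc ‖∫ y, ℓ x y ∂μ‖ ^ p ≤ (∫ y, ‖ℓ x y‖ ∂μ) ^ p :=
          Real.rpow_le_rpow (norm_nonneg _) (norm_integral_le_integral_norm _) (by linarith)
      _ ≤ _ := by
        have := (convexOn_rpow hp.le).map_integral_le (μ := μ) (f := fun y => ‖ℓ x y‖)
          (Real.continuous_rpow_const (by linarith)).continuousOn isClosed_Ici
          (ae_of_all _ fun y => norm_nonneg _) hni hnp
        simpa using this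
  have h1 : Integrable (fun x => ∫ y, ‖ℓ x y‖ ^ p ∂μ) ν := hP.integral_prod_left
  have h2 : Integrable (fun x => ‖∫ y, ℓ x y ∂μ‖ ^ p) ν := by
    refine h1.mono' ((mean_meas hℓ).norm.pow_const p).aestronglyMeasurable (ae_of_all _ fun x => ?_)
    rw [Real.norm_of_nonneg (by positivity)]; exact hj x
  refine ⟨h2, (integral_mono h2 h1 hj).trans ?_⟩
  rw [integral_integral_swap (f := fun x y => ‖ℓ x y‖ ^ p) hP]
  calc ∫ y, ∫ x, ‖ℓ x y‖ ^ p ∂ν ∂μ ≤ ∫ y, M ∂μ := integral_mono hP.integral_prod_right (integrable_const _) hM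
    _ = M := by simp

lemma sub_rpow {p : ℝ} (hp : 1 ≤ p) (a b : ℂ) : ‖a - b‖ ^ p ≤ 2 ^ (p - 1) * (‖a‖ ^ p + ‖b‖ ^ p) := by
  have h := NNReal.rpow_add_le_mul_rpow_add_rpow ‖a‖₊ ‖b‖₊ hp
  have h' : (‖a‖ + ‖b‖) ^ p ≤ 2 ^ (p - 1) * (‖a‖ ^ p + ‖b‖ ^ p) := by exact_mod_cast h
  exact (Real.rpow_le_rpow (norm_nonneg _) (norm_sub_le a b) (by linarith)).trans h'

lemma cen_lp {ν : Measure X} [SigmaFinite ν] {μ : Measure Y} [IsProbabilityMeasure μ] {p M : ℝ} (hp : 1 < p) (hM0 : 0 ≤ M)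
    {ℓ : X → Y → ℂ} (hℓ : Measurable (Function.uncurry ℓ))
    (hb : ∀ x, ∃ B, ∀ y, ‖ℓ x y‖ ≤ B)
    (hi : ∀ y, Integrable (fun x => ‖ℓ x y‖ ^ p) ν) (hM : ∀ y, ∫ x, ‖ℓ x y‖ ^ p ∂ν ≤ M ^ p) (y : Y) :
    Integrable (fun x => ‖cen μ ℓ x y‖ ^ p) ν ∧ ∫ x, ‖cen μ ℓ x y‖ ^ p ∂ν ≤ (2 * M) ^ p := by
  have h := mean_lp (μ := μ) hp hℓ hb hi hM
  have h1 : Integrable (fun x => 2 ^ (p - 1) * (‖ℓ x y‖ ^ p + ‖∫ y, ℓ x y ∂μ‖ ^ p)) ν :=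
    ((hi y).add h.1).const_mul _
  have hcm : Measurable fun x => cen μ ℓ x y := (cen_meas hℓ).comp (measurable_id.prodMk measurable_const)
  have h2 : Integrable (fun x => ‖cen μ ℓ x y‖ ^ p) ν := by
    refine h1.mono' (hcm.norm.pow_const p).aestronglyMeasurable (ae_of_all _ fun x => ?_)
    rw [Real.norm_of_nonneg (by positivity)]; exact sub_rpow hp.le _ _
  refine ⟨h2, (integral_mono h2 h1 fun x => sub_rpow hp.le _ _).trans ?_⟩
  rw [integral_const_mul, integral_add (hi y) h.1]
  calc _ ≤ 2 ^ (p - 1) * (M ^ p + M ^ p) := by gcongr; exacts [hM y, h.2]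
    _ = (2 * M) ^ p := by
      rw [Real.mul_rpow (by norm_num) hM0, Real.rpow_sub (by norm_num), Real.rpow_one]; ring

lemma cen_mean {μ : Measure Y} [IsProbabilityMeasure μ]
    {ℓ : X → Y → ℂ} (hℓ : Measurable (Function.uncurry ℓ))
    (hb : ∀ x, ∃ B, ∀ y, ‖ℓ x y‖ ≤ B) (x : X) : ∫ y, cen μ ℓ x y ∂μ = 0 := by
  obtain ⟨B, hB⟩ := hb x
  have hxm : Measurable (ℓ x) := hℓ.comp (measurable_const.prodMk measurable_id)
  have : Integrable (ℓ x) μ := Integrable.of_bound hxm.aestronglyMeasurable B (ae_of_all _ hB)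
  unfold cen
  rw [integral_sub this (integrable_const _)]; simp

lemma cen_weak {ν : Measure X} [SigmaFinite ν] {μ : Measure Y} [IsProbabilityMeasure μ] {p M : ℝ} (hp : 1 < p) (hM0 : 0 ≤ M)
    {ℓ : X → Y → ℂ} (hℓ : Measurable (Function.uncurry ℓ))
    (hb : ∀ x, ∃ B, ∀ y, ‖ℓ x y‖ ≤ B)
    (hi : ∀ y, Integrable (fun x => ‖ℓ x y‖ ^ p) ν) (hM : ∀ y, ∫ x, ‖ℓ x y‖ ^ p ∂ν ≤ M ^ p)
    {s : X → ℂ} (hs : Measurable s) (hsi : Integrable (fun x => ‖s x‖ ^ p) ν) :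
    ∫ y, ‖Wf ν p (cen μ ℓ) s y‖ ^ 2 ∂μ ≤ ∫ y, ‖Wf ν p ℓ s y‖ ^ 2 ∂μ := by
  have hℓy : ∀ y, Measurable fun x => ℓ x y := fun y => hℓ.comp (measurable_id.prodMk measurable_const)
  set D := (∫ x, ‖s x‖ ^ p ∂ν) ^ ((p - 1) / p) * M with hD
  have h1 : ∀ y, ∫ x, ‖Jf p (s x)‖ * ‖ℓ x y‖ ∂ν ≤ D := fun y => by
    refine (holder_J hp hs (hℓy y) hsi (hi y)).2.trans ?_
    have : 0 ≤ ∫ x, ‖s x‖ ^ p ∂ν := integral_nonneg fun x => by positivity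
    rw [hD]; gcongr
    calc (∫ x, ‖ℓ x y‖ ^ p ∂ν) ^ (1 / p) ≤ (M ^ p) ^ (1 / p) := by
          apply Real.rpow_le_rpow (integral_nonneg fun x => by positivity) (hM y) (by positivity)
      _ = M := by rw [← Real.rpow_mul hM0, mul_one_div_cancel (by linarith), Real.rpow_one]
  have hJm : Measurable (fun z : X × Y => Jf p (s z.1) * ℓ z.1 z.2) :=
    ((measurable_Jf p).comp (hs.comp measurable_fst)).mul hℓ
  have hWm : Measurable (Wf ν p ℓ s) := by
    have : StronglyMeasurable (fun z : Y × X => Jf p (s z.2) * ℓ z.2 z.1) :=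
      (hJm.comp measurable_swap).stronglyMeasurable
    exact this.integral_prod_right'.measurable
  have hWb : ∀ y, ‖Wf ν p ℓ s y‖ ≤ D := fun y => by
    refine le_trans ?_ (h1 y)
    unfold Wf
    refine (norm_integral_le_integral_norm _).trans (le_of_eq ?_)
    simp
  have hyi : ∀ y, Integrable (fun x => Jf p (s x) * ℓ x y) ν := fun y => by
    have := (holder_J hp hs (hℓy y) hsi (hi y)).1
    refine this.mono' ?_ (ae_of_all _ fun x => by simp)
    exact (((measurable_Jf p).comp hs).mul (hℓy y)).aestronglyMeasurable
  have hprod : Integrable (fun z : X × Y => Jf p (s z.1) * ℓ z.1 z.2) (ν.prod μ) := by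
    rw [integrable_prod_iff' hJm.aestronglyMeasurable]
    refine ⟨ae_of_all _ hyi, ?_⟩
    refine Integrable.of_bound ?_ D (ae_of_all _ fun y => ?_)
    · have : StronglyMeasurable (fun z : Y × X => ‖Jf p (s z.2) * ℓ z.2 z.1‖) :=
        (hJm.comp measurable_swap).norm.stronglyMeasurable
      exact this.integral_prod_right'.aestronglyMeasurable
    · rw [Real.norm_of_nonneg (integral_nonneg fun x => norm_nonneg _)]
      simp only [norm_mul]
      exact h1 y
  have hmi : Integrable (fun x => Jf p (s x) * ∫ y, ℓ x y ∂μ) ν := by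
    have := hprod.integral_prod_left
    simpa only [integral_const_mul] using this
  have e : ∀ y, Wf ν p (cen μ ℓ) s y = Wf ν p ℓ s y - ∫ y', Wf ν p ℓ s y' ∂μ := fun y => by
    have e1 : ∫ y', Wf ν p ℓ s y' ∂μ = ∫ x, Jf p (s x) * ∫ y, ℓ x y ∂μ ∂ν := by
      unfold Wf
      rw [← integral_integral_swap (f := fun x y => Jf p (s x) * ℓ x y) hprod]
      simp [integral_const_mul]
    rw [e1]; unfold Wf cen
    rw [← integral_sub (hyi y) hmi]
    simp only [mul_sub]
  simp only [e]
  exact center_sq hWm hWb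

end abs

section abs
variable {X Y : Type} [MeasurableSpace X] [MeasurableSpace Y]

def aC (p : ℝ) : ℝ := cS p * (4 + 2 ^ p)
def Cc (p : ℝ) : ℝ := 1 + aC p + 2 * Real.exp (2 + aC p) * (1 + aC p ^ 2)

lemma aC_pos {p : ℝ} (hp : 0 < p) : 0 < aC p := by
  have := cS_pos hp
  unfold aC; positivity

structure EmpData (ν : Measure X) (μ : Measure Y) (p M H L σ : ℝ) (n : ℕ) (ℓ : X → Y → ℂ) : Prop where
  hp : 1 < p
  hM0 : 0 ≤ M
  hH : 0 < H
  hL : 1 ≤ L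
  hℓ : Measurable (Function.uncurry ℓ)
  hb : ∀ x, ∃ B, ∀ y, ‖ℓ x y‖ ≤ B
  hi : ∀ y, Integrable (fun x => ‖ℓ x y‖ ^ p) ν
  hM : ∀ y, ∫ x, ‖ℓ x y‖ ^ p ∂ν ≤ M ^ p
  hσ : ∀ s : X → ℂ, Measurable s → Integrable (fun x => ‖s x‖ ^ p) ν →
    ∫ y, ‖Wf ν p ℓ s y‖ ^ 2 ∂μ ≤ σ ^ 2 * ((∫ x, ‖s x‖ ^ p ∂ν) ^ ((p - 1) / p)) ^ 2
  h1 : n * M ^ p ≤ H ^ p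
  h2 : L * M ≤ H
  h3 : n * L * σ ^ 2 ≤ H ^ 2

variable {ν : Measure X} [SigmaFinite ν] {μ : Measure Y} [IsProbabilityMeasure μ] {p M H L σ : ℝ} {n : ℕ} {ℓ : X → Y → ℂ}

lemma conc_core (D : EmpData ν μ p M H L σ n ℓ) {b1 b2 : ℝ} (hb1 : 0 ≤ b1) (hb2 : 0 ≤ b2)
    (k1 : L / H * b1 ≤ aC p) (k2 : n * (L / H * b2) ≤ aC p * L)
    {Q : (X → ℂ) → Y → ℝ} (hQ0 : ∀ s y, 0 ≤ Q s y)
    (hQm : ∀ s, Measurable s → Measurable (Q s))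
    (hQ1 : ∀ s, Measurable s → Integrable (fun x => ‖s x‖ ^ p) ν → ∀ y, Q s y ≤ Nf ν p H s ^ (p - 1) * b1)
    (hQ2 : ∀ s, Measurable s → Integrable (fun x => ‖s x‖ ^ p) ν → ∫ y, Q s y ∂μ ≤ Nf ν p H s ^ (p - 1) * b2)
    (hQ : ∀ s, Measurable s → Integrable (fun x => ‖s x‖ ^ p) ν → ∀ y,
      ∫ x, ‖s x + cen μ ℓ x y‖ ^ p ∂ν ≤ ∫ x, ‖s x‖ ^ p ∂ν + p * (Wf ν p (cen μ ℓ) s y).re + Q s y)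
    {m T : ℝ} (hm : 0 < m) :
    ∫⁻ y : Fin n → Y, oR ((max ((∫ x, ‖∑ k, cen μ ℓ x (y k)‖ ^ p ∂ν) ^ (1 / p) - T) 0) ^ m) ∂(Measure.pi fun _ => μ) ≤
      oR (m ^ m * H ^ m * Real.exp (Cc p * L - L * T / H)) := by
  have hp := D.hp
  have hH := D.hH
  have hL := D.hL
  have hlm : 0 < L / H := by positivity
  have ha := aC_pos (show 0 < p by linarith)
  set c := 2 + aC p with hc
  have hstep : ∀ s : X → ℂ, Measurable s → Integrable (fun x => ‖s x‖ ^ p) ν → _ :=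
    fun s hs hsi => step (ν := ν) (μ := μ) (M := 2 * M) (σ := σ) (lm := L / H) (b1 := b1) (b2 := b2) (c := c) hp hH
      (by have := D.hM0; positivity) hlm.le hb1 hb2 (cen_meas D.hℓ)
      (fun y => (cen_lp hp D.hM0 D.hℓ D.hb D.hi D.hM y).1)
      (fun y => (cen_lp hp D.hM0 D.hℓ D.hb D.hi D.hM y).2)
      (cen_mean D.hℓ D.hb) hs hsi
      (by
        refine (cen_weak hp D.hM0 D.hℓ D.hb D.hi D.hM hs hsi).trans ((D.hσ s hs hsi).trans ?_)
        have h0 : 0 ≤ ∫ x, ‖s x‖ ^ p ∂ν := integral_nonneg fun x => by positivity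
        gcongr
        exact Nf_ge_norm hp hH s (by linarith))
      (hQ0 s) (hQm s hs) (hQ1 s hs hsi) (hQ2 s hs hsi) (hQ s hs hsi)
      (by
        rw [hc, mul_add]
        have : L / H * (2 * M) ≤ 2 := by
          have := D.h2
          rw [div_mul_eq_mul_div, div_le_iff₀ hH]; linarith
        linarith)
  have := super_tail hp hH hlm (cen_meas D.hℓ)
    (fun y => (cen_lp hp D.hM0 D.hℓ D.hb D.hi D.hM y).1) hstep n (T := T) hm
  refine this.trans (ENNReal.ofReal_le_ofReal ?_)
  have e1 : (L / H) ^ (-m) ≤ H ^ m := by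
    rw [Real.rpow_neg hlm.le, ← Real.inv_rpow hlm.le, inv_div]
    apply Real.rpow_le_rpow (by positivity) _ hm.le
    exact div_le_self hH.le hL
  have e2 : L / H * H = L := by field_simp
  have e3 : (n:ℝ) * ((L / H) ^ 2 * σ ^ 2) ≤ L := by
    have := D.h3
    rw [div_pow, div_mul_eq_mul_div, mul_div_assoc', div_le_iff₀ (by positivity)]
    have := mul_le_mul_of_nonneg_left this (show 0 ≤ L by linarith)
    nlinarith
  have e4 : (n:ℝ) * ((L / H) ^ 2 * (b1 * b2)) ≤ aC p ^ 2 * L := by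
    calc (n:ℝ) * ((L / H) ^ 2 * (b1 * b2)) = (L / H * b1) * (n * (L / H * b2)) := by ring
      _ ≤ aC p * (aC p * L) := by gcongr
      _ = _ := by ring
  have hE := Real.exp_pos c
  have e5 : L / H * H + n * (L / H * b2 + 2 * Real.exp c * (L / H) ^ 2 * σ ^ 2 +
     2 * Real.exp c * (L / H) ^ 2 * (b1 * b2)) - L / H * T ≤ Cc p * L - L * T / H := by
    rw [e2, div_mul_eq_mul_div L H T]
    have e3' := mul_le_mul_of_nonneg_left e3 (show 0 ≤ 2 * Real.exp c by positivity)
    have e4' := mul_le_mul_of_nonneg_left e4 (show 0 ≤ 2 * Real.exp c by positivity)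
    unfold Cc; rw [← hc]
    nlinarith
  gcongr

lemma rpow_ratio_le {p : ℝ} (hp : 1 < p) {M H L : ℝ} (hM : 0 ≤ M) (hH : 0 < H) (hL : 1 ≤ L) (h2 : L * M ≤ H) :
    L * (M ^ p / H ^ p) ≤ 1 := by
  have h0 : M ≤ H := by nlinarith
  rw [← Real.div_rpow hM hH.le]
  have h1 : M / H ≤ 1 := by rw [div_le_one hH]; exact h0
  have h3 : (M / H) ^ p ≤ M / H := by
    calc (M / H) ^ p ≤ (M / H) ^ (1:ℝ) := Real.rpow_le_rpow_of_exponent_ge' (by positivity) h1 (by norm_num) hp.le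
      _ = _ := Real.rpow_one _
  calc L * (M / H) ^ p ≤ L * (M / H) := by gcongr
    _ = L * M / H := by ring
    _ ≤ 1 := by rw [div_le_one hH]; exact h2

lemma cen_y (hℓ : Measurable (Function.uncurry ℓ)) (y : Y) : Measurable fun x => cen μ ℓ x y :=
  (cen_meas hℓ).comp (measurable_id.prodMk measurable_const)

lemma expand_int (D : EmpData ν μ p M H L σ n ℓ) {s : X → ℂ} (hs : Measurable s)
    (hsi : Integrable (fun x => ‖s x‖ ^ p) ν) {R : X → Y → ℝ} (hR : ∀ y, Integrable (fun x => R x y) ν)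
    (h : ∀ x y, ‖s x + cen μ ℓ x y‖ ^ p ≤ ‖s x‖ ^ p + p * ‖s x‖ ^ (p - 2) * ((starRingEnd ℂ (s x)) * cen μ ℓ x y).re
      + R x y) (y : Y) :
    ∫ x, ‖s x + cen μ ℓ x y‖ ^ p ∂ν ≤ ∫ x, ‖s x‖ ^ p ∂ν + p * (Wf ν p (cen μ ℓ) s y).re + ∫ x, R x y ∂ν := by
  have hp := D.hp
  have hcp := cen_lp (μ := μ) hp D.hM0 D.hℓ D.hb D.hi D.hM y
  have hcm : Measurable fun x => cen μ ℓ x y := cen_y D.hℓ y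
  have hJi : Integrable (fun x => Jf p (s x) * cen μ ℓ x y) ν := by
    refine (holder_J hp hs hcm hsi hcp.1).1.mono' ?_ (ae_of_all _ fun x => by simp)
    exact (((measurable_Jf p).comp hs).mul hcm).aestronglyMeasurable
  have hJr : Integrable (fun x => p * (Jf p (s x) * cen μ ℓ x y).re) ν := hJi.re.const_mul p
  have hre : ∫ x, p * (Jf p (s x) * cen μ ℓ x y).re ∂ν = p * (Wf ν p (cen μ ℓ) s y).re := by
    rw [integral_const_mul]; congr 1
    exact integral_re hJi
  have i1 : Integrable (fun x => ‖s x‖ ^ p + p * (Jf p (s x) * cen μ ℓ x y).re) ν := hsi.add hJr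
  rw [← hre, ← integral_add hsi hJr, ← integral_add i1 (hR y)]
  refine integral_mono (intp_add hp.le hs hcm hsi hcp.1) (i1.add (hR y)) fun x => ?_
  refine (h x y).trans (le_of_eq ?_)
  simp only [Pi.add_apply, Jf]
  rw [mul_assoc (((‖s x‖ ^ (p - 2) : ℝ)) : ℂ), Complex.re_ofReal_mul]; ring

lemma conc_le (D : EmpData ν μ p M H L σ n ℓ) (hp2 : p ≤ 2) {m T : ℝ} (hm : 0 < m) :
    ∫⁻ y : Fin n → Y, oR ((max ((∫ x, ‖∑ k, cen μ ℓ x (y k)‖ ^ p ∂ν) ^ (1 / p) - T) 0) ^ m) ∂(Measure.pi fun _ => μ) ≤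
      oR (m ^ m * H ^ m * Real.exp (Cc p * L - L * T / H)) := by
  have hp := D.hp
  have hH := D.hH
  have hL := D.hL
  have hM0 := D.hM0
  have hcS := cS_pos (show 0 < p by linarith)
  have hcp := cen_lp (μ := μ) hp D.hM0 D.hℓ D.hb D.hi D.hM
  have hHp : (H ^ (1 - p)) / H = (H ^ p)⁻¹ := by
    rw [Real.rpow_sub hH, Real.rpow_one]; field_simp
  have hH1 : H ^ (p - 1) * H ^ (1 - p) = 1 := by rw [← Real.rpow_add hH]; simp
  have hb : L / H * (cS p * (2 * M) ^ p * H ^ (1 - p)) = cS p * 2 ^ p * (L * (M ^ p / H ^ p)) := by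
    rw [Real.mul_rpow (by norm_num) hM0]
    calc _ = cS p * 2 ^ p * L * M ^ p * (H ^ (1 - p) / H) := by ring
      _ = _ := by rw [hHp]; ring
  have haC : cS p * 2 ^ p ≤ aC p := by unfold aC; gcongr; linarith
  have hQb : ∀ y, cS p * ∫ x, ‖cen μ ℓ x y‖ ^ p ∂ν ≤ cS p * (2 * M) ^ p := fun y => by
    gcongr; exact (hcp y).2
  have hNb : ∀ s, cS p * (2 * M) ^ p ≤ Nf ν p H s ^ (p - 1) * (cS p * (2 * M) ^ p * H ^ (1 - p)) := fun s => by
    calc cS p * (2 * M) ^ p = H ^ (p - 1) * (cS p * (2 * M) ^ p * H ^ (1 - p)) := by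
          rw [mul_comm (cS p * (2 * M) ^ p), ← mul_assoc, hH1, one_mul]
      _ ≤ _ := by
          gcongr
          exact Nf_ge hp hH s
  refine conc_core D (b1 := cS p * (2 * M) ^ p * H ^ (1 - p)) (b2 := cS p * (2 * M) ^ p * H ^ (1 - p))
    (by positivity) (by positivity) ?_ ?_
    (Q := fun _ y => cS p * ∫ x, ‖cen μ ℓ x y‖ ^ p ∂ν) ?_ ?_ ?_ ?_ ?_ hm
  · rw [hb]
    have := rpow_ratio_le hp hM0 hH hL D.h2
    calc _ ≤ cS p * 2 ^ p * 1 := by gcongr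
      _ ≤ _ := by linarith
  · rw [hb]
    have h1 : n * (M ^ p / H ^ p) ≤ 1 := by
      rw [mul_div_assoc', div_le_one (by positivity)]; exact D.h1
    calc _ = cS p * 2 ^ p * L * (n * (M ^ p / H ^ p)) := by ring
      _ ≤ cS p * 2 ^ p * L * 1 := by gcongr
      _ ≤ aC p * L := by rw [mul_one]; gcongr
  · intro s y
    have : 0 ≤ ∫ x, ‖cen μ ℓ x y‖ ^ p ∂ν := integral_nonneg fun x => by positivity
    positivity
  · intro s _
    have : StronglyMeasurable (fun z : Y × X => ‖cen μ ℓ z.2 z.1‖ ^ p) :=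
      (((cen_meas D.hℓ).comp measurable_swap).norm.pow_const p).stronglyMeasurable
    exact this.integral_prod_right'.measurable.const_mul _
  · intro s _ _ y
    exact (hQb y).trans (hNb s)
  · intro s _ _
    refine le_trans ?_ (hNb s)
    calc ∫ y, cS p * ∫ x, ‖cen μ ℓ x y‖ ^ p ∂ν ∂μ ≤ ∫ y, cS p * (2 * M) ^ p ∂μ := by
          refine integral_mono_of_nonneg (ae_of_all _ fun y => ?_) (integrable_const _) (ae_of_all _ hQb)
          have : 0 ≤ ∫ x, ‖cen μ ℓ x y‖ ^ p ∂ν := integral_nonneg fun x => by positivity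
          simp only [Pi.zero_apply]; positivity
      _ = _ := by simp
  · intro s hs hsi y
    rw [← integral_const_mul]
    exact expand_int D hs hsi (R := fun x y => cS p * ‖cen μ ℓ x y‖ ^ p) (fun y => (hcp y).1.const_mul _)
      (fun x y => scalar_le hp.le hp2 _ _) y

end abs

section abs
variable {X Y : Type} [MeasurableSpace X] [MeasurableSpace Y]
variable {ν : Measure X} [SigmaFinite ν] {μ : Measure Y} [IsProbabilityMeasure μ] {p M H L σ : ℝ} {n : ℕ} {ℓ : X → Y → ℂ}

lemma holder_2 (hp : 2 < p) {s : X → ℂ} {u : X → ℝ} (hs : Measurable s) (hu : Measurable u) (hu0 : ∀ x, 0 ≤ u x)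
    (hsi : Integrable (fun x => ‖s x‖ ^ p) ν) (hui : Integrable (fun x => u x ^ (p / 2)) ν) :
    Integrable (fun x => ‖s x‖ ^ (p - 2) * u x) ν ∧
    ∫ x, ‖s x‖ ^ (p - 2) * u x ∂ν ≤ (∫ x, ‖s x‖ ^ p ∂ν) ^ ((p - 2) / p) * (∫ x, u x ^ (p / 2) ∂ν) ^ (2 / p) := by
  have hpq : (p / (p - 2)).HolderConjugate (p / 2) := by
    rw [Real.holderConjugate_iff]
    constructor
    · rw [one_lt_div (by linarith)]; linarith
    · field_simp; ring
  have e1 : ∀ x, (‖s x‖ ^ (p - 2)) ^ (p / (p - 2)) = ‖s x‖ ^ p := fun x => by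
    rw [← Real.rpow_mul (norm_nonneg _)]
    congr 1; field_simp [show p - 2 ≠ 0 by linarith]
  have hm1 : AEStronglyMeasurable (fun x => ‖s x‖ ^ (p - 2)) ν := (hs.norm.pow_const _).aestronglyMeasurable
  have h1 : MemLp (fun x => ‖s x‖ ^ (p - 2)) (oR (p / (p-2))) ν := by
    rw [← integrable_norm_rpow_iff hm1 (by simp; exact hpq.pos) (by simp)]
    rw [ENNReal.toReal_ofReal hpq.nonneg]
    refine hsi.congr (ae_of_all _ fun x => ?_)
    simp only
    rw [Real.norm_of_nonneg (by positivity), e1]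
  have h2 : MemLp u (oR (p / 2)) ν := by
    rw [← integrable_norm_rpow_iff hu.aestronglyMeasurable (by simp; linarith) (by simp)]
    rw [ENNReal.toReal_ofReal (by linarith)]
    refine hui.congr (ae_of_all _ fun x => ?_)
    simp only
    rw [Real.norm_of_nonneg (hu0 x)]
  constructor
  · have : ENNReal.HolderConjugate (oR (p / (p-2))) (oR (p / 2)) := hpq.ennrealOfReal
    exact h1.integrable_mul h2
  · have := integral_mul_le_Lp_mul_Lq_of_nonneg hpq (ae_of_all ν fun x => by positivity)
      (ae_of_all ν hu0) h1 h2
    simp only [e1] at this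
    convert this using 3 <;> field_simp

lemma conc_ge (D : EmpData ν μ p M H L σ n ℓ) (hp2 : 2 < p) {Vv : ℝ} (hV0 : 0 ≤ Vv)
    (hwi : Integrable (fun x => (∫ y, ‖ℓ x y‖ ^ 2 ∂μ) ^ (p / 2)) ν)
    (hw : ∫ x, (∫ y, ‖ℓ x y‖ ^ 2 ∂μ) ^ (p / 2) ∂ν ≤ Vv ^ p) (hV : n * Vv ^ 2 ≤ H ^ 2)
    {m T : ℝ} (hm : 0 < m) :
    ∫⁻ y : Fin n → Y, oR ((max ((∫ x, ‖∑ k, cen μ ℓ x (y k)‖ ^ p ∂ν) ^ (1 / p) - T) 0) ^ m) ∂(Measure.pi fun _ => μ) ≤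
      oR (m ^ m * H ^ m * Real.exp (Cc p * L - L * T / H)) := by
  have hp := D.hp
  have hH := D.hH
  have hL := D.hL
  have hM0 := D.hM0
  have hp0 : 0 < p := by linarith
  have hcS := cS_pos hp0
  have hcp := cen_lp (μ := μ) hp D.hM0 D.hℓ D.hb D.hi D.hM
  have hcm := fun y => cen_y (μ := μ) D.hℓ y
  have e2 : ∀ x y, (‖cen μ ℓ x y‖ ^ 2) ^ (p / 2) = ‖cen μ ℓ x y‖ ^ p := fun x y => by
    rw [← Real.rpow_natCast, ← Real.rpow_mul (norm_nonneg _)]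
    congr 1; push_cast; field_simp
  have hcp2 : ∀ y, Integrable (fun x => (‖cen μ ℓ x y‖ ^ 2) ^ (p / 2)) ν := fun y => by
    simp only [e2]; exact (hcp y).1
  have hHp : (H ^ (1 - p)) / H = (H ^ p)⁻¹ := by
    rw [Real.rpow_sub hH, Real.rpow_one]; field_simp
  have hH1 : H ^ (p - 1) * H ^ (1 - p) = 1 := by rw [← Real.rpow_add hH]; simp
  have hMr := rpow_ratio_le hp hM0 hH hL D.h2
  have hMn : n * (M ^ p / H ^ p) ≤ 1 := by
    rw [mul_div_assoc', div_le_one (by positivity)]; exact D.h1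
  have hbp : L / H * ((2 * M) ^ p * H ^ (1 - p)) = 2 ^ p * (L * (M ^ p / H ^ p)) := by
    rw [Real.mul_rpow (by norm_num) hM0]
    calc _ = 2 ^ p * L * M ^ p * (H ^ (1 - p) / H) := by ring
      _ = _ := by rw [hHp]; ring
  have hM2 : L / H * ((2 * M) ^ 2 / H) ≤ 4 := by
    have h0 : M ≤ H := by have := D.h2; nlinarith
    have : L * M * M ≤ H * H := by gcongr; exact D.h2
    rw [div_mul_div_comm, div_le_iff₀ (by positivity)]; nlinarith
  have hV2 : n * (L / H * (Vv ^ 2 / H)) ≤ L := by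
    rw [div_mul_div_comm, mul_div_assoc', div_le_iff₀ (by positivity)]
    nlinarith [mul_le_mul_of_nonneg_left hV (show 0 ≤ L by linarith)]
  have hNp : ∀ s, (2 * M) ^ p ≤ Nf ν p H s ^ (p - 1) * ((2 * M) ^ p * H ^ (1 - p)) := fun s => by
    calc (2 * M) ^ p = H ^ (p - 1) * ((2 * M) ^ p * H ^ (1 - p)) := by
          rw [mul_comm ((2 * M) ^ p), ← mul_assoc, hH1, one_mul]
      _ ≤ _ := by
          gcongr
          exact Nf_ge hp hH s
  have hN2 : ∀ (s : X → ℂ) {V : ℝ}, Nf ν p H s ^ (p - 2) * V ^ 2 ≤ Nf ν p H s ^ (p - 1) * (V ^ 2 / H) := fun s V => by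
    have hN0 := Nf_pos (ν := ν) (p := p) hH s
    have : Nf ν p H s ^ (p - 1) = Nf ν p H s ^ (p - 2) * Nf ν p H s := by
      nth_rewrite 3 [← Real.rpow_one (Nf ν p H s)]
      rw [← Real.rpow_add hN0]; congr 1; ring
    rw [this, mul_assoc]
    gcongr
    rw [mul_div_assoc', le_div_iff₀ hH, mul_comm]
    gcongr; exact Nf_ge hp hH s
  have hy2 : ∀ s : X → ℂ, Measurable s → Integrable (fun x => ‖s x‖ ^ p) ν → ∀ y,
      Integrable (fun x => ‖s x‖ ^ (p - 2) * ‖cen μ ℓ x y‖ ^ 2) ν ∧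
      ∫ x, ‖s x‖ ^ (p - 2) * ‖cen μ ℓ x y‖ ^ 2 ∂ν ≤ Nf ν p H s ^ (p - 2) * (2 * M) ^ 2 := fun s hs hsi y => by
    have h := holder_2 hp2 hs ((hcm y).norm.pow_const 2) (fun x => by positivity) hsi (hcp2 y)
    refine ⟨h.1, h.2.trans ?_⟩
    simp only [e2]
    have hI : 0 ≤ ∫ x, ‖cen μ ℓ x y‖ ^ p ∂ν := integral_nonneg fun x => by positivity
    have hN0 := Nf_pos (ν := ν) (p := p) hH s
    gcongr
    · exact Nf_ge_norm hp hH s (by linarith)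
    · calc (∫ x, ‖cen μ ℓ x y‖ ^ p ∂ν) ^ (2 / p) ≤ ((2 * M) ^ p) ^ (2 / p) := by
            gcongr; exact (hcp y).2
        _ = (2 * M) ^ 2 := by
            rw [← Real.rpow_mul (by positivity), mul_div_cancel₀ _ hp0.ne']; norm_cast
  have hcmm := cen_meas (μ := μ) D.hℓ
  have hQm1 : ∀ s : X → ℂ, Measurable s → Measurable fun y => ∫ x, ‖s x‖ ^ (p - 2) * ‖cen μ ℓ x y‖ ^ 2 ∂ν := fun s hs => by
    have h1 : Measurable (fun z : Y × X => ‖s z.2‖ ^ (p - 2)) := (hs.comp measurable_snd).norm.pow_const _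
    have h2 : Measurable (fun z : Y × X => ‖cen μ ℓ z.2 z.1‖ ^ 2) := (hcmm.comp measurable_swap).norm.pow_const 2
    exact (h1.mul h2).stronglyMeasurable.integral_prod_right'.measurable
  have hQm2 : Measurable fun y => ∫ x, ‖cen μ ℓ x y‖ ^ p ∂ν := by
    have h2 : Measurable (fun z : Y × X => ‖cen μ ℓ z.2 z.1‖ ^ p) := (hcmm.comp measurable_swap).norm.pow_const p
    exact h2.stronglyMeasurable.integral_prod_right'.measurable
  have hQ01 : ∀ (s : X → ℂ) y, 0 ≤ ∫ x, ‖s x‖ ^ (p - 2) * ‖cen μ ℓ x y‖ ^ 2 ∂ν :=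
    fun s y => integral_nonneg fun x => by positivity
  have hQ02 : ∀ y, 0 ≤ ∫ x, ‖cen μ ℓ x y‖ ^ p ∂ν := fun y => integral_nonneg fun x => by positivity
  refine conc_core D (b1 := cS p * ((2 * M) ^ 2 / H + (2 * M) ^ p * H ^ (1 - p)))
    (b2 := cS p * (Vv ^ 2 / H + (2 * M) ^ p * H ^ (1 - p)))
    (by positivity) (by positivity) ?_ ?_
    (Q := fun s y => cS p * (∫ x, ‖s x‖ ^ (p - 2) * ‖cen μ ℓ x y‖ ^ 2 ∂ν + ∫ x, ‖cen μ ℓ x y‖ ^ p ∂ν)) ?_ ?_ ?_ ?_ ?_ hm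
  · calc _ = cS p * (L / H * ((2 * M) ^ 2 / H) + L / H * ((2 * M) ^ p * H ^ (1 - p))) := by ring
      _ ≤ cS p * (4 + 2 ^ p * 1) := by rw [hbp]; gcongr
      _ = aC p := by unfold aC; ring
  · calc _ = cS p * (n * (L / H * (Vv ^ 2 / H)) + n * (L / H * ((2 * M) ^ p * H ^ (1 - p)))) := by ring
      _ = cS p * (n * (L / H * (Vv ^ 2 / H)) + 2 ^ p * L * (n * (M ^ p / H ^ p))) := by rw [hbp]; ring
      _ ≤ cS p * (L + 2 ^ p * L * 1) := by gcongr
      _ ≤ cS p * (4 * L + 2 ^ p * L * 1) := by gcongr; linarith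
      _ = aC p * L := by unfold aC; ring
  · intro s y
    have := hQ01 s y; have := hQ02 y
    positivity
  · intro s hs
    exact ((hQm1 s hs).add hQm2).const_mul _
  · intro s hs hsi y
    calc _ ≤ cS p * (Nf ν p H s ^ (p - 1) * ((2 * M) ^ 2 / H) + Nf ν p H s ^ (p - 1) * ((2 * M) ^ p * H ^ (1 - p))) := by
          gcongr
          · exact (hy2 s hs hsi y).2.trans (hN2 s)
          · exact (hcp y).2.trans (hNp s)
      _ = _ := by ring
  · intro s hs hsi
    have hN0 := Nf_pos (ν := ν) (p := p) hH s
    have hb1 : Integrable (fun y => ∫ x, ‖s x‖ ^ (p - 2) * ‖cen μ ℓ x y‖ ^ 2 ∂ν) μ := by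
      refine Integrable.of_bound (hQm1 s hs).aestronglyMeasurable (Nf ν p H s ^ (p - 2) * (2 * M) ^ 2) (ae_of_all _ fun y => ?_)
      rw [Real.norm_of_nonneg (hQ01 s y)]; exact (hy2 s hs hsi y).2
    have hb2 : Integrable (fun y => ∫ x, ‖cen μ ℓ x y‖ ^ p ∂ν) μ := by
      refine Integrable.of_bound hQm2.aestronglyMeasurable ((2 * M) ^ p) (ae_of_all _ fun y => ?_)
      rw [Real.norm_of_nonneg (hQ02 y)]; exact (hcp y).2
    have hPm : Measurable (fun z : X × Y => ‖s z.1‖ ^ (p - 2) * ‖cen μ ℓ z.1 z.2‖ ^ 2) :=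
      ((hs.comp measurable_fst).norm.pow_const _).mul (hcmm.norm.pow_const 2)
    have hP : Integrable (fun z : X × Y => ‖s z.1‖ ^ (p - 2) * ‖cen μ ℓ z.1 z.2‖ ^ 2) (ν.prod μ) := by
      rw [integrable_prod_iff' hPm.aestronglyMeasurable]
      refine ⟨ae_of_all _ fun y => (hy2 s hs hsi y).1, ?_⟩
      refine hb1.congr (ae_of_all _ fun y => ?_)
      simp only; congr 1; ext x
      rw [Real.norm_of_nonneg (by positivity)]
    have hvw : ∀ x, ∫ y, ‖cen μ ℓ x y‖ ^ 2 ∂μ ≤ ∫ y, ‖ℓ x y‖ ^ 2 ∂μ := fun x => by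
      obtain ⟨B, hB⟩ := D.hb x
      exact center_sq (D.hℓ.comp (measurable_const.prodMk measurable_id)) hB
    have hwm : Measurable fun x => ∫ y, ‖ℓ x y‖ ^ 2 ∂μ := by
      have h2 : Measurable (fun z : X × Y => ‖ℓ z.1 z.2‖ ^ 2) := D.hℓ.norm.pow_const 2
      exact h2.stronglyMeasurable.integral_prod_right'.measurable
    have hw0 : ∀ x, 0 ≤ ∫ y, ‖ℓ x y‖ ^ 2 ∂μ := fun x => integral_nonneg fun y => by positivity
    have hH2 := holder_2 hp2 hs hwm hw0 hsi hwi
    have hI1 : ∫ y, ∫ x, ‖s x‖ ^ (p - 2) * ‖cen μ ℓ x y‖ ^ 2 ∂ν ∂μ ≤ Nf ν p H s ^ (p - 2) * Vv ^ 2 := by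
      rw [← integral_integral_swap (f := fun x y => ‖s x‖ ^ (p - 2) * ‖cen μ ℓ x y‖ ^ 2) hP]
      calc _ ≤ ∫ x, ‖s x‖ ^ (p - 2) * ∫ y, ‖ℓ x y‖ ^ 2 ∂μ ∂ν := by
            refine integral_mono hP.integral_prod_left hH2.1 fun x => ?_
            simp only [integral_const_mul]
            exact mul_le_mul_of_nonneg_left (hvw x) (by positivity)
        _ ≤ _ := hH2.2
        _ ≤ _ := by
          have hI : 0 ≤ ∫ x, (∫ y, ‖ℓ x y‖ ^ 2 ∂μ) ^ (p / 2) ∂ν := integral_nonneg fun x => by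
            have := hw0 x; simp only [Pi.zero_apply]; positivity
          gcongr
          · exact Nf_ge_norm hp hH s (by linarith)
          · calc _ ≤ (Vv ^ p) ^ (2 / p) := by gcongr
              _ = Vv ^ 2 := by
                rw [← Real.rpow_mul (by positivity), mul_div_cancel₀ _ hp0.ne']; norm_cast
    have hI2 : ∫ y, ∫ x, ‖cen μ ℓ x y‖ ^ p ∂ν ∂μ ≤ (2 * M) ^ p := by
      calc _ ≤ ∫ y, (2 * M) ^ p ∂μ := integral_mono hb2 (integrable_const _) fun y => (hcp y).2
        _ = _ := by simp
    rw [integral_const_mul, integral_add hb1 hb2]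
    calc _ ≤ cS p * (Nf ν p H s ^ (p - 1) * (Vv ^ 2 / H) + Nf ν p H s ^ (p - 1) * ((2 * M) ^ p * H ^ (1 - p))) := by
          gcongr
          · exact hI1.trans (hN2 s)
          · exact hI2.trans (hNp s)
      _ = _ := by ring
  · intro s hs hsi y
    have h1 := (hy2 s hs hsi y).1
    rw [← integral_add h1 (hcp y).1, ← integral_const_mul]
    exact expand_int D hs hsi (R := fun x y => cS p * (‖s x‖ ^ (p - 2) * ‖cen μ ℓ x y‖ ^ 2 + ‖cen μ ℓ x y‖ ^ p))
      (fun y => ((hy2 s hs hsi y).1.add (hcp y).1).const_mul _)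
      (fun x y => scalar_ge hp.le _ _) y

end abs

section fourier
variable {ι : Type} [Fintype ι]

lemma continuous_dotp : Continuous fun z : (ι → ℝ) × (ι → ℝ) => dotp z.1 z.2 := by
  unfold dotp; fun_prop

lemma dotp_sub_left (a b x : ι → ℝ) : dotp (a - b) x = dotp a x - dotp b x := by
  simp [dotp, sub_mul, Finset.sum_sub_distrib]

lemma dotp_sub_right (a x y : ι → ℝ) : dotp a (x - y) = dotp a x - dotp a y := by
  simp [dotp, mul_sub, Finset.sum_sub_distrib]

lemma dotp_add_right (a x y : ι → ℝ) : dotp a (x + y) = dotp a x + dotp a y := by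
  simp [dotp, mul_add, Finset.sum_add_distrib]

def ec (t x : ι → ℝ) : ℂ := Complex.exp (Complex.I * (dotp t x : ℝ))

lemma norm_ec (t x : ι → ℝ) : ‖ec t x‖ = 1 := by
  unfold ec; rw [mul_comm]; exact Complex.norm_exp_ofReal_mul_I _

lemma continuous_ec : Continuous fun z : (ι → ℝ) × (ι → ℝ) => ec z.1 z.2 := by
  unfold ec
  exact Complex.continuous_exp.comp (continuous_const.mul (Complex.continuous_ofReal.comp continuous_dotp))

lemma ec_sub_left (a b x : ι → ℝ) : ec (a - b) x = ec a x * (starRingEnd ℂ (ec b x)) := by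
  unfold ec
  rw [← Complex.exp_conj, ← Complex.exp_add, dotp_sub_left]
  congr 1; simp; ring

lemma ec_add_right (a x y : ι → ℝ) : ec a (x + y) = ec a x * ec a y := by
  unfold ec
  rw [← Complex.exp_add, dotp_add_right]
  congr 1; push_cast; ring

lemma ec_neg_right (a x : ι → ℝ) : ec a (-x) = Complex.exp (-(Complex.I * (dotp a x : ℝ))) := by
  unfold ec
  congr 1; simp [dotp]

def FT (φ : (ι → ℝ) → ℂ) (x : ι → ℝ) : ℂ := ∫ t, ec t (-x) * φ t

lemma norm_FT_le (φ : (ι → ℝ) → ℂ) (x : ι → ℝ) : ‖FT φ x‖ ≤ ∫ t, ‖φ t‖ := by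
  unfold FT
  refine (norm_integral_le_integral_norm _).trans (le_of_eq ?_)
  simp [norm_ec]

lemma continuous_FT {φ : (ι → ℝ) → ℂ} (hφ : Integrable φ) : Continuous (FT φ) := by
  unfold FT
  refine continuous_of_dominated (bound := fun t => ‖φ t‖) ?_ ?_ hφ.norm ?_
  · intro x
    refine AEStronglyMeasurable.mul ?_ hφ.1
    exact (continuous_ec.comp (continuous_id.prodMk continuous_const)).aestronglyMeasurable
  · intro x; refine ae_of_all _ fun t => ?_
    simp [norm_ec]
  · refine ae_of_all _ fun t => ?_
    exact (continuous_ec.comp (continuous_const.prodMk continuous_neg)).mul continuous_const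

variable {Y : Type} [MeasurableSpace Y]

lemma ec_meas {r : Y → ι → ℝ} (hr : Measurable r) : Measurable fun z : (ι → ℝ) × Y => ec z.1 (r z.2) :=
  continuous_ec.measurable.comp (measurable_fst.prodMk (hr.comp measurable_snd))

set_option maxHeartbeats 800000 in
lemma schur {μ : Measure Y} [IsFiniteMeasure μ] {r : Y → ι → ℝ} (hr : Measurable r)
    {φ : (ι → ℝ) → ℂ} (hφ : Integrable φ)
    (hφ2 : Integrable fun t => ‖φ t‖ ^ 2) (hc : Integrable fun u => ∫ y, ec u (r y) ∂μ) :
    ∫ y, ‖∫ t, ec t (r y) * φ t‖ ^ 2 ∂μ ≤ (∫ t, ‖φ t‖ ^ 2) * ∫ u, ‖∫ y, ec u (r y) ∂μ‖ := by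
  set χ : (ι → ℝ) → ℂ := fun u => ∫ y, ec u (r y) ∂μ with hχ
  have hχm : Measurable χ := by
    have : StronglyMeasurable fun z : (ι → ℝ) × Y => ec z.1 (r z.2) := (ec_meas hr).stronglyMeasurable
    exact this.integral_prod_right'.measurable
  let F : Y → ((ι → ℝ) × (ι → ℝ)) → ℂ := fun y z => (ec z.1 (r y) * φ z.1) * (starRingEnd ℂ (ec z.2 (r y) * φ z.2))
  have e1 : ∀ y, ((‖∫ t, ec t (r y) * φ t‖ ^ 2 : ℝ) : ℂ) = ∫ z : (ι → ℝ) × (ι → ℝ), F y z := fun y => by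
    rw [← Complex.normSq_eq_norm_sq, ← Complex.mul_conj, ← integral_conj, ← integral_prod_mul]
    rfl
  have hFm : AEStronglyMeasurable (fun w : Y × ((ι → ℝ) × (ι → ℝ)) => F w.1 w.2) (μ.prod volume) := by
    have a1 : Measurable fun w : Y × ((ι → ℝ) × (ι → ℝ)) => ec w.2.1 (r w.1) :=
      continuous_ec.measurable.comp ((measurable_fst.comp measurable_snd).prodMk (hr.comp measurable_fst))
    have a2 : Measurable fun w : Y × ((ι → ℝ) × (ι → ℝ)) => ec w.2.2 (r w.1) :=
      continuous_ec.measurable.comp ((measurable_snd.comp measurable_snd).prodMk (hr.comp measurable_fst))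
    have b1 : AEStronglyMeasurable (fun w : Y × ((ι → ℝ) × (ι → ℝ)) => φ w.2.1) (μ.prod volume) := by
      have : AEStronglyMeasurable (fun z : ((ι → ℝ) × (ι → ℝ)) => φ z.1) (volume.prod volume) :=
        hφ.1.comp_quasiMeasurePreserving Measure.quasiMeasurePreserving_fst
      exact this.comp_quasiMeasurePreserving (g := φ ∘ Prod.fst) Measure.quasiMeasurePreserving_snd
    have b2 : AEStronglyMeasurable (fun w : Y × ((ι → ℝ) × (ι → ℝ)) => φ w.2.2) (μ.prod volume) := by
      have : AEStronglyMeasurable (fun z : ((ι → ℝ) × (ι → ℝ)) => φ z.2) (volume.prod volume) :=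
        hφ.1.comp_quasiMeasurePreserving Measure.quasiMeasurePreserving_snd
      exact this.comp_quasiMeasurePreserving (g := φ ∘ Prod.snd) Measure.quasiMeasurePreserving_snd
    exact (a1.aestronglyMeasurable.mul b1).mul (Complex.continuous_conj.comp_aestronglyMeasurable (a2.aestronglyMeasurable.mul b2))
  have hnF : ∀ y z, ‖F y z‖ = ‖φ z.1‖ * ‖φ z.2‖ := fun y z => by
    simp [F, norm_ec]
  have hFi : Integrable (fun w : Y × ((ι → ℝ) × (ι → ℝ)) => F w.1 w.2) (μ.prod volume) := by
    have : Integrable (fun z : (ι → ℝ) × (ι → ℝ) => ‖φ z.1‖ * ‖φ z.2‖) volume := hφ.norm.mul_prod hφ.norm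
    have h2 : Integrable (fun w : Y × ((ι → ℝ) × (ι → ℝ)) => ‖φ w.2.1‖ * ‖φ w.2.2‖) (μ.prod volume) := this.comp_snd μ
    refine h2.mono' hFm (ae_of_all _ fun w => (hnF _ _).le)
  have e2 : ∀ z, ∫ y, F y z ∂μ = χ (z.1 - z.2) * (φ z.1 * starRingEnd ℂ (φ z.2)) := fun z => by
    rw [hχ]; simp only
    rw [← integral_mul_const]
    congr 1; ext y
    simp only [F, ec_sub_left, map_mul]; ring
  have hre : (∫ y, ‖∫ t, ec t (r y) * φ t‖ ^ 2 ∂μ) = ‖((∫ y, ‖∫ t, ec t (r y) * φ t‖ ^ 2 ∂μ : ℝ) : ℂ)‖ := by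
    rw [Complex.norm_real, Real.norm_of_nonneg (integral_nonneg fun y => sq_nonneg _)]
  have h1 : Integrable (fun z : (ι → ℝ) × (ι → ℝ) => ‖φ z.1‖ ^ 2 * ‖χ (z.1 - z.2)‖) volume := by
    rw [Measure.volume_eq_prod, integrable_prod_iff]
    · constructor
      · exact ae_of_all _ fun t => by simpa using (hc.norm.comp_sub_left t).const_mul (‖φ t‖ ^ 2)
      · have : ∀ t, ∫ s, ‖‖φ t‖ ^ 2 * ‖χ (t - s)‖‖ = ‖φ t‖ ^ 2 * ∫ u, ‖χ u‖ := fun t => by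
          simp only [norm_mul, norm_pow, norm_norm]
          rw [integral_const_mul, integral_sub_left_eq_self (fun u => ‖χ u‖)]
        simp only [this]
        exact hφ2.mul_const _
    · refine AEStronglyMeasurable.mul ?_ ?_
      · exact (hφ.1.comp_fst).norm.pow 2
      · exact (hχm.comp (measurable_fst.sub measurable_snd)).norm.aestronglyMeasurable
  have h2 : Integrable (fun z : (ι → ℝ) × (ι → ℝ) => ‖φ z.2‖ ^ 2 * ‖χ (z.1 - z.2)‖) volume := by
    rw [Measure.volume_eq_prod, integrable_prod_iff']
    · constructor
      · exact ae_of_all _ fun t => by simpa using (hc.norm.comp_sub_right t).const_mul (‖φ t‖ ^ 2)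
      · have : ∀ t, ∫ s, ‖‖φ t‖ ^ 2 * ‖χ (s - t)‖‖ = ‖φ t‖ ^ 2 * ∫ u, ‖χ u‖ := fun t => by
          simp only [norm_mul, norm_pow, norm_norm]
          rw [integral_const_mul, integral_sub_right_eq_self (fun u => ‖χ u‖)]
        simp only [this]
        exact hφ2.mul_const _
    · refine AEStronglyMeasurable.mul ?_ ?_
      · exact (hφ.1.comp_snd).norm.pow 2
      · exact (hχm.comp (measurable_fst.sub measurable_snd)).norm.aestronglyMeasurable
  have i1 : ∫ z : (ι → ℝ) × (ι → ℝ), ‖φ z.1‖ ^ 2 * ‖χ (z.1 - z.2)‖ = (∫ t, ‖φ t‖ ^ 2) * ∫ u, ‖χ u‖ := by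
    rw [Measure.volume_eq_prod, integral_prod _ h1, ← integral_mul_const]
    congr 1; ext t
    simp only []
    rw [integral_const_mul, integral_sub_left_eq_self (fun u => ‖χ u‖)]
  have i2 : ∫ z : (ι → ℝ) × (ι → ℝ), ‖φ z.2‖ ^ 2 * ‖χ (z.1 - z.2)‖ = (∫ t, ‖φ t‖ ^ 2) * ∫ u, ‖χ u‖ := by
    rw [Measure.volume_eq_prod, integral_prod_symm _ h2, ← integral_mul_const]
    congr 1; ext t
    simp only []
    rw [integral_const_mul, integral_sub_right_eq_self (fun u => ‖χ u‖)]
  rw [hre, ← integral_complex_ofReal]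
  simp only [e1]
  rw [integral_integral_swap hFi]
  simp only [e2]
  refine (norm_integral_le_integral_norm _).trans ?_
  calc _ ≤ ∫ z : (ι → ℝ) × (ι → ℝ), (1/2) * (‖φ z.1‖ ^ 2 * ‖χ (z.1 - z.2)‖ + ‖φ z.2‖ ^ 2 * ‖χ (z.1 - z.2)‖) := by
        refine integral_mono_of_nonneg (ae_of_all _ fun z => norm_nonneg _) ((h1.add h2).const_mul _) (ae_of_all _ fun z => ?_)
        simp only [norm_mul, RCLike.norm_conj]
        nlinarith [mul_nonneg (norm_nonneg (χ (z.1 - z.2))) (sq_nonneg (‖φ z.1‖ - ‖φ z.2‖))]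
    _ = _ := by
        rw [integral_const_mul, integral_add h1 h2, i1, i2]; ring

end fourier

section planch
variable {ι : Type} [Fintype ι]

def gw (b : ℝ) (x : ι → ℝ) : ℝ := Real.exp (-b * ∑ i, x i ^ 2)

lemma continuous_gw (b : ℝ) : Continuous (gw b : (ι → ℝ) → ℝ) := by
  unfold gw; fun_prop

lemma integrable_gw {b : ℝ} (hb : 0 < b) : Integrable (gw b : (ι → ℝ) → ℝ) := by
  have h := GaussianFourier.integrable_cexp_neg_mul_sum_add (ι := ι) (b := (b : ℂ)) (by simpa using hb) 0
  have := h.norm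
  refine this.congr (ae_of_all _ fun x => ?_)
  simp only [Pi.zero_apply, zero_mul, Finset.sum_const_zero, add_zero, gw]
  rw [Complex.norm_exp]
  congr 1
  rw [← Complex.ofReal_neg]
  rw [show (∑ i, ((x i : ℝ) : ℂ) ^ 2) = ((∑ i, x i ^ 2 : ℝ) : ℂ) by push_cast; rfl, ← Complex.ofReal_mul, Complex.ofReal_re]

lemma integral_gw {b : ℝ} (hb : 0 < b) : ∫ x : ι → ℝ, gw b x = (Real.pi / b) ^ ((Fintype.card ι : ℝ) / 2) := by
  have h := GaussianFourier.integral_cexp_neg_mul_sum_add (ι := ι) (b := (b : ℂ)) (by simpa using hb) 0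
  have e : ∀ v : ι → ℝ, Complex.exp (-(b : ℂ) * ∑ i, (v i : ℂ) ^ 2 + ∑ i, (0 : ι → ℂ) i * v i) = ((gw b v : ℝ) : ℂ) := fun v => by
    simp [gw]
  simp only [e] at h
  rw [integral_complex_ofReal] at h
  have h2 : (((Real.pi / b) ^ ((Fintype.card ι : ℝ) / 2) : ℝ) : ℂ) = ((Real.pi : ℂ) / b) ^ ((Fintype.card ι : ℂ) / 2) := by
    rw [Complex.ofReal_cpow (by positivity)]; push_cast; rfl
  simp only [Pi.zero_apply, ne_eq, OfNat.ofNat_ne_zero, not_false_eq_true, zero_pow, Finset.sum_const_zero, zero_div,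
    Complex.exp_zero, mul_one] at h
  rw [← h2] at h
  exact_mod_cast h

lemma ft_gw {b : ℝ} (hb : 0 < b) (u : ι → ℝ) : ∫ x : ι → ℝ, ec u x * (gw b x : ℂ) =
    (((Real.pi / b) ^ ((Fintype.card ι : ℝ) / 2) * gw (1 / (4 * b)) u : ℝ) : ℂ) := by
  have h := GaussianFourier.integral_cexp_neg_mul_sum_add (ι := ι) (b := (b : ℂ)) (by simpa using hb) (fun i => Complex.I * u i)
  have e : ∀ v : ι → ℝ, Complex.exp (-(b : ℂ) * ∑ i, (v i : ℂ) ^ 2 + ∑ i, (Complex.I * u i) * v i) = ec u v * ((gw b v : ℝ) : ℂ) := fun v => by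
    simp only [gw, ec, dotp]
    push_cast
    rw [← Complex.exp_add, Finset.mul_sum (s := univ) (a := Complex.I)]
    congr 1
    rw [add_comm]; congr 1
    exact Finset.sum_congr rfl fun i _ => by ring
  simp only [e] at h
  rw [h]
  have h2 : (((Real.pi / b) ^ ((Fintype.card ι : ℝ) / 2) : ℝ) : ℂ) = ((Real.pi : ℂ) / b) ^ ((Fintype.card ι : ℂ) / 2) := by
    rw [Complex.ofReal_cpow (by positivity)]; push_cast; rfl
  rw [Complex.ofReal_mul, h2]
  congr 1
  unfold gw
  push_cast
  congr 1
  simp only [mul_pow, Complex.I_sq]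
  rw [Finset.sum_div, Finset.mul_sum]
  refine Finset.sum_congr rfl fun i _ => ?_
  have : (b : ℂ) ≠ 0 := by exact_mod_cast hb.ne'
  field_simp

lemma planch_fin {φ : (ι → ℝ) → ℂ} (hφ : Integrable φ) (hφ2 : Integrable fun t => ‖φ t‖ ^ 2) {b : ℝ} (hb : 0 < b) :
    ∫⁻ x, oR (gw b x) * ‖FT φ x‖ₑ ^ 2 ≤ oR ((2 * Real.pi) ^ (Fintype.card ι) * ∫ t, ‖φ t‖ ^ 2) := by
  set μ : Measure (ι → ℝ) := volume.withDensity fun x => oR (gw b x) with hμ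
  have hgm : Measurable fun x : ι → ℝ => oR (gw b x) := (continuous_gw b).measurable.ennreal_ofReal
  have hgn : ∀ x : ι → ℝ, 0 ≤ gw b x := fun x => (Real.exp_pos _).le
  haveI : IsFiniteMeasure μ := by
    rw [hμ]
    refine isFiniteMeasure_withDensity_ofReal (integrable_gw hb).2
  have hχ : ∀ u : ι → ℝ, ∫ y, ec u (-y) ∂μ = (((Real.pi / b) ^ ((Fintype.card ι : ℝ) / 2) * gw (1 / (4 * b)) u : ℝ) : ℂ) := fun u => by
    rw [← ft_gw hb u, hμ, integral_withDensity_eq_integral_toReal_smul hgm (ae_of_all _ fun x => ENNReal.ofReal_lt_top),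
      ← integral_neg_eq_self]
    refine integral_congr_ae (ae_of_all _ fun x => ?_)
    simp only [neg_neg]
    rw [ENNReal.toReal_ofReal (hgn _), Complex.real_smul, mul_comm]
    simp [gw]
  have h4 : (0:ℝ) < 1 / (4 * b) := by positivity
  have hI : Integrable fun u : ι → ℝ => ∫ y, ec u (-y) ∂μ := by
    simp only [hχ]
    exact ((integrable_gw h4).const_mul _).ofReal
  have hs := schur (μ := μ) (r := fun y => -y) measurable_neg hφ hφ2 hI
  have e1 : ∫ u : ι → ℝ, ‖∫ y, ec u (-y) ∂μ‖ = (2 * Real.pi) ^ (Fintype.card ι) := by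
    simp only [hχ, Complex.norm_real]
    have : ∀ u : ι → ℝ, ‖(Real.pi / b) ^ ((Fintype.card ι : ℝ) / 2) * gw (1 / (4 * b)) u‖ = (Real.pi / b) ^ ((Fintype.card ι : ℝ) / 2) * gw (1 / (4 * b)) u := fun u => by
      rw [Real.norm_of_nonneg]; unfold gw; positivity
    simp only [this]
    rw [integral_const_mul, integral_gw h4, ← Real.mul_rpow (by positivity) (by positivity)]
    rw [show Real.pi / b * (Real.pi / (1 / (4 * b))) = (2 * Real.pi) ^ 2 by field_simp; ring]
    rw [← Real.rpow_natCast, ← Real.rpow_natCast, ← Real.rpow_mul (by positivity)]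
    congr 1; push_cast; ring
  rw [e1] at hs
  have hFm : Measurable fun x => ‖FT φ x‖ₑ ^ 2 := ((continuous_FT hφ).measurable.enorm).pow_const 2
  have hFb : ∀ x, ‖FT φ x‖ ^ 2 ≤ (∫ t, ‖φ t‖) ^ 2 := fun x => by
    have := norm_FT_le φ x
    gcongr
  have hFi : Integrable (fun x => ‖FT φ x‖ ^ 2) μ := by
    refine Integrable.of_bound ((continuous_FT hφ).measurable.norm.pow_const 2).aestronglyMeasurable ((∫ t, ‖φ t‖) ^ 2) (ae_of_all _ fun x => ?_)
    rw [Real.norm_of_nonneg (sq_nonneg _)]; exact hFb x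
  calc _ = ∫⁻ x, ‖FT φ x‖ₑ ^ 2 ∂μ := by
        rw [hμ, lintegral_withDensity_eq_lintegral_mul _ hgm hFm]; rfl
    _ = ∫⁻ x, oR (‖FT φ x‖ ^ 2) ∂μ := by
        refine lintegral_congr fun x => ?_
        rw [ENNReal.ofReal_pow (norm_nonneg _), ofReal_norm]
    _ = oR (∫ x, ‖FT φ x‖ ^ 2 ∂μ) := (ofReal_integral_eq_lintegral_ofReal hFi (ae_of_all _ fun x => sq_nonneg _)).symm
    _ ≤ _ := by
        refine ENNReal.ofReal_le_ofReal ?_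
        rw [mul_comm]; exact hs

lemma planch {φ : (ι → ℝ) → ℂ} (hφ : Integrable φ) (hφ2 : Integrable fun t => ‖φ t‖ ^ 2) :
    ∫⁻ x, ‖FT φ x‖ₑ ^ 2 ≤ oR ((2 * Real.pi) ^ (Fintype.card ι) * ∫ t, ‖φ t‖ ^ 2) := by
  have hlim : ∀ x : ι → ℝ, Tendsto (fun n : ℕ => oR (gw (1 / ((n : ℝ) + 1)) x) * ‖FT φ x‖ₑ ^ 2) atTop (𝓝 (‖FT φ x‖ₑ ^ 2)) := fun x => by
    have h1 : Tendsto (fun n : ℕ => gw (1 / ((n : ℝ) + 1)) x) atTop (𝓝 1) := by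
      unfold gw
      have := (tendsto_one_div_add_atTop_nhds_zero_nat (𝕜 := ℝ)).neg.mul_const (∑ i, x i ^ 2)
      have := (Real.continuous_exp.tendsto _).comp this
      simpa [Function.comp_def] using this
    have h2 := (ENNReal.continuous_ofReal.tendsto _).comp h1
    have h3 := ENNReal.Tendsto.mul_const (b := ‖FT φ x‖ₑ ^ 2) h2 (Or.inl (by simp))
    simpa using h3
  calc _ = ∫⁻ x, liminf (fun n : ℕ => oR (gw (1 / ((n : ℝ) + 1)) x) * ‖FT φ x‖ₑ ^ 2) atTop :=
        lintegral_congr fun x => ((hlim x).liminf_eq).symm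
    _ ≤ liminf (fun n : ℕ => ∫⁻ x, oR (gw (1 / ((n : ℝ) + 1)) x) * ‖FT φ x‖ₑ ^ 2) atTop := by
        refine lintegral_liminf_le fun n => ?_
        exact (continuous_gw _).measurable.ennreal_ofReal.mul (((continuous_FT hφ).measurable.enorm).pow_const 2)
    _ ≤ _ := by
        refine liminf_le_of_le (by isBoundedDefault) fun b hb => ?_
        obtain ⟨n, hn⟩ := hb.exists
        exact hn.trans (planch_fin hφ hφ2 (by positivity))

end planch

section kern
open scoped FourierTransform SchwartzMap

def kap (K : ℝ → ℝ) (t : ℝ) : ℂ := ∫ z, Complex.exp (Complex.I * ((t * z : ℝ) : ℂ)) * (K z : ℂ)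

lemma kap_schwartz {K : ℝ → ℝ} (hK : IsKernel K) : ∃ S : 𝓢(ℝ, ℂ),
    (∀ t, kap K t = S (-(1 / (2 * Real.pi)) * t)) ∧
    (∀ z, (K z : ℂ) = ∫ w, Complex.exp (((2 * Real.pi * (w * z) : ℝ) : ℂ) * Complex.I) * S w) := by
  obtain ⟨⟨KS, rfl⟩, -, -⟩ := hK
  let KC : 𝓢(ℝ, ℂ) := KS.postcompCLM (𝕜 := ℝ) Complex.ofRealCLM
  have hKC : ∀ z, KC z = ((KS z : ℝ) : ℂ) := fun z => by
    simp [KC]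
  refine ⟨𝓕 KC, fun t => ?_, fun z => ?_⟩
  · rw [SchwartzMap.fourier_coe, Real.fourier_eq']
    unfold kap
    refine integral_congr_ae (ae_of_all _ fun z => ?_)
    simp only [smul_eq_mul, hKC]
    congr 2
    rw [mul_comm]
    congr 2
    simp
    have := Real.pi_pos.ne'
    field_simp
  · have h1 : (𝓕⁻ (𝓕 KC)) z = KC z := by rw [FourierTransform.fourierInv_fourier_eq]
    rw [SchwartzMap.fourierInv_coe, Real.fourierInv_eq'] at h1
    rw [← hKC, ← h1]
    refine integral_congr_ae (ae_of_all _ fun w => ?_)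
    simp only [smul_eq_mul]
    congr 4
    simp [mul_comm]

lemma kap_diff {K : ℝ → ℝ} (hK : IsKernel K) : Differentiable ℝ (kap K) := by
  obtain ⟨S, h1, -⟩ := kap_schwartz hK
  rw [show kap K = fun t => S (-(1 / (2 * Real.pi)) * t) from funext h1]
  exact S.differentiable.comp (differentiable_id.const_mul _)

lemma kap_decay {K : ℝ → ℝ} (hK : IsKernel K) (N : ℕ) : ∃ C : ℝ, 1 ≤ C ∧
    (∀ t, ‖kap K t‖ * (1 + t ^ 2) ^ N ≤ C) ∧ (∀ t, ‖deriv (kap K) t‖ * (1 + t ^ 2) ^ N ≤ C) := by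
  obtain ⟨S, h1, -⟩ := kap_schwartz hK
  set c : ℝ := 1 / (2 * Real.pi) with hc
  have hc0 : 0 < c := by positivity
  have hc1 : c ≤ 1 := by
    rw [hc, div_le_one (by positivity)]; nlinarith [Real.pi_gt_three]
  have key : ∀ T : 𝓢(ℝ, ℂ), ∃ D : ℝ, ∀ t, ‖T (-c * t)‖ * (1 + t ^ 2) ^ N ≤ D := fun T => by
    refine ⟨c⁻¹ ^ (2 * N) * (2 ^ (2 * N) * (Finset.Iic ((2 * N, 0) : ℕ × ℕ)).sup (fun m => SchwartzMap.seminorm ℝ m.1 m.2) T), fun t => ?_⟩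
    have := SchwartzMap.one_add_le_sup_seminorm_apply (𝕜 := ℝ) (m := (2 * N, 0)) (k := 2 * N) (n := 0) le_rfl le_rfl T (-c * t)
    rw [norm_iteratedFDeriv_zero] at this
    have h2 : (1 + t ^ 2) ^ N ≤ c⁻¹ ^ (2 * N) * (1 + ‖-c * t‖) ^ (2 * N) := by
      rw [← mul_pow, pow_mul]
      refine pow_le_pow_left₀ (by positivity) ?_ N
      have h3 : 1 + |t| ≤ c⁻¹ * (1 + ‖-c * t‖) := by
        rw [norm_mul, norm_neg, Real.norm_of_nonneg hc0.le, Real.norm_eq_abs, mul_add, inv_mul_cancel_left₀ hc0.ne', mul_one]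
        have := (one_le_inv₀ hc0).2 hc1
        linarith
      have h4 := abs_nonneg t
      calc 1 + t ^ 2 ≤ (1 + |t|) ^ 2 := by rw [← sq_abs]; nlinarith
        _ ≤ _ := by gcongr
    calc _ ≤ ‖T (-c * t)‖ * (c⁻¹ ^ (2 * N) * (1 + ‖-c * t‖) ^ (2 * N)) := by gcongr
      _ = c⁻¹ ^ (2 * N) * ((1 + ‖-c * t‖) ^ (2 * N) * ‖T (-c * t)‖) := by ring
      _ ≤ _ := by gcongr
  obtain ⟨D1, hD1⟩ := key S
  obtain ⟨D2, hD2⟩ := key (SchwartzMap.derivCLM ℝ ℂ S)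
  refine ⟨max 1 (max D1 D2), le_max_left _ _, fun t => ?_, fun t => ?_⟩
  · rw [h1]; exact (hD1 t).trans ((le_max_left _ _).trans (le_max_right _ _))
  · have hd : deriv (kap K) t = (-c) • deriv S (-c * t) := by
      rw [show kap K = fun t => S (-c * t) from funext h1]
      exact deriv_comp_mul_left (-c) S t
    have h5 := hD2 t
    rw [SchwartzMap.derivCLM_apply] at h5
    rw [hd, norm_smul, norm_neg, Real.norm_of_nonneg hc0.le]
    refine le_trans ?_ (h5.trans ((le_max_right _ _).trans (le_max_right _ _)))
    have : 0 ≤ ‖deriv S (-c * t)‖ * (1 + t ^ 2) ^ N := by positivity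
    nlinarith

lemma kap_inv {K : ℝ → ℝ} (hK : IsKernel K) {h : ℝ} (hh : 0 < h) (x : ℝ) :
    ∫ t : ℝ, Complex.exp (Complex.I * ((t * -x : ℝ) : ℂ)) * kap K (h * t) =
      ((2 * Real.pi * (h⁻¹ * K (x / h)) : ℝ) : ℂ) := by
  obtain ⟨S, h1, h2⟩ := kap_schwartz hK
  have hpi := Real.pi_pos
  have e : ∀ t : ℝ, Complex.exp (Complex.I * ((t * -x : ℝ) : ℂ)) * kap K (h * t) =
      (fun w => Complex.exp (((2 * Real.pi * (w * (x / h)) : ℝ) : ℂ) * Complex.I) * S w) (-(h / (2 * Real.pi)) * t) := fun t => by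
    simp only [h1]
    rw [mul_comm Complex.I, show t * -x = 2 * Real.pi * (-(h / (2 * Real.pi)) * t * (x / h)) by field_simp,
      show -(1 / (2 * Real.pi)) * (h * t) = -(h / (2 * Real.pi)) * t by ring]
  simp only [e]
  rw [Measure.integral_comp_mul_left (fun w => Complex.exp (((2 * Real.pi * (w * (x / h)) : ℝ) : ℂ) * Complex.I) * S w), ← h2]
  rw [inv_neg, abs_neg, abs_of_pos (by positivity), Complex.real_smul]
  push_cast
  have : (h : ℂ) ≠ 0 := by exact_mod_cast hh.ne'
  field_simp

lemma kern_integrable {K : ℝ → ℝ} (hK : IsKernel K) : Integrable K := by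
  obtain ⟨⟨KS, rfl⟩, -, -⟩ := hK
  exact KS.integrable

lemma kern_cont {K : ℝ → ℝ} (hK : IsKernel K) : Continuous K := by
  obtain ⟨⟨KS, rfl⟩, -, -⟩ := hK
  exact KS.continuous

variable {ι : Type} [Fintype ι]

lemma pi_prod {𝕜 : Type*} [RCLike 𝕜] (f : ι → ℝ → 𝕜) : ∫ x : ι → ℝ, ∏ i, f i (x i) = ∏ i, ∫ z, f i z :=
  integral_fintype_prod_volume_eq_prod (E := fun _ => ℝ) f

lemma pi_prod' {𝕜 : Type*} [RCLike 𝕜] (f : ι → ℝ → 𝕜) {F : (ι → ℝ) → 𝕜} (h : ∀ x, F x = ∏ i, f i (x i)) :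
    ∫ x : ι → ℝ, F x = ∏ i, ∫ z, f i z := by
  simp only [h]; exact pi_prod f

lemma ec_prod (t x : ι → ℝ) : ec t x = ∏ j, Complex.exp (Complex.I * ((t j * x j : ℝ) : ℂ)) := by
  rw [← Complex.exp_sum, ec, dotp, ← Finset.mul_sum]
  push_cast; rfl

def kprod (K : ℝ → ℝ) (h : ι → ℝ) (x : ι → ℝ) : ℝ := ∏ j, (h j)⁻¹ * K (x j / h j)

def kapp (K : ℝ → ℝ) (h : ι → ℝ) (t : ι → ℝ) : ℂ := ∏ j, kap K (h j * t j)

lemma kscal_integrable {K : ℝ → ℝ} (hK : IsKernel K) {h : ℝ} (hh : 0 < h) : Integrable fun z => h⁻¹ * K (z / h) :=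
  ((kern_integrable hK).comp_div hh.ne').const_mul _

lemma kprod_integrable {K : ℝ → ℝ} (hK : IsKernel K) {h : ι → ℝ} (hh : ∀ j, 0 < h j) : Integrable (kprod K h) :=
  Integrable.fintype_prod (f := fun j z => (h j)⁻¹ * K (z / h j)) fun j => kscal_integrable hK (hh j)

lemma kprod_cont {K : ℝ → ℝ} (hK : IsKernel K) (h : ι → ℝ) : Continuous (kprod K h) := by
  unfold kprod
  have := kern_cont hK
  fun_prop

lemma kprod_l1 {K : ℝ → ℝ} {h : ι → ℝ} (hh : ∀ j, 0 < h j) :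
    ∫ x, |kprod K h x| = (∫ z, |K z|) ^ (Fintype.card ι) := by
  have : ∀ x, |kprod K h x| = ∏ j, (fun j z => |(h j)⁻¹ * K (z / h j)|) j (x j) := fun x => Finset.abs_prod _ _
  refine (pi_prod' (fun j z => |(h j)⁻¹ * K (z / h j)|) this).trans ?_
  rw [Finset.prod_congr rfl (g := fun _ => ∫ z, |K z|), Finset.prod_const, Finset.card_univ]
  intro j _
  simp only [abs_mul]
  rw [integral_const_mul, Measure.integral_comp_div (fun z => |K z|) (h j), smul_eq_mul, abs_inv,
    inv_mul_cancel_left₀ (abs_pos.2 (hh j).ne').ne']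

lemma ft_kprod {K : ℝ → ℝ} {h : ι → ℝ} (hh : ∀ j, 0 < h j) (t : ι → ℝ) :
    ∫ x, ec t x * (kprod K h x : ℂ) = kapp K h t := by
  have : ∀ x, ec t x * (kprod K h x : ℂ) =
      ∏ j, (fun (j : ι) (z : ℝ) => Complex.exp (Complex.I * ((t j * z : ℝ) : ℂ)) * (((h j)⁻¹ * K (z / h j) : ℝ) : ℂ)) j (x j) := fun x => by
    rw [ec_prod, kprod, Complex.ofReal_prod, Finset.prod_mul_distrib]
  refine (pi_prod' (fun (j : ι) (z : ℝ) => Complex.exp (Complex.I * ((t j * z : ℝ) : ℂ)) * (((h j)⁻¹ * K (z / h j) : ℝ) : ℂ)) this).trans ?_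
  refine Finset.prod_congr rfl fun j _ => ?_
  have e : ∀ z : ℝ, Complex.exp (Complex.I * ((t j * z : ℝ) : ℂ)) * (((h j)⁻¹ * K (z / h j) : ℝ) : ℂ) =
      ((h j)⁻¹ : ℝ) • (fun z => Complex.exp (Complex.I * ((h j * t j * z : ℝ) : ℂ)) * (K z : ℂ)) (z / h j) := fun z => by
    have := (hh j).ne'
    rw [Complex.real_smul]
    simp only
    rw [show h j * t j * (z / h j) = t j * z by field_simp]
    push_cast; ring
  simp only [e]
  rw [integral_smul, Measure.integral_comp_div (fun z => Complex.exp (Complex.I * ((h j * t j * z : ℝ) : ℂ)) * (K z : ℂ)) (h j),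
    smul_smul, abs_of_pos (hh j), inv_mul_cancel₀ (hh j).ne', one_smul]
  rfl

lemma inv_kprod {K : ℝ → ℝ} (hK : IsKernel K) {h : ι → ℝ} (hh : ∀ j, 0 < h j) (x : ι → ℝ) :
    FT (kapp K h) x = (((2 * Real.pi) ^ (Fintype.card ι) * kprod K h x : ℝ) : ℂ) := by
  have : ∀ t, ec t (-x) * kapp K h t =
      ∏ j, (fun (j : ι) (z : ℝ) => Complex.exp (Complex.I * ((z * -x j : ℝ) : ℂ)) * kap K (h j * z)) j (t j) := fun t => by
    rw [ec_prod, kapp, Finset.prod_mul_distrib]; rfl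
  unfold FT
  refine (pi_prod' (fun (j : ι) (z : ℝ) => Complex.exp (Complex.I * ((z * -x j : ℝ) : ℂ)) * kap K (h j * z)) this).trans ?_
  simp only [kap_inv hK (hh _)]
  rw [← Complex.ofReal_prod, Finset.prod_mul_distrib, Finset.prod_const, Finset.card_univ]
  rfl

end kern

section gb
variable {ι : Type} [Fintype ι]

def gh (K : ℝ → ℝ) (Q : (ι → ℝ) → ℂ) (h : ι → ℝ) (t : ι → ℝ) : ℂ := kapp K h t * (Q t)⁻¹

def wt (h : ι → ℝ) (t : ι → ℝ) : ℝ := ∏ j, (1 + (h j * t j) ^ 2)⁻¹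

lemma wt_pos (h t : ι → ℝ) : 0 < wt h t := Finset.prod_pos fun j _ => by positivity
lemma wt_le (h t : ι → ℝ) : wt h t ≤ 1 := Finset.prod_le_one (fun j _ => by positivity) fun j _ =>
  inv_le_one_of_one_le₀ (by nlinarith [sq_nonneg (h j * t j)])

lemma cau_int {h : ℝ} (hh : 0 < h) : Integrable (fun z : ℝ => (1 + (h * z) ^ 2)⁻¹) ∧ ∫ z : ℝ, (1 + (h * z) ^ 2)⁻¹ = Real.pi * h⁻¹ := by
  constructor
  · exact (integrable_inv_one_add_sq.comp_mul_left' hh.ne')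
  · rw [Measure.integral_comp_mul_left (fun z : ℝ => (1 + z ^ 2)⁻¹), integral_univ_inv_one_add_sq, abs_of_pos (by positivity),
      smul_eq_mul, mul_comm]

lemma wt_int {h : ι → ℝ} (hh : ∀ j, 0 < h j) : Integrable (wt h) ∧ ∫ t, wt h t = Real.pi ^ (Fintype.card ι) * ∏ j, (h j)⁻¹ := by
  constructor
  · exact Integrable.fintype_prod (f := fun j z => (1 + (h j * z) ^ 2)⁻¹) fun j => (cau_int (hh j)).1
  · refine (pi_prod' (fun j z => (1 + (h j * z) ^ 2)⁻¹) fun x => rfl).trans ?_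
    simp only [(cau_int (hh _)).2]
    rw [Finset.prod_mul_distrib, Finset.prod_const, Finset.card_univ]

lemma brk_scale {h : ℝ} (h0 : 0 < h) (h1 : h ≤ 1) {l : ℝ} (hl : 0 < l) (t : ℝ) :
    (1 + t ^ 2) ^ (l / 2) ≤ h ^ (-l) * (1 + (h * t) ^ 2) ^ (l / 2) := by
  have e : h ^ (-l) = (h ^ (-2 : ℝ)) ^ (l / 2) := by
    rw [← Real.rpow_mul h0.le]; congr 1; ring
  rw [e, ← Real.mul_rpow (by positivity) (by positivity)]
  refine Real.rpow_le_rpow (by positivity) ?_ (by positivity)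
  rw [Real.rpow_neg h0.le, Real.rpow_two, inv_mul_eq_div, le_div_iff₀ (by positivity)]
  nlinarith [sq_nonneg t, sq_nonneg (h * t), mul_pos h0 h0]

lemma kap_brk {K : ℝ → ℝ} (hK : IsKernel K) (l : ℝ) (hl : 0 < l) (N : ℕ) : ∃ C : ℝ, 1 ≤ C ∧ ∀ h : ℝ, 0 < h → h ≤ 1 → ∀ t : ℝ,
    ‖kap K (h * t)‖ * (1 + t ^ 2) ^ (l / 2) ≤ C * h ^ (-l) * (1 + (h * t) ^ 2)⁻¹ ^ N ∧
    ‖deriv (kap K) (h * t)‖ * (1 + t ^ 2) ^ (l / 2) ≤ C * h ^ (-l) * (1 + (h * t) ^ 2)⁻¹ ^ N := by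
  obtain ⟨C, hC, h1, h2⟩ := kap_decay hK (⌈l⌉₊ + N)
  refine ⟨C, hC, fun h h0 hh t => ?_⟩
  have key : ∀ a : ℝ, 0 ≤ a → a * (1 + (h * t) ^ 2) ^ (⌈l⌉₊ + N) ≤ C → a * (1 + t ^ 2) ^ (l / 2) ≤ C * h ^ (-l) * (1 + (h * t) ^ 2)⁻¹ ^ N := by
    intro a ha hle
    have hb : (1:ℝ) ≤ 1 + (h * t) ^ 2 := by nlinarith [sq_nonneg (h * t)]
    have e1 : (1 + (h * t) ^ 2) ^ (l / 2) ≤ (1 + (h * t) ^ 2) ^ ⌈l⌉₊ := by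
      rw [← Real.rpow_natCast _ ⌈l⌉₊]
      exact Real.rpow_le_rpow_of_exponent_le hb (by have := Nat.le_ceil l; linarith)
    calc _ ≤ a * (h ^ (-l) * (1 + (h * t) ^ 2) ^ ⌈l⌉₊) := by
          gcongr; exact (brk_scale h0 hh hl t).trans (by gcongr)
      _ = h ^ (-l) * (a * (1 + (h * t) ^ 2) ^ (⌈l⌉₊ + N)) * (1 + (h * t) ^ 2)⁻¹ ^ N := by
          rw [inv_pow, pow_add]; field_simp
      _ ≤ h ^ (-l) * C * (1 + (h * t) ^ 2)⁻¹ ^ N := by gcongr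
      _ = _ := by ring
  exact ⟨key _ (norm_nonneg _) (h1 _), key _ (norm_nonneg _) (h2 _)⟩

lemma gh_bound {K : ℝ → ℝ} (hK : IsKernel K) (Q : (ι → ℝ) → ℂ) (A : ℝ) (lam : ι → ℝ) (hl : ∀ j, 0 < lam j)
    (hQ : ∀ t, ‖(Q t)⁻¹‖ ≤ A * ∏ j, (1 + t j ^ 2) ^ (lam j / 2)) : ∃ C : ℝ, 1 ≤ C ∧ ∀ h : ι → ℝ, (∀ j, 0 < h j) → (∀ j, h j ≤ 1) →
      ∀ t, ‖gh K Q h t‖ ≤ C * (∏ j, h j ^ (-lam j)) * (wt h t) ^ 2 := by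
  choose c hc1 hc using fun j => kap_brk hK (lam j) (hl j) 2
  have hA0 : 0 ≤ A := by
    have := (norm_nonneg _).trans (hQ 0)
    refine nonneg_of_mul_nonneg_left this (Finset.prod_pos fun j _ => by positivity)
  refine ⟨max 1 (A * ∏ j, c j), le_max_left _ _, fun h h0 h1 t => ?_⟩
  unfold gh kapp
  rw [norm_mul, norm_prod]
  calc _ ≤ (∏ j, ‖kap K (h j * t j)‖) * (A * ∏ j, (1 + t j ^ 2) ^ (lam j / 2)) := by
        gcongr; exact hQ t
    _ = A * ∏ j, (‖kap K (h j * t j)‖ * (1 + t j ^ 2) ^ (lam j / 2)) := by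
        rw [Finset.prod_mul_distrib]; ring
    _ ≤ A * ∏ j, (c j * h j ^ (-lam j) * (1 + (h j * t j) ^ 2)⁻¹ ^ 2) := by
        exact mul_le_mul_of_nonneg_left (Finset.prod_le_prod (fun j _ => by positivity) fun j _ => (hc j (h j) (h0 j) (h1 j) (t j)).1) hA0
    _ = (A * ∏ j, c j) * (∏ j, h j ^ (-lam j)) * (wt h t) ^ 2 := by
        rw [Finset.prod_mul_distrib, Finset.prod_mul_distrib, wt, ← Finset.prod_pow]; ring
    _ ≤ _ := by
        have : 0 ≤ ∏ j, h j ^ (-lam j) := Finset.prod_nonneg fun j _ => (Real.rpow_pos_of_pos (h0 j) _).le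
        gcongr
        exact le_max_right _ _

structure GB (g : (ι → ℝ) → ℂ) (h lam : ι → ℝ) (C : ℝ) : Prop where
  sup : ∀ t, ‖g t‖ ≤ C * ∏ j, h j ^ (-lam j)
  int : Integrable g
  int1 : ∫ t, ‖g t‖ ≤ C * ∏ j, h j ^ (-lam j - 1)
  int2 : Integrable fun t => ‖g t‖ ^ 2
  int3 : ∫ t, ‖g t‖ ^ 2 ≤ C * (∏ j, h j ^ (-lam j - 1 / 2)) ^ 2
  mom : ∀ i, Integrable fun t => |t i| * ‖g t‖
  mom1 : ∀ i, ∫ t, |t i| * ‖g t‖ ≤ C * (∏ j, h j ^ (-lam j - 1)) * (h i)⁻¹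

lemma gb_of {g : (ι → ℝ) → ℂ} {h lam : ι → ℝ} {C : ℝ} (h0 : ∀ j, 0 < h j) (hC : 1 ≤ C) (hm : Measurable g)
    (hg : ∀ t, ‖g t‖ ≤ C * (∏ j, h j ^ (-lam j)) * (wt h t) ^ 2) : GB g h lam (C ^ 2 * Real.pi ^ (Fintype.card ι)) := by
  have hP : 0 < ∏ j, h j ^ (-lam j) := Finset.prod_pos fun j _ => Real.rpow_pos_of_pos (h0 j) _
  set P := ∏ j, h j ^ (-lam j) with hPd
  have hpi : 1 ≤ Real.pi ^ (Fintype.card ι) := one_le_pow₀ (by linarith [Real.pi_gt_three])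
  have hCC : C ≤ C ^ 2 := by nlinarith
  have hw := fun t => wt_pos h t
  have hw1 := fun t => wt_le h t
  have b1 : ∀ t, ‖g t‖ ≤ C * P * wt h t := fun t => (hg t).trans (by
    have : wt h t ^ 2 ≤ wt h t := by nlinarith [hw t, hw1 t]
    gcongr)
  obtain ⟨wi, wI⟩ := wt_int h0
  have e1 : P * ∏ j, (h j)⁻¹ = ∏ j, h j ^ (-lam j - 1) := by
    rw [hPd, ← Finset.prod_mul_distrib]
    exact Finset.prod_congr rfl fun j _ => by rw [Real.rpow_sub (h0 j), Real.rpow_one, div_eq_mul_inv]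
  have e2 : P ^ 2 * ∏ j, (h j)⁻¹ = (∏ j, h j ^ (-lam j - 1 / 2)) ^ 2 := by
    rw [hPd, ← Finset.prod_pow, ← Finset.prod_pow, ← Finset.prod_mul_distrib]
    refine Finset.prod_congr rfl fun j _ => ?_
    rw [← Real.rpow_neg_one, ← Real.rpow_natCast, ← Real.rpow_natCast, ← Real.rpow_mul (h0 j).le, ← Real.rpow_mul (h0 j).le, ← Real.rpow_add (h0 j)]
    congr 1; push_cast; ring
  have hi : Integrable g := (wi.const_mul (C * P)).mono' hm.aestronglyMeasurable (ae_of_all _ b1)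
  have b2 : ∀ t, ‖g t‖ ^ 2 ≤ (C * P) ^ 2 * wt h t := fun t => by
    calc _ ≤ (C * P * wt h t) ^ 2 := by gcongr; exact b1 t
      _ = (C * P) ^ 2 * (wt h t) ^ 2 := by ring
      _ ≤ _ := by
        have : wt h t ^ 2 ≤ wt h t := by nlinarith [hw t, hw1 t]
        gcongr
  have b3 : ∀ i t, |t i| * ‖g t‖ ≤ (h i)⁻¹ * (C * P) * wt h t := fun i t => by
    have h3 : |t i| * wt h t ≤ (h i)⁻¹ := by
      have : wt h t ≤ (1 + (h i * t i) ^ 2)⁻¹ := by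
        classical
        unfold wt
        rw [← Finset.mul_prod_erase _ _ (Finset.mem_univ i)]
        refine mul_le_of_le_one_right (by positivity) (Finset.prod_le_one (fun j _ => by positivity) fun j _ => ?_)
        exact inv_le_one_of_one_le₀ (by nlinarith [sq_nonneg (h j * t j)])
      calc _ ≤ |t i| * (1 + (h i * t i) ^ 2)⁻¹ := by gcongr
        _ ≤ _ := by
          rw [← div_eq_mul_inv, div_le_iff₀ (by positivity), inv_mul_eq_div, le_div_iff₀ (h0 i)]
          have : |t i| * h i = |h i * t i| := by rw [abs_mul, abs_of_pos (h0 i), mul_comm]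
          rw [this, ← sq_abs (h i * t i)]
          nlinarith [sq_nonneg (|h i * t i| - 1), abs_nonneg (h i * t i)]
    calc _ ≤ |t i| * (C * P * wt h t ^ 2) := by gcongr; exact hg t
      _ = (|t i| * wt h t) * (C * P) * wt h t := by ring
      _ ≤ _ := by
        have := (hw t).le
        gcongr
  have mi : ∀ i, Integrable fun t => |t i| * ‖g t‖ := fun i =>
    (wi.const_mul ((h i)⁻¹ * (C * P))).mono' (((measurable_pi_apply i).abs).mul hm.norm).aestronglyMeasurable
      (ae_of_all _ fun t => by rw [Real.norm_of_nonneg (by positivity)]; exact b3 i t)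
  have i2 : Integrable fun t => ‖g t‖ ^ 2 := (wi.const_mul ((C * P) ^ 2)).mono' (hm.norm.pow_const 2).aestronglyMeasurable
      (ae_of_all _ fun t => by rw [Real.norm_of_nonneg (by positivity)]; exact b2 t)
  refine ⟨fun t => (b1 t).trans ?_, hi, ?_, i2, ?_, mi, fun i => ?_⟩
  · calc _ ≤ C * P * 1 := by gcongr; exact hw1 t
      _ = C * 1 * P := by ring
      _ ≤ _ := by gcongr
  · calc _ ≤ ∫ t, C * P * wt h t := integral_mono hi.norm (wi.const_mul _) b1
      _ = C * Real.pi ^ (Fintype.card ι) * ∏ j, h j ^ (-lam j - 1) := by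
        rw [integral_const_mul, wI, ← e1]; ring
      _ ≤ _ := by
        rw [← e1]
        have : 0 ≤ ∏ j, (h j)⁻¹ := Finset.prod_nonneg fun j _ => (inv_pos.2 (h0 j)).le
        gcongr
  · calc _ ≤ ∫ t, (C * P) ^ 2 * wt h t := integral_mono i2 (wi.const_mul _) b2
      _ = _ := by
        rw [integral_const_mul, wI, ← e2]; ring
  · calc _ ≤ ∫ t, (h i)⁻¹ * (C * P) * wt h t := integral_mono (mi i) (wi.const_mul _) (b3 i)
      _ = C * Real.pi ^ (Fintype.card ι) * (∏ j, h j ^ (-lam j - 1)) * (h i)⁻¹ := by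
        rw [integral_const_mul, wI, ← e1]; ring
      _ ≤ _ := by
        rw [← e1]
        have : 0 ≤ ∏ j, (h j)⁻¹ := Finset.prod_nonneg fun j _ => (inv_pos.2 (h0 j)).le
        have := (inv_pos.2 (h0 i)).le
        gcongr

end gb

section onedim

def rhof (u s : ℝ) : ℝ := if |s| ≤ 2 * |u| then 1 else |u| / |s|

lemma diff_core {F : ℝ → ℂ} (hF : Differentiable ℝ F) {B : ℝ} (h1 : ∀ s, ‖F s‖ ≤ B * (1 + s ^ 2)⁻¹)
    (h2 : ∀ s, |s| * ‖deriv F s‖ ≤ B * (1 + s ^ 2)⁻¹) {u : ℝ} (hu : |u| ≤ 4) (s : ℝ) :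
    ‖F (s + u) - F s‖ ≤ 40 * B * (rhof u s * (1 + s ^ 2)⁻¹) := by
  have hB : 0 ≤ B := by
    have := (norm_nonneg _).trans (h1 0); simpa using this
  have hu2 : u ^ 2 ≤ 16 := by rw [← sq_abs]; nlinarith [abs_nonneg u]
  unfold rhof
  split_ifs with hs
  · have e1 : (1 + (s + u) ^ 2)⁻¹ ≤ 34 * (1 + s ^ 2)⁻¹ := by
      rw [← div_eq_mul_inv, inv_eq_one_div, div_le_div_iff₀ (by positivity) (by positivity)]
      nlinarith [sq_nonneg (s + 2 * u), sq_nonneg (s + u)]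
    calc _ ≤ ‖F (s + u)‖ + ‖F s‖ := norm_sub_le _ _
      _ ≤ B * (34 * (1 + s ^ 2)⁻¹) + B * (1 + s ^ 2)⁻¹ := by
        refine add_le_add ((h1 _).trans (by gcongr)) (h1 s)
      _ = 35 * (B * (1 + s ^ 2)⁻¹) := by ring
      _ ≤ _ := by
        have : 0 ≤ B * (1 + s ^ 2)⁻¹ := by positivity
        nlinarith
  · push Not at hs
    have hs0 : 0 < |s| := lt_of_le_of_lt (by positivity) hs
    have key : ∀ y ∈ segment ℝ s (s + u), ‖deriv F y‖ ≤ 8 * B * (1 + s ^ 2)⁻¹ / |s| := by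
      intro y hy
      rw [segment_eq_image'] at hy
      obtain ⟨θ, ⟨hθ0, hθ1⟩, rfl⟩ := hy
      simp only [add_sub_cancel_left, smul_eq_mul]
      have a1 : |θ * u| ≤ |s| / 2 := by
        rw [abs_mul, abs_of_nonneg hθ0]; nlinarith [abs_nonneg u]
      have a2 : |s| / 2 ≤ |s + θ * u| := by
        have := abs_sub_abs_le_abs_sub s (-(θ * u))
        rw [abs_neg, sub_neg_eq_add] at this; linarith
      have a3 : (1 + (s + θ * u) ^ 2)⁻¹ ≤ 4 * (1 + s ^ 2)⁻¹ := by
        rw [← div_eq_mul_inv, inv_eq_one_div, div_le_div_iff₀ (by positivity) (by positivity)]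
        have := mul_self_le_mul_self (by positivity) a2
        rw [← sq_abs (s + θ * u), ← sq_abs s]; nlinarith
      have := h2 (s + θ * u)
      rw [le_div_iff₀ hs0]
      have hd := norm_nonneg (deriv F (s + θ * u))
      calc _ ≤ 2 * (|s + θ * u| * ‖deriv F (s + θ * u)‖) := by nlinarith
        _ ≤ 2 * (B * (4 * (1 + s ^ 2)⁻¹)) := by
          have : B * (1 + (s + θ * u) ^ 2)⁻¹ ≤ B * (4 * (1 + s ^ 2)⁻¹) := by gcongr
          linarith
        _ = _ := by ring
    have := Convex.norm_image_sub_le_of_norm_deriv_le (f := F) (s := segment ℝ s (s + u)) (x := s) (y := s + u)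
      (fun y _ => hF y) key (convex_segment _ _) (left_mem_segment _ _ _) (right_mem_segment _ _ _)
    rw [add_sub_cancel_left, Real.norm_eq_abs] at this
    refine this.trans ?_
    have h3 : 0 ≤ B * (|u| / |s| * (1 + s ^ 2)⁻¹) := by positivity
    calc _ = 8 * (B * (|u| / |s| * (1 + s ^ 2)⁻¹)) := by ring
      _ ≤ _ := by linarith

lemma diff_kap {K : ℝ → ℝ} (hK : IsKernel K) (l : ℝ) (hl : 0 < l) : ∃ C : ℝ, 1 ≤ C ∧ ∀ h : ℝ, 0 < h → h ≤ 1 →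
    ∀ (f : ℝ → ℂ) (G : ℝ), Differentiable ℝ f → 0 ≤ G → (∀ s, ‖f s‖ ≤ G * (1 + s ^ 2) ^ (l / 2)) →
    (∀ s, |s| * ‖deriv f s‖ ≤ G * (1 + s ^ 2) ^ (l / 2)) →
    (∀ s, ‖kap K (h * s) * f s‖ ≤ G * (C * h ^ (-l - 2) * (1 + s ^ 2)⁻¹)) ∧
    ∀ u s, |u| ≤ 4 → ‖kap K (h * (s + u)) * f (s + u) - kap K (h * s) * f s‖ ≤ G * (C * h ^ (-l - 2) * (rhof u s * (1 + s ^ 2)⁻¹)) := by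
  obtain ⟨C, hC, hk⟩ := kap_brk hK l hl 2
  refine ⟨80 * C, by linarith, fun h h0 hh f G hf hG hf1 hf2 => ?_⟩
  have hsc : ∀ s : ℝ, (1 + (h * s) ^ 2)⁻¹ ≤ h ^ (-2 : ℝ) * (1 + s ^ 2)⁻¹ := fun s => by
    rw [Real.rpow_neg h0.le, Real.rpow_two, ← mul_inv]
    refine inv_anti₀ (by positivity) ?_
    have : h ^ 2 ≤ 1 := pow_le_one₀ h0.le hh
    nlinarith
  have hpw : h ^ (-l - 2) = h ^ (-l) * h ^ (-2 : ℝ) := by rw [← Real.rpow_add h0]; congr 1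
  have hv : ∀ s : ℝ, (1 + (h * s) ^ 2)⁻¹ ≤ 1 := fun s => inv_le_one_of_one_le₀ (by nlinarith [sq_nonneg (h * s)])
  have hv2 : ∀ s : ℝ, (1 + (h * s) ^ 2)⁻¹ ^ 2 ≤ (1 + (h * s) ^ 2)⁻¹ := fun s => by
    have : 0 < (1 + (h * s) ^ 2)⁻¹ := by positivity
    nlinarith [hv s]
  have hl0 : 0 < h ^ (-l) := Real.rpow_pos_of_pos h0 _
  have A1 : ∀ s, ‖kap K (h * s)‖ * (G * (1 + s ^ 2) ^ (l / 2)) ≤ G * C * h ^ (-l - 2) * (1 + s ^ 2)⁻¹ := fun s => by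
    calc _ = G * (‖kap K (h * s)‖ * (1 + s ^ 2) ^ (l / 2)) := by ring
      _ ≤ G * (C * h ^ (-l) * (h ^ (-2 : ℝ) * (1 + s ^ 2)⁻¹)) := by
        refine mul_le_mul_of_nonneg_left (((hk h h0 hh s).1).trans ?_) hG
        refine mul_le_mul_of_nonneg_left ((hv2 s).trans (hsc s)) (by positivity)
      _ = _ := by rw [hpw]; ring
  have A2 : ∀ s, h * |s| * ‖deriv (kap K) (h * s)‖ * (G * (1 + s ^ 2) ^ (l / 2)) ≤ G * C * h ^ (-l - 2) * (1 + s ^ 2)⁻¹ := fun s => by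
    have a : h * |s| * (1 + (h * s) ^ 2)⁻¹ ≤ 1 := by
      rw [← div_eq_mul_inv, div_le_one (by positivity), ← sq_abs, abs_mul, abs_of_pos h0]
      nlinarith [sq_nonneg (h * |s| - 1), mul_nonneg h0.le (abs_nonneg s)]
    have hp := hk h h0 hh s
    calc _ = G * (h * |s|) * (‖deriv (kap K) (h * s)‖ * (1 + s ^ 2) ^ (l / 2)) := by ring
      _ ≤ G * (h * |s|) * (C * h ^ (-l) * (1 + (h * s) ^ 2)⁻¹ ^ 2) := by
        exact mul_le_mul_of_nonneg_left hp.2 (by positivity)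
      _ = (G * C * h ^ (-l)) * ((h * |s| * (1 + (h * s) ^ 2)⁻¹) * (1 + (h * s) ^ 2)⁻¹) := by ring
      _ ≤ (G * C * h ^ (-l)) * (1 * (h ^ (-2 : ℝ) * (1 + s ^ 2)⁻¹)) := by
        have := hsc s
        gcongr
      _ = _ := by rw [hpw]; ring
  set F : ℝ → ℂ := fun s => kap K (h * s) * f s with hFd
  have hk' : Differentiable ℝ fun s => kap K (h * s) := (kap_diff hK).comp (differentiable_id.const_mul h)
  have hF : Differentiable ℝ F := hk'.mul hf
  set B := 2 * (G * C * h ^ (-l - 2)) with hB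
  have hp2 : 0 < h ^ (-l - 2) := Real.rpow_pos_of_pos h0 _
  have hFn : ∀ s, ‖F s‖ ≤ G * C * h ^ (-l - 2) * (1 + s ^ 2)⁻¹ := fun s => by
    rw [hFd]; simp only [norm_mul]
    exact (mul_le_mul_of_nonneg_left (hf1 s) (norm_nonneg _)).trans (A1 s)
  have hF1 : ∀ s, ‖F s‖ ≤ B * (1 + s ^ 2)⁻¹ := fun s => (hFn s).trans (by
    have : 0 ≤ G * C * h ^ (-l - 2) * (1 + s ^ 2)⁻¹ := by positivity
    rw [hB]; linarith)
  have hF2 : ∀ s, |s| * ‖deriv F s‖ ≤ B * (1 + s ^ 2)⁻¹ := fun s => by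
    have e : deriv F s = (h • deriv (kap K) (h * s)) * f s + kap K (h * s) * deriv f s := by
      rw [hFd]
      have := deriv_comp_mul_left h (kap K) s
      rw [← this]
      exact deriv_mul (hk' s) (hf s)
    rw [e]
    calc _ ≤ |s| * (h * ‖deriv (kap K) (h * s)‖ * ‖f s‖ + ‖kap K (h * s)‖ * ‖deriv f s‖) := by
          gcongr
          refine (norm_add_le _ _).trans (le_of_eq ?_)
          rw [norm_mul, norm_mul, norm_smul, Real.norm_of_nonneg h0.le]
      _ = h * |s| * ‖deriv (kap K) (h * s)‖ * ‖f s‖ + ‖kap K (h * s)‖ * (|s| * ‖deriv f s‖) := by ring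
      _ ≤ G * C * h ^ (-l - 2) * (1 + s ^ 2)⁻¹ + G * C * h ^ (-l - 2) * (1 + s ^ 2)⁻¹ := by
          refine add_le_add (le_trans ?_ (A2 s)) (le_trans ?_ (A1 s))
          · have := hf1 s; gcongr
          · have := hf2 s; gcongr
      _ = _ := by rw [hB]; ring
  refine ⟨fun s => (hFn s).trans ?_, fun u s hu => ?_⟩
  · have : 0 ≤ G * C * h ^ (-l - 2) * (1 + s ^ 2)⁻¹ := by positivity
    calc _ ≤ 80 * (G * C * h ^ (-l - 2) * (1 + s ^ 2)⁻¹) := by linarith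
      _ = _ := by ring
  · refine (diff_core hF hF1 hF2 hu s).trans (le_of_eq ?_)
    rw [hB]; ring

end onedim

lemma kap_contDiff {K : ℝ → ℝ} (hK : IsKernel K) (n : ℕ) : ContDiff ℝ n (kap K) := by
  obtain ⟨S, h1, -⟩ := kap_schwartz hK
  rw [show kap K = fun t => S (-(1 / (2 * Real.pi)) * t) from funext h1]
  exact (S.smooth n).comp (contDiff_const.mul contDiff_id)

section mixed
variable {ι : Type} [Fintype ι] [DecidableEq ι]

def Bop (K : ℝ → ℝ) (h : ι → ℝ) (j : ι) (v : ℝ) (ψ : (ι → ℝ) → ℂ) (t : ι → ℝ) : ℂ :=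
  kap K (h j * (t j + v)) * ψ (t + Pi.single j v)

def Aop (K : ℝ → ℝ) (h : ι → ℝ) (J : Finset ι) (u : ι → ℝ) (j : ι) (ψ : (ι → ℝ) → ℂ) (t : ι → ℝ) : ℂ :=
  if j ∈ J then Bop K h j (u j) ψ t - Bop K h j 0 ψ t else Bop K h j 0 ψ t

def DS (S : Finset ι) (l : List ι) (ψ : (ι → ℝ) → ℂ) : (ι → ℝ) → ℂ :=
  l.foldr (fun i φ => if i ∈ S then cpd i φ else φ) ψ

lemma DS_cons (S : Finset ι) (j : ι) (l : List ι) (ψ : (ι → ℝ) → ℂ) :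
    DS S (j :: l) ψ = if j ∈ S then cpd j (DS S l ψ) else DS S l ψ := rfl

lemma Bop_contDiff {K : ℝ → ℝ} (hK : IsKernel K) (h : ι → ℝ) (j : ι) (v : ℝ) {n : ℕ} {ψ : (ι → ℝ) → ℂ} (hψ : ContDiff ℝ n ψ) :
    ContDiff ℝ n (Bop K h j v ψ) := by
  unfold Bop
  refine ContDiff.mul ((kap_contDiff hK n).comp ?_) (hψ.comp ?_)
  · exact contDiff_const.mul ((contDiff_apply ℝ ℝ j).add contDiff_const)
  · exact contDiff_id.add contDiff_const

lemma Aop_contDiff {K : ℝ → ℝ} (hK : IsKernel K) (h : ι → ℝ) (J : Finset ι) (u : ι → ℝ) (j : ι) {n : ℕ} {ψ : (ι → ℝ) → ℂ} (hψ : ContDiff ℝ n ψ) :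
    ContDiff ℝ n (Aop K h J u j ψ) := by
  by_cases hj : j ∈ J
  · have e : Aop K h J u j ψ = fun t => Bop K h j (u j) ψ t - Bop K h j 0 ψ t := by
      ext t; simp [Aop, hj]
    rw [e]
    exact (Bop_contDiff hK h j (u j) hψ).sub (Bop_contDiff hK h j 0 hψ)
  · have e : Aop K h J u j ψ = Bop K h j 0 ψ := by
      ext t; simp [Aop, hj]
    rw [e]
    exact Bop_contDiff hK h j 0 hψ

lemma cpd_contDiff {n : ℕ} {ψ : (ι → ℝ) → ℂ} (hψ : ContDiff ℝ ((n + 1 : ℕ)) ψ) (i : ι) : ContDiff ℝ n (cpd i ψ) := by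
  unfold cpd
  exact (hψ.fderiv_right (m := n) (by norm_cast)).clm_apply contDiff_const

lemma DS_contDiff (S : Finset ι) (l : List ι) {n : ℕ} {ψ : (ι → ℝ) → ℂ} (hψ : ContDiff ℝ ((n + l.length : ℕ)) ψ) : ContDiff ℝ n (DS S l ψ) := by
  induction l generalizing n with
  | nil => simpa [DS] using hψ
  | cons j l ih =>
    rw [DS_cons]
    split_ifs
    · refine cpd_contDiff (ih ?_) j
      have e : n + 1 + l.length = n + (j :: l).length := by simp; omega
      rw [e]; exact hψ
    · exact ih (hψ.of_le (by norm_cast; simp))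

lemma cpd_Bop {K : ℝ → ℝ} (hK : IsKernel K) (h : ι → ℝ) {i j : ι} (hij : i ≠ j) (v : ℝ) {ψ : (ι → ℝ) → ℂ} (hψ : Differentiable ℝ ψ) :
    cpd i (Bop K h j v ψ) = Bop K h j v (cpd i ψ) := by
  ext t
  unfold cpd Bop
  have h1 : HasFDerivAt (fun t : ι → ℝ => h j * (t j + v)) (h j • (ContinuousLinearMap.proj (R := ℝ) (φ := fun _ : ι => ℝ) j)) t := by
    exact ((hasFDerivAt_apply (𝕜 := ℝ) j t).add_const v).const_mul (h j)
  have h2 := (kap_diff hK (h j * (t j + v))).hasFDerivAt.comp t h1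
  have h3 : HasFDerivAt (fun t => ψ (t + Pi.single j v)) (fderiv ℝ ψ (t + Pi.single j v)) t := by
    have := (hψ (t + Pi.single j v)).hasFDerivAt.comp t ((hasFDerivAt_id t).add_const (Pi.single j v))
    exact this
  have h4 := h2.mul h3
  have := h4.fderiv
  simp only [Function.comp_def] at this
  rw [show (fun t : ι → ℝ => kap K (h j * (t j + v)) * ψ (t + Pi.single j v)) = ((fun x => kap K (h j * (x j + v))) * fun t => ψ (t + Pi.single j v)) from rfl, this]
  simp [hij.symm]

lemma cpd_Aop {K : ℝ → ℝ} (hK : IsKernel K) (h : ι → ℝ) (J : Finset ι) (u : ι → ℝ) {i j : ι} (hij : i ≠ j) {ψ : (ι → ℝ) → ℂ} (hψ : ContDiff ℝ (1 : ℕ) ψ) :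
    cpd i (Aop K h J u j ψ) = Aop K h J u j (cpd i ψ) := by
  have hd : Differentiable ℝ ψ := hψ.differentiable (by norm_num)
  by_cases hj : j ∈ J
  · have e : ∀ φ, Aop K h J u j φ = Bop K h j (u j) φ - Bop K h j 0 φ := fun φ => by
      ext t; simp [Aop, hj]
    rw [e, e, ← cpd_Bop hK h hij _ hd, ← cpd_Bop hK h hij _ hd]
    ext t
    have d1 := (Bop_contDiff hK h j (u j) hψ).differentiable (by norm_num) t
    have d2 := (Bop_contDiff hK h j 0 hψ).differentiable (by norm_num) t
    unfold cpd
    rw [fderiv_sub d1 d2]; rfl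
  · have e : ∀ φ, Aop K h J u j φ = Bop K h j 0 φ := fun φ => by
      ext t; simp [Aop, hj]
    rw [e, e, cpd_Bop hK h hij _ hd]

lemma DS_Aop {K : ℝ → ℝ} (hK : IsKernel K) (h : ι → ℝ) (J : Finset ι) (u : ι → ℝ) (S : Finset ι) (j : ι) (l : List ι) (hj : j ∉ l)
    {ψ : (ι → ℝ) → ℂ} (hψ : ContDiff ℝ (l.length : ℕ) ψ) :
    DS S l (Aop K h J u j ψ) = Aop K h J u j (DS S l ψ) := by
  induction l with
  | nil => rfl
  | cons i l ih =>
    simp only [List.mem_cons, not_or] at hj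
    have hψ' : ContDiff ℝ (l.length : ℕ) ψ := hψ.of_le (by norm_cast; simp)
    rw [DS_cons, DS_cons, ih hj.2 hψ']
    split_ifs
    · refine cpd_Aop hK h J u (Ne.symm hj.1) (DS_contDiff S l ?_)
      have e : 1 + l.length = (i :: l).length := by simp; omega
      rw [e]; exact hψ
    · rfl

def bbf (C h lam : ι → ℝ) (J : Finset ι) (u : ι → ℝ) (i : ι) (s : ℝ) : ℝ :=
  C i * h i ^ (-lam i - 2) * ((if i ∈ J then rhof (u i) s else 1) * (1 + s ^ 2)⁻¹)

def vvf (C h lam : ι → ℝ) (J : Finset ι) (u : ι → ℝ) (l : List ι) (t : ι → ℝ) : ℝ :=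
  ∏ i, if i ∈ l then (1 + t i ^ 2) ^ (lam i / 2) else bbf C h lam J u i (t i)

def mmf (S : Finset ι) (l : List ι) (t : ι → ℝ) : ℝ := ∏ i, if i ∈ S ∧ i ∈ l then |t i| else 1

lemma rhof_nonneg (u s : ℝ) : 0 ≤ rhof u s := by
  unfold rhof; split_ifs <;> positivity

lemma DS_congr {S S' : Finset ι} (l : List ι) (hS : ∀ i ∈ l, (i ∈ S ↔ i ∈ S')) (ψ : (ι → ℝ) → ℂ) : DS S l ψ = DS S' l ψ := by
  induction l with
  | nil => rfl
  | cons i l ih =>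
    rw [DS_cons, DS_cons, ih fun k hk => hS k (List.mem_cons_of_mem _ hk)]
    simp only [hS i List.mem_cons_self]

lemma step_bd {K : ℝ → ℝ} (hK : IsKernel K) {C h lam : ι → ℝ} (J : Finset ι) (u : ι → ℝ) (h0 : ∀ j, 0 < h j)
    (hC1 : ∀ j, 1 ≤ C j)
    (hC : ∀ j, ∀ (f : ℝ → ℂ) (G : ℝ), Differentiable ℝ f → 0 ≤ G → (∀ s, ‖f s‖ ≤ G * (1 + s ^ 2) ^ (lam j / 2)) →
      (∀ s, |s| * ‖deriv f s‖ ≤ G * (1 + s ^ 2) ^ (lam j / 2)) →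
      (∀ s, ‖kap K (h j * s) * f s‖ ≤ G * (C j * h j ^ (-lam j - 2) * (1 + s ^ 2)⁻¹)) ∧
      ∀ u s, |u| ≤ 4 → ‖kap K (h j * (s + u)) * f (s + u) - kap K (h j * s) * f s‖ ≤ G * (C j * h j ^ (-lam j - 2) * (rhof u s * (1 + s ^ 2)⁻¹)))
    (hu : ∀ j ∈ J, |u j| ≤ 4) {M : ℝ} (hM : 0 ≤ M) (j : ι) (l : List ι) (hj : j ∉ l) {ψ : (ι → ℝ) → ℂ} (hψ : ContDiff ℝ ((l.length + 1 : ℕ)) ψ)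
    (H : ∀ S t, ‖DS S (j :: l) ψ t‖ * mmf S (j :: l) t ≤ M * vvf C h lam J u (j :: l) t) (S : Finset ι) (t : ι → ℝ) :
    ‖DS S l (Aop K h J u j ψ) t‖ * mmf S l t ≤ M * vvf C h lam J u l t := by
  rw [DS_Aop hK h J u S j l hj (hψ.of_le (by norm_cast; simp))]
  set χ := DS S l ψ with hχ
  have hχd : Differentiable ℝ χ := by
    have : ContDiff ℝ (1 : ℕ) χ := DS_contDiff S l (by rw [add_comm 1 l.length]; exact hψ)
    exact this.differentiable (by norm_num)
  set R : ℝ := ∏ i ∈ Finset.univ.erase j, (if i ∈ l then (1 + t i ^ 2) ^ (lam i / 2) else bbf C h lam J u i (t i)) with hR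
  have hbn : ∀ i s, 0 ≤ bbf C h lam J u i s := fun i s => by
    unfold bbf
    have := hC1 i
    have := Real.rpow_pos_of_pos (h0 i) (-lam i - 2)
    have := rhof_nonneg (u i) s
    split_ifs <;> positivity
  have hR0 : 0 ≤ R := Finset.prod_nonneg fun i _ => by
    split_ifs
    · positivity
    · exact hbn _ _
  set m : ℝ := mmf S l t with hm
  have hm0 : 0 ≤ m := Finset.prod_nonneg fun i _ => by split_ifs <;> positivity
  have hmu : ∀ s, mmf S l (Function.update t j s) = m := fun s => by
    refine Finset.prod_congr rfl fun i _ => ?_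
    by_cases hi : i = j
    · subst hi; simp [hj]
    · rw [Function.update_of_ne hi]
  have hvu : ∀ s, vvf C h lam J u (j :: l) (Function.update t j s) = (1 + s ^ 2) ^ (lam j / 2) * R := fun s => by
    unfold vvf
    rw [← Finset.mul_prod_erase _ _ (Finset.mem_univ j)]
    congr 1
    · simp
    · refine Finset.prod_congr rfl fun i hi => ?_
      have hi' := Finset.ne_of_mem_erase hi
      simp [hi']
  have hvl : vvf C h lam J u l t = bbf C h lam J u j (t j) * R := by
    unfold vvf
    rw [← Finset.mul_prod_erase _ _ (Finset.mem_univ j)]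
    simp [hj, hR]
  set f : ℝ → ℂ := fun s => (m : ℂ) * χ (Function.update t j s) with hf
  have hder : ∀ s, HasDerivAt f ((m : ℂ) * cpd j χ (Function.update t j s)) s := fun s => by
    have h1 := (hχd (Function.update t j s)).hasFDerivAt.comp_hasDerivAt s (hasDerivAt_update t j s)
    exact h1.const_mul _
  have hn : ∀ c : ℂ, ‖(m : ℂ) * c‖ = ‖c‖ * m := fun c => by
    rw [norm_mul, Complex.norm_real, Real.norm_of_nonneg hm0, mul_comm]
  have b1 : ∀ s, ‖f s‖ ≤ (M * R) * (1 + s ^ 2) ^ (lam j / 2) := fun s => by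
    have := H (S.erase j) (Function.update t j s)
    rw [DS_cons, if_neg (by simp), hvu] at this
    rw [DS_congr (S' := S) l (fun i hi => by
      have : i ≠ j := fun e => hj (e ▸ hi)
      simp [this])] at this
    have e : mmf (S.erase j) (j :: l) (Function.update t j s) = m := by
      rw [← hmu s]
      refine Finset.prod_congr rfl fun i _ => ?_
      by_cases hi : i = j
      · subst hi; simp [hj]
      · simp [hi]
    rw [e] at this
    rw [hf]; simp only [hn]
    refine this.trans (le_of_eq (by ring))
  have b2 : ∀ s, |s| * ‖deriv f s‖ ≤ (M * R) * (1 + s ^ 2) ^ (lam j / 2) := fun s => by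
    rw [(hder s).deriv, hn]
    have := H (insert j S) (Function.update t j s)
    rw [DS_cons, if_pos (by simp), hvu] at this
    rw [DS_congr (S' := S) l (fun i hi => by
      have : i ≠ j := fun e => hj (e ▸ hi)
      simp [this])] at this
    have e : mmf (insert j S) (j :: l) (Function.update t j s) = |s| * m := by
      rw [← hmu s]
      unfold mmf
      rw [← Finset.mul_prod_erase _ _ (Finset.mem_univ j), ← Finset.mul_prod_erase univ (fun i => if i ∈ S ∧ i ∈ l then _ else _) (Finset.mem_univ j)]
      simp only [hj, and_false, if_false, one_mul]
      congr 1
      · simp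
      · refine Finset.prod_congr rfl fun i hi => ?_
        have hi' := Finset.ne_of_mem_erase hi
        simp [hi']
    rw [e] at this
    calc _ = ‖cpd j (DS S l ψ) (Function.update t j s)‖ * (|s| * m) := by ring
      _ ≤ _ := this.trans (le_of_eq (by ring))
  obtain ⟨c1, c2⟩ := hC j f (M * R) (fun s => (hder s).differentiableAt) (by positivity) b1 b2
  have hsh : ∀ v, t + Pi.single j v = Function.update t j (t j + v) := fun v => by
    ext i
    by_cases hi : i = j
    · subst hi; simp
    · simp [hi]
  rw [hvl]
  unfold Aop
  split_ifs with hjJ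
  · have := c2 (u j) (t j) (hu j hjJ)
    have e : kap K (h j * (t j + u j)) * f (t j + u j) - kap K (h j * t j) * f (t j) = (m : ℂ) * (Bop K h j (u j) χ t - Bop K h j 0 χ t) := by
      simp only [hf, Bop, hsh, add_zero]; ring
    rw [e, hn] at this
    refine this.trans (le_of_eq ?_)
    simp only [bbf, hjJ, if_true]; ring
  · have := c1 (t j)
    have e : kap K (h j * t j) * f (t j) = (m : ℂ) * Bop K h j 0 χ t := by
      simp only [hf, Bop, hsh, add_zero]; ring
    rw [e, hn] at this
    refine this.trans (le_of_eq ?_)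
    simp only [bbf, hjJ, if_false]; ring

lemma fold_bd {K : ℝ → ℝ} (hK : IsKernel K) {C h lam : ι → ℝ} (J : Finset ι) (u : ι → ℝ) (h0 : ∀ j, 0 < h j)
    (hC1 : ∀ j, 1 ≤ C j)
    (hC : ∀ j, ∀ (f : ℝ → ℂ) (G : ℝ), Differentiable ℝ f → 0 ≤ G → (∀ s, ‖f s‖ ≤ G * (1 + s ^ 2) ^ (lam j / 2)) →
      (∀ s, |s| * ‖deriv f s‖ ≤ G * (1 + s ^ 2) ^ (lam j / 2)) →
      (∀ s, ‖kap K (h j * s) * f s‖ ≤ G * (C j * h j ^ (-lam j - 2) * (1 + s ^ 2)⁻¹)) ∧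
      ∀ u s, |u| ≤ 4 → ‖kap K (h j * (s + u)) * f (s + u) - kap K (h j * s) * f s‖ ≤ G * (C j * h j ^ (-lam j - 2) * (rhof u s * (1 + s ^ 2)⁻¹)))
    (hu : ∀ j ∈ J, |u j| ≤ 4) {M : ℝ} (hM : 0 ≤ M) (l : List ι) (hl : l.Nodup) {ψ : (ι → ℝ) → ℂ} (hψ : ContDiff ℝ (l.length : ℕ) ψ)
    (H : ∀ S t, ‖DS S l ψ t‖ * mmf S l t ≤ M * vvf C h lam J u l t) (t : ι → ℝ) :
    ‖l.foldl (fun φ j => Aop K h J u j φ) ψ t‖ ≤ M * ∏ i, bbf C h lam J u i (t i) := by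
  induction l generalizing ψ with
  | nil =>
    have := H ∅ t
    simpa [DS, mmf, vvf] using this
  | cons j l ih =>
    rw [List.foldl_cons]
    rw [List.nodup_cons] at hl
    refine ih hl.2 (Aop_contDiff hK h J u j (hψ.of_le (by norm_cast; simp))) ?_
    exact step_bd hK J u h0 hC1 hC hu hM j l hl.1 (by simpa using hψ) H

end mixed

lemma sing_int {θ : ℝ} (h0 : 0 < θ) (h1 : θ < 1) : Integrable fun s : ℝ => |s| ^ (-θ) * (1 + s ^ 2)⁻¹ := by
  have key := integrable_fun_norm_addHaar (E := ℝ) (volume : Measure ℝ) (f := fun y : ℝ => y ^ (-θ) * (1 + y ^ 2)⁻¹)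
  simp only [Real.norm_eq_abs, sq_abs] at key
  rw [key]
  simp only [Module.finrank_self, Nat.sub_self, pow_zero, one_smul]
  have e : Set.Ioi (0 : ℝ) = Set.Ioc 0 1 ∪ Set.Ioi 1 := (Set.Ioc_union_Ioi_eq_Ioi zero_le_one).symm
  have hm : Measurable fun y : ℝ => y ^ (-θ) * (1 + y ^ 2)⁻¹ := by fun_prop
  rw [e]
  refine IntegrableOn.union ?_ ?_
  · have := (intervalIntegral.intervalIntegrable_rpow' (r := -θ) (by linarith) (a := 0) (b := 1)).1
    refine Integrable.mono' this hm.aestronglyMeasurable ?_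
    filter_upwards [ae_restrict_mem measurableSet_Ioc] with s hs
    have := Real.rpow_nonneg hs.1.le (-θ)
    rw [Real.norm_of_nonneg (by positivity)]
    exact mul_le_of_le_one_right this (inv_le_one_of_one_le₀ (by nlinarith))
  · have := integrableOn_Ioi_rpow_of_lt (a := -2) (by norm_num) (c := 1) one_pos
    refine Integrable.mono' this hm.aestronglyMeasurable ?_
    filter_upwards [ae_restrict_mem measurableSet_Ioi] with s hs
    have hs : 1 < s := hs
    have h3 := Real.rpow_nonneg (show (0:ℝ) ≤ s by linarith) (-θ)
    rw [Real.norm_of_nonneg (by positivity)]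
    have h4 : s ^ (-θ) ≤ 1 := Real.rpow_le_one_of_one_le_of_nonpos hs.le (by linarith)
    have e2 : s ^ (-2 : ℝ) = (s ^ 2)⁻¹ := by rw [Real.rpow_neg (by linarith), Real.rpow_two]
    rw [e2]
    have : (1 + s ^ 2)⁻¹ ≤ (s ^ 2)⁻¹ := inv_anti₀ (by positivity) (by linarith)
    have h5 : 0 ≤ (1 + s ^ 2)⁻¹ := by positivity
    nlinarith

lemma rhof_meas (u : ℝ) : Measurable (rhof u) := by
  unfold rhof
  exact Measurable.ite (measurableSet_le (by fun_prop) (by fun_prop)) measurable_const (by fun_prop)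

lemma rhof_le {θ : ℝ} (h0 : 0 < θ) (h1 : θ < 1) (u : ℝ) {s : ℝ} (hs : s ≠ 0) : rhof u s ≤ 2 * |u| ^ θ * |s| ^ (-θ) := by
  have hs' : 0 < |s| := abs_pos.2 hs
  have e : |u| ^ θ * |s| ^ (-θ) = (|u| / |s|) ^ θ := by
    rw [Real.div_rpow (abs_nonneg _) hs'.le, Real.rpow_neg hs'.le]; rfl
  rw [mul_assoc, e]
  unfold rhof
  split_ifs with h
  · have h2 : 1 / 2 ≤ |u| / |s| := by rw [div_le_div_iff₀ (by norm_num) hs']; linarith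
    have h3 : (1 / 2 : ℝ) ^ θ ≤ (|u| / |s|) ^ θ := Real.rpow_le_rpow (by norm_num) h2 h0.le
    have h4 : (1 / 2 : ℝ) ^ (1 : ℝ) ≤ (1 / 2 : ℝ) ^ θ := Real.rpow_le_rpow_of_exponent_ge (by norm_num) (by norm_num) h1.le
    rw [Real.rpow_one] at h4
    linarith
  · push Not at h
    have h2 : |u| / |s| ≤ 1 := by rw [div_le_one hs']; nlinarith [abs_nonneg u]
    have h3 : 0 ≤ |u| / |s| := by positivity
    rcases h3.eq_or_lt with h4 | h4
    · rw [← h4]; positivity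
    have h5 : (|u| / |s|) ^ (1 : ℝ) ≤ (|u| / |s|) ^ θ := Real.rpow_le_rpow_of_exponent_ge h4 h2 h1.le
    rw [Real.rpow_one] at h5
    have := Real.rpow_nonneg h3 θ
    linarith

lemma rhof_int {θ : ℝ} (h0 : 0 < θ) (h1 : θ < 1) : ∃ C : ℝ, 0 ≤ C ∧ ∀ u : ℝ, Integrable (fun s => rhof u s * (1 + s ^ 2)⁻¹) ∧
    ∫ s, rhof u s * (1 + s ^ 2)⁻¹ ≤ C * |u| ^ θ := by
  refine ⟨2 * ∫ s : ℝ, |s| ^ (-θ) * (1 + s ^ 2)⁻¹, by positivity, fun u => ?_⟩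
  have hI := (sing_int h0 h1).const_mul (2 * |u| ^ θ)
  have hle : ∀ᵐ s : ℝ, rhof u s * (1 + s ^ 2)⁻¹ ≤ 2 * |u| ^ θ * (|s| ^ (-θ) * (1 + s ^ 2)⁻¹) := by
    have : ∀ᵐ s : ℝ, s ≠ 0 := by simp [ae_iff]
    filter_upwards [this] with s hs
    rw [← mul_assoc]
    exact mul_le_mul_of_nonneg_right (rhof_le h0 h1 u hs) (by positivity)
  have hII : Integrable (fun s => rhof u s * (1 + s ^ 2)⁻¹) := by
    refine hI.mono' (by have := rhof_meas u; exact Measurable.aestronglyMeasurable (by fun_prop)) ?_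
    filter_upwards [hle] with s hs
    rw [Real.norm_of_nonneg (mul_nonneg (rhof_nonneg _ _) (by positivity))]
    exact hs
  refine ⟨hII, (integral_mono_ae hII hI hle).trans (le_of_eq ?_)⟩
  rw [integral_const_mul]; ring

section ft
variable {ι : Type} [Fintype ι] [DecidableEq ι]

lemma FT_shift (G : (ι → ℝ) → ℂ) (a x : ι → ℝ) : FT (fun t => G (t + a)) x = starRingEnd ℂ (ec a (-x)) * FT G x := by
  unfold FT
  rw [← integral_const_mul]
  rw [← integral_sub_right_eq_self (μ := volume) (fun t => ec t (-x) * G (t + a)) a]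
  refine integral_congr_ae (ae_of_all _ fun t => ?_)
  simp only [sub_add_cancel]
  rw [ec_sub_left]; ring

lemma ec_integrable {φ : (ι → ℝ) → ℂ} (hφ : Integrable φ) (x : ι → ℝ) : Integrable fun t => ec t (-x) * φ t := by
  refine hφ.bdd_mul (c := 1) ?_ (ae_of_all _ fun t => (norm_ec _ _).le)
  exact (continuous_ec.comp (continuous_id.prodMk continuous_const)).aestronglyMeasurable

def Pl (K : ℝ → ℝ) (h : ι → ℝ) (l : List ι) (ψ : (ι → ℝ) → ℂ) (t : ι → ℝ) : ℂ := (l.map fun j => kap K (h j * t j)).prod * ψ t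

lemma FT_fold {K : ℝ → ℝ} {h : ι → ℝ} {J : Finset ι} {u x : ι → ℝ} (hux : ∀ j ∈ J, u j * x j = Real.pi) (l : List ι) (hl : l.Nodup)
    {ψ : (ι → ℝ) → ℂ} (hi : Integrable (Pl K h l ψ)) :
    ‖FT (Pl K h l ψ) x‖ ≤ ‖FT (l.foldl (fun φ j => Aop K h J u j φ) ψ) x‖ := by
  induction l generalizing ψ with
  | nil =>
    have : Pl K h [] ψ = ψ := by ext t; simp [Pl]
    rw [this]; rfl
  | cons j l ih =>
    rw [List.nodup_cons] at hl
    rw [List.foldl_cons]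
    have e0 : Pl K h (j :: l) ψ = Pl K h l (Bop K h j 0 ψ) := by
      ext t; simp only [Pl, Bop, List.map_cons, List.prod_cons, Pi.single_zero, add_zero]; ring
    by_cases hj : j ∈ J
    · set G := Pl K h (j :: l) ψ with hG
      have e1 : Pl K h l (Aop K h J u j ψ) = fun t => G (t + Pi.single j (u j)) - G t := by
        ext t
        have e2 : (l.map fun i => kap K (h i * (t + (Pi.single j (u j) : ι → ℝ)) i)) = (l.map fun i => kap K (h i * t i)) := by
          refine List.map_congr_left fun i hi => ?_
          have : i ≠ j := fun e => hl.1 (e ▸ hi)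
          simp [this]
        simp only [hG, Pl, List.map_cons, List.prod_cons]
        rw [e2]
        simp only [Aop, hj, if_true, Bop, Pi.single_zero, add_zero, Pi.add_apply, Pi.single_eq_same]
        ring
      have hi' : Integrable (fun t : ι → ℝ => G (t + Pi.single j (u j))) := Integrable.comp_add_right (f := G) (μ := volume) hi (Pi.single j (u j))
      have e3 : FT (Pl K h l (Aop K h J u j ψ)) x = -2 * FT G x := by
        have e4 : FT (fun t : ι → ℝ => G (t + Pi.single j (u j)) - G t) x = FT (fun t : ι → ℝ => G (t + Pi.single j (u j))) x - FT G x := by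
          unfold FT
          rw [← integral_sub]
          · simp only [mul_sub]
          · exact ec_integrable hi' x
          · exact ec_integrable hi x
        rw [e1, e4, FT_shift]
        have e5 : ec (Pi.single j (u j)) (-x) = -1 := by
          rw [ec_neg_right]
          have : dotp (Pi.single j (u j)) x = Real.pi := by
            unfold dotp
            rw [Finset.sum_eq_single j]
            · simp [hux j hj]
            · intro b _ hb; simp [hb]
            · simp
          rw [this, Complex.exp_neg, mul_comm, Complex.exp_pi_mul_I]; norm_num
        rw [e5]; simp; ring
      have := ih hl.2 (ψ := Aop K h J u j ψ) (by rw [e1]; exact hi'.sub hi)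
      rw [e3, norm_mul] at this
      have h2 : ‖(-2 : ℂ)‖ = 2 := by simp
      rw [h2] at this
      have := norm_nonneg (FT G x)
      linarith
    · have e1 : Aop K h J u j ψ = Bop K h j 0 ψ := by ext t; simp [Aop, hj]
      rw [e1, e0]
      exact ih hl.2 (by rw [← e0]; exact hi)

lemma multiPD_DS (S : Finset ι) (ψ : (ι → ℝ) → ℂ) :
    multiPD (fun i => if i ∈ S then 1 else 0) ψ = DS S (univ (α := ι)).toList ψ := by
  unfold multiPD DS
  congr 1
  ext j φ t
  by_cases h : j ∈ S <;> simp [h]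

lemma ptw_aux {K : ℝ → ℝ} (hK : IsKernel K) (Q : (ι → ℝ) → ℂ) {A : ℝ} (hA : 0 < A) (lam : ι → ℝ) (hl : ∀ j, 0 < lam j)
    (hcd : ContDiff ℝ (Fintype.card ι : ℕ) fun t => (Q t)⁻¹)
    (hb : ∀ α : ι → ℕ, (∑ j, α j) ≤ Fintype.card ι → ∀ t : ι → ℝ,
      ‖multiPD α (fun u => (Q u)⁻¹) t * ∏ j, (t j : ℂ) ^ α j‖ ≤ A * ∏ j, (1 + t j ^ 2) ^ (lam j / 2))
    {θ : ℝ} (hθ0 : 0 < θ) (hθ1 : θ < 1) :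
    ∃ C : ℝ, 1 ≤ C ∧ ∀ h : ι → ℝ, (∀ j, 0 < h j) → (∀ j, h j ≤ 1) → Integrable (gh K Q h) → ∀ x,
      ‖FT (gh K Q h) x‖ ≤ (C * ∏ j, h j ^ (-lam j - 2)) * ∏ j, (1 + |x j|) ^ (-θ) := by
  choose C hC1 hC using fun j => diff_kap hK (lam j) (hl j)
  obtain ⟨c, hc0, hc⟩ := rhof_int hθ0 hθ1
  set D : ℝ := 2 * (Real.pi + c * 4) with hD
  have hπ := Real.pi_gt_three
  have hD0 : 1 ≤ D := by rw [hD]; nlinarith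
  refine ⟨max 1 (A * ∏ j, (C j * D)), le_max_left _ _, fun h h0 h1 hi x => ?_⟩
  set J : Finset ι := Finset.univ.filter fun j => 1 ≤ |x j| with hJ
  set u : ι → ℝ := fun j => Real.pi / x j with hu
  have hxJ : ∀ j ∈ J, 1 ≤ |x j| := fun j hj => by simpa [hJ] using hj
  have hux : ∀ j ∈ J, u j * x j = Real.pi := fun j hj => by
    have : x j ≠ 0 := abs_pos.1 (by linarith [hxJ j hj])
    simp only [hu]; field_simp
  have huJ : ∀ j ∈ J, |u j| = Real.pi / |x j| := fun j hj => by
    simp only [hu, abs_div, abs_of_pos Real.pi_pos]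
  have hu4 : ∀ j ∈ J, |u j| ≤ 4 := fun j hj => by
    rw [huJ j hj, div_le_iff₀ (by linarith [hxJ j hj])]
    nlinarith [Real.pi_lt_d2, hxJ j hj]
  set l : List ι := (univ (α := ι)).toList with hl'
  have hlen : l.length = Fintype.card ι := by rw [hl', Finset.length_toList, Finset.card_univ]
  have hnd : l.Nodup := Finset.nodup_toList _
  have hmem : ∀ i, i ∈ l := fun i => by simp [hl']
  have eP : gh K Q h = Pl K h l (fun t => (Q t)⁻¹) := by
    ext t
    simp only [gh, kapp, Pl, hl', Finset.prod_map_toList]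
  have hfold := fold_bd hK (C := C) (h := h) (lam := lam) J u h0 hC1 (fun j => hC j (h j) (h0 j) (h1 j)) hu4 hA.le l hnd
    (ψ := fun t => (Q t)⁻¹) (by rw [hlen]; exact hcd) (fun S t => by
      have := hb (fun i => if i ∈ S then 1 else 0) (by
        calc _ ≤ ∑ j : ι, 1 := Finset.sum_le_sum fun j _ => by split_ifs <;> simp
          _ = _ := by simp) t
      rw [multiPD_DS, norm_mul] at this
      have e1 : ‖∏ j, (t j : ℂ) ^ (if j ∈ S then 1 else 0)‖ = mmf S l t := by
        rw [norm_prod]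
        refine Finset.prod_congr rfl fun i _ => ?_
        simp only [hmem, and_true]
        split_ifs <;> simp
      have e2 : vvf C h lam J u l t = ∏ j, (1 + t j ^ 2) ^ (lam j / 2) := by
        refine Finset.prod_congr rfl fun i _ => by simp [hmem]
      rw [e1] at this
      rw [e2]; exact this)
  have hone : ∀ i, Integrable (bbf C h lam J u i) ∧ ∫ s, bbf C h lam J u i s ≤ (C i * D) * (h i ^ (-lam i - 2) * (1 + |x i|) ^ (-θ)) := fun i => by
    have hp : 0 ≤ C i * h i ^ (-lam i - 2) := mul_nonneg (by linarith [hC1 i]) (Real.rpow_nonneg (h0 i).le _)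
    have hx1 : (0:ℝ) < 1 + |x i| := by positivity
    unfold bbf
    by_cases hij : i ∈ J
    · simp only [hij, if_true]
      refine ⟨(hc (u i)).1.const_mul _, ?_⟩
      rw [integral_const_mul]
      have b1 := (hc (u i)).2
      have b2 : |u i| ^ θ ≤ 8 * (1 + |x i|) ^ (-θ) := by
        have hx := hxJ i hij
        have q1 : |u i| ≤ 8 / (1 + |x i|) := by
          rw [huJ i hij, div_le_div_iff₀ (by linarith) hx1]
          nlinarith [Real.pi_lt_d2]
        have q2 : |u i| ^ θ ≤ (8 / (1 + |x i|)) ^ θ := Real.rpow_le_rpow (abs_nonneg _) q1 hθ0.le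
        rw [Real.div_rpow (by norm_num) hx1.le] at q2
        rw [Real.rpow_neg hx1.le]
        have q3 : (8:ℝ) ^ θ ≤ 8 ^ (1:ℝ) := Real.rpow_le_rpow_of_exponent_le (by norm_num) hθ1.le
        rw [Real.rpow_one] at q3
        refine q2.trans ?_
        rw [div_eq_mul_inv]
        exact mul_le_mul_of_nonneg_right q3 (by positivity)
      calc _ ≤ C i * h i ^ (-lam i - 2) * (c * (8 * (1 + |x i|) ^ (-θ))) := mul_le_mul_of_nonneg_left (b1.trans (mul_le_mul_of_nonneg_left b2 hc0)) hp
        _ ≤ C i * h i ^ (-lam i - 2) * (D * (1 + |x i|) ^ (-θ)) := by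
          refine mul_le_mul_of_nonneg_left ?_ hp
          rw [← mul_assoc]
          refine mul_le_mul_of_nonneg_right ?_ (Real.rpow_nonneg hx1.le _)
          rw [hD]; linarith
        _ = _ := by ring
    · simp only [hij, if_false, one_mul]
      refine ⟨integrable_inv_one_add_sq.const_mul _, ?_⟩
      rw [integral_const_mul, integral_univ_inv_one_add_sq]
      have hx : |x i| < 1 := by simpa [hJ] using hij
      have b2 : 1 / 2 ≤ (1 + |x i|) ^ (-θ) := by
        have q1 : (2:ℝ) ^ (-θ) ≤ (1 + |x i|) ^ (-θ) := Real.rpow_le_rpow_of_nonpos hx1 (by linarith) (by linarith)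
        have q2 : (2:ℝ) ^ (-1:ℝ) ≤ 2 ^ (-θ) := Real.rpow_le_rpow_of_exponent_le (by norm_num) (by linarith)
        rw [Real.rpow_neg_one] at q2
        linarith
      calc _ ≤ C i * h i ^ (-lam i - 2) * (D * (1 + |x i|) ^ (-θ)) := by
            refine mul_le_mul_of_nonneg_left ?_ hp
            have : Real.pi ≤ D * (1 / 2) := by rw [hD]; linarith
            exact this.trans (mul_le_mul_of_nonneg_left b2 (by linarith))
        _ = _ := by ring
  have hbn : ∀ i s, 0 ≤ bbf C h lam J u i s := fun i s => by
    unfold bbf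
    have := hC1 i
    have := Real.rpow_pos_of_pos (h0 i) (-lam i - 2)
    have := rhof_nonneg (u i) s
    split_ifs <;> positivity
  have hint : Integrable fun t : ι → ℝ => ∏ i, bbf C h lam J u i (t i) := Integrable.fintype_prod fun i => (hone i).1
  calc ‖FT (gh K Q h) x‖ ≤ ‖FT (l.foldl (fun φ j => Aop K h J u j φ) fun t => (Q t)⁻¹) x‖ := by
        rw [eP]; exact FT_fold hux l hnd (by rw [← eP]; exact hi)
    _ ≤ ∫ t, ‖l.foldl (fun φ j => Aop K h J u j φ) (fun t => (Q t)⁻¹) t‖ := norm_FT_le _ _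
    _ ≤ ∫ t : ι → ℝ, A * ∏ i, bbf C h lam J u i (t i) :=
        integral_mono_of_nonneg (ae_of_all _ fun _ => norm_nonneg _) (hint.const_mul A) (ae_of_all _ hfold)
    _ = A * ∏ i, ∫ s, bbf C h lam J u i s := by
        rw [integral_const_mul, pi_prod' (fun i => bbf C h lam J u i) fun t => rfl]
    _ ≤ A * ∏ i, ((C i * D) * (h i ^ (-lam i - 2) * (1 + |x i|) ^ (-θ))) :=
        mul_le_mul_of_nonneg_left (Finset.prod_le_prod (fun i _ => integral_nonneg (hbn i)) fun i _ => (hone i).2) hA.le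
    _ = ((A * ∏ j, (C j * D)) * ∏ j, h j ^ (-lam j - 2)) * ∏ j, (1 + |x j|) ^ (-θ) := by
        rw [Finset.prod_mul_distrib, Finset.prod_mul_distrib (f := fun i => h i ^ (-lam i - 2))]; ring
    _ ≤ _ := by
        refine mul_le_mul_of_nonneg_right (mul_le_mul_of_nonneg_right (le_max_right _ _) ?_) ?_
        · exact Finset.prod_nonneg fun i _ => Real.rpow_nonneg (h0 i).le _
        · exact Finset.prod_nonneg fun i _ => by positivity

lemma ptw {K : ℝ → ℝ} (hK : IsKernel K) (Q : (ι → ℝ) → ℂ) {A : ℝ} (hA : 0 < A) (lam : ι → ℝ) (hl : ∀ j, 0 < lam j)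
    (hcd : ContDiff ℝ (Fintype.card ι : ℕ) fun t => (Q t)⁻¹)
    (hb : ∀ α : ι → ℕ, (∑ j, α j) ≤ Fintype.card ι → ∀ t : ι → ℝ,
      ‖multiPD α (fun u => (Q u)⁻¹) t * ∏ j, (t j : ℂ) ^ α j‖ ≤ A * ∏ j, (1 + t j ^ 2) ^ (lam j / 2))
    {r : ℝ} (hr : 1 < r) :
    ∃ C : ℝ, 1 ≤ C ∧ ∀ h : ι → ℝ, (∀ j, 0 < h j) → (∀ j, h j ≤ 1) → Integrable (gh K Q h) →
      Integrable (fun x => ‖FT (gh K Q h) x‖ ^ r) ∧ ∫ x, ‖FT (gh K Q h) x‖ ^ r ≤ (C * ∏ j, h j ^ (-lam j - 2)) ^ r := by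
  set θ : ℝ := (1 + 1 / r) / 2 with hθ
  have hr1 : 1 / r < 1 := by rw [div_lt_one (by linarith)]; exact hr
  have hr0 : 0 < 1 / r := by positivity
  have hrr : r * (1 / r) = 1 := by field_simp
  obtain ⟨C, hC, H⟩ := ptw_aux hK Q hA lam hl hcd hb (θ := θ) (by linarith) (by linarith)
  have hθr : 1 < θ * r := by rw [hθ]; nlinarith
  have h1 : Integrable fun s : ℝ => (1 + |s|) ^ (-(θ * r)) := by
    have := integrable_one_add_norm (E := ℝ) (μ := volume) (r := θ * r) (by simpa using hθr)
    simpa using this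
  set E : ℝ := ∏ _j : ι, ∫ s : ℝ, (1 + |s|) ^ (-(θ * r)) with hE
  have hE0 : 0 ≤ E := Finset.prod_nonneg fun i _ => integral_nonneg fun s => by positivity
  refine ⟨C * (1 + E), by nlinarith, fun h h0 h1' hi => ?_⟩
  set N : ℝ := ∏ j, h j ^ (-lam j - 2) with hN
  have hN0 : 0 ≤ N := Finset.prod_nonneg fun i _ => Real.rpow_nonneg (h0 i).le _
  have hI : Integrable fun x : ι → ℝ => (C * N) ^ r * ∏ j, (1 + |x j|) ^ (-(θ * r)) := (Integrable.fintype_prod fun i => h1).const_mul _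
  have hle : ∀ x, ‖FT (gh K Q h) x‖ ^ r ≤ (C * N) ^ r * ∏ j, (1 + |x j|) ^ (-(θ * r)) := fun x => by
    refine (Real.rpow_le_rpow (norm_nonneg _) (H h h0 h1' hi x) (by linarith)).trans (le_of_eq ?_)
    rw [Real.mul_rpow (by positivity) (Finset.prod_nonneg fun i _ => by positivity)]
    congr 1
    rw [← Real.finsetProd_rpow _ _ (fun i _ => by positivity)]
    refine Finset.prod_congr rfl fun i _ => ?_
    rw [← Real.rpow_mul (by positivity)]; ring_nf
  have hII : Integrable (fun x => ‖FT (gh K Q h) x‖ ^ r) := by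
    refine hI.mono' ?_ (ae_of_all _ fun x => ?_)
    · exact ((continuous_FT hi).norm.rpow_const fun x => Or.inr (by linarith)).aestronglyMeasurable
    · rw [Real.norm_of_nonneg (by positivity)]; exact hle x
  refine ⟨hII, (integral_mono hII hI hle).trans ?_⟩
  rw [integral_const_mul, pi_prod' (fun (_ : ι) (s : ℝ) => (1 + |s|) ^ (-(θ * r))) fun t => rfl, ← hE, show C * (1 + E) * N = (C * N) * (1 + E) by ring,
    Real.mul_rpow (mul_nonneg (by linarith) hN0) (by linarith)]
  refine mul_le_mul_of_nonneg_left ?_ (Real.rpow_nonneg (by positivity) _)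
  calc E ≤ (1 + E) ^ (1:ℝ) := by rw [Real.rpow_one]; linarith
    _ ≤ _ := Real.rpow_le_rpow_of_exponent_le (by linarith) hr.le
end ft

section mix
variable {ι : Type} [Fintype ι] {Y : Type} [MeasurableSpace Y]

lemma FT_mix {ν : Measure Y} [SigmaFinite ν] {w : Y → ℂ} (hw : Integrable w ν) {r : Y → ι → ℝ} (hr : Measurable r)
    {φ : (ι → ℝ) → ℂ} (hφ : Integrable φ) (x : ι → ℝ) :
    ∫ y, w y * FT φ (x - r y) ∂ν = FT (fun t => φ t * ∫ y, ec t (r y) * w y ∂ν) x := by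
  unfold FT
  have e : ∀ t y, ec t (-(x - r y)) = ec t (-x) * ec t (r y) := fun t y => by
    rw [← ec_add_right]; congr 1; abel
  simp only [← integral_const_mul]
  rw [integral_integral_swap]
  · refine integral_congr_ae (ae_of_all _ fun t => ?_)
    refine integral_congr_ae (ae_of_all _ fun y => ?_)
    simp only [e]; ring
  · have h1 : Integrable (fun z : Y × (ι → ℝ) => w z.1 * φ z.2) (ν.prod volume) := hw.mul_prod hφ
    have hm : Measurable fun z : Y × (ι → ℝ) => ec z.2 (-(x - r z.1)) := by
      refine continuous_ec.measurable.comp (measurable_snd.prodMk ?_)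
      exact ((measurable_const.sub (hr.comp measurable_fst))).neg
    have := h1.bdd_mul (c := 1) hm.aestronglyMeasurable (ae_of_all _ fun z => (norm_ec _ _).le)
    refine this.congr (ae_of_all _ fun z => ?_)
    simp only [Function.uncurry]; ring
end mix

section law
variable {d : ℕ}

abbrev Ix (d : ℕ) : Type := ↥(univ : Finset (Fin d))

def rr (y : Fin d → ℝ) : Ix d → ℝ := fun j => y ↑j

def ri (x : Ix d → ℝ) : Fin d → ℝ := fun i => x ⟨i, Finset.mem_univ i⟩

lemma rr_ri (x : Ix d → ℝ) : rr (ri x) = x := rfl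
lemma ri_rr (y : Fin d → ℝ) : ri (rr y) = y := rfl

def eix (d : ℕ) : Fin d ≃ Ix d := ⟨fun i => ⟨i, Finset.mem_univ i⟩, fun j => ↑j, fun _ => rfl, fun _ => rfl⟩

lemma rr_meas : Measurable (rr (d := d)) := measurable_pi_lambda _ fun j => measurable_pi_apply _
lemma ri_meas : Measurable (ri (d := d)) := measurable_pi_lambda _ fun j => measurable_pi_apply _

lemma rr_mp : MeasurePreserving (rr (d := d)) volume volume := by
  have := volume_measurePreserving_piCongrLeft (fun _ : Ix d => ℝ) (eix d)
  convert this using 1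
  ext y j
  rw [MeasurableEquiv.coe_piCongrLeft, Equiv.piCongrLeft_apply]; rfl

def rre (d : ℕ) : (Fin d → ℝ) ≃ᵐ (Ix d → ℝ) := ⟨⟨rr, ri, ri_rr, rr_ri⟩, rr_meas, ri_meas⟩

lemma ri_mp : MeasurePreserving (ri (d := d)) volume volume := (MeasurePreserving.symm (rre d) rr_mp)

lemma int_rr {E : Type*} [NormedAddCommGroup E] [NormedSpace ℝ E] (F : (Ix d → ℝ) → E) : ∫ y, F (rr y) = ∫ x, F x :=
  rr_mp.integral_comp (rre d).measurableEmbedding F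

lemma rr_add (a b : Fin d → ℝ) : rr (a + b) = rr a + rr b := rfl

lemma marg (q : (Fin d → ℝ) → ℝ) (x : Ix d → ℝ) : marginal univ q x = q (ri x) := by
  unfold marginal
  have : ∀ y, glue univ x y = ri x := fun y => by ext i; simp [glue, ri]
  simp only [this]
  rw [integral_const]
  have : IsEmpty (↥((univ : Finset (Fin d))ᶜ))  := ⟨fun z => by simpa using z.2⟩
  have h1 : (volume : Measure (↥((univ : Finset (Fin d))ᶜ) → ℝ)) Set.univ = 1 := by
    rw [volume_pi, Measure.pi_univ]; simp
  simp [Measure.real, h1]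

lemma dens_int {ι : Type} [Fintype ι] {q : (ι → ℝ) → ℝ} (hq : IsDensity q) : Integrable q := by
  by_contra h
  have := hq.2
  rw [integral_undef h] at this; norm_num at this

def om (f q : (Fin d → ℝ) → ℝ) : Measure (Fin d → ℝ) := volume.withDensity fun x => oR (conv f q x)

lemma conv_eq (f q : (Fin d → ℝ) → ℝ) : conv f q = MeasureTheory.convolution q f (ContinuousLinearMap.mul ℝ ℝ) volume := by
  ext x; simp only [conv, MeasureTheory.convolution, ContinuousLinearMap.mul_apply', mul_comm]

lemma conv_int {f q : (Fin d → ℝ) → ℝ} (hf : IsDensity f) (hq : IsDensity q) : Integrable (conv f q) := by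
  rw [conv_eq]; exact (dens_int hq).integrable_convolution _ (dens_int hf)

lemma conv_nonneg {f q : (Fin d → ℝ) → ℝ} (hf : IsDensity f) (hq : IsDensity q) (x : Fin d → ℝ) : 0 ≤ conv f q x :=
  integral_nonneg fun y => mul_nonneg (hf.1 _) (hq.1 _)

lemma om_prob {f q : (Fin d → ℝ) → ℝ} (hf : IsDensity f) (hq : IsDensity q) : IsProbabilityMeasure (om f q) := by
  refine ⟨?_⟩
  rw [om, withDensity_apply _ MeasurableSet.univ, Measure.restrict_univ,
    ← ofReal_integral_eq_lintegral_ofReal (conv_int hf hq) (ae_of_all _ (conv_nonneg hf hq)), conv_eq, integral_convolution _ (dens_int hq) (dens_int hf)]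
  simp [hf.2, hq.2]

lemma om_chf {f q : (Fin d → ℝ) → ℝ} (hf : IsDensity f) (hq : IsDensity q) (t : Ix d → ℝ) :
    ∫ y, ec t (rr y) ∂(om f q) = ftI (marginal univ f) t * ftI (marginal univ q) t := by
  rw [om, integral_withDensity_eq_integral_toReal_smul₀ (conv_int hf hq).1.aemeasurable.ennreal_ofReal (ae_of_all _ fun _ => ENNReal.ofReal_lt_top)]
  have hec : ∀ {g : (Fin d → ℝ) → ℝ}, Integrable g → Integrable fun y => ec t (rr y) * (g y : ℂ) := fun {g} hg => by
    have hm : Measurable fun y : Fin d → ℝ => ec t (rr y) := continuous_ec.measurable.comp (measurable_const.prodMk rr_meas)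
    exact hg.ofReal.bdd_mul (c := 1) hm.aestronglyMeasurable (ae_of_all _ fun z => (norm_ec _ _).le)
  have e1 : ∀ y, (oR (conv f q y)).toReal • ec t (rr y) =
      MeasureTheory.convolution (fun y => ec t (rr y) * (q y : ℂ)) (fun y => ec t (rr y) * (f y : ℂ)) (ContinuousLinearMap.mul ℝ ℂ) volume y := fun y => by
    rw [ENNReal.toReal_ofReal (conv_nonneg hf hq y), Complex.real_smul, conv, ← integral_complex_ofReal, ← integral_mul_const, MeasureTheory.convolution]
    refine integral_congr_ae (ae_of_all _ fun z => ?_)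
    simp only [ContinuousLinearMap.mul_apply']
    have : ec t (rr y) = ec t (rr (y - z)) * ec t (rr z) := by
      rw [← ec_add_right, ← rr_add, sub_add_cancel]
    rw [this]; push_cast; ring
  simp only [e1]
  rw [integral_convolution _ (hec (dens_int hq)) (hec (dens_int hf)), ContinuousLinearMap.mul_apply', mul_comm]
  have e2 : ∀ g : (Fin d → ℝ) → ℝ, ∫ y, ec t (rr y) * (g y : ℂ) = ftI (marginal univ g) t := fun g => by
    have := int_rr (d := d) fun x => ec t x * ((marginal univ g x : ℝ) : ℂ)
    simp only [marg, ri_rr] at this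
    rw [this]; simp only [ftI, marg]; rfl
  rw [e2, e2]

lemma ftI_norm_le {f : (Fin d → ℝ) → ℝ} (hf : IsDensity f) (t : Ix d → ℝ) : ‖ftI (marginal univ f) t‖ ≤ 1 := by
  unfold ftI
  refine (norm_integral_le_integral_norm _).trans (le_of_eq ?_)
  have : ∀ x : Ix d → ℝ, ‖Complex.exp (Complex.I * (dotp t x : ℝ)) * ((marginal univ f x : ℝ) : ℂ)‖ = f (ri x) := fun x => by
    have h1 := norm_ec t x
    unfold ec at h1
    rw [norm_mul, h1, one_mul, marg, Complex.norm_real, Real.norm_of_nonneg (hf.1 _)]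
  simp only [this]
  rw [← hf.2, ← int_rr (d := d) fun x => f (ri x)]; rfl

lemma om_le {f q : (Fin d → ℝ) → ℝ} (hf : IsDensity f) (hq : IsDensity q) {B : ℝ} (hB : 0 ≤ B)
    (hqB : ∀ᵐ x : Ix d → ℝ, marginal univ q x ≤ B) {F : (Ix d → ℝ) → ℝ≥0∞} (hF : Measurable F) (x : Ix d → ℝ) :
    ∫⁻ y, F (x - rr y) ∂(om f q) ≤ oR B * ∫⁻ x, F x := by
  have hqB' : ∀ᵐ y : Fin d → ℝ, q y ≤ B := by
    have := rr_mp.quasiMeasurePreserving.ae hqB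
    simpa only [marg, ri_rr] using this
  have h1 : ∀ y, conv f q y ≤ B := fun y => by
    have hi : Integrable fun z => f (y - z) := (dens_int hf).comp_sub_left y
    calc conv f q y ≤ ∫ z, f (y - z) * B := by
          refine integral_mono_of_nonneg (ae_of_all _ fun z => mul_nonneg (hf.1 _) (hq.1 _)) (hi.mul_const B) ?_
          filter_upwards [hqB'] with z hz
          exact mul_le_mul_of_nonneg_left hz (hf.1 _)
      _ = B := by rw [integral_mul_const, integral_sub_left_eq_self, hf.2, one_mul]
  have hFm : Measurable fun y : Fin d → ℝ => F (x - rr y) := hF.comp (measurable_const.sub rr_meas)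
  rw [om, lintegral_withDensity_eq_lintegral_mul₀ (conv_int hf hq).1.aemeasurable.ennreal_ofReal hFm.aemeasurable]
  calc _ ≤ ∫⁻ y, oR B * F (x - rr y) := lintegral_mono fun y => by
        simp only [Pi.mul_apply]
        gcongr
        exact h1 y
    _ = oR B * ∫⁻ y, F (x - rr y) := lintegral_const_mul _ hFm
    _ = _ := by
        congr 1
        rw [rr_mp.lintegral_comp (f := fun z => F (x - z)) (hF.comp (measurable_const.sub measurable_id))]
        exact lintegral_sub_left_eq_self F x

def hx (h : Fin d → ℝ) : Ix d → ℝ := fun j => h ↑j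

def Qf (q : (Fin d → ℝ) → ℝ) : (Ix d → ℝ) → ℂ := ftI (marginal univ q)

def c2 (d : ℕ) : ℝ := ((2 * Real.pi) ^ d)⁻¹

lemma prod_ix (f : Fin d → ℝ) : ∏ j ∈ (univ : Finset (Fin d)), f j = ∏ j : Ix d, f ↑j := (Finset.prod_coe_sort univ f).symm

lemma Kh_eq (K : ℝ → ℝ) (h : Fin d → ℝ) : Kh univ K h = kprod K (hx h) := by
  ext x
  unfold Kh kprod
  rw [prod_ix, Finset.prod_mul_distrib, Finset.prod_inv_distrib]; rfl

lemma ftI_ec {ι : Type} [Fintype ι] (g : (ι → ℝ) → ℝ) (t : ι → ℝ) : ftI g t = ∫ x, ec t x * (g x : ℂ) := rfl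

lemma Lh_eq {K : ℝ → ℝ} (q : (Fin d → ℝ) → ℝ) {h : Fin d → ℝ} (h0 : ∀ j, 0 < hx h j) (x : Ix d → ℝ) :
    Lh univ K q h x = (c2 d : ℂ) * FT (gh K (Qf q) (hx h)) x := by
  unfold Lh FT
  congr 1
  · congr 1
    rw [c2, Finset.card_univ, Fintype.card_fin, Real.rpow_neg (by positivity), Real.rpow_natCast]
  · refine integral_congr_ae (ae_of_all _ fun t => ?_)
    simp only []
    rw [ec_neg_right, Kh_eq, ftI_ec, ft_kprod h0, gh, Qf, div_eq_mul_inv]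

lemma card_ix : Fintype.card (Ix d) = d := by simp

lemma c2_pos : 0 < c2 d := by unfold c2; positivity

lemma gh_mul_Q {K : ℝ → ℝ} {q : (Fin d → ℝ) → ℝ} (hQ : ∀ t, Qf q t ≠ 0) (h t : Ix d → ℝ) : gh K (Qf q) h t * Qf q t = kapp K h t := by
  rw [gh, mul_assoc, inv_mul_cancel₀ (hQ t), mul_one]

lemma ri_dens_int {f : (Fin d → ℝ) → ℝ} (hf : IsDensity f) : Integrable fun x : Ix d → ℝ => f (ri x) :=
  (ri_mp.integrable_comp_emb (MeasurableEquiv.measurableEmbedding (rre d).symm)).2 (dens_int hf)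

lemma mean_eq {K : ℝ → ℝ} (hK : IsKernel K) {f q : (Fin d → ℝ) → ℝ} (hf : IsDensity f) (hq : IsDensity q) {h : Fin d → ℝ} (h0 : ∀ j, 0 < hx h j)
    (hQ : ∀ t, Qf q t ≠ 0) (hg : Integrable (gh K (Qf q) (hx h))) (hk : Integrable (kapp K (hx h))) (x : Ix d → ℝ) :
    ∫ y, Lh univ K q h (x - rr y) ∂(om f q) = ∫ u, ((f (ri u) : ℝ) : ℂ) * ((kprod K (hx h) (x - u) : ℝ) : ℂ) := by
  haveI := om_prob hf hq
  simp only [Lh_eq q h0]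
  rw [integral_const_mul]
  have h1 := FT_mix (ν := om f q) (w := fun _ => 1) (integrable_const _) rr_meas hg x
  simp only [one_mul, mul_one, om_chf hf hq] at h1
  have h2 := FT_mix (ν := (volume : Measure (Ix d → ℝ))) (w := fun u => ((f (ri u) : ℝ) : ℂ)) (ri_dens_int hf).ofReal (r := fun u => u) measurable_id hk x
  rw [h1]
  have e : (fun t => gh K (Qf q) (hx h) t * (ftI (marginal univ f) t * ftI (marginal univ q) t)) =
      fun t => kapp K (hx h) t * ∫ y, ec t y * ((f (ri y) : ℝ) : ℂ) := by
    ext t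
    rw [← gh_mul_Q hQ]
    simp only [ftI_ec (marginal univ f), marg, Qf]; ring
  rw [e, ← h2, ← integral_const_mul]
  refine integral_congr_ae (ae_of_all _ fun u => ?_)
  simp only [inv_kprod hK h0, card_ix, c2]
  have : ((2 * Real.pi : ℂ)) ^ d ≠ 0 := pow_ne_zero _ (by simp [Real.pi_ne_zero])
  push_cast
  field_simp

lemma smooth_eq {K : ℝ → ℝ} (hK : IsKernel K) {q : (Fin d → ℝ) → ℝ} {h η : Fin d → ℝ} (h0 : ∀ j, 0 < hx h j) (e0 : ∀ j, 0 < hx η j)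
    (hg : Integrable (gh K (Qf q) (hx h))) (x : Ix d → ℝ) :
    ∫ u, ((Kh univ K η u : ℝ) : ℂ) * Lh univ K q h (x - u) = (c2 d : ℂ) * FT (fun t => kapp K (hx h) t * kapp K (hx η) t * (Qf q t)⁻¹) x := by
  have h1 := FT_mix (ν := (volume : Measure (Ix d → ℝ))) (w := fun u => ((kprod K (hx η) u : ℝ) : ℂ)) (kprod_integrable hK e0).ofReal (r := fun u => u) measurable_id hg x
  simp only [Lh_eq q h0, Kh_eq]
  simp only [ft_kprod e0] at h1
  have e : (fun t => kapp K (hx h) t * kapp K (hx η) t * (Qf q t)⁻¹) = fun t => gh K (Qf q) (hx h) t * kapp K (hx η) t := by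
    ext t; rw [gh]; ring
  rw [e, ← h1, ← integral_const_mul]
  refine integral_congr_ae (ae_of_all _ fun u => ?_)
  simp only []; ring
end law

section cv
variable {ι : Type} [Fintype ι]

lemma conv_Lp {k : (ι → ℝ) → ℝ} (hk : Integrable k) (hkm : Measurable k) {F : (ι → ℝ) → ℂ} (hF : AEStronglyMeasurable F)
    {p : ℝ≥0∞} (hp : 1 < p) :
    eLpNorm (fun x => ∫ u, (k u : ℂ) * F (x - u)) p volume ≤ oR (∫ u, |k u|) * eLpNorm F p volume := by
  have hkn : ∫⁻ u, ‖k u‖ₑ = oR (∫ u, |k u|) := by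
    rw [← ofReal_integral_norm_eq_lintegral_enorm hk]; rfl
  wlog hFm : Measurable F generalizing F
  · have e1 : ∀ x, ∫ u, (k u : ℂ) * F (x - u) = ∫ u, (k u : ℂ) * hF.mk F (x - u) := fun x => by
      have : ∀ᵐ u : ι → ℝ, F (x - u) = hF.mk F (x - u) :=
        (quasiMeasurePreserving_sub_left_of_right_invariant volume x).ae hF.ae_eq_mk
      refine integral_congr_ae ?_
      filter_upwards [this] with u hu
      rw [hu]
    simp only [e1]
    rw [eLpNorm_congr_ae hF.ae_eq_mk]
    exact this hF.stronglyMeasurable_mk.aestronglyMeasurable hF.stronglyMeasurable_mk.measurable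
  have hpt : ∀ x, ‖∫ u, (k u : ℂ) * F (x - u)‖ₑ ≤ ∫⁻ u, ‖k u‖ₑ * ‖F (x - u)‖ₑ := fun x => by
    refine (enorm_integral_le_lintegral_enorm _).trans (le_of_eq ?_)
    refine lintegral_congr fun u => ?_
    rw [enorm_mul]; congr 1
    rw [← ofReal_norm_eq_enorm, Complex.norm_real, ofReal_norm_eq_enorm]
  rw [← hkn]
  by_cases hpt' : p = ⊤
  · subst hpt'
    rw [eLpNorm_exponent_top, eLpNorm_exponent_top]
    refine eLpNormEssSup_le_of_ae_enorm_bound (ae_of_all _ fun x => (hpt x).trans ?_)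
    have : ∀ᵐ u : ι → ℝ, ‖F (x - u)‖ₑ ≤ eLpNormEssSup F volume :=
      (quasiMeasurePreserving_sub_left_of_right_invariant volume x).ae (enorm_ae_le_eLpNormEssSup F volume)
    rw [← lintegral_mul_const _ hkm.enorm]
    refine lintegral_mono_ae ?_
    filter_upwards [this] with u hu
    gcongr
  have hp0 : p ≠ 0 := (zero_lt_one.trans hp).ne'
  set P := p.toReal with hP
  have hP1 : 1 < P := by
    rw [hP, ← ENNReal.toReal_one]; exact (ENNReal.toReal_lt_toReal one_ne_top hpt').2 hp
  have hP0 : 0 < P := by linarith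
  rw [eLpNorm_eq_lintegral_rpow_enorm_toReal hp0 hpt', eLpNorm_eq_lintegral_rpow_enorm_toReal hp0 hpt', ← hP]
  set N := ∫⁻ u, ‖k u‖ₑ with hN
  have hN0 : N ≠ ⊤ := by rw [hkn]; exact ENNReal.ofReal_ne_top
  have hh : ∀ x, (∫⁻ u, ‖k u‖ₑ * ‖F (x - u)‖ₑ) ^ P ≤ N ^ (P - 1) * ∫⁻ u, ‖k u‖ₑ * ‖F (x - u)‖ₑ ^ P := fun x => by
    have hc : P.HolderConjugate (P / (P - 1)) := Real.HolderConjugate.conjExponent hP1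
    set P' := P / (P - 1) with hP'
    have hP'0 : 0 < P' := hc.symm.pos
    have hs : P⁻¹ + P'⁻¹ = 1 := hc.inv_add_inv_eq_one
    have hFx : Measurable fun u => ‖F (x - u)‖ₑ := (hFm.comp (measurable_const.sub measurable_id)).enorm
    have := ENNReal.lintegral_mul_le_Lp_mul_Lq (volume : Measure (ι → ℝ)) hc (f := fun u => ‖k u‖ₑ ^ P⁻¹ * ‖F (x - u)‖ₑ) (g := fun u => ‖k u‖ₑ ^ P'⁻¹)
      ((hkm.enorm.pow_const _).mul hFx).aemeasurable (hkm.enorm.pow_const _).aemeasurable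
    have e1 : ∀ u, ((fun u => ‖k u‖ₑ ^ P⁻¹ * ‖F (x - u)‖ₑ) * fun u => ‖k u‖ₑ ^ P'⁻¹) u = ‖k u‖ₑ * ‖F (x - u)‖ₑ := fun u => by
      simp only [Pi.mul_apply]
      rw [mul_right_comm, ← ENNReal.rpow_add_of_nonneg _ _ (by positivity) (by positivity), hs, ENNReal.rpow_one]
    have e2 : ∀ u, (‖k u‖ₑ ^ P⁻¹ * ‖F (x - u)‖ₑ) ^ P = ‖k u‖ₑ * ‖F (x - u)‖ₑ ^ P := fun u => by
      rw [ENNReal.mul_rpow_of_nonneg _ _ hP0.le, ← ENNReal.rpow_mul, inv_mul_cancel₀ hP0.ne', ENNReal.rpow_one]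
    have e3 : ∀ u, (‖k u‖ₑ ^ P'⁻¹) ^ P' = ‖k u‖ₑ := fun u => by
      rw [← ENNReal.rpow_mul, inv_mul_cancel₀ hP'0.ne', ENNReal.rpow_one]
    rw [lintegral_congr e1, lintegral_congr e2, lintegral_congr e3, ← hN] at this
    calc _ ≤ ((∫⁻ u, ‖k u‖ₑ * ‖F (x - u)‖ₑ ^ P) ^ (1 / P) * N ^ (1 / P')) ^ P := ENNReal.rpow_le_rpow this hP0.le
      _ = _ := by
        rw [ENNReal.mul_rpow_of_nonneg _ _ hP0.le, ← ENNReal.rpow_mul, ← ENNReal.rpow_mul, one_div_mul_cancel hP0.ne', ENNReal.rpow_one, mul_comm]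
        congr 2
        rw [hP']; field_simp
  have hmm : Measurable fun z : (ι → ℝ) × (ι → ℝ) => ‖k z.2‖ₑ * ‖F (z.1 - z.2)‖ₑ ^ P :=
    (hkm.comp measurable_snd).enorm.mul ((hFm.comp (measurable_fst.sub measurable_snd)).enorm.pow_const _)
  have hfin : ∫⁻ x, ‖∫ u, (k u : ℂ) * F (x - u)‖ₑ ^ P ≤ N ^ P * ∫⁻ x, ‖F x‖ₑ ^ P := by
    calc _ ≤ ∫⁻ x, N ^ (P - 1) * ∫⁻ u, ‖k u‖ₑ * ‖F (x - u)‖ₑ ^ P :=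
          lintegral_mono fun x => (ENNReal.rpow_le_rpow (hpt x) hP0.le).trans (hh x)
      _ = N ^ (P - 1) * ∫⁻ x, ∫⁻ u, ‖k u‖ₑ * ‖F (x - u)‖ₑ ^ P := lintegral_const_mul _ hmm.lintegral_prod_right'
      _ = N ^ (P - 1) * ∫⁻ u, ∫⁻ x, ‖k u‖ₑ * ‖F (x - u)‖ₑ ^ P := by rw [lintegral_lintegral_swap hmm.aemeasurable]
      _ = N ^ (P - 1) * ∫⁻ u, ‖k u‖ₑ * ∫⁻ x, ‖F x‖ₑ ^ P := by
          congr 1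
          refine lintegral_congr fun u => ?_
          rw [lintegral_const_mul (f := fun x => ‖F (x - u)‖ₑ ^ P) _ (((hFm.comp (measurable_id.sub_const u)).enorm.pow_const _) : Measurable fun x => ‖F (x - u)‖ₑ ^ P)]
          congr 1
          exact lintegral_sub_right_eq_self (fun x => ‖F x‖ₑ ^ P) u
      _ = N ^ (P - 1) * (N * ∫⁻ x, ‖F x‖ₑ ^ P) := by rw [lintegral_mul_const _ hkm.enorm]
      _ = _ := by
          rw [← mul_assoc]; congr 1
          have : N ^ (P - 1) * N = N ^ (P - 1) * N ^ (1:ℝ) := by rw [ENNReal.rpow_one]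
          rw [this, ← ENNReal.rpow_add_of_nonneg _ _ (by linarith) (by norm_num), sub_add_cancel]
  calc _ ≤ (N ^ P * ∫⁻ x, ‖F x‖ₑ ^ P) ^ (1 / P) := ENNReal.rpow_le_rpow hfin (by positivity)
    _ = _ := by
      rw [ENNReal.mul_rpow_of_nonneg _ _ (by positivity), ← ENNReal.rpow_mul, mul_one_div_cancel hP0.ne', ENNReal.rpow_one]
end cv

section reg
variable {d : ℕ}

lemma dotp_sym {ι : Type} [Fintype ι] (a b : ι → ℝ) : dotp a b = dotp b a := by
  unfold dotp; exact Finset.sum_congr rfl fun j _ => mul_comm _ _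

lemma Qf_cont {q : (Fin d → ℝ) → ℝ} (hq : IsDensity q) : Continuous (Qf q) := by
  have : Qf q = fun t => FT (fun x => ((q (ri x) : ℝ) : ℂ)) (-t) := by
    ext t
    simp only [Qf, ftI_ec, FT, marg, neg_neg]
    refine integral_congr_ae (ae_of_all _ fun x => ?_)
    simp only [ec, dotp_sym t x]
  rw [this]
  exact (continuous_FT (ri_dens_int hq).ofReal).comp continuous_neg

lemma kapp_cont {K : ℝ → ℝ} (hK : IsKernel K) (h : Ix d → ℝ) : Continuous (kapp K h) := by
  unfold kapp
  have := (kap_diff hK).continuous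
  fun_prop

structure Reg (K : ℝ → ℝ) (q : (Fin d → ℝ) → ℝ) (lam : Fin d → ℝ) (C : ℝ) : Prop where
  hK : IsKernel K
  hq : IsDensity q
  hC : 1 ≤ C
  hl : ∀ j, 0 < lam j
  hQ : ∀ t, Qf q t ≠ 0
  gb : ∀ h : Ix d → ℝ, (∀ j, 0 < h j) → (∀ j, h j ≤ 1) → GB (gh K (Qf q) h) h (fun j => lam ↑j) C

lemma reg_of {K : ℝ → ℝ} (hK : IsKernel K) {q : (Fin d → ℝ) → ℝ} (hq : IsDensity q) {A : ℝ} {lam : Fin d → ℝ} {p : ℝ≥0∞}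
    (hN : N1N2 p (univ : Finset (Fin d)) q A lam) (hd : 0 < d) : ∃ C, Reg K q lam C := by
  obtain ⟨hA, hl, h2, -, hm, hi⟩ := hN
  have key : (∀ t, Qf q t ≠ 0) ∧ ∀ t, ‖(Qf q t)⁻¹‖ ≤ A * ∏ j : Ix d, (1 + t j ^ 2) ^ (lam ↑j / 2) := by
    by_cases p2 : p = 2
    · have h := (h2 p2).2
      have hpos : ∀ t : Ix d → ℝ, 0 < A⁻¹ * ∏ j : Ix d, (1 + t j ^ 2) ^ (-lam ↑j / 2) := fun t =>
        mul_pos (inv_pos.2 hA) (Finset.prod_pos fun j _ => Real.rpow_pos_of_pos (by positivity) _)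
      refine ⟨fun t ht => ?_, fun t => ?_⟩
      · have := (hpos t).trans_le (h t)
        have e : ‖ftI (marginal univ q) t‖ = 0 := by rw [norm_eq_zero]; exact ht
        linarith
      · rw [norm_inv]
        refine (inv_anti₀ (hpos t) (h t)).trans (le_of_eq ?_)
        rw [mul_inv, inv_inv, ← Finset.prod_inv_distrib]
        congr 1
        refine Finset.prod_congr rfl fun j _ => ?_
        rw [← Real.rpow_neg (by positivity)]; congr 1; ring
    · by_cases pt : p = ⊤
      · obtain ⟨a, -, c⟩ := hi pt
        exact ⟨a, fun t => by simpa [Qf] using c ⟨⟨0, hd⟩, Finset.mem_univ _⟩ 0 zero_le_one t⟩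
      · obtain ⟨a, -, c⟩ := hm p2 pt
        refine ⟨a, fun t => ?_⟩
        have := c (fun _ => 0) (by simp) t
        have e : ∀ (l : List (Ix d)) (φ : (Ix d → ℝ) → ℂ), l.foldr (fun j ψ => (cpd j)^[(fun _ => 0 : Ix d → ℕ) j] ψ) φ = φ := by
          intro l φ; induction l with
          | nil => rfl
          | cons a l ih => simpa using ih
        unfold multiPD at this
        rw [e] at this
        simpa [Qf] using this
  obtain ⟨C, hC1, hC⟩ := gh_bound hK (Qf q) A (fun j : Ix d => lam ↑j) (fun j => hl _) key.2
  have hpi : 1 ≤ Real.pi ^ (Fintype.card (Ix d)) := one_le_pow₀ (by linarith [Real.pi_gt_three])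
  refine ⟨C ^ 2 * Real.pi ^ (Fintype.card (Ix d)), hK, hq, by nlinarith, hl, key.1, fun h h0 h1 => gb_of h0 hC1 ?_ (hC h h0 h1)⟩
  exact ((kapp_cont hK h).mul ((Qf_cont hq).inv₀ key.1)).measurable

lemma Reg.kint {K : ℝ → ℝ} {q : (Fin d → ℝ) → ℝ} {lam : Fin d → ℝ} {C : ℝ} (R : Reg K q lam C) {h : Ix d → ℝ}
    (h0 : ∀ j, 0 < h j) (h1 : ∀ j, h j ≤ 1) : Integrable (kapp K h) := by
  have := (R.gb h h0 h1).int
  have h2 := this.mul_bdd (c := 1) (Qf_cont R.hq).aestronglyMeasurable (ae_of_all _ fun t => ftI_norm_le R.hq t)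
  exact h2.congr (ae_of_all _ fun t => gh_mul_Q R.hQ h t)

structure GF (h : Fin d → ℝ) : Prop where
  h0 : ∀ j, 0 < hx h j
  h1 : ∀ j, hx h j ≤ 1

def Pp (p : ℝ≥0∞) : ℝ := if p = ⊤ then 1 else p.toReal

lemma Pp_ge {p : ℝ≥0∞} (hp : 1 < p) : 1 ≤ Pp p := by
  unfold Pp; split_ifs with h
  · exact le_rfl
  · rw [← ENNReal.toReal_one]; exact ENNReal.toReal_mono h hp.le

lemma grid_gf {lam : Fin d → ℝ} {p : ℝ≥0∞} {n : ℕ} {h : Fin d → ℝ} (hg : memGrid lam p n univ h) : GF h := by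
  obtain ⟨a, -, -⟩ := hg
  refine ⟨fun j => ?_, fun j => ?_⟩ <;> obtain ⟨k, hk, e⟩ := a j (Finset.mem_univ _) <;> simp only [hx, e]
  · positivity
  · exact Real.rpow_le_one_of_one_le_of_nonpos (by norm_num) (by simp)

lemma grid_low {lam : Fin d → ℝ} {p : ℝ≥0∞} {n : ℕ} {h : Fin d → ℝ} (hn : 3 ≤ n) (hp : 1 < p) (hg : memGrid lam p n univ h) (j : Fin d) :
    (n : ℝ) ^ (-Pp p) ≤ h j := by
  obtain ⟨-, b, -⟩ := hg
  refine le_trans ?_ (b j (Finset.mem_univ _)).1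
  have hn1 : (1 : ℝ) ≤ n := by exact_mod_cast (by omega : 1 ≤ n)
  have h1 := Pp_ge hp
  unfold hminG Pp at *
  split_ifs at * with hh
  · rw [Real.rpow_neg_one]
  · refine Real.rpow_le_rpow_of_exponent_le hn1 (neg_le_neg (max_le h1 ?_))
    have : 1 ≤ d := by have := j.2; omega
    simp only [Finset.card_univ, Fintype.card_fin]
    exact div_le_self (by linarith) (by exact_mod_cast this)

lemma grid_fin {lam : Fin d → ℝ} {p : ℝ≥0∞} {n : ℕ} (hn : 3 ≤ n) (hp : 1 < p) : ∃ S : Finset (Fin d → ℝ), (∀ h, h ∈ S ↔ memGrid lam p n univ h) ∧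
    (S.card : ℝ) ≤ 2 ^ d * (n : ℝ) ^ (Pp p * d) := by
  classical
  have hn1 : (1 : ℝ) ≤ n := by exact_mod_cast (by omega : 1 ≤ n)
  have hnP : 1 ≤ (n : ℝ) ^ Pp p := Real.one_le_rpow hn1 (by linarith [Pp_ge hp])
  set N := ⌊(n : ℝ) ^ Pp p⌋₊ with hN
  set S0 : Finset (Fin d → ℝ) := (Fintype.piFinset fun _ : Fin d => Finset.range (N + 1)).image fun (k : Fin d → ℕ) j => (2 : ℝ) ^ (-(k j : ℝ)) with hS0
  have hsub : ∀ h, memGrid lam p n univ h → h ∈ S0 := by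
    intro h hg
    choose k hk e using fun j => hg.1 j (Finset.mem_univ _)
    rw [hS0, Finset.mem_image]
    refine ⟨k, ?_, funext fun j => (e j).symm⟩
    rw [Fintype.mem_piFinset]; intro j
    rw [Finset.mem_range, Nat.lt_succ_iff]
    refine Nat.le_floor ?_
    have := grid_low hn hp hg j
    rw [e j, Real.rpow_neg (by linarith), Real.rpow_neg (by norm_num), inv_le_inv₀ (by linarith) (by positivity)] at this
    refine le_trans ?_ this
    rw [Real.rpow_natCast]
    exact_mod_cast (Nat.lt_two_pow_self (n := k j)).le
  refine ⟨S0.filter fun h => memGrid lam p n univ h, fun h => ?_, ?_⟩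
  · rw [Finset.mem_filter]; exact ⟨fun a => a.2, fun a => ⟨hsub h a, a⟩⟩
  · have h1 : (S0.filter fun h => memGrid lam p n univ h).card ≤ (N + 1) ^ d := by
      refine (Finset.card_filter_le _ _).trans (Finset.card_image_le.trans ?_)
      rw [Fintype.card_piFinset]; simp
    have h2 : (N : ℝ) ≤ (n : ℝ) ^ Pp p := Nat.floor_le (by linarith)
    calc _ ≤ (((N + 1) ^ d : ℕ) : ℝ) := by exact_mod_cast h1
      _ = ((N : ℝ) + 1) ^ d := by push_cast; rfl
      _ ≤ (2 * (n : ℝ) ^ Pp p) ^ d := by gcongr; linarith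
      _ = _ := by rw [mul_pow, Real.rpow_mul (by linarith), Real.rpow_natCast]
end reg

section det
variable {d : ℕ} {K : ℝ → ℝ} {q : (Fin d → ℝ) → ℝ} {lam : Fin d → ℝ} {C : ℝ}

lemma Lh_cont (R : Reg K q lam C) {h : Fin d → ℝ} (g : GF h) : Continuous (Lh univ K q h) := by
  rw [show Lh univ K q h = fun x => (c2 d : ℂ) * FT (gh K (Qf q) (hx h)) x from funext (Lh_eq q g.h0)]
  exact continuous_const.mul (continuous_FT (R.gb _ g.h0 g.h1).int)

lemma Lh_bd (R : Reg K q lam C) {h : Fin d → ℝ} (g : GF h) (x : Ix d → ℝ) : ‖Lh univ K q h x‖ ≤ c2 d * ∫ t, ‖gh K (Qf q) (hx h) t‖ := by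
  rw [Lh_eq q g.h0, norm_mul, Complex.norm_real, Real.norm_of_nonneg c2_pos.le]
  exact mul_le_mul_of_nonneg_left (norm_FT_le _ _) c2_pos.le

lemma fHat_eq (h : Fin d → ℝ) {n : ℕ} (y : Fin n → Fin d → ℝ) (x : Ix d → ℝ) :
    fHat univ K q h y x = (n : ℂ)⁻¹ * ∑ k, Lh univ K q h (x - rr (y k)) := rfl

lemma fHat_cont (R : Reg K q lam C) {h : Fin d → ℝ} (g : GF h) {n : ℕ} (y : Fin n → Fin d → ℝ) : Continuous (fHat univ K q h y) := by
  have := Lh_cont R g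
  rw [show fHat univ K q h y = fun x => (n : ℂ)⁻¹ * ∑ k, Lh univ K q h (x - rr (y k)) from rfl]
  fun_prop

lemma Kh_Lh_int (R : Reg K q lam C) {h η : Fin d → ℝ} (g : GF h) (e : GF η) (x : Ix d → ℝ) :
    Integrable fun u => ((Kh univ K η u : ℝ) : ℂ) * Lh univ K q h (x - u) := by
  rw [Kh_eq]
  exact (kprod_integrable R.hK e.h0).ofReal.mul_bdd (c := c2 d * ∫ t, ‖gh K (Qf q) (hx h) t‖)
    ((Lh_cont R g).comp (continuous_const.sub continuous_id)).aestronglyMeasurable (ae_of_all _ fun u => Lh_bd R g _)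

lemma fHatConv_eq (R : Reg K q lam C) {h η : Fin d → ℝ} (g : GF h) (e : GF η) {n : ℕ} (y : Fin n → Fin d → ℝ) (x : Ix d → ℝ) :
    fHatConv K q univ h η y x = (n : ℂ)⁻¹ * ∑ k, ∫ u, ((Kh univ K η u : ℝ) : ℂ) * Lh univ K q h ((x - rr (y k)) - u) := by
  rw [← integral_finset_sum _ fun k _ => Kh_Lh_int R g e _, ← integral_const_mul]
  refine integral_congr_ae (ae_of_all _ fun u => ?_)
  simp only [← Finset.mul_sum]
  have : (fun j : Ix d => x j - u j) = x - u := rfl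
  rw [this, fHat_eq]
  have : ∀ k, x - u - rr (y k) = x - rr (y k) - u := fun k => by abel
  simp only [this]
  ring

lemma fHatConv_comm (R : Reg K q lam C) {h η : Fin d → ℝ} (g : GF h) (e : GF η) {n : ℕ} (y : Fin n → Fin d → ℝ) :
    fHatConv K q univ h η y = fHatConv K q univ η h y := by
  ext x
  rw [fHatConv_eq R g e, fHatConv_eq R e g]
  congr 1
  refine Finset.sum_congr rfl fun k _ => ?_
  rw [smooth_eq R.hK g.h0 e.h0 (R.gb _ g.h0 g.h1).int, smooth_eq R.hK e.h0 g.h0 (R.gb _ e.h0 e.h1).int]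
  simp only [mul_comm (kapp K (hx h) _) (kapp K (hx η) _)]

lemma fHatMean_eq (R : Reg K q lam C) {f : (Fin d → ℝ) → ℝ} (hf : IsDensity f) {h : Fin d → ℝ} (g : GF h) (x : Ix d → ℝ) :
    fHatMean univ K f q h x = ∫ u, ((Kh univ K h u : ℝ) : ℂ) * ((f (ri (x - u)) : ℝ) : ℂ) := by
  have := mean_eq R.hK hf R.hq g.h0 R.hQ (R.gb _ g.h0 g.h1).int (R.kint g.h0 g.h1) x
  refine Eq.trans this ?_
  rw [← integral_sub_left_eq_self (μ := volume) (fun u => ((f (ri u) : ℝ) : ℂ) * ((kprod K (hx h) (x - u) : ℝ) : ℂ)) x, Kh_eq]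
  refine integral_congr_ae (ae_of_all _ fun u => ?_)
  simp only [sub_sub_cancel]; ring

lemma kprod_bd (R : Reg K q lam C) {h : Fin d → ℝ} (g : GF h) : ∃ B, ∀ u, ‖((kprod K (hx h) u : ℝ) : ℂ)‖ ≤ B := by
  refine ⟨c2 d * ∫ t, ‖kapp K (hx h) t‖, fun u => ?_⟩
  have := norm_FT_le (kapp K (hx h)) u
  rw [inv_kprod R.hK g.h0, card_ix] at this
  have e : ((kprod K (hx h) u : ℝ) : ℂ) = (c2 d : ℂ) * (((2 * Real.pi) ^ d * kprod K (hx h) u : ℝ) : ℂ) := by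
    rw [← Complex.ofReal_mul, c2, ← mul_assoc, inv_mul_cancel₀ (by positivity), one_mul]
  rw [e, norm_mul, Complex.norm_real (c2 d), Real.norm_of_nonneg c2_pos.le]
  exact mul_le_mul_of_nonneg_left this c2_pos.le

lemma Kh_f_int (R : Reg K q lam C) {f : (Fin d → ℝ) → ℝ} (hf : IsDensity f) {h : Fin d → ℝ} (g : GF h) (x : Ix d → ℝ) :
    Integrable fun u => ((Kh univ K h u : ℝ) : ℂ) * ((f (ri (x - u)) : ℝ) : ℂ) := by
  rw [Kh_eq]
  obtain ⟨B, hB⟩ := kprod_bd R g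
  refine Integrable.bdd_mul (c := B) (f := fun u => ((kprod K (hx h) u : ℝ) : ℂ)) (g := fun u => ((f (ri (x - u)) : ℝ) : ℂ)) ?_ ?_ (ae_of_all _ hB)
  · exact (((ri_dens_int hf).comp_sub_left x).ofReal)
  · exact (Complex.continuous_ofReal.comp (kprod_cont R.hK _)).aestronglyMeasurable

lemma fHatConv_sub (R : Reg K q lam C) {f : (Fin d → ℝ) → ℝ} (hf : IsDensity f) {h η : Fin d → ℝ} (g : GF h) (e : GF η) {n : ℕ} (y : Fin n → Fin d → ℝ) (x : Ix d → ℝ) :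
    fHatConv K q univ h η y x - fHat univ K q η y x =
      (∫ u, ((kprod K (hx η) u : ℝ) : ℂ) * (fun x => fHat univ K q h y x - ((f (ri x) : ℝ) : ℂ)) (x - u)) - xiProc univ K f q η y x := by
  have h1 : fHatMean univ K f q η x = _ := fHatMean_eq R hf e x
  have h2 : Integrable fun u => ((Kh univ K η u : ℝ) : ℂ) * fHat univ K q h y (x - u) := by
    have := (integrable_finset_sum univ fun k _ => Kh_Lh_int R g e (x - rr (y k))).const_mul ((n : ℂ)⁻¹)
    refine this.congr (ae_of_all _ fun u => ?_)
    simp only [← Finset.mul_sum, fHat_eq]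
    have : ∀ k, x - u - rr (y k) = x - rr (y k) - u := fun k => by abel
    simp only [this]
    ring
  have h3 : ∫ u, ((kprod K (hx η) u : ℝ) : ℂ) * (fun x => fHat univ K q h y x - ((f (ri x) : ℝ) : ℂ)) (x - u) =
      fHatConv K q univ h η y x - fHatMean univ K f q η x := by
    rw [h1, ← Kh_eq]
    unfold fHatConv
    rw [← integral_sub]
    · refine integral_congr_ae (ae_of_all _ fun u => ?_)
      simp only [mul_sub]; rfl
    · exact h2
    · exact Kh_f_int R hf e x
  rw [h3, xiProc]; ring

lemma fri_meas {f : (Fin d → ℝ) → ℝ} (hf : IsDensity f) : AEStronglyMeasurable (fun x : Ix d → ℝ => ((f (ri x) : ℝ) : ℂ)) :=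
  (ri_dens_int hf).ofReal.aestronglyMeasurable

lemma xi_meas (R : Reg K q lam C) {f : (Fin d → ℝ) → ℝ} (hf : IsDensity f) {h : Fin d → ℝ} (g : GF h) {n : ℕ} (y : Fin n → Fin d → ℝ) :
    Continuous (xiProc univ K f q h y) := by
  refine (fHat_cont R g y).sub ?_
  haveI := om_prob hf R.hq
  unfold fHatMean
  refine continuous_of_dominated (bound := fun _ => c2 d * ∫ t, ‖gh K (Qf q) (hx h) t‖) ?_ ?_ ?_ ?_
  · exact fun x => ((Lh_cont R g).measurable.comp (measurable_const.sub rr_meas)).aestronglyMeasurable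
  · exact fun x => ae_of_all _ fun y => Lh_bd R g _
  · exact integrable_const (μ := om f q) _
  · exact ae_of_all _ fun y => (Lh_cont R g).comp (continuous_id.sub continuous_const : Continuous fun x : Ix d → ℝ => x - rr y)

lemma fHatConv_cont (R : Reg K q lam C) {h η : Fin d → ℝ} (g : GF h) (e : GF η) {n : ℕ} (y : Fin n → Fin d → ℝ) :
    Continuous (fHatConv K q univ h η y) := by
  have h1 : Continuous fun x : Ix d → ℝ => ∫ u, ((Kh univ K η u : ℝ) : ℂ) * Lh univ K q h (x - u) := by
    refine continuous_of_dominated (bound := fun u => ‖((Kh univ K η u : ℝ) : ℂ)‖ * (c2 d * ∫ t, ‖gh K (Qf q) (hx h) t‖)) ?_ ?_ ?_ ?_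
    · exact fun x => (Kh_Lh_int R g e x).aestronglyMeasurable
    · intro x; refine ae_of_all _ fun u => ?_
      rw [norm_mul]; exact mul_le_mul_of_nonneg_left (Lh_bd R g _) (norm_nonneg _)
    · rw [Kh_eq]; exact (kprod_integrable R.hK e.h0).ofReal.norm.mul_const _
    · exact ae_of_all _ fun u => continuous_const.mul ((Lh_cont R g).comp (continuous_id.sub continuous_const))
  rw [show fHatConv K q univ h η y = _ from funext (fHatConv_eq R g e y)]
  exact continuous_const.mul (continuous_finset_sum _ fun k _ => h1.comp (continuous_id.sub continuous_const))

lemma term_le (R : Reg K q lam C) {p : ℝ≥0∞} (hp : 1 < p) {f : (Fin d → ℝ) → ℝ} (hf : IsDensity f) {h η : Fin d → ℝ} (g : GF h) (e : GF η) {n : ℕ} (y : Fin n → Fin d → ℝ) :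
    eLpNorm (fun x => fHatConv K q univ h η y x - fHat univ K q η y x) p volume ≤
      oR ((∫ z, |K z|) ^ d) * eLpNorm (fun x => fHat univ K q h y x - ((f (ri x) : ℝ) : ℂ)) p volume + eLpNorm (xiProc univ K f q η y) p volume := by
  have hF : AEStronglyMeasurable (fun x => fHat univ K q h y x - ((f (ri x) : ℝ) : ℂ)) := (fHat_cont R g y).aestronglyMeasurable.sub (fri_meas hf)
  have hc := conv_Lp (kprod_integrable R.hK e.h0) (kprod_cont R.hK (hx η)).measurable hF hp
  rw [kprod_l1 e.h0, card_ix] at hc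
  set G := fun x => ∫ u, ((kprod K (hx η) u : ℝ) : ℂ) * (fun x => fHat univ K q h y x - ((f (ri x) : ℝ) : ℂ)) (x - u) with hG
  have hs : (fun x => fHatConv K q univ h η y x - fHat univ K q η y x) = G - xiProc univ K f q η y :=
    funext fun x => fHatConv_sub R hf g e y x
  have hGm : Continuous G := by
    have : G = (fun x => fHatConv K q univ h η y x - fHat univ K q η y x) + xiProc univ K f q η y := by
      rw [hs, sub_add_cancel]
    rw [this]
    exact ((fHatConv_cont R g e y).sub (fHat_cont R e y)).add (xi_meas R hf e y)
  rw [hs]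
  exact (eLpNorm_sub_le hGm.aestronglyMeasurable (xi_meas R hf e y).aestronglyMeasurable hp.le).trans (add_le_add_left hc _)

lemma det_oracle (R : Reg K q lam C) {p : ℝ≥0∞} (hp : 1 < p) {f : (Fin d → ℝ) → ℝ} (hf : IsDensity f) {n : ℕ} {y : Fin n → Fin d → ℝ}
    {γ : ℝ≥0∞} {B : ℝ≥0∞} (hB : ∀ η, memGrid lam p n univ η → eLpNorm (xiProc univ K f q η y) p volume ≤ γ * Up K q lam p n univ η + B)
    {h s : Fin d → ℝ} (hh : memGrid lam p n univ h) (hs : memGrid lam p n univ s)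
    (hc : critU K q lam p γ n y s ≤ critU K q lam p γ n y h) :
    eLpNorm (fun x => fHat univ K q s y x - ((f (ri x) : ℝ) : ℂ)) p volume ≤
      oR (1 + 2 * (∫ z, |K z|) ^ d) * eLpNorm (fun x => fHat univ K q h y x - ((f (ri x) : ℝ) : ℂ)) p volume +
        2 * γ * Up K q lam p n univ h + 2 * B := by
  set U := Up K q lam p n univ with hU
  set D := fun h : Fin d → ℝ => (⨆ η ∈ {η : Fin d → ℝ | memGrid lam p n (univ : Finset (Fin d)) η},
    (eLpNorm (fun xI => fHatConv K q univ h η y xI - fHat univ K q η y xI) p volume - γ * U η)) with hD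
  have hcr : ∀ h, critU K q lam p γ n y h = D h + γ * U h := fun h => rfl
  have hDt : ∀ h η, memGrid lam p n univ η → eLpNorm (fun x => fHatConv K q univ h η y x - fHat univ K q η y x) p volume ≤ D h + γ * U η := by
    intro h η hη
    rw [← tsub_le_iff_right]
    exact le_iSup₂ (f := fun η (_ : η ∈ {η : Fin d → ℝ | memGrid lam p n (univ : Finset (Fin d)) η}) => (eLpNorm (fun xI => fHatConv K q univ h η y xI - fHat univ K q η y xI) p volume - γ * U η)) η hη
  set N := eLpNorm (fun x => fHat univ K q h y x - ((f (ri x) : ℝ) : ℂ)) p volume with hN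
  have hDle : D h ≤ oR ((∫ z, |K z|) ^ d) * N + B := by
    refine iSup₂_le fun η hη => ?_
    rw [tsub_le_iff_right]
    refine (term_le R hp hf (grid_gf hh) (grid_gf hη) y).trans ?_
    rw [add_assoc]
    refine add_le_add_right ?_ _
    rw [add_comm B]; exact hB η hη
  have gh := grid_gf hh
  have gs := grid_gf hs
  have m1 : AEStronglyMeasurable (fHat univ K q s y) volume := (fHat_cont R gs y).aestronglyMeasurable
  have m2 : AEStronglyMeasurable (fHatConv K q univ h s y) volume := (fHatConv_cont R gh gs y).aestronglyMeasurable
  have m3 : AEStronglyMeasurable (fHat univ K q h y) volume := (fHat_cont R gh y).aestronglyMeasurable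
  have t1 : eLpNorm (fun x => fHat univ K q s y x - ((f (ri x) : ℝ) : ℂ)) p volume ≤
      (eLpNorm (fun x => fHatConv K q univ s h y x - fHat univ K q h y x) p volume +
      eLpNorm (fun x => fHatConv K q univ h s y x - fHat univ K q s y x) p volume) + N := by
    have e : (fun x => fHat univ K q s y x - ((f (ri x) : ℝ) : ℂ)) =
      ((fHatConv K q univ s h y - fHat univ K q h y) - (fHatConv K q univ h s y - fHat univ K q s y)) +
        (fHat univ K q h y - fun x => ((f (ri x) : ℝ) : ℂ)) := by
      rw [fHatConv_comm R gs gh]; ext x; simp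
    rw [e]
    refine (eLpNorm_add_le ?_ ?_ hp.le).trans (add_le_add_left ((eLpNorm_sub_le ?_ ?_ hp.le)) _)
    · exact (((fHatConv_cont R gs gh y).aestronglyMeasurable.sub m3).sub (m2.sub m1))
    · exact m3.sub (fri_meas hf)
    · exact (fHatConv_cont R gs gh y).aestronglyMeasurable.sub m3
    · exact m2.sub m1
  rw [hcr, hcr] at hc
  have hk : 0 ≤ (∫ z, |K z|) ^ d := pow_nonneg (integral_nonneg fun _ => abs_nonneg _) _
  calc _ ≤ ((D s + γ * U h) + (D h + γ * U s)) + N := t1.trans (add_le_add_left (add_le_add (hDt s h hh) (hDt h s hs)) _)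
    _ = ((D s + γ * U s) + (D h + γ * U h)) + N := by ring
    _ ≤ ((D h + γ * U h) + (D h + γ * U h)) + N := by gcongr
    _ = (2 * D h + 2 * γ * U h) + N := by ring
    _ ≤ (2 * (oR ((∫ z, |K z|) ^ d) * N + B) + 2 * γ * U h) + N := by gcongr
    _ = _ := by
      rw [ENNReal.ofReal_add zero_le_one (by positivity), ENNReal.ofReal_mul (by norm_num)]
      simp only [ENNReal.ofReal_one, ENNReal.ofReal_ofNat]
      ring
end det

section asm
variable {d : ℕ} {K : ℝ → ℝ} {q : (Fin d → ℝ) → ℝ} {lam : Fin d → ℝ} {C : ℝ}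

lemma mink {Ω : Type} [MeasurableSpace Ω] {μ : Measure Ω} {P : ℝ} (hP : 1 ≤ P) (N : Ω → ℝ≥0∞) {B : Ω → ℝ≥0∞} (hB : Measurable B) :
    (∫⁻ y, (N y + B y) ^ P ∂μ) ^ (1 / P) ≤ (∫⁻ y, N y ^ P ∂μ) ^ (1 / P) + (∫⁻ y, B y ^ P ∂μ) ^ (1 / P) := by
  have hP0 : 0 < P := by linarith
  obtain ⟨g, hg, hle, he⟩ := exists_measurable_le_lintegral_eq μ fun y => (N y + B y) ^ P
  rw [he]
  have h1 : Measurable fun y => g y ^ (1 / P) - B y := (hg.pow_const _).sub hB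
  have h2 := ENNReal.lintegral_Lp_add_le (μ := μ) h1.aemeasurable hB.aemeasurable hP
  refine le_trans ?_ (h2.trans (add_le_add_left ?_ _))
  · refine ENNReal.rpow_le_rpow (lintegral_mono fun y => ?_) (by positivity)
    calc g y = (g y ^ (1 / P)) ^ P := by rw [← ENNReal.rpow_mul, one_div_mul_cancel hP0.ne', ENNReal.rpow_one]
      _ ≤ _ := ENNReal.rpow_le_rpow le_tsub_add hP0.le
  · refine ENNReal.rpow_le_rpow (lintegral_mono fun y => ENNReal.rpow_le_rpow ?_ hP0.le) (by positivity)
    rw [tsub_le_iff_right]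
    calc g y ^ (1 / P) ≤ ((N y + B y) ^ P) ^ (1 / P) := ENNReal.rpow_le_rpow (hle y) (by positivity)
      _ = _ := by rw [← ENNReal.rpow_mul, mul_one_div_cancel hP0.ne', ENNReal.rpow_one]

lemma riskH_eq (p : ℝ≥0∞) (n : ℕ) (h : Fin d → ℝ) (f : (Fin d → ℝ) → ℝ) :
    riskH K q p n h f = (∫⁻ y, eLpNorm (fun x => fHat univ K q h y x - ((f (ri x) : ℝ) : ℂ)) p volume ^ Pp p ∂obsMeasure d n f q) ^ (1 / Pp p) := by
  unfold riskH Pp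
  split_ifs with hp
  · subst hp; simp; rfl
  · rfl

lemma riskSelU_eq (p : ℝ≥0∞) (n : ℕ) (sel : (Fin n → Fin d → ℝ) → Fin d → ℝ) (f : (Fin d → ℝ) → ℝ) :
    riskSelU K q p n sel f = (∫⁻ y, eLpNorm (fun x => fHat univ K q (sel y) y x - ((f (ri x) : ℝ) : ℂ)) p volume ^ Pp p ∂obsMeasure d n f q) ^ (1 / Pp p) := by
  unfold riskSelU Pp
  split_ifs with hp
  · subst hp; simp; rfl
  · rfl

def Stoch (K : ℝ → ℝ) (q : (Fin d → ℝ) → ℝ) (lam : Fin d → ℝ) (p : ℝ≥0∞) : Prop := ∀ κ : ℝ, 0 < κ → ∃ γ C : ℝ, 0 < γ ∧ 0 < C ∧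
  ∀ n : ℕ, 3 ≤ n → ∀ f : (Fin d → ℝ) → ℝ, IsDensity f → ∀ h, memGrid lam p n univ h →
    ∃ B : (Fin n → Fin d → ℝ) → ℝ≥0∞, Measurable B ∧
      (∀ y, eLpNorm (xiProc univ K f q h y) p volume ≤ oR γ * Up K q lam p n univ h + B y) ∧
      ∫⁻ y, B y ^ Pp p ∂(Measure.pi fun _ => om f q) ≤ oR (C * (n : ℝ) ^ (-κ))

lemma assemble (R : Reg K q lam C) {p : ℝ≥0∞} (hp : 1 < p) (hS : Stoch K q lam p) :
    ∃ γp Cp : ℝ≥0∞, 0 < γp ∧ γp ≠ ⊤ ∧ 0 < Cp ∧ Cp ≠ ⊤ ∧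
      ∀ n : ℕ, 3 ≤ n → ∀ f : (Fin d → ℝ) → ℝ, IsDensity f →
        ∀ sel : (Fin n → Fin d → ℝ) → Fin d → ℝ,
          (∀ y, sel y ∈ {h : Fin d → ℝ | memGrid lam p n univ h} ∧
            critU K q lam p γp n y (sel y) =
              ⨅ h ∈ {h : Fin d → ℝ | memGrid lam p n univ h},
                critU K q lam p γp n y h) →
          riskSelU K q p n sel f ≤
            (⨅ h ∈ {h : Fin d → ℝ | memGrid lam p n univ h},
              (oR (1 + 2 * (∫ z, |K z|) ^ d) * riskH K q p n h f +
                2 * γp * Up K q lam p n univ h)) +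
            2 * Cp * oR ((n : ℝ) ^ (-(1 : ℝ) / 2)) := by
  have hP := Pp_ge hp
  set P := Pp p with hPd
  have hP0 : 0 < P := by linarith
  obtain ⟨γ, c, hγ, hc, hst⟩ := hS (P / 2 + P * d) (by positivity)
  refine ⟨oR γ, oR ((2 ^ d * c) ^ (1 / P)), by simpa, ENNReal.ofReal_ne_top, by simp; positivity, ENNReal.ofReal_ne_top, ?_⟩
  intro n hn f hf sel hsel
  have hn0 : (0 : ℝ) < n := by exact_mod_cast (by omega : 0 < n)
  obtain ⟨S, hSm, hSc⟩ := grid_fin (lam := lam) (d := d) hn hp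
  have hb : ∀ h : Fin d → ℝ, ∃ B : (Fin n → Fin d → ℝ) → ℝ≥0∞, Measurable B ∧ (h ∈ S →
      (∀ y, eLpNorm (xiProc univ K f q h y) p volume ≤ oR γ * Up K q lam p n univ h + B y) ∧
      ∫⁻ y, B y ^ P ∂(Measure.pi fun _ => om f q) ≤ oR (c * (n : ℝ) ^ (-(P / 2 + P * d)))) := by
    intro h
    by_cases hh : h ∈ S
    · obtain ⟨B, a, b⟩ := hst n hn f hf h ((hSm h).1 hh)
      exact ⟨B, a, fun _ => b⟩
    · exact ⟨0, measurable_const, fun x => absurd x hh⟩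
  choose B hBm hB using hb
  set T : (Fin n → Fin d → ℝ) → ℝ≥0∞ := fun y => (∑ η ∈ S, B η y ^ P) ^ (1 / P) with hT
  have hTm : Measurable T := (Finset.measurable_fun_sum _ fun η _ => (hBm η).pow_const _).pow_const _
  have hTB : ∀ η ∈ S, ∀ y, B η y ≤ T y := fun η hη y => by
    calc B η y = (B η y ^ P) ^ (1 / P) := by rw [← ENNReal.rpow_mul, mul_one_div_cancel hP0.ne', ENNReal.rpow_one]
      _ ≤ _ := ENNReal.rpow_le_rpow (Finset.single_le_sum (f := fun η => B η y ^ P) (fun _ _ => zero_le) hη) (by positivity)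
  have hTi : (∫⁻ y, T y ^ P ∂(Measure.pi fun _ => om f q)) ^ (1 / P) ≤ oR ((2 ^ d * c) ^ (1 / P)) * oR ((n : ℝ) ^ (-(1 : ℝ) / 2)) := by
    have e : ∀ y, T y ^ P = ∑ η ∈ S, B η y ^ P := fun y => by
      rw [hT]; simp only []; rw [← ENNReal.rpow_mul, one_div_mul_cancel hP0.ne', ENNReal.rpow_one]
    rw [lintegral_congr e, lintegral_finset_sum _ fun η _ => (hBm η).pow_const _]
    have h1 : ∑ η ∈ S, ∫⁻ y, B η y ^ P ∂(Measure.pi fun _ => om f q) ≤ oR (2 ^ d * c * (n : ℝ) ^ (-(P / 2))) := by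
      calc _ ≤ ∑ η ∈ S, oR (c * (n : ℝ) ^ (-(P / 2 + P * d))) := Finset.sum_le_sum fun η hη => (hB η hη).2
        _ = oR (S.card * (c * (n : ℝ) ^ (-(P / 2 + P * d)))) := by
          rw [Finset.sum_const, nsmul_eq_mul, ENNReal.ofReal_mul (p := (S.card : ℝ)) (by positivity), ENNReal.ofReal_natCast]
        _ ≤ _ := by
          refine ENNReal.ofReal_le_ofReal ?_
          calc _ ≤ 2 ^ d * (n : ℝ) ^ (P * d) * (c * (n : ℝ) ^ (-(P / 2 + P * d))) := by gcongr
            _ = 2 ^ d * c * ((n : ℝ) ^ (P * d) * (n : ℝ) ^ (-(P / 2 + P * d))) := by ring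
            _ = _ := by rw [← Real.rpow_add hn0]; congr 2; ring
    refine (ENNReal.rpow_le_rpow h1 (by positivity)).trans (le_of_eq ?_)
    rw [ENNReal.ofReal_rpow_of_nonneg (by positivity) (by positivity), Real.mul_rpow (by positivity) (by positivity), ← Real.rpow_mul hn0.le,
      ENNReal.ofReal_mul (by positivity)]
    congr 3; field_simp
  rw [← tsub_le_iff_right]
  refine le_iInf₂ fun h hh => ?_
  rw [tsub_le_iff_right, riskSelU_eq, riskH_eq]
  have hpt : ∀ y, eLpNorm (fun x => fHat univ K q (sel y) y x - ((f (ri x) : ℝ) : ℂ)) p volume ≤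
      oR (1 + 2 * (∫ z, |K z|) ^ d) * eLpNorm (fun x => fHat univ K q h y x - ((f (ri x) : ℝ) : ℂ)) p volume +
        2 * oR γ * Up K q lam p n univ h + 2 * T y := fun y =>
    det_oracle R hp hf (fun η hη => ((hB η ((hSm η).2 hη)).1 y).trans (add_le_add_right (hTB η ((hSm η).2 hη) y) _)) hh (hsel y).1
      ((hsel y).2.le.trans (iInf₂_le h hh))
  haveI := om_prob hf R.hq
  have hpm : IsProbabilityMeasure (obsMeasure d n f q) := inferInstanceAs (IsProbabilityMeasure (Measure.pi fun _ => om f q))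
  have hcm : ∀ (a : ℝ≥0∞) (ha : a ≠ ⊤) (N : (Fin n → Fin d → ℝ) → ℝ≥0∞), (∫⁻ y, (a * N y) ^ P ∂obsMeasure d n f q) ^ (1 / P) = a * (∫⁻ y, N y ^ P ∂obsMeasure d n f q) ^ (1 / P) := by
    intro a ha N
    simp only [ENNReal.mul_rpow_of_nonneg _ _ hP0.le]
    rw [lintegral_const_mul' _ _ (ENNReal.rpow_ne_top_of_nonneg hP0.le ha), ENNReal.mul_rpow_of_nonneg _ _ (by positivity), ← ENNReal.rpow_mul,
      mul_one_div_cancel hP0.ne', ENNReal.rpow_one]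
  refine (ENNReal.rpow_le_rpow (lintegral_mono fun y => ENNReal.rpow_le_rpow (hpt y) hP0.le) (by positivity)).trans ?_
  refine (mink hP _ (hTm.const_mul 2)).trans (add_le_add ((mink hP _ measurable_const).trans (add_le_add ?_ ?_)) ?_)
  · rw [hcm _ ENNReal.ofReal_ne_top]
  · rw [lintegral_const, measure_univ, mul_one, ← ENNReal.rpow_mul, mul_one_div_cancel hP0.ne', ENNReal.rpow_one]
  · rw [hcm _ (by norm_num), mul_assoc]
    exact mul_le_mul_right hTi _
end asm

section st
variable {d : ℕ} {K : ℝ → ℝ} {q : (Fin d → ℝ) → ℝ} {lam : Fin d → ℝ} {C : ℝ}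

lemma core_st {Ω : Type} [MeasurableSpace Ω] {μ : Measure Ω} {P c1 CH a c3 c0 κ H0 : ℝ} {n : ℕ} {Z : Ω → ℝ} {X : Ω → ℝ≥0∞} {U : ℝ≥0∞}
    (hP : 0 < P) (hc1 : 0 < c1) (hCH : 0 < CH) (ha : 0 ≤ a) (hc0 : 0 < c0) (hc3 : 0 < c3) (hκ : 0 < κ) (hn : 3 ≤ n) (hZ : Measurable Z) (hH : 0 < H0)
    (hHC : H0 ≤ CH * (n : ℝ) ^ a) (hX : ∀ y, X y ≤ oR (c1 * ((n : ℝ)⁻¹ * Z y))) (hU : oR ((n : ℝ)⁻¹ * H0) ≤ oR c3 * U)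
    (hT : ∀ T : ℝ, ∫⁻ y, oR ((max (Z y - T) 0) ^ P) ∂μ ≤ oR (P ^ P * H0 ^ P * Real.exp (c0 * Real.log n - Real.log n * T / H0))) :
    ∃ B : Ω → ℝ≥0∞, Measurable B ∧ (∀ y, X y ≤ oR (c1 * (c0 + P * a + κ) * c3) * U + B y) ∧
      ∫⁻ y, B y ^ P ∂μ ≤ oR ((c1 * P * CH) ^ P * (n : ℝ) ^ (-κ)) := by
  set g := c0 + P * a + κ with hg
  have hg0 : 0 < g := by positivity
  have hn1 : (1 : ℝ) ≤ n := by exact_mod_cast (by omega : 1 ≤ n)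
  have hn0 : (0 : ℝ) < n := by linarith
  refine ⟨fun y => oR (c1 * ((n : ℝ)⁻¹ * max (Z y - g * H0) 0)), ?_, fun y => ?_, ?_⟩
  · fun_prop
  · have h1 : oR (c1 * g * ((n : ℝ)⁻¹ * H0)) ≤ oR (c1 * g * c3) * U := by
      rw [ENNReal.ofReal_mul (by positivity), ENNReal.ofReal_mul (p := c1 * g) (by positivity), mul_assoc]
      gcongr
    refine (hX y).trans (le_trans ?_ (add_le_add_left h1 _))
    rw [← ENNReal.ofReal_add (by positivity) (by positivity)]
    refine ENNReal.ofReal_le_ofReal ?_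
    have : Z y ≤ g * H0 + max (Z y - g * H0) 0 := by linarith [le_max_left (Z y - g * H0) 0]
    calc c1 * ((n : ℝ)⁻¹ * Z y) ≤ c1 * ((n : ℝ)⁻¹ * (g * H0 + max (Z y - g * H0) 0)) := by gcongr
      _ = _ := by ring
  · have e : ∀ y, oR (c1 * ((n : ℝ)⁻¹ * max (Z y - g * H0) 0)) ^ P ≤ oR (c1 ^ P) * oR ((max (Z y - g * H0) 0) ^ P) := fun y => by
      rw [ENNReal.ofReal_rpow_of_nonneg (by positivity) hP.le, ← ENNReal.ofReal_mul (by positivity), ← Real.mul_rpow hc1.le (le_max_right _ _)]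
      refine ENNReal.ofReal_le_ofReal (Real.rpow_le_rpow (by positivity) ?_ hP.le)
      refine mul_le_mul_of_nonneg_left ?_ hc1.le
      exact mul_le_of_le_one_left (le_max_right _ _) (inv_le_one_of_one_le₀ hn1)
    calc _ ≤ ∫⁻ y, oR (c1 ^ P) * oR ((max (Z y - g * H0) 0) ^ P) ∂μ := lintegral_mono e
      _ = oR (c1 ^ P) * ∫⁻ y, oR ((max (Z y - g * H0) 0) ^ P) ∂μ := lintegral_const_mul' _ _ ENNReal.ofReal_ne_top
      _ ≤ oR (c1 ^ P) * oR (P ^ P * H0 ^ P * Real.exp (c0 * Real.log n - Real.log n * (g * H0) / H0)) := by gcongr; exact hT _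
      _ ≤ _ := by
        rw [← ENNReal.ofReal_mul (by positivity)]
        refine ENNReal.ofReal_le_ofReal ?_
        have e1 : Real.exp (c0 * Real.log n - Real.log n * (g * H0) / H0) = (n : ℝ) ^ (-(P * a) - κ) := by
          rw [Real.rpow_def_of_pos hn0]; congr 1; rw [hg]; field_simp; ring
        have e2 : H0 ^ P ≤ CH ^ P * (n : ℝ) ^ (P * a) := by
          calc H0 ^ P ≤ (CH * (n : ℝ) ^ a) ^ P := Real.rpow_le_rpow hH.le hHC hP.le
            _ = _ := by rw [Real.mul_rpow hCH.le (by positivity), ← Real.rpow_mul hn0.le, mul_comm a]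
        rw [e1]
        calc _ ≤ c1 ^ P * (P ^ P * (CH ^ P * (n : ℝ) ^ (P * a)) * (n : ℝ) ^ (-(P * a) - κ)) := by gcongr
          _ = c1 ^ P * P ^ P * CH ^ P * ((n : ℝ) ^ (P * a) * (n : ℝ) ^ (-(P * a) - κ)) := by ring
          _ = _ := by
            rw [← Real.rpow_add hn0, Real.mul_rpow (by positivity) hCH.le, Real.mul_rpow hc1.le hP.le]
            congr 2; ring

lemma stoch_of {p : ℝ≥0∞} (hp : 1 < p) {c1 CH a c3 c0 : ℝ} (hc1 : 0 < c1) (hCH : 0 < CH) (ha : 0 ≤ a) (hc0 : 0 < c0) (hc3 : 0 < c3)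
    (hyp : ∀ n : ℕ, 3 ≤ n → ∀ f : (Fin d → ℝ) → ℝ, IsDensity f → ∀ h, memGrid lam p n univ h →
      (∀ y : Fin n → Fin d → ℝ, eLpNorm (xiProc univ K f q h y) p volume = 0) ∨
      ∃ (Z : (Fin n → Fin d → ℝ) → ℝ) (H0 : ℝ), Measurable Z ∧ 0 < H0 ∧ H0 ≤ CH * (n : ℝ) ^ a ∧
      (∀ y, eLpNorm (xiProc univ K f q h y) p volume ≤ oR (c1 * ((n : ℝ)⁻¹ * Z y))) ∧
      oR ((n : ℝ)⁻¹ * H0) ≤ oR c3 * Up K q lam p n univ h ∧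
      ∀ T : ℝ, ∫⁻ y, oR ((max (Z y - T) 0) ^ Pp p) ∂(Measure.pi fun _ => om f q) ≤
        oR (Pp p ^ Pp p * H0 ^ Pp p * Real.exp (c0 * Real.log n - Real.log n * T / H0))) : Stoch K q lam p := by
  intro κ hκ
  have hP := Pp_ge hp
  have hP0 : 0 < Pp p := by linarith
  refine ⟨c1 * (c0 + Pp p * a + κ) * c3, (c1 * Pp p * CH) ^ Pp p, by positivity, by positivity, fun n hn f hf h hh => ?_⟩
  rcases hyp n hn f hf h hh with h0 | ⟨Z, H0, m, hH, hHC, hX, hU, hT⟩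
  · refine ⟨0, measurable_const, fun y => by rw [h0]; exact zero_le, ?_⟩
    simp [hP0]
  · exact core_st hP0 hc1 hCH ha hc0 hc3 hκ hn m hH hHC hX hU hT

lemma prod_poly {p : ℝ≥0∞} {n : ℕ} {h : Fin d → ℝ} (hn : 3 ≤ n) (hp : 1 < p) (hg : memGrid lam p n univ h) (hl : ∀ j, 0 < lam j) {b : ℝ} (hb : 0 ≤ b) :
    ∏ j : Ix d, hx h j ^ (-lam ↑j - b) ≤ (n : ℝ) ^ (Pp p * ∑ j : Ix d, (lam ↑j + b)) := by
  have hn0 : (0 : ℝ) < n := by exact_mod_cast (by omega : 0 < n)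
  rw [Finset.mul_sum, Real.rpow_sum_of_pos hn0]
  refine Finset.prod_le_prod (fun j _ => (Real.rpow_pos_of_pos ((grid_gf hg).h0 j) _).le) fun j _ => ?_
  have h1 := grid_low hn hp hg ↑j
  have : -lam ↑j - b ≤ 0 := by linarith [hl ↑j]
  refine (Real.rpow_le_rpow_of_nonpos (by positivity) h1 this).trans (le_of_eq ?_)
  rw [← Real.rpow_mul hn0.le]; congr 1; ring

def el (K : ℝ → ℝ) (q : (Fin d → ℝ) → ℝ) (h : Fin d → ℝ) (x : Ix d → ℝ) (y : Fin d → ℝ) : ℂ := Lh univ K q h (x - rr y)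

def LM (K : ℝ → ℝ) (q : (Fin d → ℝ) → ℝ) (h : Fin d → ℝ) (P : ℝ) : ℝ := (∫ x, ‖Lh univ K q h x‖ ^ P) ^ (1 / P)

lemma LM_nonneg (h : Fin d → ℝ) (P : ℝ) : 0 ≤ LM K q h P := Real.rpow_nonneg (integral_nonneg fun x => by positivity) _

lemma LM_pow (h : Fin d → ℝ) {P : ℝ} (hP : 0 < P) : LM K q h P ^ P = ∫ x, ‖Lh univ K q h x‖ ^ P := by
  rw [LM, ← Real.rpow_mul (integral_nonneg fun x => by positivity), one_div_mul_cancel hP.ne', Real.rpow_one]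

lemma eLp_LM (R : Reg K q lam C) {h : Fin d → ℝ} (g : GF h) {P : ℝ} (hP : 0 < P) (hi : Integrable fun x => ‖Lh univ K q h x‖ ^ P) :
    eLpNorm (Lh univ K q h) (oR P) volume = oR (LM K q h P) := by
  have m : MemLp (Lh univ K q h) (oR P) volume := by
    rw [← integrable_norm_rpow_iff (Lh_cont R g).aestronglyMeasurable (by simpa using hP) ENNReal.ofReal_ne_top, ENNReal.toReal_ofReal hP.le]
    exact hi
  rw [m.eLpNorm_eq_integral_rpow_norm (by simpa using hP) ENNReal.ofReal_ne_top, ENNReal.toReal_ofReal hP.le, LM, one_div]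

lemma el_meas (R : Reg K q lam C) {h : Fin d → ℝ} (g : GF h) : Measurable (Function.uncurry (el K q h)) :=
  (Lh_cont R g).measurable.comp (measurable_fst.sub (rr_meas.comp measurable_snd))

lemma el_bd (R : Reg K q lam C) {h : Fin d → ℝ} (g : GF h) (x : Ix d → ℝ) : ∃ B, ∀ y, ‖el K q h x y‖ ≤ B := ⟨_, fun y => Lh_bd R g _⟩

lemma el_int {h : Fin d → ℝ} {P : ℝ} (hi : Integrable fun x => ‖Lh univ K q h x‖ ^ P) (y : Fin d → ℝ) : Integrable fun x => ‖el K q h x y‖ ^ P :=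
  hi.comp_sub_right (rr y)

lemma el_M (h : Fin d → ℝ) {P : ℝ} (hP : 0 < P) (y : Fin d → ℝ) : ∫ x, ‖el K q h x y‖ ^ P = LM K q h P ^ P := by
  rw [LM_pow h hP]
  exact integral_sub_right_eq_self (fun x => ‖Lh univ K q h x‖ ^ P) (rr y)

lemma xi_eq {f : (Fin d → ℝ) → ℝ} (h : Fin d → ℝ) {n : ℕ} (hn : 3 ≤ n) (y : Fin n → Fin d → ℝ) (x : Ix d → ℝ) :
    xiProc univ K f q h y x = (n : ℂ)⁻¹ * ∑ k, cen (om f q) (el K q h) x (y k) := by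
  have hn0 : (n : ℂ) ≠ 0 := by exact_mod_cast (by omega : n ≠ 0)
  simp only [cen, Finset.sum_sub_distrib, Finset.sum_const, Finset.card_univ, Fintype.card_fin, nsmul_eq_mul, mul_sub]
  rw [inv_mul_cancel_left₀ hn0]
  rfl

def Zf (ν : Measure (Fin d → ℝ)) (K : ℝ → ℝ) (q : (Fin d → ℝ) → ℝ) (h : Fin d → ℝ) (P : ℝ) {n : ℕ} (y : Fin n → Fin d → ℝ) : ℝ :=
  (∫ x, ‖∑ k, cen ν (el K q h) x (y k)‖ ^ P) ^ (1 / P)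

lemma Zf_meas (R : Reg K q lam C) {f : (Fin d → ℝ) → ℝ} (hf : IsDensity f) {h : Fin d → ℝ} (g : GF h) (P : ℝ) {n : ℕ} :
    Measurable (Zf (om f q) K q h P (n := n)) := by
  haveI := om_prob hf R.hq
  have h1 := sum_meas (n := n) (cen_meas (μ := om f q) (el_meas R g)) (s := fun _ => 0) measurable_const
  simp only [zero_add] at h1
  have : StronglyMeasurable (fun z : (Fin n → Fin d → ℝ) × (Ix d → ℝ) => ‖∑ k, cen (om f q) (el K q h) z.2 (z.1 k)‖ ^ P) :=
    ((h1.comp measurable_swap).norm.pow_const P).stronglyMeasurable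
  exact this.integral_prod_right'.measurable.pow_const _

lemma xi_Zf (R : Reg K q lam C) {f : (Fin d → ℝ) → ℝ} (hf : IsDensity f) {h : Fin d → ℝ} (g : GF h) {P : ℝ} (hP : 1 < P)
    (hi : Integrable fun x => ‖Lh univ K q h x‖ ^ P) {n : ℕ} (hn : 3 ≤ n) (y : Fin n → Fin d → ℝ) :
    eLpNorm (xiProc univ K f q h y) (oR P) volume = oR (1 * ((n : ℝ)⁻¹ * Zf (om f q) K q h P y)) := by
  haveI := om_prob hf R.hq
  have hP0 : 0 < P := by linarith
  have hc := cen_lp (μ := om f q) hP (LM_nonneg h P) (el_meas R g) (el_bd R g) (el_int hi) (fun y => (el_M h hP0 y).le)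
  have m : ∀ k, MemLp (fun x => cen (om f q) (el K q h) x (y k)) (oR P) volume := fun k => by
    rw [← integrable_norm_rpow_iff (cen_y (el_meas R g) (y k)).aestronglyMeasurable (by simpa using hP0) ENNReal.ofReal_ne_top, ENNReal.toReal_ofReal hP0.le]
    exact (hc (y k)).1
  have ms : MemLp (fun x => ∑ k, cen (om f q) (el K q h) x (y k)) (oR P) volume := memLp_finset_sum _ fun k _ => m k
  rw [show xiProc univ K f q h y = (n : ℂ)⁻¹ • (fun x => ∑ k, cen (om f q) (el K q h) x (y k)) from funext fun x => xi_eq h hn y x,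
    eLpNorm_const_smul, ms.eLpNorm_eq_integral_rpow_norm (by simpa using hP0) ENNReal.ofReal_ne_top, ENNReal.toReal_ofReal hP0.le, one_mul,
    ENNReal.ofReal_mul (by positivity), Zf, one_div, ← ofReal_norm_eq_enorm]
  simp

lemma weak_triv (R : Reg K q lam C) {f : (Fin d → ℝ) → ℝ} (hf : IsDensity f) {h : Fin d → ℝ} (g : GF h) {P : ℝ} (hP : 1 < P)
    (hi : Integrable fun x => ‖Lh univ K q h x‖ ^ P) (s : (Ix d → ℝ) → ℂ) (hs : Measurable s) (hsi : Integrable (fun x => ‖s x‖ ^ P)) :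
    ∫ y, ‖Wf volume P (el K q h) s y‖ ^ 2 ∂(om f q) ≤ (LM K q h P) ^ 2 * ((∫ x, ‖s x‖ ^ P) ^ ((P - 1) / P)) ^ 2 := by
  haveI := om_prob hf R.hq
  have hP0 : 0 < P := by linarith
  have hb : ∀ y, ‖Wf volume P (el K q h) s y‖ ≤ (∫ x, ‖s x‖ ^ P) ^ ((P - 1) / P) * LM K q h P := fun y => by
    have hm : Measurable fun x => el K q h x y := (Lh_cont R g).measurable.comp (measurable_id.sub_const (rr y))
    have h1 := holder_J hP hs hm hsi (el_int hi y)
    refine (norm_integral_le_integral_norm _).trans ?_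
    simp only [norm_mul]
    refine h1.2.trans (le_of_eq ?_)
    rw [el_M h hP0, ← Real.rpow_mul (LM_nonneg _ _), mul_one_div_cancel hP0.ne', Real.rpow_one]
  have h2 := integral_mono_of_nonneg (μ := om f q) (f := fun y => ‖Wf volume P (el K q h) s y‖ ^ 2) (g := fun _ => ((∫ x, ‖s x‖ ^ P) ^ ((P - 1) / P) * LM K q h P) ^ 2)
    (ae_of_all _ fun y => by positivity) (integrable_const _) (ae_of_all _ fun y => by simp only []; gcongr; exact hb y)
  refine h2.trans (le_of_eq ?_)
  rw [integral_const, probReal_univ, one_smul]; ring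

lemma LM_poly {A : ℝ} {p : ℝ≥0∞} (R : Reg K q lam C) (hN : N1N2 p (univ : Finset (Fin d)) q A lam) (hp2 : p ≠ 2) (hpt : p ≠ ⊤) (hp : 1 < p) {r : ℝ} (hr : 1 < r) :
    ∃ c a : ℝ, 1 ≤ c ∧ 0 ≤ a ∧ ∀ n : ℕ, 3 ≤ n → ∀ h, memGrid lam p n univ h → Integrable (fun x => ‖Lh univ K q h x‖ ^ r) ∧ LM K q h r ≤ c * (n : ℝ) ^ a := by
  obtain ⟨hA, hl, -, -, hm, -⟩ := hN
  obtain ⟨-, b, c⟩ := hm hp2 hpt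
  obtain ⟨c, hc, H⟩ := ptw R.hK (Qf q) hA (fun j : Ix d => lam ↑j) (fun j => hl _) (by simpa [Qf] using b) (by simpa [Qf] using c) hr
  have hr0 : 0 < r := by linarith
  have hP := Pp_ge hp
  refine ⟨max 1 (c2 d * c), Pp p * ∑ j : Ix d, (lam ↑j + 2), le_max_left _ _, mul_nonneg (by linarith) (Finset.sum_nonneg fun j _ => by linarith [hl ↑j]), fun n hn h hh => ?_⟩
  have g := grid_gf hh
  obtain ⟨h1, h2⟩ := H (hx h) g.h0 g.h1 (R.gb _ g.h0 g.h1).int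
  have e : ∀ x, ‖Lh univ K q h x‖ ^ r = c2 d ^ r * ‖FT (gh K (Qf q) (hx h)) x‖ ^ r := fun x => by
    rw [Lh_eq q g.h0, norm_mul, Complex.norm_real, Real.norm_of_nonneg c2_pos.le, Real.mul_rpow c2_pos.le (norm_nonneg _)]
  have hpp : 0 ≤ ∏ j : Ix d, hx h j ^ (-lam ↑j - 2) := Finset.prod_nonneg fun j _ => (Real.rpow_pos_of_pos (g.h0 j) _).le
  refine ⟨?_, ?_⟩
  · simp only [e]; exact h1.const_mul _
  · have h3 : LM K q h r ≤ c2 d * (c * ∏ j : Ix d, hx h j ^ (-lam ↑j - 2)) := by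
      rw [LM]; simp only [e]; rw [integral_const_mul]
      have hcc : 0 ≤ c * ∏ j : Ix d, hx h j ^ (-lam ↑j - 2) := by positivity
      calc _ ≤ (c2 d ^ r * (c * ∏ j : Ix d, hx h j ^ (-lam ↑j - 2)) ^ r) ^ (1 / r) := by
            refine Real.rpow_le_rpow (mul_nonneg (Real.rpow_nonneg c2_pos.le _) (integral_nonneg fun x => by positivity)) ?_ (by positivity)
            exact mul_le_mul_of_nonneg_left h2 (Real.rpow_nonneg c2_pos.le _)
        _ = _ := by
          rw [← Real.mul_rpow c2_pos.le hcc, ← Real.rpow_mul (mul_nonneg c2_pos.le hcc), mul_one_div_cancel hr0.ne', Real.rpow_one]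
    have h4 := prod_poly hn hp hh hl (b := 2) (by norm_num)
    calc _ ≤ c2 d * (c * (n : ℝ) ^ (Pp p * ∑ j : Ix d, (lam ↑j + 2))) := h3.trans (by gcongr; exact c2_pos.le)
      _ = (c2 d * c) * (n : ℝ) ^ (Pp p * ∑ j : Ix d, (lam ↑j + 2)) := by ring
      _ ≤ _ := by gcongr; exact le_max_right _ _

end st

section st2
variable {d : ℕ} {K : ℝ → ℝ} {q : (Fin d → ℝ) → ℝ} {lam : Fin d → ℝ} {C : ℝ}

lemma log_ge {n : ℕ} (hn : 3 ≤ n) : 1 ≤ Real.log n := by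
  have hn3 : (3 : ℝ) ≤ n := by exact_mod_cast hn
  rw [Real.le_log_iff_exp_le (by linarith)]
  linarith [Real.exp_one_lt_d9]

lemma Cc_pos {p : ℝ} (hp : 0 < p) : 0 < Cc p := by
  have := aC_pos hp
  unfold Cc; positivity

lemma xi_zero (R : Reg K q lam C) {h : Fin d → ℝ} (g : GF h) {P : ℝ} (hP : 0 < P) (hi : Integrable fun x => ‖Lh univ K q h x‖ ^ P)
    (h0 : LM K q h P = 0) {f : (Fin d → ℝ) → ℝ} {n : ℕ} (hn : 3 ≤ n) (y : Fin n → Fin d → ℝ) : xiProc univ K f q h y = 0 := by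
  have h1 := eLp_LM R g hP hi
  rw [h0, ENNReal.ofReal_zero, eLpNorm_eq_zero_iff (Lh_cont R g).aestronglyMeasurable (by simpa using hP)] at h1
  have h2 := (Lh_cont R g).ae_eq_iff_eq volume continuous_zero |>.1 h1
  ext x
  rw [xi_eq h hn]
  simp [cen, el, h2]

lemma stoch_lt2 {A : ℝ} {p : ℝ≥0∞} (R : Reg K q lam C) (hN : N1N2 p (univ : Finset (Fin d)) q A lam) (hp : 1 < p) (hp2 : p < 2) : Stoch K q lam p := by
  have hpt : p ≠ ⊤ := (hp2.trans (by norm_num)).ne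
  set P := p.toReal with hPd
  have eP : p = oR P := (ENNReal.ofReal_toReal hpt).symm
  have hP1 : 1 < P := by rw [hPd, ← ENNReal.toReal_one]; exact (ENNReal.toReal_lt_toReal (by simp) hpt).2 hp
  have hP2 : P < 2 := by rw [hPd, ← ENNReal.toReal_ofNat 2]; exact (ENNReal.toReal_lt_toReal hpt (by simp)).2 hp2
  have hP0 : 0 < P := by linarith
  have ePp : Pp p = P := by unfold Pp; rw [if_neg hpt]
  obtain ⟨cL, aL, hcL, haL, HL⟩ := LM_poly R hN hp2.ne hpt hp hP1
  set ε := 2 / P - 1 with hε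
  have hε0 : 0 < ε := by rw [hε, sub_pos, lt_div_iff₀ hP0]; linarith
  set c := 1 / ε + 2 with hc
  have hc1 : 1 ≤ c := by have : 0 < 1 / ε := by positivity
                         linarith
  refine stoch_of hp (c1 := 1) (CH := c * cL) (a := 1 + aL) (c3 := c) (c0 := Cc P) one_pos (by positivity) (by positivity) (Cc_pos hP0) (by positivity) fun n hn f hf h hh => ?_
  have g := grid_gf hh
  haveI := om_prob hf R.hq
  have hn1 : (1 : ℝ) ≤ n := by exact_mod_cast (by omega : 1 ≤ n)
  have hn0 : (0 : ℝ) < n := by linarith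
  have hL1 := log_ge hn
  obtain ⟨hi, hLM⟩ := HL n hn h hh
  set M := LM K q h P with hMd
  rcases (LM_nonneg h P : 0 ≤ M).eq_or_lt with h0 | hM
  · left; intro y; rw [xi_zero R g hP0 hi h0.symm hn y]; simp
  right
  set s := (n : ℝ) ^ (1 / P) with hs
  have hs0 : 0 < s := Real.rpow_pos_of_pos hn0 _
  have hs1 : 1 ≤ s := Real.one_le_rpow hn1 (by positivity)
  have hsP : s ^ P = n := by rw [hs, ← Real.rpow_mul hn0.le, one_div_mul_cancel hP0.ne', Real.rpow_one]
  have hsn : s ≤ n := by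
    conv_rhs => rw [← Real.rpow_one (n : ℝ)]
    exact Real.rpow_le_rpow_of_exponent_le hn1 (by rw [div_le_one hP0]; exact hP1.le)
  have hlog : n * Real.log n ≤ c * s ^ 2 := by
    have e : s ^ 2 = n * (n : ℝ) ^ ε := by
      rw [hs, ← Real.rpow_natCast, ← Real.rpow_mul hn0.le]
      conv_rhs => rw [← Real.rpow_one (n : ℝ), ← Real.rpow_mul hn0.le, one_mul, ← Real.rpow_add hn0]
      congr 1; rw [hε]; push_cast; ring
    have := Real.log_le_rpow_div hn0.le hε0
    rw [e]
    calc n * Real.log n ≤ n * ((n : ℝ) ^ ε / ε) := by gcongr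
      _ = (1 / ε) * (n * (n : ℝ) ^ ε) := by ring
      _ ≤ _ := by gcongr; linarith
  have hlog2 : Real.log n ≤ c * s := by
    have : Real.log n ≤ (n : ℝ) ^ (1 / P) / (1 / P) := Real.log_le_rpow_div hn0.le (by positivity)
    rw [← hs] at this
    calc _ ≤ s / (1 / P) := this
      _ = P * s := by field_simp
      _ ≤ _ := by gcongr; have : 0 < 1 / ε := by positivity
                  linarith
  have D : EmpData volume (om f q) P M (c * s * M) (Real.log n) M n (el K q h) :=
    { hp := hP1, hM0 := hM.le, hH := by positivity, hL := hL1, hℓ := el_meas R g, hb := el_bd R g, hi := el_int hi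
      hM := fun y => (el_M h hP0 y).le, hσ := weak_triv R hf g hP1 hi
      h1 := by
        rw [Real.mul_rpow (by positivity) hM.le, Real.mul_rpow (by positivity) hs0.le, hsP]
        have : 1 ≤ c ^ P := Real.one_le_rpow hc1 hP0.le
        gcongr; exact le_mul_of_one_le_left hn0.le this
      h2 := by gcongr
      h3 := by
        calc n * Real.log n * M ^ 2 ≤ c * s ^ 2 * M ^ 2 := by gcongr
          _ ≤ c ^ 2 * s ^ 2 * M ^ 2 := by gcongr; exact le_self_pow₀ hc1 (by norm_num)
          _ = _ := by ring }
  refine ⟨Zf (om f q) K q h P, c * s * M, Zf_meas R hf g P, by positivity, ?_, fun y => ?_, ?_, fun T => ?_⟩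
  · rw [Real.rpow_add hn0, Real.rpow_one]
    calc c * s * M ≤ c * n * (cL * (n : ℝ) ^ aL) := by gcongr
      _ = _ := by ring
  · rw [eP]; exact (xi_Zf R hf g hP1 hi hn y).le
  · have : Up K q lam p n univ h = oR ((n : ℝ) ^ (1 / P - 1)) * oR M := by
      rw [Up, if_neg hpt, if_neg hp2.ne, if_pos hP2, hMd, ← eLp_LM R g hP0 hi, ← eP]
    rw [this, ← ENNReal.ofReal_mul (by positivity), ← ENNReal.ofReal_mul (by positivity), Real.rpow_sub hn0, Real.rpow_one, ← hs]
    refine ENNReal.ofReal_le_ofReal (le_of_eq ?_); field_simp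
  · rw [ePp]; exact conc_le D hP2.le hP0
end st2

section st3
variable {d : ℕ} {K : ℝ → ℝ} {q : (Fin d → ℝ) → ℝ} {lam : Fin d → ℝ} {C : ℝ}

lemma gh_cont (R : Reg K q lam C) (h : Ix d → ℝ) : Continuous (gh K (Qf q) h) := (kapp_cont R.hK h).mul ((Qf_cont R.hq).inv₀ R.hQ)

def ef (K : ℝ → ℝ) (q : (Fin d → ℝ) → ℝ) (h : Fin d → ℝ) (t : Ix d → ℝ) (y : Fin d → ℝ) : ℂ := gh K (Qf q) (hx h) t * ec t (rr y)

lemma ef_norm (h : Fin d → ℝ) (t : Ix d → ℝ) (y : Fin d → ℝ) : ‖ef K q h t y‖ = ‖gh K (Qf q) (hx h) t‖ := by rw [ef, norm_mul, norm_ec, mul_one]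

lemma ef_meas (R : Reg K q lam C) (h : Fin d → ℝ) : Measurable (Function.uncurry (ef K q h)) :=
  ((gh_cont R (hx h)).measurable.comp measurable_fst).mul (ec_meas rr_meas)

lemma cen_ef_bd {f : (Fin d → ℝ) → ℝ} [IsProbabilityMeasure (om f q)] (h : Fin d → ℝ) (t : Ix d → ℝ) (y : Fin d → ℝ) :
    ‖cen (om f q) (ef K q h) t y‖ ≤ 2 * ‖gh K (Qf q) (hx h) t‖ := by
  unfold cen
  refine (norm_sub_le _ _).trans ?_
  have := norm_integral_le_of_norm_le_const (μ := om f q) (f := fun y' => ef K q h t y') (ae_of_all _ fun y' => (ef_norm h t y').le)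
  rw [probReal_univ, mul_one] at this
  rw [ef_norm]; linarith

lemma cen_ef_int (R : Reg K q lam C) {f : (Fin d → ℝ) → ℝ} (hf : IsDensity f) {h : Fin d → ℝ} (g : GF h) (y : Fin d → ℝ) :
    Integrable fun t => cen (om f q) (ef K q h) t y := by
  haveI := om_prob hf R.hq
  exact ((R.gb _ g.h0 g.h1).int.norm.const_mul 2).mono' (cen_y (ef_meas R h) y).aestronglyMeasurable (ae_of_all _ fun t => cen_ef_bd h t y)

lemma cen_FT (R : Reg K q lam C) {f : (Fin d → ℝ) → ℝ} (hf : IsDensity f) {h : Fin d → ℝ} (g : GF h) (x : Ix d → ℝ) (y : Fin d → ℝ) :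
    cen (om f q) (el K q h) x y = (c2 d : ℂ) * FT (fun t => cen (om f q) (ef K q h) t y) x := by
  haveI := om_prob hf R.hq
  have gi := (R.gb _ g.h0 g.h1).int
  have h1 : ∀ y, el K q h x y = (c2 d : ℂ) * FT (fun t => ef K q h t y) x := fun y => by
    rw [el, Lh_eq q g.h0]; unfold FT ef; congr 2; ext t
    rw [show -(x - rr y) = -x + rr y by abel, ec_add_right]; ring
  have h2 := FT_mix (ν := om f q) (w := fun _ => 1) (integrable_const _) rr_meas gi x
  simp only [one_mul, mul_one] at h2
  have h3 : ∫ y', el K q h x y' ∂(om f q) = (c2 d : ℂ) * FT (fun t => ∫ y', ef K q h t y' ∂(om f q)) x := by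
    simp only [el, Lh_eq q g.h0, ef]; rw [integral_const_mul, h2]; simp only [integral_const_mul]
  have i1 : Integrable fun t => ef K q h t y :=
    gi.norm.mono' ((gh_cont R (hx h)).mul (continuous_ec.comp (continuous_id.prodMk continuous_const))).aestronglyMeasurable (ae_of_all _ fun t => (ef_norm h t y).le)
  have i2 : Integrable fun t => ∫ y', ef K q h t y' ∂(om f q) := by
    have := i1.sub (cen_ef_int R hf g y)
    refine this.congr (ae_of_all _ fun t => ?_)
    simp [cen]
  rw [cen, h1, h3, ← mul_sub]; unfold FT
  rw [← integral_sub (ec_integrable i1 x) (ec_integrable i2 x)]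
  simp only [cen, mul_sub]

lemma sum_FT (R : Reg K q lam C) {f : (Fin d → ℝ) → ℝ} (hf : IsDensity f) {h : Fin d → ℝ} (g : GF h) {n : ℕ} (y : Fin n → Fin d → ℝ) (x : Ix d → ℝ) :
    ∑ k, cen (om f q) (el K q h) x (y k) = (c2 d : ℂ) * FT (fun t => ∑ k, cen (om f q) (ef K q h) t (y k)) x := by
  simp only [cen_FT R hf g, ← Finset.mul_sum]
  unfold FT
  rw [← integral_finset_sum _ fun k _ => ec_integrable (cen_ef_int R hf g (y k)) x]
  simp only [Finset.mul_sum]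

lemma planch_norm {ι : Type} [Fintype ι] {φ : (ι → ℝ) → ℂ} (hφ : Integrable φ) (hφ2 : Integrable fun t => ‖φ t‖ ^ 2) :
    eLpNorm (FT φ) 2 volume ≤ oR (√((2 * Real.pi) ^ Fintype.card ι) * (∫ t, ‖φ t‖ ^ (2 : ℝ)) ^ (1 / (2 : ℝ))) := by
  rw [eLpNorm_eq_lintegral_rpow_enorm_toReal (by norm_num) (by norm_num)]
  simp only [ENNReal.toReal_ofNat, Real.rpow_two]
  have := planch hφ hφ2
  rw [← Real.sqrt_eq_rpow, ← Real.sqrt_mul (by positivity), Real.sqrt_eq_rpow,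
    ← ENNReal.ofReal_rpow_of_nonneg (mul_nonneg (by positivity) (integral_nonneg fun t => by positivity)) (by norm_num)]
  refine ENNReal.rpow_le_rpow (le_trans (le_of_eq ?_) this) (by norm_num)
  refine lintegral_congr fun x => ?_
  norm_cast

lemma weak_two (R : Reg K q lam C) {f : (Fin d → ℝ) → ℝ} (hf : IsDensity f) {h : Fin d → ℝ} (g : GF h) (hI : Integrable (Qf q)) (s : (Ix d → ℝ) → ℂ)
    (hs : Measurable s) (hsi : Integrable fun x => ‖s x‖ ^ (2 : ℝ)) :
    ∫ y, ‖Wf volume 2 (ef K q h) s y‖ ^ 2 ∂(om f q) ≤ (C * (∏ j : Ix d, hx h j ^ (-lam ↑j)) * ((∫ t, ‖Qf q t‖) + 1)) ^ 2 * ((∫ x, ‖s x‖ ^ (2 : ℝ)) ^ (((2 : ℝ) - 1) / 2)) ^ 2 := by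
  haveI := om_prob hf R.hq
  have gb := R.gb _ g.h0 g.h1
  set G := gh K (Qf q) (hx h) with hG
  have hGm : Measurable G := (gh_cont R (hx h)).measurable
  set S := C * ∏ j : Ix d, hx h j ^ (-lam ↑j) with hS
  have hS0 : 0 ≤ S := (norm_nonneg _).trans (gb.sup 0)
  have hφm : Measurable fun t => Jf 2 (s t) * G t := ((measurable_Jf 2).comp hs).mul hGm
  have hn : ∀ t, ‖Jf 2 (s t) * G t‖ = ‖s t‖ * ‖G t‖ := fun t => by rw [norm_mul, norm_Jf (by norm_num)]; norm_num
  have hle : ∀ t, ‖Jf 2 (s t) * G t‖ ^ 2 ≤ S ^ 2 * ‖s t‖ ^ (2 : ℝ) := fun t => by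
    rw [hn, Real.rpow_two, mul_pow, mul_comm]; gcongr; exact gb.sup t
  have hφ2 : Integrable fun t => ‖Jf 2 (s t) * G t‖ ^ 2 := (hsi.const_mul (S ^ 2)).mono' (hφm.norm.pow_const 2).aestronglyMeasurable
    (ae_of_all _ fun t => by rw [Real.norm_of_nonneg (by positivity)]; exact hle t)
  have hφ : Integrable fun t => Jf 2 (s t) * G t := by
    have := (holder_J (p := 2) (by norm_num) hs hGm hsi (by simpa using gb.int2)).1
    exact this.mono' hφm.aestronglyMeasurable (ae_of_all _ fun t => (norm_mul _ _).le)
  have hcb : ∀ u : Ix d → ℝ, ‖∫ y, ec u (rr y) ∂(om f q)‖ ≤ ‖Qf q u‖ := fun u => by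
    rw [om_chf hf R.hq, norm_mul]; exact mul_le_of_le_one_left (norm_nonneg _) (ftI_norm_le hf u)
  have hcm : Measurable fun u : Ix d → ℝ => ∫ y, ec u (rr y) ∂(om f q) := mean_meas (ec_meas rr_meas)
  have hc : Integrable fun u : Ix d → ℝ => ∫ y, ec u (rr y) ∂(om f q) := hI.norm.mono' hcm.aestronglyMeasurable (ae_of_all _ hcb)
  have h1 := schur (μ := om f q) rr_meas hφ hφ2 hc
  have e : ∀ y, Wf volume 2 (ef K q h) s y = ∫ t, ec t (rr y) * (Jf 2 (s t) * G t) := fun y => by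
    unfold Wf ef; congr 1; ext t; ring
  simp only [e]
  refine h1.trans ?_
  have h2 : ∫ t, ‖Jf 2 (s t) * G t‖ ^ 2 ≤ S ^ 2 * ∫ t, ‖s t‖ ^ (2 : ℝ) := by
    rw [← integral_const_mul]; exact integral_mono hφ2 (hsi.const_mul _) hle
  have h3 : ∫ u : Ix d → ℝ, ‖∫ y, ec u (rr y) ∂(om f q)‖ ≤ ∫ t, ‖Qf q t‖ := integral_mono hc.norm hI.norm hcb
  have hI0 : 0 ≤ ∫ t, ‖Qf q t‖ := integral_nonneg fun t => norm_nonneg _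
  have hs0 : 0 ≤ ∫ t, ‖s t‖ ^ (2 : ℝ) := integral_nonneg fun t => by positivity
  calc _ ≤ (S ^ 2 * ∫ t, ‖s t‖ ^ (2 : ℝ)) * ((∫ t, ‖Qf q t‖) + 1) ^ 2 := by
        refine mul_le_mul h2 (h3.trans ?_) (integral_nonneg fun t => norm_nonneg _) (by positivity)
        nlinarith
    _ = _ := by
      rw [← Real.rpow_natCast (_ ^ _) 2, ← Real.rpow_mul hs0]; norm_num; ring

lemma VW {h : Fin d → ℝ} (g : GF h) : (∏ j : Ix d, hx h j ^ (-lam ↑j)) ^ 2 = (∏ j : Ix d, hx h j ^ (-lam ↑j - 1 / 2)) ^ 2 * ∏ j : Ix d, hx h j := by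
  rw [← Finset.prod_pow, ← Finset.prod_pow, ← Finset.prod_mul_distrib]
  refine Finset.prod_congr rfl fun j _ => ?_
  rw [← Real.rpow_natCast, ← Real.rpow_natCast, ← Real.rpow_mul (g.h0 j).le, ← Real.rpow_mul (g.h0 j).le]
  nth_rw 3 [← Real.rpow_one (hx h j)]
  rw [← Real.rpow_add (g.h0 j)]; congr 1; push_cast; ring

lemma V_pos {h : Fin d → ℝ} (g : GF h) (b : ℝ) : 0 < ∏ j : Ix d, hx h j ^ (-lam ↑j - b) := Finset.prod_pos fun j _ => Real.rpow_pos_of_pos (g.h0 j) _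

lemma log_sqrt {n : ℕ} (hn : 3 ≤ n) : Real.log n ≤ 2 * √n := by
  have : Real.log n ≤ (n : ℝ) ^ (1 / 2 : ℝ) / (1 / 2) := Real.log_le_rpow_div (by positivity) (by norm_num)
  rw [← Real.sqrt_eq_rpow] at this; linarith

lemma sqrt_neg {n : ℕ} (hn : 3 ≤ n) : (n : ℝ)⁻¹ * √n = (n : ℝ) ^ (-(1 : ℝ) / 2) := by
  have hn0 : (0 : ℝ) < n := by exact_mod_cast (by omega : 0 < n)
  rw [Real.sqrt_eq_rpow, ← Real.rpow_neg_one, ← Real.rpow_add hn0]; norm_num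

lemma stoch_2 {A : ℝ} (R : Reg K q lam C) (hN : N1N2 2 (univ : Finset (Fin d)) q A lam) (hd : 0 < d) : Stoch K q lam 2 := by
  obtain ⟨-, hl, h2, -⟩ := hN
  have hI : Integrable (Qf q) := (h2 rfl).1
  have ePp : Pp 2 = 2 := by unfold Pp; rw [if_neg (by norm_num)]; simp
  set I := (∫ t, ‖Qf q t‖) + 1 with hId
  have hI1 : 1 ≤ I := by have : 0 ≤ ∫ t, ‖Qf q t‖ := integral_nonneg fun t => norm_nonneg _
                         linarith
  have hC := R.hC
  refine stoch_of (by norm_num) (c1 := c2 d * √((2 * Real.pi) ^ d)) (CH := 2 * C * I) (a := 1 + Pp 2 * ∑ j : Ix d, (lam ↑j + 1 / 2)) (c3 := 2 * C * I) (c0 := Cc 2)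
    (mul_pos c2_pos (by positivity)) (by positivity) ?_ (Cc_pos (by norm_num)) (by positivity) fun n hn f hf h hh => Or.inr ?_
  · rw [ePp]; have : 0 ≤ ∑ j : Ix d, (lam ↑j + 1 / 2) := Finset.sum_nonneg fun j _ => by linarith [hl ↑j]
    positivity
  have g := grid_gf hh
  have gb := R.gb _ g.h0 g.h1
  haveI := om_prob hf R.hq
  have hn1 : (1 : ℝ) ≤ n := by exact_mod_cast (by omega : 1 ≤ n)
  have hn0 : (0 : ℝ) < n := by linarith
  have hL1 := log_ge hn
  have hL2 := log_sqrt hn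
  set V := ∏ j : Ix d, hx h j ^ (-lam ↑j - 1 / 2) with hVd
  have hV : 0 < V := V_pos g _
  set W := ∏ j : Ix d, hx h j ^ (-lam ↑j) with hW
  have hVW : W ^ 2 = V ^ 2 * ∏ j : Ix d, hx h j := VW g
  have hprod : Real.log n * ∏ j : Ix d, hx h j ≤ 1 := by
    have : ∏ j : Ix d, hx h j ≤ (Real.log n) ^ (-(2 : ℝ)) := by
      have h1 : ∀ j ∈ (univ : Finset (Ix d)), hx h j ≤ (Real.log n) ^ (-(2 / d : ℝ)) := fun j _ => by
        have := (hh.2.1 ↑j (Finset.mem_univ _)).2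
        simpa [hmaxG, hx] using this
      refine (Finset.prod_le_prod (fun j _ => (g.h0 j).le) h1).trans (le_of_eq ?_)
      rw [Finset.prod_const, Finset.card_univ, card_ix, ← Real.rpow_natCast, ← Real.rpow_mul (by linarith)]
      congr 1; have : (d : ℝ) ≠ 0 := by exact_mod_cast hd.ne'
      field_simp
    calc _ ≤ Real.log n * (Real.log n) ^ (-(2 : ℝ)) := by gcongr
      _ = (Real.log n) ^ (-(1 : ℝ)) := by
        nth_rw 1 [← Real.rpow_one (Real.log n)]; rw [← Real.rpow_add (by linarith)]; norm_num
      _ ≤ 1 := Real.rpow_le_one_of_one_le_of_nonpos hL1 (by norm_num)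
  have sq : √(n : ℝ) ^ 2 = n := Real.sq_sqrt hn0.le
  have hs1 : 1 ≤ √(n : ℝ) := by rw [Real.one_le_sqrt]; exact hn1
  have hsn : √(n : ℝ) ≤ n := by nlinarith
  have hef : ∀ y, (fun x => ‖ef K q h x y‖ ^ (2 : ℝ)) = fun t => ‖gh K (Qf q) (hx h) t‖ ^ 2 := fun y => by ext t; rw [ef_norm, Real.rpow_two]
  have D : EmpData volume (om f q) 2 (C * V) (2 * C * I * √n * V) (Real.log n) (C * W * I) n (ef K q h) :=
    { hp := by norm_num, hM0 := by positivity, hH := by positivity, hL := hL1, hℓ := ef_meas R h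
      hb := fun x => ⟨_, fun y => (ef_norm h x y).le⟩
      hi := fun y => by rw [hef]; exact gb.int2
      hM := fun y => by
        rw [hef, Real.rpow_two]; refine gb.int3.trans ?_
        rw [mul_pow]; gcongr; nlinarith
      hσ := weak_two R hf g hI
      h1 := by
        rw [Real.rpow_two, Real.rpow_two]
        calc n * (C * V) ^ 2 = √(n : ℝ) ^ 2 * (C * V) ^ 2 * 1 := by rw [sq]; ring
          _ ≤ √(n : ℝ) ^ 2 * (C * V) ^ 2 * (2 * I) ^ 2 := by gcongr; nlinarith
          _ = _ := by ring
      h2 := by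
        calc Real.log n * (C * V) ≤ 2 * √n * (C * V) * 1 := by rw [mul_one]; gcongr
          _ ≤ 2 * √n * (C * V) * I := by gcongr
          _ = _ := by ring
      h3 := by
        calc n * Real.log n * (C * W * I) ^ 2 = n * (C * I) ^ 2 * V ^ 2 * (Real.log n * ∏ j : Ix d, hx h j) := by rw [mul_pow, mul_pow, hVW]; ring
          _ ≤ √(n : ℝ) ^ 2 * (C * I) ^ 2 * V ^ 2 * 4 := by rw [sq]; gcongr; linarith
          _ = _ := by ring }
  refine ⟨fun y => (∫ x, ‖∑ k, cen (om f q) (ef K q h) x (y k)‖ ^ (2 : ℝ)) ^ (1 / (2 : ℝ)), 2 * C * I * √n * V, ?_, by positivity, ?_, fun y => ?_, ?_, fun T => ?_⟩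
  · have h1 := sum_meas (n := n) (cen_meas (μ := om f q) (ef_meas R h)) (s := fun _ => 0) measurable_const
    simp only [zero_add] at h1
    have : StronglyMeasurable (fun z : (Fin n → Fin d → ℝ) × (Ix d → ℝ) => ‖∑ k, cen (om f q) (ef K q h) z.2 (z.1 k)‖ ^ (2 : ℝ)) :=
      ((h1.comp measurable_swap).norm.pow_const (2 : ℝ)).stronglyMeasurable
    exact this.integral_prod_right'.measurable.pow_const _
  · have := prod_poly hn (by norm_num) hh hl (b := 1 / 2) (by norm_num)
    rw [Real.rpow_add hn0, Real.rpow_one]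
    calc _ ≤ 2 * C * I * n * (n : ℝ) ^ (Pp 2 * ∑ j : Ix d, (lam ↑j + 1 / 2)) := by gcongr
      _ = _ := by ring
  · set φ := fun t => ∑ k, cen (om f q) (ef K q h) t (y k) with hφd
    have hφ : Integrable φ := integrable_finset_sum _ fun k _ => cen_ef_int R hf g (y k)
    have hφb : ∀ t, ‖φ t‖ ≤ n * (2 * ‖gh K (Qf q) (hx h) t‖) := fun t => by
      refine (norm_sum_le _ _).trans ((Finset.sum_le_card_nsmul _ _ _ fun k _ => cen_ef_bd h t (y k)).trans (le_of_eq ?_))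
      simp
    have hφ2 : Integrable fun t => ‖φ t‖ ^ 2 := by
      refine (gb.int2.const_mul ((n * 2) ^ 2)).mono' (hφ.aestronglyMeasurable.norm.pow 2) (ae_of_all _ fun t => ?_)
      rw [Real.norm_of_nonneg (by positivity), ← mul_pow, mul_assoc]
      exact pow_le_pow_left₀ (norm_nonneg _) (hφb t) 2
    have hp := planch_norm hφ hφ2
    rw [show xiProc univ K f q h y = ((n : ℂ)⁻¹ * c2 d) • FT φ from funext fun x => by
      rw [xi_eq h hn, sum_FT R hf g]; simp [mul_assoc, hφd], eLpNorm_const_smul, ← ofReal_norm_eq_enorm, norm_mul, norm_inv, Complex.norm_natCast, Complex.norm_real,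
      Real.norm_of_nonneg c2_pos.le]
    refine (mul_le_mul_right hp _).trans (le_of_eq ?_)
    rw [← ENNReal.ofReal_mul (mul_nonneg (by positivity) c2_pos.le), card_ix]
    congr 1; ring
  · rw [Up, if_neg (by norm_num), if_pos rfl, ← ENNReal.ofReal_mul (by positivity), prod_ix, ← sqrt_neg hn]
    refine ENNReal.ofReal_le_ofReal (le_of_eq ?_); rw [hVd]; simp only [hx]; ring
  · rw [ePp]; exact conc_le D le_rfl (by norm_num)
end st3

section st4
variable {d : ℕ} {K : ℝ → ℝ} {q : (Fin d → ℝ) → ℝ} {lam : Fin d → ℝ} {C : ℝ}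

lemma young_e {X : Type} [MeasurableSpace X] {ν : Measure X} {a b : X → ℝ≥0∞} (ha : Measurable a) (hb : Measurable b) {P : ℝ} (hP : 2 < P) :
    (∫⁻ x, a x ^ ((P - 1) / P) * b x ∂ν) ^ (2 : ℝ) ≤ (∫⁻ x, a x * b x ^ (2 * P / (P + 2)) ∂ν) *
      ((∫⁻ x, a x ∂ν) ^ (1 - 2 / P) * (∫⁻ x, b x ^ (2 * P / (P + 2)) ∂ν) ^ (2 / P)) := by
  have hP0 : 0 < P := by linarith
  set r := 2 * P / (P + 2) with hr
  have hr0 : 0 ≤ r := by positivity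
  have hu : 0 ≤ 1 - 2 / P := by rw [sub_nonneg, div_le_one hP0]; exact hP.le
  have hm := hb.pow_const r
  have h1 := ENNReal.lintegral_mul_norm_pow_le (μ := ν) (ha.mul hm).aemeasurable ((ha.pow_const (1 - 2 / P)).mul (hm.pow_const (2 / P))).aemeasurable
    (p := 1 / 2) (q := 1 / 2) (by norm_num) (by norm_num) (by norm_num)
  have h2 := ENNReal.lintegral_mul_norm_pow_le (μ := ν) ha.aemeasurable hm.aemeasurable hu (show 0 ≤ 2 / P by positivity) (by ring)
  have e : ∀ x, a x ^ ((P - 1) / P) * b x = (a x * b x ^ r) ^ (1 / 2 : ℝ) * (a x ^ (1 - 2 / P) * (b x ^ r) ^ (2 / P)) ^ (1 / 2 : ℝ) := fun x => by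
    rw [ENNReal.mul_rpow_of_nonneg _ _ (by norm_num), ENNReal.mul_rpow_of_nonneg _ _ (by norm_num), ← ENNReal.rpow_mul, ← ENNReal.rpow_mul, ← ENNReal.rpow_mul, ← ENNReal.rpow_mul,
      show a x ^ (1 / 2 : ℝ) * b x ^ (r * (1 / 2)) * (a x ^ ((1 - 2 / P) * (1 / 2)) * b x ^ (r * (2 / P * (1 / 2)))) =
        (a x ^ (1 / 2 : ℝ) * a x ^ ((1 - 2 / P) * (1 / 2))) * (b x ^ (r * (1 / 2)) * b x ^ (r * (2 / P * (1 / 2)))) by ring,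
      ← ENNReal.rpow_add_of_nonneg _ _ (by norm_num) (by positivity), ← ENNReal.rpow_add_of_nonneg _ _ (by positivity) (by positivity),
      show r * (1 / 2) + r * (2 / P * (1 / 2)) = 1 by rw [hr]; field_simp, ENNReal.rpow_one]
    congr 2; field_simp; ring
  simp only [e]
  have h3 := ENNReal.rpow_le_rpow h1 (show (0 : ℝ) ≤ 2 by norm_num)
  refine h3.trans ?_
  rw [ENNReal.mul_rpow_of_nonneg _ _ (by norm_num), ← ENNReal.rpow_mul, ← ENNReal.rpow_mul, show (1 / 2 : ℝ) * 2 = 1 by norm_num, ENNReal.rpow_one, ENNReal.rpow_one]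
  exact mul_le_mul_right h2 _

lemma int_le_of_lint {Y : Type} [MeasurableSpace Y] {μ : Measure Y} {F : Y → ℝ} (hF : ∀ y, 0 ≤ F y) {c : ℝ} (hc : 0 ≤ c)
    (h : ∫⁻ y, oR (F y) ∂μ ≤ oR c) : ∫ y, F y ∂μ ≤ c := by
  by_cases hi : Integrable F μ
  · rw [← ofReal_integral_eq_lintegral_ofReal hi (ae_of_all _ hF)] at h
    exact (ENNReal.ofReal_le_ofReal_iff hc).1 h
  · rw [integral_undef hi]; exact hc

lemma enorm_rpow (z : ℂ) {P : ℝ} (hP : 0 ≤ P) : oR (‖z‖ ^ P) = ‖z‖ₑ ^ P := by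
  rw [← ENNReal.ofReal_rpow_of_nonneg (norm_nonneg _) hP, ofReal_norm]

lemma lint_el (h : Fin d → ℝ) {P : ℝ} (hP : 0 < P) (hi : Integrable fun x => ‖Lh univ K q h x‖ ^ P) : 
    ∫⁻ x, ‖Lh univ K q h x‖ₑ ^ P = oR (LM K q h P ^ P) := by
  rw [LM_pow h hP, ofReal_integral_eq_lintegral_ofReal hi (ae_of_all _ fun x => by positivity)]
  simp only [enorm_rpow _ hP.le]

lemma weak_gt (R : Reg K q lam C) {f : (Fin d → ℝ) → ℝ} (hf : IsDensity f) {h : Fin d → ℝ} (g : GF h) {P B : ℝ} (hP : 2 < P) (hB : 1 ≤ B)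
    (hqB : ∀ᵐ x : Ix d → ℝ, marginal univ q x ≤ B) (hi : Integrable fun x => ‖Lh univ K q h x‖ ^ (2 * P / (P + 2)))
    (s : (Ix d → ℝ) → ℂ) (hs : Measurable s) (hsi : Integrable (fun x => ‖s x‖ ^ P)) :
    ∫ y, ‖Wf volume P (el K q h) s y‖ ^ 2 ∂(om f q) ≤ (B * LM K q h (2 * P / (P + 2))) ^ 2 * ((∫ x, ‖s x‖ ^ P) ^ ((P - 1) / P)) ^ 2 := by
  have := om_prob hf R.hq
  have hP0 : 0 < P := by linarith
  set r := 2 * P / (P + 2) with hr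
  have hr0 : 0 < r := by positivity
  have hu : 0 ≤ 1 - 2 / P := by rw [sub_nonneg, div_le_one hP0]; exact hP.le
  set Λ := LM K q h r with hΛ
  have hΛ0 : 0 ≤ Λ := LM_nonneg h r
  set A0 := ∫ x, ‖s x‖ ^ P with hA0
  have hA : 0 ≤ A0 := integral_nonneg fun x => by positivity
  have hLm := (Lh_cont R g).measurable
  have ham : Measurable fun x => ‖s x‖ₑ ^ P := hs.enorm.pow_const P
  have hai : ∫⁻ x, ‖s x‖ₑ ^ P = oR A0 := by
    rw [hA0, ofReal_integral_eq_lintegral_ofReal hsi (ae_of_all _ fun x => by positivity)]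
    simp only [enorm_rpow _ hP0.le]
  have hbm : ∀ y, Measurable fun x => ‖el K q h x y‖ₑ := fun y => (hLm.comp (measurable_id.sub_const (rr y))).enorm
  have hbi : ∀ y, ∫⁻ x, ‖el K q h x y‖ₑ ^ r = oR (Λ ^ r) := fun y => by
    rw [hΛ, ← lint_el h hr0 hi]
    exact lintegral_sub_right_eq_self (fun x => ‖Lh univ K q h x‖ₑ ^ r) (rr y)
  refine int_le_of_lint (fun y => by positivity) (by positivity) ?_
  have hW : ∀ y, oR (‖Wf volume P (el K q h) s y‖ ^ 2) ≤ (∫⁻ x, ‖s x‖ₑ ^ P * ‖el K q h x y‖ₑ ^ r) * (oR A0 ^ (1 - 2 / P) * oR (Λ ^ r) ^ (2 / P)) := fun y => by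
    have h1 := young_e (ν := volume) ham (hbm y) hP
    rw [hai, hbi y] at h1
    refine le_trans ?_ h1
    rw [← Real.rpow_natCast, enorm_rpow _ (by norm_num)]
    push_cast
    refine ENNReal.rpow_le_rpow ?_ (by norm_num)
    refine (enorm_integral_le_lintegral_enorm _).trans (lintegral_mono fun x => ?_)
    rw [enorm_mul, ← ofReal_norm (Jf P (s x)), norm_Jf (by linarith), enorm_rpow _ (by linarith), ← ENNReal.rpow_mul]
    refine mul_le_mul_left (le_of_eq ?_) _
    congr 1; field_simp
  refine (lintegral_mono hW).trans ?_
  rw [lintegral_mul_const' _ _ (ENNReal.mul_ne_top (ENNReal.rpow_ne_top_of_nonneg hu ENNReal.ofReal_ne_top) (ENNReal.rpow_ne_top_of_nonneg (by positivity) ENNReal.ofReal_ne_top))]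
  have hm2 : Measurable (Function.uncurry fun (y : Fin d → ℝ) (x : Ix d → ℝ) => ‖s x‖ₑ ^ P * ‖el K q h x y‖ₑ ^ r) :=
    (ham.comp measurable_snd).mul (((el_meas R g).comp measurable_swap).enorm.pow_const r)
  rw [lintegral_lintegral_swap hm2.aemeasurable]
  have h2 : ∫⁻ x, ∫⁻ y, ‖s x‖ₑ ^ P * ‖el K q h x y‖ₑ ^ r ∂(om f q) ≤ oR A0 * oR (B * Λ ^ r) := by
    rw [← hai, ← lintegral_mul_const _ ham]
    refine lintegral_mono fun x => ?_
    have hF : Measurable fun u => ‖Lh univ K q h u‖ₑ ^ r := hLm.enorm.pow_const r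
    rw [lintegral_const_mul' _ _ (ENNReal.rpow_ne_top_of_nonneg hP0.le enorm_ne_top)]
    refine mul_le_mul_right ?_ _
    have := om_le hf R.hq (by linarith) hqB hF x
    rwa [lint_el h hr0 hi, ← ENNReal.ofReal_mul (by linarith)] at this
  refine (mul_le_mul_left h2 _).trans ?_
  rw [ENNReal.ofReal_rpow_of_nonneg hA hu, ENNReal.ofReal_rpow_of_nonneg (by positivity) (by positivity), ← ENNReal.ofReal_mul hA, ← ENNReal.ofReal_mul (by positivity),
    ← ENNReal.ofReal_mul (by positivity)]
  refine ENNReal.ofReal_le_ofReal ?_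
  have e1 : A0 * A0 ^ (1 - 2 / P) = (A0 ^ ((P - 1) / P)) ^ 2 := by
    rw [← Real.rpow_natCast, ← Real.rpow_mul hA]; nth_rw 1 [← Real.rpow_one A0]; rw [← Real.rpow_add_of_nonneg hA zero_le_one hu]; congr 1; push_cast; field_simp; ring
  have e2 : Λ ^ r * (Λ ^ r) ^ (2 / P) = Λ ^ 2 := by
    rw [← Real.rpow_mul hΛ0, ← Real.rpow_add_of_nonneg hΛ0 hr0.le (by positivity), ← Real.rpow_natCast]; congr 1; rw [hr]; push_cast; field_simp
  calc _ = B * (Λ ^ r * (Λ ^ r) ^ (2 / P)) * (A0 * A0 ^ (1 - 2 / P)) := by ring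
    _ = B * Λ ^ 2 * (A0 ^ ((P - 1) / P)) ^ 2 := by rw [e1, e2]
    _ ≤ B ^ 2 * Λ ^ 2 * (A0 ^ ((P - 1) / P)) ^ 2 := by gcongr; exact le_self_pow₀ hB (by norm_num)
    _ = _ := by ring

lemma c2_le : c2 d ≤ 1 := by
  unfold c2
  exact inv_le_one_of_one_le₀ (one_le_pow₀ (by linarith [Real.pi_gt_three]))

lemma Lh_two (R : Reg K q lam C) {h : Fin d → ℝ} (g : GF h) :
    Integrable (fun x => ‖Lh univ K q h x‖ ^ (2 : ℝ)) ∧ ∫ x, ‖Lh univ K q h x‖ ^ (2 : ℝ) ≤ C * (∏ j : Ix d, hx h j ^ (-lam ↑j - 1 / 2)) ^ 2 := by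
  have gb := R.gb _ g.h0 g.h1
  have hc := c2_pos (d := d)
  have h1 := planch gb.int gb.int2
  rw [card_ix] at h1
  have e : ∀ x, oR (‖Lh univ K q h x‖ ^ (2 : ℝ)) = oR (c2 d ^ 2) * ‖FT (gh K (Qf q) (hx h)) x‖ₑ ^ 2 := fun x => by
    rw [enorm_rpow _ (by norm_num), Lh_eq q g.h0, enorm_mul, ENNReal.mul_rpow_of_nonneg _ _ (by norm_num), ← ofReal_norm (c2 d : ℂ), Complex.norm_real, Real.norm_of_nonneg hc.le,
      ENNReal.ofReal_rpow_of_nonneg hc.le (by norm_num)]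
    norm_cast
  have hV := (V_pos (lam := lam) g (1 / 2)).le
  have hb : ∫⁻ x, oR (‖Lh univ K q h x‖ ^ (2 : ℝ)) ≤ oR (C * (∏ j : Ix d, hx h j ^ (-lam ↑j - 1 / 2)) ^ 2) := by
    simp only [e]
    rw [lintegral_const_mul' _ _ ENNReal.ofReal_ne_top]
    refine (mul_le_mul_right h1 _).trans ?_
    rw [← ENNReal.ofReal_mul (by positivity)]
    refine ENNReal.ofReal_le_ofReal ?_
    have h3 := gb.int3
    have h4 : 0 ≤ ∫ t, ‖gh K (Qf q) (hx h) t‖ ^ 2 := integral_nonneg fun t => by positivity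
    have h5 : c2 d ^ 2 * (2 * Real.pi) ^ d = c2 d := by unfold c2; field_simp
    rw [← mul_assoc, h5]
    exact (mul_le_of_le_one_left h4 c2_le).trans h3
  refine ⟨⟨((Lh_cont R g).norm.rpow_const fun x => Or.inr (by norm_num)).aestronglyMeasurable, ?_⟩, int_le_of_lint (fun x => by positivity) (mul_nonneg (by linarith [R.hC]) (by positivity)) hb⟩
  rw [hasFiniteIntegral_iff_ofReal (ae_of_all _ fun x => by positivity)]
  exact hb.trans_lt ENNReal.ofReal_lt_top

lemma Lh_sup (R : Reg K q lam C) {h : Fin d → ℝ} (g : GF h) {n : ℕ} {κ : ℝ} (hκ : 0 < κ) (hg : κ ≤ √(n * ∏ j : Ix d, hx h j)) (x : Ix d → ℝ) :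
    ‖Lh univ K q h x‖ ≤ C / κ * √n * ∏ j : Ix d, hx h j ^ (-lam ↑j - 1 / 2) := by
  have hC := R.hC
  have gb := R.gb _ g.h0 g.h1
  set V := ∏ j : Ix d, hx h j ^ (-lam ↑j - 1 / 2) with hV
  have hV0 : 0 < V := V_pos g _
  set π := ∏ j : Ix d, hx h j with hπ
  have hπ0 : 0 < π := Finset.prod_pos fun j _ => g.h0 j
  have e : ∏ j : Ix d, hx h j ^ (-lam ↑j - 1) = V * (√π)⁻¹ := by
    rw [Real.sqrt_eq_rpow, ← Real.rpow_neg hπ0.le, hπ, ← Real.finsetProd_rpow _ _ (fun j _ => (g.h0 j).le), hV, ← Finset.prod_mul_distrib]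
    refine Finset.prod_congr rfl fun j _ => ?_
    rw [← Real.rpow_add (g.h0 j)]; congr 1; ring
  have h1 : (√π)⁻¹ ≤ √n / κ := by
    rw [Real.sqrt_mul (by positivity)] at hg
    have : 0 < √π := Real.sqrt_pos.2 hπ0
    rw [inv_eq_one_div, div_le_div_iff₀ this hκ]; linarith
  have h2 : 0 ≤ ∫ t, ‖gh K (Qf q) (hx h) t‖ := integral_nonneg fun t => norm_nonneg _
  calc _ ≤ C * (V * (√π)⁻¹) := (Lh_bd R g x).trans ((mul_le_of_le_one_left h2 c2_le).trans (e ▸ gb.int1))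
    _ ≤ C * (V * (√n / κ)) := by gcongr
    _ = _ := by ring

lemma grid_half {p : ℝ≥0∞} (hl : ∀ j, 0 < lam j) {n : ℕ} {h : Fin d → ℝ} (hp : 2 < p) (hh : memGrid lam p n univ h) :
    (if p = ⊤ then √(Real.log n) else cpGrid lam p) ≤ √(n * ∏ j : Ix d, hx h j) := by
  have g := grid_gf hh
  refine hh.2.2.trans ?_
  have hb : bp p = 1 / 2 := by
    unfold bp
    refine min_eq_left ?_
    by_cases ht : p = ⊤
    · rw [ht]; norm_num
    have : 2 < p.toReal := by rw [← ENNReal.toReal_ofNat 2]; exact (ENNReal.toReal_lt_toReal (by simp) ht).2 hp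
    have : 1 / p.toReal ≤ 1 / 2 := one_div_le_one_div_of_le (by norm_num) this.le
    linarith
  rw [hb, prod_ix, prod_ix, ← Real.sqrt_eq_rpow]
  refine mul_le_of_le_one_right (Real.sqrt_nonneg _) (Finset.prod_le_one (fun j _ => (Real.rpow_pos_of_pos (g.h0 j) _).le) fun j _ => ?_)
  exact Real.rpow_le_one (g.h0 j).le (g.h1 j) (hl _).le

lemma cp_pos {p : ℝ≥0∞} (hl : ∀ j, 0 < lam j) (hp : 0 < p.toReal) : 0 < cpGrid lam p ∧ cpGrid lam p ≤ 1 := by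
  refine ⟨lt_min one_pos (Real.rpow_pos_of_pos ?_ _), min_le_left _ _⟩
  have h1 : 0 ≤ lamMax lam := Real.sSup_nonneg (by rintro _ ⟨j, rfl⟩; exact (hl j).le)
  have h2 : 0 ≤ max 2 (p.toReal / (p.toReal - 1)) := le_max_of_le_left (by norm_num)
  positivity

lemma q_bdd (hN : eLpNorm (marginal (univ : Finset (Fin d)) q) ⊤ volume < ⊤) : ∃ B : ℝ, 1 ≤ B ∧ ∀ᵐ x : Ix d → ℝ, marginal univ q x ≤ B := by
  refine ⟨max 1 (eLpNorm (marginal (univ : Finset (Fin d)) q) ⊤ volume).toReal, le_max_left _ _, ?_⟩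
  rw [eLpNorm_exponent_top] at *
  filter_upwards [enorm_ae_le_eLpNormEssSup (marginal (univ : Finset (Fin d)) q) volume] with x hx
  refine le_max_of_le_right ((Real.le_norm_self _).trans ?_)
  rw [← toReal_enorm]; exact ENNReal.toReal_mono hN.ne hx

end st4

section st5
variable {d : ℕ} {K : ℝ → ℝ} {q : (Fin d → ℝ) → ℝ} {lam : Fin d → ℝ} {C : ℝ}

lemma lint_two (R : Reg K q lam C) {h : Fin d → ℝ} (g : GF h) :
    ∫⁻ x, ‖Lh univ K q h x‖ₑ ^ (2 : ℝ) ≤ oR (C * (∏ j : Ix d, hx h j ^ (-lam ↑j - 1 / 2)) ^ 2) := by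
  rw [lint_el h two_pos (Lh_two R g).1, LM_pow h two_pos]
  exact ENNReal.ofReal_le_ofReal (Lh_two R g).2

lemma w_lint (R : Reg K q lam C) {f : (Fin d → ℝ) → ℝ} (hf : IsDensity f) {h : Fin d → ℝ} (g : GF h) (x : Ix d → ℝ) :
    Integrable (fun y => ‖el K q h x y‖ ^ 2) (om f q) ∧ oR (∫ y, ‖el K q h x y‖ ^ 2 ∂(om f q)) = ∫⁻ y, ‖el K q h x y‖ₑ ^ (2 : ℝ) ∂(om f q) := by
  have := om_prob hf R.hq
  obtain ⟨B, hB⟩ := el_bd R g x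
  have hm : Measurable fun y => el K q h x y := (Lh_cont R g).measurable.comp (measurable_const.sub rr_meas)
  have hi : Integrable (fun y => ‖el K q h x y‖ ^ 2) (om f q) := by
    refine Integrable.of_bound (hm.norm.pow_const 2).aestronglyMeasurable (B ^ 2) (ae_of_all _ fun y => ?_)
    rw [Real.norm_of_nonneg (by positivity)]
    exact pow_le_pow_left₀ (norm_nonneg _) (hB y) 2
  refine ⟨hi, ?_⟩
  rw [ofReal_integral_eq_lintegral_ofReal hi (ae_of_all _ fun x => by positivity)]
  refine lintegral_congr fun y => ?_
  rw [← enorm_rpow _ (by norm_num)]; norm_cast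

lemma w_le (R : Reg K q lam C) {f : (Fin d → ℝ) → ℝ} (hf : IsDensity f) {h : Fin d → ℝ} (g : GF h) {B : ℝ} (hB : 1 ≤ B)
    (hqB : ∀ᵐ x : Ix d → ℝ, marginal univ q x ≤ B) (x : Ix d → ℝ) :
    ∫ y, ‖el K q h x y‖ ^ 2 ∂(om f q) ≤ B * (C * (∏ j : Ix d, hx h j ^ (-lam ↑j - 1 / 2)) ^ 2) := by
  have hC := R.hC
  have h1 := om_le hf R.hq (by linarith) hqB ((Lh_cont R g).measurable.enorm.pow_const (2 : ℝ)) x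
  refine (ENNReal.ofReal_le_ofReal_iff (by positivity)).1 ?_
  rw [(w_lint R hf g x).2, ENNReal.ofReal_mul (by linarith)]
  exact h1.trans (mul_le_mul_right (lint_two R g) _)

lemma w_int (R : Reg K q lam C) {f : (Fin d → ℝ) → ℝ} (hf : IsDensity f) {h : Fin d → ℝ} (g : GF h) :
    ∫⁻ x, oR (∫ y, ‖el K q h x y‖ ^ 2 ∂(om f q)) ≤ oR (C * (∏ j : Ix d, hx h j ^ (-lam ↑j - 1 / 2)) ^ 2) := by
  have := om_prob hf R.hq
  simp only [fun x => (w_lint R hf g x).2]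
  rw [lintegral_lintegral_swap (((el_meas R g).enorm.pow_const (2 : ℝ)).aemeasurable)]
  have e : ∀ y, ∫⁻ x, ‖el K q h x y‖ₑ ^ (2 : ℝ) = ∫⁻ x, ‖Lh univ K q h x‖ₑ ^ (2 : ℝ) := fun y =>
    lintegral_sub_right_eq_self (fun x => ‖Lh univ K q h x‖ₑ ^ (2 : ℝ)) (rr y)
  simp only [e, lintegral_const, measure_univ, mul_one]
  exact lint_two R g

lemma h5_aux {n u w : ℝ} (hn : 1 ≤ n) (hu : 1 ≤ u) (hw : 1 ≤ w) : n * u + n * n * w ≤ 2 * (n * n * u * w) := by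
  have h1 : n * u ≤ n * n * u * w := by
    calc n * u = n * 1 * u * 1 := by ring
      _ ≤ _ := by gcongr
  have h2 : n * n * w ≤ n * n * u * w := by
    calc n * n * w = n * n * 1 * w := by ring
      _ ≤ _ := by gcongr
  linarith

set_option maxHeartbeats 1000000 in
lemma stoch_gt2 {A : ℝ} {p : ℝ≥0∞} (R : Reg K q lam C) (hN : N1N2 p (univ : Finset (Fin d)) q A lam) (hp2 : 2 < p) (hpt : p ≠ ⊤) : Stoch K q lam p := by
  have hp : 1 < p := lt_trans (by norm_num) hp2
  have hC := R.hC
  set P := p.toReal with hPd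
  have eP : p = oR P := (ENNReal.ofReal_toReal hpt).symm
  have hP2 : 2 < P := by rw [hPd, ← ENNReal.toReal_ofNat 2]; exact (ENNReal.toReal_lt_toReal (by simp) hpt).2 hp2
  have hP0 : 0 < P := by linarith
  have ePp : Pp p = P := by unfold Pp; rw [if_neg hpt]
  set r := 2 * P / (P + 2) with hr
  have hr1 : 1 < r := by rw [hr, lt_div_iff₀ (by linarith)]; linarith
  have hr0 : 0 < r := by linarith
  obtain ⟨B, hB, hqB⟩ := q_bdd (hN.2.2.2.1 hp2)
  obtain ⟨cL, aL, hcL, haL, HL⟩ := LM_poly R hN hp2.ne' hpt hp hr1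
  obtain ⟨cP, aP, hcP, haP, HP⟩ := LM_poly R hN hp2.ne' hpt hp (show 1 < P by linarith)
  obtain ⟨hκ, hκ1⟩ := cp_pos R.hl (p := p) hP0
  set κ := cpGrid lam p with hκd
  set S := C / κ with hS
  have hSC : C ≤ S := by rw [hS, le_div_iff₀ hκ]; nlinarith
  have hS1 : 1 ≤ S := hC.trans hSC
  set c := P * B * S with hc
  have hc1 : 1 ≤ c := by have : 1 ≤ P * B := by nlinarith
                         rw [hc]; nlinarith
  have hSc : S ≤ c := by rw [hc]; exact le_mul_of_one_le_left (by linarith) (by nlinarith)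
  have hBc : B ≤ c := by rw [hc]; nlinarith [mul_le_mul (show 1 ≤ P by linarith) hS1 zero_le_one (by linarith)]
  set a1 := Pp p * ∑ j : Ix d, (lam ↑j + 1 / 2) with ha1
  have ha10 : 0 ≤ a1 := mul_nonneg (by rw [ePp]; exact hP0.le) (Finset.sum_nonneg fun j _ => by linarith [R.hl ↑j])
  refine stoch_of hp (c1 := 1) (CH := 2 * c * cL) (a := 2 + a1 + aL) (c3 := c) (c0 := Cc P) one_pos (by positivity) (by positivity) (Cc_pos hP0) (by positivity) fun n hn f hf h hh => ?_
  right
  have g := grid_gf hh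
  have := om_prob hf R.hq
  have hn1 : (1 : ℝ) ≤ n := by exact_mod_cast (by omega : 1 ≤ n)
  have hn0 : (0 : ℝ) < n := by linarith
  have hL1 := log_ge hn
  have hg2 := grid_half R.hl hp2 hh
  rw [if_neg hpt, ← hκd] at hg2
  have hsup := Lh_sup R g hκ hg2
  rw [← hS] at hsup
  have hVp := prod_poly hn hp hh R.hl (b := 1 / 2) (by norm_num)
  rw [← ha1] at hVp
  have L2 := Lh_two R g
  have wl := w_le R hf g hB hqB
  have wi := w_int R hf g
  have hV0 := V_pos (lam := lam) g (1 / 2)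
  have hUp : Up K q lam p n univ h = oR ((n : ℝ) ^ (-(1 : ℝ) / 2)) * (oR (∏ j : Ix d, hx h j ^ (-lam ↑j - 1 / 2)) + oR √(Real.log n) * oR (LM K q h r)) := by
    rw [Up, if_neg hpt, if_neg hp2.ne', if_neg (by linarith), ← eLp_LM R g hr0 (HL n hn h hh).1, prod_ix]
    rfl
  set V := ∏ j : Ix d, hx h j ^ (-lam ↑j - 1 / 2) with hV
  obtain ⟨hir, hLr⟩ := HL n hn h hh
  have hi := (HP n hn h hh).1
  set Λ := LM K q h r with hΛ
  have hΛ0 : 0 ≤ Λ := LM_nonneg h r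
  set M := LM K q h P with hM
  have hM0 : 0 ≤ M := LM_nonneg h P
  have hsn := Real.sqrt_pos.2 hn0
  have hsn2 : √(n : ℝ) ^ 2 = n := Real.sq_sqrt hn0.le
  have hsl2 : √(Real.log n) ^ 2 = Real.log n := Real.sq_sqrt (by linarith)
  set N0 := S * √n * V with hN0
  have hN00 : 0 < N0 := by positivity
  set H := c * (√n * V + √n * √(Real.log n) * Λ) with hH
  have hx1 : 0 ≤ √(n : ℝ) * √(Real.log n) * Λ := by positivity
  have hH0 : 0 < H := by positivity
  have hNH : P * N0 ≤ H := by
    calc P * N0 ≤ P * B * N0 := by gcongr; exact le_mul_of_one_le_right hP0.le hB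
      _ = c * (√n * V) := by rw [hN0, hc]; ring
      _ ≤ H := by rw [hH]; gcongr; linarith
  have hN1 : N0 ≤ H := (le_mul_of_one_le_left hN00.le (by linarith)).trans hNH
  have hHσ : B * (√n * √(Real.log n) * Λ) ≤ H := by
    rw [hH]; exact mul_le_mul hBc (by have := mul_pos hsn hV0; linarith) hx1 (by linarith)
  have hHV : B * C * V * √n ≤ H := by
    calc B * C * V * √n ≤ c * (√n * V) := by
          have : B * C ≤ c := by rw [hc]; calc B * C ≤ B * S := by gcongr
                                           _ ≤ P * B * S := by gcongr; exact le_mul_of_one_le_left (by linarith) (by linarith)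
          calc B * C * V * √n = B * C * (√n * V) := by ring
            _ ≤ _ := by gcongr
      _ ≤ H := by rw [hH]; gcongr; linarith
  have hMn : n * M ^ P ≤ N0 ^ P := by
    rw [hM, LM_pow h hP0, ← integral_const_mul]
    have hpt2 : ∀ x, (n : ℝ) * ‖Lh univ K q h x‖ ^ P ≤ n * (N0 ^ (P - 2) * ‖Lh univ K q h x‖ ^ (2 : ℝ)) := fun x => by
      have : ‖Lh univ K q h x‖ ^ P = ‖Lh univ K q h x‖ ^ (P - 2) * ‖Lh univ K q h x‖ ^ (2 : ℝ) := by
        rw [← Real.rpow_add_of_nonneg (norm_nonneg _) (by linarith) (by norm_num)]; congr 1; ring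
      rw [this]
      gcongr
      exact hsup x
    refine (integral_mono (hi.const_mul _) ((L2.1.const_mul _).const_mul _) hpt2).trans ?_
    rw [integral_const_mul, integral_const_mul]
    have e : N0 ^ P = N0 ^ (P - 2) * (S ^ 2 * n * V ^ 2) := by
      have : S ^ 2 * n * V ^ 2 = N0 ^ (2 : ℝ) := by rw [hN0]; norm_cast; rw [mul_pow, mul_pow, hsn2]
      rw [this, ← Real.rpow_add hN00]; congr 1; ring
    rw [e]
    calc _ ≤ n * (N0 ^ (P - 2) * (C * V ^ 2)) := by gcongr; exact L2.2
      _ = N0 ^ (P - 2) * (C * n * V ^ 2) := by ring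
      _ ≤ _ := by gcongr; exact hSC.trans (le_self_pow₀ hS1 (by norm_num))
  have hMn2 : (n : ℝ) ^ (1 / P) * M ≤ N0 := by
    refine (Real.rpow_le_rpow_iff (by positivity) hN00.le hP0).1 ?_
    rw [Real.mul_rpow (by positivity) hM0, ← Real.rpow_mul hn0.le, one_div_mul_cancel hP0.ne', Real.rpow_one]
    exact hMn
  have D : EmpData volume (om f q) P M H (Real.log n) (B * Λ) n (el K q h) :=
    { hp := by linarith, hM0 := hM0, hH := hH0, hL := hL1, hℓ := el_meas R g, hb := el_bd R g, hi := el_int hi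
      hM := fun y => (el_M h hP0 y).le, hσ := weak_gt R hf g hP2 hB hqB hir
      h1 := hMn.trans (Real.rpow_le_rpow hN00.le hN1 hP0.le)
      h2 := by
        have : Real.log n ≤ (n : ℝ) ^ (1 / P) / (1 / P) := Real.log_le_rpow_div hn0.le (by positivity)
        calc Real.log n * M ≤ ((n : ℝ) ^ (1 / P) / (1 / P)) * M := by gcongr
          _ = P * ((n : ℝ) ^ (1 / P) * M) := by field_simp
          _ ≤ P * N0 := by gcongr
          _ ≤ H := hNH
      h3 := by
        calc n * Real.log n * (B * Λ) ^ 2 = (B * (√n * √(Real.log n) * Λ)) ^ 2 := by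
              rw [mul_pow, mul_pow, mul_pow, mul_pow, hsn2, hsl2]; ring
          _ ≤ _ := by gcongr }
  have ev : ∀ x, 0 ≤ ∫ y, ‖el K q h x y‖ ^ 2 ∂(om f q) := fun x => integral_nonneg fun y => by positivity
  have hwi : Integrable (fun x => (∫ y, ‖el K q h x y‖ ^ 2 ∂(om f q)) ^ (P / 2)) := by
    have e2 : ∀ x y, ‖((‖el K q h x y‖ ^ 2 : ℝ) : ℂ)‖ ^ (P / 2) = ‖el K q h x y‖ ^ P := fun x y => by
      rw [Complex.norm_real, Real.norm_of_nonneg (by positivity), ← Real.rpow_natCast, ← Real.rpow_mul (norm_nonneg _)]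
      congr 1; push_cast; field_simp
    have := (mean_lp (ν := volume) (μ := om f q) (p := P / 2) (M := M ^ P) (by linarith) (ℓ := fun x y => ((‖el K q h x y‖ ^ 2 : ℝ) : ℂ))
      (Complex.measurable_ofReal.comp ((el_meas R g).norm.pow_const 2)) (fun x => ?_) (fun y => ?_) (fun y => ?_)).1
    · refine this.congr (ae_of_all _ fun x => ?_)
      have : ∫ y, ((‖el K q h x y‖ ^ 2 : ℝ) : ℂ) ∂(om f q) = ((∫ y, ‖el K q h x y‖ ^ 2 ∂(om f q) : ℝ) : ℂ) := integral_ofReal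
      simp only
      rw [this, Complex.norm_real, Real.norm_of_nonneg (ev x)]
    · obtain ⟨b, hb⟩ := el_bd R g x
      refine ⟨b ^ 2, fun y => ?_⟩
      rw [Complex.norm_real, Real.norm_of_nonneg (by positivity)]
      exact pow_le_pow_left₀ (norm_nonneg _) (hb y) 2
    · simp only [e2]; exact el_int hi y
    · simp only [e2]; exact (el_M h hP0 y).le
  have hw : ∫ x, (∫ y, ‖el K q h x y‖ ^ 2 ∂(om f q)) ^ (P / 2) ≤ (B * C * V) ^ P := by
    refine int_le_of_lint (fun x => Real.rpow_nonneg (ev x) _) (by positivity) ?_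
    set b := B * (C * V ^ 2) with hb
    have hb0 : 0 < b := by positivity
    have hpw : ∀ x, oR ((∫ y, ‖el K q h x y‖ ^ 2 ∂(om f q)) ^ (P / 2)) ≤ oR (b ^ (P / 2 - 1)) * oR (∫ y, ‖el K q h x y‖ ^ 2 ∂(om f q)) := fun x => by
      rw [← ENNReal.ofReal_mul (by positivity)]
      refine ENNReal.ofReal_le_ofReal ?_
      have hv := ev x
      have hw := wl x
      set v := ∫ y, ‖el K q h x y‖ ^ 2 ∂(om f q)
      have : v ^ (P / 2) = v ^ (P / 2 - 1) * v := by
        conv_rhs => rw [← Real.rpow_one v, ← Real.rpow_mul hv, one_mul, ← Real.rpow_add_of_nonneg hv (by linarith) zero_le_one]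
        congr 1; ring
      rw [this]; gcongr; linarith
    refine (lintegral_mono hpw).trans ?_
    rw [lintegral_const_mul' _ _ ENNReal.ofReal_ne_top]
    refine (mul_le_mul_right wi _).trans ?_
    rw [← ENNReal.ofReal_mul (by positivity)]
    refine ENNReal.ofReal_le_ofReal ?_
    have hq1 : C * V ^ 2 ≤ b := by rw [hb]; exact le_mul_of_one_le_left (by positivity) hB
    calc b ^ (P / 2 - 1) * (C * V ^ 2) ≤ b ^ (P / 2 - 1) * b := by gcongr
      _ = b ^ (P / 2) := by nth_rw 2 [← Real.rpow_one b]; rw [← Real.rpow_add hb0]; congr 1; ring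
      _ ≤ ((B * C * V) ^ 2) ^ (P / 2) := by
        refine Real.rpow_le_rpow hb0.le ?_ (by linarith)
        have : B * C ≤ (B * C) ^ 2 := le_self_pow₀ (one_le_mul_of_one_le_of_one_le hB hC) (by norm_num)
        calc b = B * C * V ^ 2 := by rw [hb]; ring
          _ ≤ (B * C) ^ 2 * V ^ 2 := by gcongr
          _ = _ := by ring
      _ = _ := by rw [← Real.rpow_natCast, ← Real.rpow_mul (by positivity)]; congr 1; push_cast; field_simp
  refine ⟨Zf (om f q) K q h P, H, Zf_meas R hf g P, hH0, ?_, fun y => ?_, ?_, fun T => ?_⟩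
  · have h1 : √(n : ℝ) ≤ n := by rw [Real.sqrt_le_left hn0.le]; exact le_self_pow₀ hn1 (by norm_num)
    have h2 : √(Real.log n) ≤ n := by
      rw [Real.sqrt_le_left hn0.le]; exact (Real.log_le_self hn0.le).trans (le_self_pow₀ hn1 (by norm_num))
    have e : (n : ℝ) ^ (2 + a1 + aL) = n * n * (n : ℝ) ^ a1 * (n : ℝ) ^ aL := by
      rw [Real.rpow_add hn0, Real.rpow_add hn0]; norm_cast; ring
    have hna : 1 ≤ (n : ℝ) ^ a1 := Real.one_le_rpow hn1 ha10
    have hnL : 1 ≤ cL * (n : ℝ) ^ aL := one_le_mul_of_one_le_of_one_le hcL (Real.one_le_rpow hn1 haL)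
    set u := (n : ℝ) ^ a1
    set w := (n : ℝ) ^ aL
    rw [hH, e]
    calc c * (√n * V + √n * √(Real.log n) * Λ) ≤ c * (n * u + n * n * (cL * w)) := by gcongr
      _ ≤ c * (2 * (n * n * u * (cL * w))) := mul_le_mul_of_nonneg_left (h5_aux hn1 hna hnL) (by linarith)
      _ = _ := by ring
  · rw [eP]; exact (xi_Zf R hf g (by linarith) hi hn y).le
  · rw [hUp, ← ENNReal.ofReal_mul (by positivity), ← ENNReal.ofReal_add (by positivity) (by positivity), ← ENNReal.ofReal_mul (by positivity), ← ENNReal.ofReal_mul (by positivity), ← sqrt_neg hn]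
    refine ENNReal.ofReal_le_ofReal (le_of_eq ?_)
    rw [hH]; ring
  · rw [ePp]
    refine conc_ge D hP2 (Vv := B * C * V) (by positivity) hwi hw ?_ hP0
    calc n * (B * C * V) ^ 2 = (B * C * V * √n) ^ 2 := by rw [mul_pow _ √(n : ℝ), hsn2]; ring
      _ ≤ H ^ 2 := by gcongr
end st5

section sup1
variable {Y : Type} [MeasurableSpace Y] {μ : Measure Y} [IsProbabilityMeasure μ]

lemma mgf_pi {u : Y → ℝ} (hu : Measurable u) (hb : ∀ y, |u y| ≤ 1) (h0 : ∫ y, u y ∂μ = 0) {v : ℝ} (hv : ∫ y, u y ^ 2 ∂μ ≤ v) {n : ℕ} :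
    Integrable (fun y : Fin n → Y => Real.exp (∑ k, u (y k))) (Measure.pi fun _ => μ) ∧
    ∫ y : Fin n → Y, Real.exp (∑ k, u (y k)) ∂(Measure.pi fun _ => μ) ≤ Real.exp (n * v) := by
  have hui : Integrable u μ := Integrable.of_bound hu.aestronglyMeasurable 1 (ae_of_all _ hb)
  have hu2 : Integrable (fun y => u y ^ 2) μ := Integrable.of_bound (hu.pow_const 2).aestronglyMeasurable 1 (ae_of_all _ fun y => by
    rw [Real.norm_eq_abs, abs_pow]; exact pow_le_one₀ (abs_nonneg _) (hb y))
  have hei : Integrable (fun y => Real.exp (u y)) μ := Integrable.of_bound hu.exp.aestronglyMeasurable (Real.exp 1) (ae_of_all _ fun y => by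
    rw [Real.norm_eq_abs, Real.abs_exp]; exact Real.exp_le_exp.2 ((le_abs_self _).trans (hb y)))
  have h1 : ∫ y, Real.exp (u y) ∂μ ≤ Real.exp v := by
    have : ∫ y, Real.exp (u y) ∂μ ≤ ∫ y, (1 + u y + u y ^ 2) ∂μ := by
      refine integral_mono hei (((integrable_const _).add hui).add hu2) fun y => ?_
      have := (abs_le.1 (Real.abs_exp_sub_one_sub_id_le (hb y))).2
      simp only; linarith
    have e : ∫ y, (1 + u y + u y ^ 2) ∂μ = 1 + ∫ y, u y ^ 2 ∂μ := by
      have i1 : Integrable (fun y => 1 + u y) μ := (integrable_const _).add hui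
      rw [integral_add i1 hu2, integral_add (integrable_const _) hui, h0]; simp
    have := Real.add_one_le_exp v
    linarith
  simp only [Real.exp_sum]
  refine ⟨Integrable.fintype_prod (f := fun _ : Fin n => fun y => Real.exp (u y)) fun _ => hei, ?_⟩
  rw [integral_fintype_prod_eq_prod (f := fun _ : Fin n => fun y => Real.exp (u y))]
  simp only [Finset.prod_const, Finset.card_univ, Fintype.card_fin]
  rw [mul_comm, Real.exp_mul, Real.rpow_natCast]
  exact pow_le_pow_left₀ (integral_nonneg fun y => (Real.exp_pos _).le) h1 n

lemma cosh_pi {u : Y → ℝ} (hu : Measurable u) (hb : ∀ y, |u y| ≤ 1) (h0 : ∫ y, u y ∂μ = 0) {v : ℝ} (hv : ∫ y, u y ^ 2 ∂μ ≤ v) {n : ℕ} :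
    ∫⁻ y : Fin n → Y, oR (Real.cosh (∑ k, u (y k)) - 1) ∂(Measure.pi fun _ => μ) ≤ oR (n * v * Real.exp (n * v)) := by
  obtain ⟨i1, b1⟩ := mgf_pi hu hb h0 hv (n := n)
  obtain ⟨i2, b2⟩ := mgf_pi (u := fun y => - u y) (μ := μ) hu.neg (fun y => by rw [abs_neg]; exact hb y) (by rw [integral_neg, h0, neg_zero]) (by simpa using hv) (n := n)
  have e : ∀ y : Fin n → Y, Real.cosh (∑ k, u (y k)) - 1 = (Real.exp (∑ k, u (y k)) + Real.exp (∑ k, - u (y k))) / 2 - 1 := fun y => by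
    rw [Real.cosh_eq, Finset.sum_neg_distrib]
  have i3 : Integrable (fun y : Fin n → Y => Real.cosh (∑ k, u (y k)) - 1) (Measure.pi fun _ => μ) := by
    simp only [e]; exact ((i1.add i2).div_const 2).sub (integrable_const _)
  rw [← ofReal_integral_eq_lintegral_ofReal i3 (ae_of_all _ fun y => by have := Real.one_le_cosh (∑ k, u (y k)); simp only [Pi.zero_apply]; linarith)]
  refine ENNReal.ofReal_le_ofReal ?_
  simp only [e]
  have i4 : Integrable (fun y : Fin n → Y => (Real.exp (∑ k, u (y k)) + Real.exp (∑ k, - u (y k))) / 2) (Measure.pi fun _ => μ) := (i1.add i2).div_const 2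
  rw [integral_sub i4 (integrable_const _), integral_div, integral_add i1 i2]
  have h1 : ∫ _y : Fin n → Y, (1 : ℝ) ∂(Measure.pi fun _ => μ) = 1 := by simp
  rw [h1]
  have h2 := Real.add_one_le_exp (-(n * v))
  have h3 := mul_le_mul_of_nonneg_right h2 (Real.exp_pos (n * v)).le
  rw [← Real.exp_add, neg_add_cancel, Real.exp_zero] at h3
  linarith
end sup1

section sup2
variable {ι : Type} [Fintype ι] {Y : Type} [MeasurableSpace Y] {μ : Measure Y} [IsProbabilityMeasure μ]

def Psi (θ : ℝ) (F : (ι → ℝ) → ℂ) : ℝ≥0∞ := ∫⁻ x, (oR (Real.cosh (θ * (F x).re) - 1) + oR (Real.cosh (θ * (F x).im) - 1))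

lemma sq_cen {w : Y → ℂ} (hw : Measurable w) {B : ℝ} (hB : ∀ y, ‖w y‖ ≤ B) {c : Y → ℝ} (hc : Measurable c)
    (h : ∀ y, |c y| ≤ ‖w y - ∫ y', w y' ∂μ‖) (θ : ℝ) : ∫ y, (θ * c y) ^ 2 ∂μ ≤ θ ^ 2 * ∫ y, ‖w y‖ ^ 2 ∂μ := by
  simp only [mul_pow]
  rw [integral_const_mul]
  refine mul_le_mul_of_nonneg_left (le_trans ?_ (center_sq hw hB)) (by positivity)
  have hm : Measurable fun y => w y - ∫ y', w y' ∂μ := hw.sub_const _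
  have hbd : ∀ y, ‖w y - ∫ y', w y' ∂μ‖ ≤ B + ‖∫ y', w y' ∂μ‖ := fun y => (norm_sub_le _ _).trans (add_le_add (hB y) le_rfl)
  have hp : ∀ y, c y ^ 2 ≤ ‖w y - ∫ y', w y' ∂μ‖ ^ 2 := fun y => by
    rw [← sq_abs]; exact pow_le_pow_left₀ (abs_nonneg _) (h y) 2
  have hi : Integrable (fun y => ‖w y - ∫ y', w y' ∂μ‖ ^ 2) μ := Integrable.of_bound (hm.norm.pow_const 2).aestronglyMeasurable ((B + ‖∫ y', w y' ∂μ‖) ^ 2)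
    (ae_of_all _ fun y => by rw [Real.norm_of_nonneg (by positivity)]; exact pow_le_pow_left₀ (norm_nonneg _) (hbd y) 2)
  exact integral_mono (hi.mono' (hc.pow_const 2).aestronglyMeasurable (ae_of_all _ fun y => by
    rw [Real.norm_of_nonneg (by positivity)]; exact hp y)) hi hp

lemma Psi_mean {ℓ : (ι → ℝ) → Y → ℂ} (hℓ : Measurable (Function.uncurry ℓ)) (hb : ∀ x, ∃ B, ∀ y, ‖ℓ x y‖ ≤ B) {θ b W : ℝ} (hθ : 0 < θ)
    (hc : ∀ x y, θ * ‖cen μ ℓ x y‖ ≤ 1) (hw : ∀ x, ∫ y, ‖ℓ x y‖ ^ 2 ∂μ ≤ b) (hW : ∫⁻ x, oR (∫ y, ‖ℓ x y‖ ^ 2 ∂μ) ≤ oR W) {n : ℕ} :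
    Measurable (fun y : Fin n → Y => Psi θ fun x => ∑ k, cen μ ℓ x (y k)) ∧
    ∫⁻ y : Fin n → Y, Psi θ (fun x => ∑ k, cen μ ℓ x (y k)) ∂(Measure.pi fun _ => μ) ≤ oR (2 * (n * θ ^ 2 * Real.exp (n * (θ ^ 2 * b)))) * oR W := by
  have hm0 := sum_meas (n := n) (cen_meas (μ := μ) hℓ) (s := fun _ => 0) measurable_const
  simp only [zero_add] at hm0
  have hm : Measurable fun z : (Fin n → Y) × (ι → ℝ) => ∑ k, cen μ ℓ z.2 (z.1 k) := hm0.comp measurable_swap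
  have hF : Measurable fun z : (Fin n → Y) × (ι → ℝ) => oR (Real.cosh (θ * (∑ k, cen μ ℓ z.2 (z.1 k)).re) - 1) + oR (Real.cosh (θ * (∑ k, cen μ ℓ z.2 (z.1 k)).im) - 1) :=
    (((Complex.measurable_re.comp hm).const_mul θ).cosh.sub_const 1).ennreal_ofReal.add (((Complex.measurable_im.comp hm).const_mul θ).cosh.sub_const 1).ennreal_ofReal
  refine ⟨hF.lintegral_prod_right', ?_⟩
  unfold Psi
  rw [lintegral_lintegral_swap hF.aemeasurable]
  refine le_trans ?_ (mul_le_mul_right hW _)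
  rw [← lintegral_const_mul' _ _ ENNReal.ofReal_ne_top]
  refine lintegral_mono fun x => ?_
  obtain ⟨B, hB⟩ := hb x
  have hlx : Measurable (ℓ x) := hℓ.comp (measurable_const.prodMk measurable_id)
  have hcx : Measurable (cen μ ℓ x) := (cen_meas hℓ).comp (measurable_const.prodMk measurable_id)
  have hci : Integrable (cen μ ℓ x) μ := Integrable.of_bound hcx.aestronglyMeasurable (1 / θ) (ae_of_all _ fun y => by
    rw [le_div_iff₀ hθ, mul_comm]; exact hc x y)
  have h0 := cen_mean (μ := μ) hℓ hb x
  have hre : ∫ y, (cen μ ℓ x y).re ∂μ = 0 := by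
    have := Complex.reCLM.integral_comp_comm hci
    simp only [Complex.reCLM_apply] at this
    rw [this, h0]; rfl
  have him : ∫ y, (cen μ ℓ x y).im ∂μ = 0 := by
    have := Complex.imCLM.integral_comp_comm hci
    simp only [Complex.imCLM_apply] at this
    rw [this, h0]; rfl
  set w := ∫ y, ‖ℓ x y‖ ^ 2 ∂μ with hwd
  have hw0 : 0 ≤ w := integral_nonneg fun y => by positivity
  have a1 := cosh_pi (μ := μ) (n := n) (u := fun y => θ * (cen μ ℓ x y).re) ((Complex.measurable_re.comp hcx).const_mul θ)
    (fun y => by rw [abs_mul, abs_of_pos hθ]; exact (mul_le_mul_of_nonneg_left (Complex.abs_re_le_norm _) hθ.le).trans (hc x y))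
    (by rw [integral_const_mul, hre, mul_zero]) (sq_cen hlx hB (Complex.measurable_re.comp hcx) (fun y => Complex.abs_re_le_norm _) θ)
  have a2 := cosh_pi (μ := μ) (n := n) (u := fun y => θ * (cen μ ℓ x y).im) ((Complex.measurable_im.comp hcx).const_mul θ)
    (fun y => by rw [abs_mul, abs_of_pos hθ]; exact (mul_le_mul_of_nonneg_left (Complex.abs_im_le_norm _) hθ.le).trans (hc x y))
    (by rw [integral_const_mul, him, mul_zero]) (sq_cen hlx hB (Complex.measurable_im.comp hcx) (fun y => Complex.abs_im_le_norm _) θ)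
  simp only [← Finset.mul_sum] at a1 a2
  rw [← hwd] at a1 a2
  simp only [Complex.re_sum, Complex.im_sum]
  have hmr : Measurable fun y : Fin n → Y => oR (Real.cosh (θ * ∑ k, (cen μ ℓ x (y k)).re) - 1) :=
    (((Finset.measurable_sum _ fun k _ => Complex.measurable_re.comp (hcx.comp (measurable_pi_apply k))).const_mul θ).cosh.sub_const 1).ennreal_ofReal
  rw [lintegral_add_left hmr]
  refine (add_le_add a1 a2).trans ?_
  rw [← ENNReal.ofReal_add (by positivity) (by positivity), ← ENNReal.ofReal_mul (by positivity)]
  refine ENNReal.ofReal_le_ofReal ?_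
  have he : Real.exp (n * (θ ^ 2 * w)) ≤ Real.exp (n * (θ ^ 2 * b)) := by
    refine Real.exp_le_exp.2 ?_; gcongr; exact hw x
  calc _ = 2 * (n * θ ^ 2 * Real.exp (n * (θ ^ 2 * w))) * w := by ring
    _ ≤ _ := by gcongr

lemma Psi_low {F : (ι → ℝ) → ℂ} {θ δ : ℝ} (hθ : 0 < θ) (hδ : 0 < δ) (x : ι → ℝ) (hF : ∀ x', ‖x' - x‖ ≤ δ → θ * ‖F x' - F x‖ ≤ 1) :
    oR (Real.exp (θ * ‖F x‖ / 2)) ≤ 4 + 4 * ((oR ((2 * δ) ^ Fintype.card ι))⁻¹ * Psi θ F) := by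
  set m := Real.exp (θ * ‖F x‖ / 2) with hm
  set v := oR ((2 * δ) ^ Fintype.card ι) with hv
  have hv0 : v ≠ 0 := by rw [hv]; simp only [ne_eq, ENNReal.ofReal_eq_zero, not_le]; positivity
  have hvt : v ≠ ⊤ := ENNReal.ofReal_ne_top
  have hE : Real.exp (1 / 2) ≤ 2 := by
    have h1 : Real.exp (1 / 2) ^ 2 = Real.exp 1 := by rw [← Real.exp_nat_mul]; norm_num
    have h2 := Real.exp_one_lt_d9
    have h3 := Real.exp_pos (1 / 2)
    by_contra hc
    push Not at hc
    have : (2 : ℝ) ^ 2 ≤ Real.exp (1 / 2) ^ 2 := pow_le_pow_left₀ (by norm_num) hc.le 2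
    rw [h1] at this; linarith
  have key : oR (m / 4 - 1) * v ≤ Psi θ F := by
    have hball : volume (Metric.ball x δ) = v := by rw [Real.volume_pi_ball x hδ]
    rw [← hball, ← setLIntegral_const]
    refine (setLIntegral_mono' Metric.isOpen_ball.measurableSet fun x' hx' => ?_).trans (setLIntegral_le_lintegral _ _)
    rw [Metric.mem_ball, dist_eq_norm] at hx'
    have h1 := hF x' hx'.le
    have h2 : θ * ‖F x‖ - 1 ≤ θ * ‖F x'‖ := by
      have := mul_le_mul_of_nonneg_left (norm_sub_norm_le (F x) (F x')) hθ.le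
      rw [norm_sub_rev] at this; linarith
    have h3 : m / 4 ≤ Real.cosh (θ * ‖F x'‖ / 2) := by
      have h4 : m ≤ Real.exp (θ * ‖F x'‖ / 2) * Real.exp (1 / 2) := by
        rw [hm, ← Real.exp_add]; exact Real.exp_le_exp.2 (by linarith)
      have h5 := Real.exp_pos (θ * ‖F x'‖ / 2)
      have h6 := mul_le_mul_of_nonneg_left hE h5.le
      have h7 := Real.exp_pos (-(θ * ‖F x'‖ / 2))
      rw [Real.cosh_eq]; linarith
    have h8 : ∀ r : ℝ, ‖F x'‖ / 2 ≤ |r| → oR (m / 4 - 1) ≤ oR (Real.cosh (θ * r) - 1) := fun r hr => by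
      refine ENNReal.ofReal_le_ofReal (sub_le_sub_right (h3.trans (Real.cosh_le_cosh.2 ?_)) _)
      rw [abs_of_nonneg (by positivity), abs_mul, abs_of_pos hθ, mul_div_assoc]
      exact mul_le_mul_of_nonneg_left hr hθ.le
    have h9 := Complex.norm_le_abs_re_add_abs_im (F x')
    rcases le_total |(F x').re| |(F x').im| with hh | hh
    · exact (h8 _ (by linarith)).trans le_add_self
    · exact (h8 _ (by linarith)).trans le_self_add
  have key2 : oR (m / 4 - 1) ≤ v⁻¹ * Psi θ F := by
    rw [mul_comm, ← div_eq_mul_inv, ENNReal.le_div_iff_mul_le (Or.inl hv0) (Or.inl hvt)]; exact key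
  calc oR m ≤ oR 4 + oR (4 * (m / 4 - 1)) := by
        refine le_trans (le_of_eq ?_) ENNReal.ofReal_add_le; congr 1; ring
    _ = 4 + 4 * oR (m / 4 - 1) := by rw [ENNReal.ofReal_mul (by norm_num)]; norm_num
    _ ≤ _ := by gcongr

lemma sup_conc {Ω : Type} [MeasurableSpace Ω] {P : Measure Ω} [IsProbabilityMeasure P] {S : Ω → (ι → ℝ) → ℂ} {θ δ N E : ℝ} (hθ : 0 < θ) (hδ : 0 < δ) (hE : 0 ≤ E)
    (hS : ∀ y x x', ‖x' - x‖ ≤ δ → θ * ‖S y x' - S y x‖ ≤ 1) (hN : ∀ y x, ‖S y x‖ ≤ N) (hm : Measurable fun y => Psi θ (S y)) (hP : ∫⁻ y, Psi θ (S y) ∂P ≤ oR E) :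
    ∃ Z : Ω → ℝ, Measurable Z ∧ (∀ y x, ‖S y x‖ ≤ 2 * Z y) ∧
      ∀ T, ∫⁻ y, oR (max (Z y - T) 0) ∂P ≤ oR (θ⁻¹ * Real.exp (-(θ * T)) * (4 + 4 * (((2 * δ) ^ Fintype.card ι)⁻¹ * E))) := by
  set v := (2 * δ) ^ Fintype.card ι with hv
  have hv0 : 0 < v := by positivity
  set G : Ω → ℝ≥0∞ := fun y => min (4 + 4 * ((oR v)⁻¹ * Psi θ (S y))) (oR (4 + Real.exp (θ * N / 2))) with hG
  have hGm : Measurable G := (((hm.const_mul _).const_mul _).const_add _).min measurable_const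
  have hGt : ∀ y, G y ≠ ⊤ := fun y => ne_top_of_le_ne_top ENNReal.ofReal_ne_top (min_le_right _ _)
  have hG4 : ∀ y, 4 ≤ G y := fun y => le_min le_self_add (by
    rw [show (4 : ℝ≥0∞) = oR 4 by norm_num]; exact ENNReal.ofReal_le_ofReal (by have := Real.exp_pos (θ * N / 2); linarith))
  have hG0 : ∀ y, 0 < (G y).toReal := fun y => ENNReal.toReal_pos (fun h => by have := hG4 y; rw [h] at this; norm_num at this) (hGt y)
  have hZe : ∀ y, oR (Real.exp (θ * (θ⁻¹ * Real.log (G y).toReal))) = G y := fun y => by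
    rw [mul_inv_cancel_left₀ hθ.ne', Real.exp_log (hG0 y), ENNReal.ofReal_toReal (hGt y)]
  refine ⟨fun y => θ⁻¹ * Real.log (G y).toReal, (hGm.ennreal_toReal.log).const_mul _, fun y x => ?_, fun T => ?_⟩
  · have h1 : oR (Real.exp (θ * ‖S y x‖ / 2)) ≤ G y := le_min (Psi_low hθ hδ x (hS y x)) (ENNReal.ofReal_le_ofReal (by
      have : Real.exp (θ * ‖S y x‖ / 2) ≤ Real.exp (θ * N / 2) := by
        refine Real.exp_le_exp.2 ?_; have := hN y x; gcongr
      linarith))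
    rw [← hZe y, ENNReal.ofReal_le_ofReal_iff (Real.exp_pos _).le, Real.exp_le_exp] at h1
    refine le_of_mul_le_mul_left (a := θ) ?_ hθ
    linarith
  · have h1 : ∀ y, oR (max (θ⁻¹ * Real.log (G y).toReal - T) 0) ≤ oR (θ⁻¹ * Real.exp (-(θ * T))) * (4 + 4 * ((oR v)⁻¹ * Psi θ (S y))) := fun y => by
      have hg : G y ≤ 4 + 4 * ((oR v)⁻¹ * Psi θ (S y)) := min_le_left _ _
      refine le_trans ?_ (mul_le_mul_right hg _)
      have hz := hZe y
      set z := θ⁻¹ * Real.log (G y).toReal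
      rw [← hz, ← ENNReal.ofReal_mul (by positivity)]
      refine ENNReal.ofReal_le_ofReal ?_
      rw [mul_assoc, ← Real.exp_add]
      refine max_le ?_ (by positivity)
      have := Real.add_one_le_exp (-(θ * T) + θ * z)
      have h2 : θ * (z - T) ≤ Real.exp (-(θ * T) + θ * z) := by linarith
      calc z - T = θ⁻¹ * (θ * (z - T)) := by rw [inv_mul_cancel_left₀ hθ.ne']
        _ ≤ _ := by gcongr
    refine (lintegral_mono h1).trans ?_
    rw [lintegral_const_mul' _ _ ENNReal.ofReal_ne_top, lintegral_add_left measurable_const, lintegral_const_mul' _ _ (by norm_num), lintegral_const_mul' _ _ (by simpa using hv0),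
      lintegral_const, measure_univ, mul_one, ENNReal.ofReal_mul (p := θ⁻¹ * Real.exp (-(θ * T))) (by positivity)]
    refine mul_le_mul_right ?_ _
    rw [ENNReal.ofReal_add (by norm_num) (by positivity), ENNReal.ofReal_mul (by norm_num), ENNReal.ofReal_mul (by positivity), ENNReal.ofReal_inv_of_pos hv0]
    norm_num
    gcongr
end sup2

section st7
variable {d : ℕ} {K : ℝ → ℝ} {q : (Fin d → ℝ) → ℝ} {lam : Fin d → ℝ} {C : ℝ}

lemma ec_lip {ι : Type} [Fintype ι] (t x x' : ι → ℝ) : ‖ec t (-x') - ec t (-x)‖ ≤ (∑ i, |t i|) * ‖x' - x‖ := by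
  have e : ec t (-x') - ec t (-x) = ec t (-x) * (ec t (-(x' - x)) - 1) := by
    rw [mul_sub, mul_one, ← ec_add_right]; congr 2; abel
  rw [e, norm_mul, norm_ec, one_mul]
  unfold ec
  refine (Real.norm_exp_I_mul_ofReal_sub_one_le).trans ?_
  unfold dotp
  refine (norm_sum_le _ _).trans ?_
  rw [Finset.sum_mul]
  refine Finset.sum_le_sum fun i _ => ?_
  rw [norm_mul, Real.norm_eq_abs]
  refine mul_le_mul_of_nonneg_left ?_ (abs_nonneg _)
  rw [Pi.neg_apply, norm_neg]
  exact norm_le_pi_norm (x' - x) i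

lemma Lh_lip (R : Reg K q lam C) {h : Fin d → ℝ} (g : GF h) (x x' : Ix d → ℝ) :
    ‖Lh univ K q h x' - Lh univ K q h x‖ ≤ (∑ i : Ix d, C * (∏ j : Ix d, hx h j ^ (-lam ↑j - 1)) * (hx h i)⁻¹) * ‖x' - x‖ := by
  have gb := R.gb _ g.h0 g.h1
  rw [Lh_eq q g.h0, Lh_eq q g.h0, ← mul_sub, norm_mul, Complex.norm_real, Real.norm_of_nonneg c2_pos.le]
  refine (mul_le_of_le_one_left (norm_nonneg _) c2_le).trans ?_
  unfold FT
  rw [← integral_sub (ec_integrable gb.int _) (ec_integrable gb.int _)]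
  have hi : Integrable fun t => ∑ i, |t i| * ‖gh K (Qf q) (hx h) t‖ := integrable_finset_sum _ fun i _ => gb.mom i
  refine (norm_integral_le_of_norm_le (hi.mul_const ‖x' - x‖) (ae_of_all _ fun t => ?_)).trans ?_
  · rw [← sub_mul, norm_mul, ← Finset.sum_mul, mul_right_comm]
    exact mul_le_mul_of_nonneg_right (ec_lip t x x') (norm_nonneg _)
  · rw [integral_mul_const, integral_finset_sum _ fun i _ => gb.mom i]
    exact mul_le_mul_of_nonneg_right (Finset.sum_le_sum fun i _ => gb.mom1 i) (norm_nonneg _)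

lemma cen_lip (R : Reg K q lam C) {f : (Fin d → ℝ) → ℝ} (hf : IsDensity f) {h : Fin d → ℝ} (g : GF h) {Λ : ℝ} 
    (hΛ : ∀ x x', ‖Lh univ K q h x' - Lh univ K q h x‖ ≤ Λ * ‖x' - x‖) (x x' : Ix d → ℝ) (y : Fin d → ℝ) :
    ‖cen (om f q) (el K q h) x' y - cen (om f q) (el K q h) x y‖ ≤ 2 * (Λ * ‖x' - x‖) := by
  haveI := om_prob hf R.hq
  have hE : ∀ y, ‖el K q h x' y - el K q h x y‖ ≤ Λ * ‖x' - x‖ := fun y => by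
    have := hΛ (x - rr y) (x' - rr y)
    rwa [sub_sub_sub_cancel_right] at this
  have hm : ∀ x, Integrable (fun y => el K q h x y) (om f q) := fun x => by
    obtain ⟨b, hb⟩ := el_bd R g x
    exact Integrable.of_bound ((Lh_cont R g).measurable.comp (measurable_const.sub rr_meas)).aestronglyMeasurable b (ae_of_all _ hb)
  unfold cen
  rw [sub_sub_sub_comm, ← integral_sub (hm x') (hm x)]
  refine (norm_sub_le _ _).trans ?_
  have := norm_integral_le_of_norm_le_const (μ := om f q) (ae_of_all _ hE)
  rw [probReal_univ, mul_one] at this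
  have := hE y
  linarith

lemma cen_sup (R : Reg K q lam C) {f : (Fin d → ℝ) → ℝ} (hf : IsDensity f) {h : Fin d → ℝ} {N : ℝ} 
    (hN : ∀ x, ‖Lh univ K q h x‖ ≤ N) (x : Ix d → ℝ) (y : Fin d → ℝ) : ‖cen (om f q) (el K q h) x y‖ ≤ 2 * N := by
  haveI := om_prob hf R.hq
  unfold cen
  refine (norm_sub_le _ _).trans ?_
  have := norm_integral_le_of_norm_le_const (μ := om f q) (f := fun y' => el K q h x y') (ae_of_all _ fun y' => hN (x - rr y'))
  rw [probReal_univ, mul_one] at this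
  have := hN (x - rr y)
  unfold el at *
  linarith

lemma xi_sup {f : (Fin d → ℝ) → ℝ} (h : Fin d → ℝ) {n : ℕ} (hn : 3 ≤ n) (y : Fin n → Fin d → ℝ) {z : ℝ}
    (hz : ∀ x, ‖∑ k, cen (om f q) (el K q h) x (y k)‖ ≤ z) : eLpNorm (xiProc univ K f q h y) ⊤ volume ≤ oR ((n : ℝ)⁻¹ * z) := by
  rw [eLpNorm_exponent_top]
  refine eLpNormEssSup_le_of_ae_bound (ae_of_all _ fun x => ?_)
  rw [xi_eq h hn, norm_mul, norm_inv, Complex.norm_natCast]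
  exact mul_le_mul_of_nonneg_left (hz x) (by positivity)

lemma lip_poly (R : Reg K q lam C) {n : ℕ} {h : Fin d → ℝ} (hn : 3 ≤ n) (hh : memGrid lam ⊤ n univ h) (x x' : Ix d → ℝ) :
    ‖Lh univ K q h x' - Lh univ K q h x‖ ≤ (C * (d + 1) * (n : ℝ) ^ (∑ j : Ix d, (lam ↑j + 1) + 1)) * ‖x' - x‖ := by
  have g := grid_gf hh
  have hC := R.hC
  have hn0 : (0 : ℝ) < n := by exact_mod_cast (by omega : 0 < n)
  refine (Lh_lip R g x x').trans (mul_le_mul_of_nonneg_right ?_ (norm_nonneg _))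
  have hP : Pp ⊤ = 1 := by unfold Pp; rw [if_pos rfl]
  have h1 := prod_poly hn (by simp) hh R.hl (b := 1) (by norm_num)
  rw [hP, one_mul] at h1
  have h2 : ∀ i : Ix d, (hx h i)⁻¹ ≤ n := fun i => by
    have := grid_low hn (by simp) hh ↑i
    rw [hP, Real.rpow_neg_one] at this
    exact inv_le_of_inv_le₀ hn0 this
  have hV : 0 < ∏ j : Ix d, hx h j ^ (-lam ↑j - 1) := V_pos g 1
  calc _ ≤ ∑ i : Ix d, C * (n : ℝ) ^ (∑ j : Ix d, (lam ↑j + 1)) * n := by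
        refine Finset.sum_le_sum fun i _ => ?_
        have := h2 i
        have := g.h0 i
        gcongr
    _ = C * d * ((n : ℝ) ^ (∑ j : Ix d, (lam ↑j + 1)) * n) := by
        rw [Finset.sum_const, Finset.card_univ, card_ix, nsmul_eq_mul]; ring
    _ ≤ _ := by
        rw [Real.rpow_add_one hn0.ne']; gcongr; linarith

lemma top_num {n : ℕ} (hn : 3 ≤ n) {M a : ℝ} (hM : 1 ≤ M) (ha : 0 ≤ a) (d : ℕ) :
    4 + 4 * (((2 * (2 * (M * (n : ℝ) ^ a))⁻¹) ^ d)⁻¹ * (2 * (n : ℝ) ^ 2)) ≤ Real.exp ((Real.log (12 * M ^ d) + (a * d + 2)) * Real.log n) := by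
  have hn1 : (1 : ℝ) ≤ n := by exact_mod_cast (by omega : 1 ≤ n)
  have hn0 : (0 : ℝ) < n := by linarith
  have hL := log_ge hn
  have hMd : 1 ≤ M ^ d := one_le_pow₀ hM
  have hna : 1 ≤ ((n : ℝ) ^ a) ^ d := one_le_pow₀ (Real.one_le_rpow hn1 ha)
  have e1 : 2 * (2 * (M * (n : ℝ) ^ a))⁻¹ = (M * (n : ℝ) ^ a)⁻¹ := by
    rw [mul_inv, mul_inv_cancel_left₀ (by norm_num)]
  have e2 : ((n : ℝ) ^ a) ^ d = (n : ℝ) ^ (a * d) := by rw [← Real.rpow_natCast, ← Real.rpow_mul hn0.le]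
  rw [e1, inv_pow, inv_inv, mul_pow]
  have h3 : 12 * M ^ d ≤ Real.exp (Real.log (12 * M ^ d) * Real.log n) := by
    calc 12 * M ^ d = Real.exp (Real.log (12 * M ^ d)) := (Real.exp_log (by positivity)).symm
      _ ≤ _ := Real.exp_le_exp.2 (le_mul_of_one_le_right (Real.log_nonneg (by linarith)) hL)
  have h4 : ((n : ℝ) ^ a) ^ d * (n : ℝ) ^ 2 = Real.exp ((a * d + 2) * Real.log n) := by
    rw [mul_comm (a * d + 2), ← Real.rpow_def_of_pos hn0, Real.rpow_add hn0, e2]; norm_cast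
  rw [add_mul (Real.log _), Real.exp_add, ← h4]
  have h5 : 1 ≤ M ^ d * (((n : ℝ) ^ a) ^ d * (n : ℝ) ^ 2) := one_le_mul_of_one_le_of_one_le hMd (one_le_mul_of_one_le_of_one_le hna (one_le_pow₀ hn1))
  calc _ = 4 + 8 * (M ^ d * (((n : ℝ) ^ a) ^ d * (n : ℝ) ^ 2)) := by ring
    _ ≤ 12 * M ^ d * (((n : ℝ) ^ a) ^ d * (n : ℝ) ^ 2) := by linarith
    _ ≤ _ := by gcongr

lemma stoch_top {A : ℝ} (R : Reg K q lam C) (hN : N1N2 ⊤ (univ : Finset (Fin d)) q A lam) : Stoch K q lam ⊤ := by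
  have hC := R.hC
  have ePp : Pp ⊤ = 1 := by unfold Pp; rw [if_pos rfl]
  obtain ⟨B, hB, hqB⟩ := q_bdd (hN.2.2.2.1 (by simp))
  set c := 2 * B * C with hc
  have hBC : 1 ≤ B * C := one_le_mul_of_one_le_of_one_le hB hC
  have hc1 : 1 ≤ c := by rw [hc, mul_assoc]; linarith
  set a1 := ∑ j : Ix d, (lam ↑j + 1 / 2) with ha1
  have ha10 : 0 ≤ a1 := Finset.sum_nonneg fun j _ => by linarith [R.hl ↑j]
  set a2 := ∑ j : Ix d, (lam ↑j + 1) + 1 with ha2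
  have ha20 : 0 ≤ a2 := add_nonneg (Finset.sum_nonneg fun j _ => by linarith [R.hl ↑j]) zero_le_one
  set M := C * (d + 1) with hM
  have hM1 : 1 ≤ M := one_le_mul_of_one_le_of_one_le hC (by linarith [(Nat.cast_nonneg d : (0 : ℝ) ≤ d)])
  have hM12 : 1 < 12 * M ^ d := by have := one_le_pow₀ hM1 (n := d); linarith
  refine stoch_of (by simp) (c1 := 2) (CH := c) (a := 2 + a1) (c3 := c) (c0 := Real.log (12 * M ^ d) + ((a2 + 2) * d + 2)) two_pos (by positivity) (by positivity)
    (add_pos (Real.log_pos hM12) (by positivity)) (by positivity) fun n hn f hf h hh => Or.inr ?_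
  have g := grid_gf hh
  haveI := om_prob hf R.hq
  have hn1 : (1 : ℝ) ≤ n := by exact_mod_cast (by omega : 1 ≤ n)
  have hn0 : (0 : ℝ) < n := by linarith
  have hL1 := log_ge hn
  have hLn : Real.log n ≤ n := Real.log_le_self hn0.le
  have hg2 := grid_half R.hl (by simp) hh
  rw [if_pos rfl] at hg2
  set L := Real.log n with hL
  have hsL1 : 1 ≤ √L := Real.one_le_sqrt.2 hL1
  have hsup := Lh_sup R g (by linarith) hg2
  have hwl := w_le R hf g hB hqB
  have hwi := w_int R hf g
  have hpp := prod_poly hn (by simp) hh R.hl (b := 1 / 2) (by norm_num)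
  have hUp : Up K q lam ⊤ n univ h = oR ((n : ℝ) ^ (-(1 : ℝ) / 2) * √L * ∏ j : Ix d, hx h j ^ (-lam ↑j - 1 / 2)) := by
    unfold Up; rw [if_pos rfl, prod_ix]; rfl
  rw [ePp, one_mul, ← ha1] at hpp
  have hV0 : 0 < ∏ j : Ix d, hx h j ^ (-lam ↑j - 1 / 2) := V_pos g _
  have hV1 : 1 ≤ ∏ j : Ix d, hx h j ^ (-lam ↑j - 1 / 2) := Finset.prod_induction _ (fun z : ℝ => 1 ≤ z) (fun a b ha hb => one_le_mul_of_one_le_of_one_le ha hb) le_rfl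
    fun j _ => Real.one_le_rpow_of_pos_of_le_one_of_nonpos (g.h0 j) (g.h1 j) (by linarith [R.hl ↑j])
  set V := ∏ j : Ix d, hx h j ^ (-lam ↑j - 1 / 2) with hV
  have hlip := lip_poly R hn hh
  have hsn1 : 1 ≤ √(n : ℝ) := Real.one_le_sqrt.2 hn1
  have hsn2 : √(n : ℝ) ^ 2 = n := Real.sq_sqrt hn0.le
  have hsl2 : √L ^ 2 = L := Real.sq_sqrt (by linarith)
  set H := c * (√n * √L * V) with hH
  have hH1 : 1 ≤ H := one_le_mul_of_one_le_of_one_le hc1 (one_le_mul_of_one_le_of_one_le (one_le_mul_of_one_le_of_one_le hsn1 hsL1) hV1)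
  have hH0 : 0 < H := by linarith
  set θ := L / H with hθ
  have hθ0 : 0 < θ := by positivity
  have hθH : θ * H = L := div_mul_cancel₀ _ hH0.ne'
  have hθn : θ ≤ n := (div_le_self (by linarith) hH1).trans hLn
  have hθ2 : n * θ ^ 2 * V ^ 2 * c ^ 2 = L := by
    refine mul_right_cancel₀ (b := L) (by linarith) ?_
    calc n * θ ^ 2 * V ^ 2 * c ^ 2 * L = √(n : ℝ) ^ 2 * θ ^ 2 * V ^ 2 * c ^ 2 * √L ^ 2 := by rw [hsn2, hsl2]
      _ = (θ * H) ^ 2 := by rw [hH]; ring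
      _ = L * L := by rw [hθH]; ring
  have hBCc : B * C ≤ c ^ 2 := by
    refine le_trans ?_ (le_self_pow₀ hc1 (by norm_num)); rw [hc, mul_assoc]; linarith
  have hθ3 : n * (θ ^ 2 * (B * (C * V ^ 2))) ≤ L := by
    calc n * (θ ^ 2 * (B * (C * V ^ 2))) = n * θ ^ 2 * V ^ 2 * (B * C) := by ring
      _ ≤ n * θ ^ 2 * V ^ 2 * c ^ 2 := by gcongr
      _ = L := hθ2
  have hθ4 : n * (θ ^ 2 * (C * V ^ 2)) ≤ L := by
    refine le_trans ?_ hθ3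
    exact mul_le_mul_of_nonneg_left (mul_le_mul_of_nonneg_left (le_mul_of_one_le_left (by positivity) hB) (by positivity)) hn0.le
  set N0 := C / √L * √n * V with hN0
  have hcs := cen_sup R hf hsup
  have hcl := cen_lip R hf g hlip
  have hcθ : ∀ x y, θ * ‖cen (om f q) (el K q h) x y‖ ≤ 1 := fun x y => by
    refine (mul_le_mul_of_nonneg_left (hcs x y) hθ0.le).trans ?_
    rw [hθ, div_mul_eq_mul_div, div_le_one hH0]
    have : L * (2 * N0) = 2 * C * (√n * √L * V) := by
      rw [hN0]; nth_rw 1 [← hsl2]; field_simp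
    rw [this, hH, hc]
    gcongr
    linarith
  obtain ⟨hPm, hPi⟩ := Psi_mean (n := n) (el_meas R g) (el_bd R g) hθ0 hcθ hwl hwi
  set S : (Fin n → Fin d → ℝ) → (Ix d → ℝ) → ℂ := fun y x => ∑ k, cen (om f q) (el K q h) x (y k) with hS
  set δ := (2 * (M * (n : ℝ) ^ (a2 + 2)))⁻¹ with hδ
  have hδ0 : 0 < δ := by positivity
  have hA1 : ∀ y x x', ‖x' - x‖ ≤ δ → θ * ‖S y x' - S y x‖ ≤ 1 := fun y x x' hx' => by
    simp only [hS]
    rw [← Finset.sum_sub_distrib]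
    have : ‖∑ k, (cen (om f q) (el K q h) x' (y k) - cen (om f q) (el K q h) x (y k))‖ ≤ n * (2 * (M * (n : ℝ) ^ a2 * δ)) := by
      refine (norm_sum_le_of_le _ (fun k _ => (hcl x x' (y k)).trans ?_)).trans (b := ∑ _k : Fin n, 2 * (M * (n : ℝ) ^ a2 * δ)) (le_of_eq (by simp))
      gcongr
    calc _ ≤ n * (n * (2 * (M * (n : ℝ) ^ a2 * δ))) := by gcongr
      _ = 2 * (M * (n : ℝ) ^ (a2 + 2)) * δ := by rw [Real.rpow_add hn0 a2 2, Real.rpow_two]; ring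
      _ = 1 := mul_inv_cancel₀ (by positivity)
      _ ≤ 1 := le_rfl
  have hA2 : ∀ y x, ‖S y x‖ ≤ n * (2 * N0) := fun y x => by
    refine (norm_sum_le_of_le _ (fun k _ => hcs x (y k))).trans (le_of_eq (by simp))
  have hA3 : oR (2 * (n * θ ^ 2 * Real.exp (n * (θ ^ 2 * (B * (C * V ^ 2)))))) * oR (C * V ^ 2) ≤ oR (2 * (n : ℝ) ^ 2) := by
    rw [← ENNReal.ofReal_mul (by positivity)]
    refine ENNReal.ofReal_le_ofReal ?_
    have he : Real.exp (n * (θ ^ 2 * (B * (C * V ^ 2)))) ≤ n := by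
      refine (Real.exp_le_exp.2 hθ3).trans (le_of_eq ?_); rw [hL, Real.exp_log hn0]
    calc _ = 2 * ((n * (θ ^ 2 * (C * V ^ 2))) * Real.exp (n * (θ ^ 2 * (B * (C * V ^ 2))))) := by ring
      _ ≤ 2 * (n * n) := by gcongr; exact hθ4.trans hLn
      _ = _ := by ring
  obtain ⟨Z, hZm, hZS, hZT⟩ := sup_conc (P := Measure.pi fun _ : Fin n => om f q) (S := S) (E := 2 * (n : ℝ) ^ 2) hθ0 hδ0 (by positivity) hA1 hA2 hPm (hPi.trans hA3)
  refine ⟨Z, H, hZm, hH0, ?_, fun y => ?_, ?_, fun T => ?_⟩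
  · have h1 : √(n : ℝ) ≤ n := by rw [Real.sqrt_le_left hn0.le]; exact le_self_pow₀ hn1 (by norm_num)
    have h2 : √L ≤ n := by
      rw [Real.sqrt_le_left hn0.le]; exact hLn.trans (le_self_pow₀ hn1 (by norm_num))
    have e : (n : ℝ) ^ (2 + a1) = n * n * (n : ℝ) ^ a1 := by
      rw [Real.rpow_add hn0]; norm_cast; ring
    rw [hH, e]
    gcongr
  · refine (xi_sup h hn y (z := 2 * Z y) (hZS y)).trans (le_of_eq ?_)
    congr 1; ring
  · rw [hUp, ← ENNReal.ofReal_mul (by positivity), ← sqrt_neg hn]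
    refine ENNReal.ofReal_le_ofReal (le_of_eq ?_)
    rw [hH]; ring
  · rw [ePp]
    simp only [Real.rpow_one, one_mul]
    refine (hZT T).trans (ENNReal.ofReal_le_ofReal ?_)
    have hnum := top_num hn hM1 (show 0 ≤ a2 + 2 by linarith) d
    rw [← hδ] at hnum
    rw [card_ix]
    have hθi : θ⁻¹ ≤ H := by rw [hθ, inv_div]; exact div_le_self hH0.le hL1
    calc _ ≤ H * Real.exp (-(θ * T)) * Real.exp ((Real.log (12 * M ^ d) + ((a2 + 2) * d + 2)) * L) := by gcongr
      _ = _ := by rw [mul_assoc, ← Real.exp_add]; congr 2; rw [hθ]; ring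
end st7

lemma stoch_all {d : ℕ} {K : ℝ → ℝ} {q : (Fin d → ℝ) → ℝ} {lam : Fin d → ℝ} {A C : ℝ} {p : ℝ≥0∞} (R : Reg K q lam C)
    (hN : N1N2 p (univ : Finset (Fin d)) q A lam) (hd : 0 < d) (hp : 1 < p) : Stoch K q lam p := by
  rcases lt_trichotomy p 2 with h | h | h
  · exact stoch_lt2 R hN hp h
  · subst h; exact stoch_2 R hN hd
  · by_cases ht : p = ⊤
    · subst ht; exact stoch_top R hN
    · exact stoch_gt2 R hN h ht

/-- **Theorem 4** (oracle inequality without independence structure, `𝔓 = {{1,…,d}}`):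
for `p ∈ (1,∞]`, under Assumptions (N1)-(N2), there are constants `γ_p ∈ (0,∞)` and
`C_p ∈ (0,∞)` such that for every `n ≥ 3` and every probability density `f` on `ℝ^d`,
any estimator `f̃ = f̃_{h̃}` obeying the selection rule satisfies
`R_p[f̃,f] ≤ inf_{h ∈ H_p} {(1 + 2‖K‖_1^d) R_p[f̃_h,f] + 2γ_p U_p(h)} + 2 C_p n^{-1/2}`. -/
theorem statement7 (d : ℕ) (hd : 0 < d)
    (K : ℝ → ℝ) (hK : IsKernel K) (q : (Fin d → ℝ) → ℝ) (hq : IsDensity q)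
    (A : ℝ) (lam : Fin d → ℝ) (p : ℝ≥0∞) (hp : 1 < p)
    (hN : N1N2 p (Finset.univ : Finset (Fin d)) q A lam) :
    ∃ γp Cp : ℝ≥0∞, 0 < γp ∧ γp ≠ ⊤ ∧ 0 < Cp ∧ Cp ≠ ⊤ ∧
      ∀ n : ℕ, 3 ≤ n → ∀ f : (Fin d → ℝ) → ℝ, IsDensity f →
        ∀ sel : (Fin n → Fin d → ℝ) → Fin d → ℝ,
          (∀ y, sel y ∈ {h : Fin d → ℝ | memGrid lam p n Finset.univ h} ∧
            critU K q lam p γp n y (sel y) =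
              ⨅ h ∈ {h : Fin d → ℝ | memGrid lam p n Finset.univ h},
                critU K q lam p γp n y h) →
          riskSelU K q p n sel f ≤
            (⨅ h ∈ {h : Fin d → ℝ | memGrid lam p n Finset.univ h},
              (ENNReal.ofReal (1 + 2 * (∫ z, |K z|) ^ d) * riskH K q p n h f +
                2 * γp * Up K q lam p n Finset.univ h)) +
            2 * Cp * ENNReal.ofReal ((n : ℝ) ^ (-(1 : ℝ) / 2)) := by
  obtain ⟨C, R⟩ := reg_of hK hq hN hd
  exact assemble R hp (stoch_all R hN hd hp)

end Deconv
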